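/- Let p be an odd prime and let F be a number field containing a primitive p²-th root of unity. Then every continuous homomorphism Gal(F_s/F) → U_3(𝔽_p) admits a lift to a continuous homomorphism Gal(F_s/F) → U_3(ℤ/p²) along the reduction ℤ/p² → ℤ/p. -/

import Mathlib

open scoped MatrixGroups

/-- The absolute Galois group `Gal(F_s/F)`, with its Krull topology. -/
abbrev AbsGal (F : Type) [Field F] : Type :=
  SeparableClosure F ≃ₐ[F] SeparableClosure F

/-- A matrix in `GL_d(R)` is upper triangular (i.e. lies in the Borel `B_d(R)`). -/
def IsUpperTri {d : ℕ} {R : Type} [CommRing R] (g : GL (Fin d) R) : Prop :=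
  ∀ i j : Fin d, j < i → (g : Matrix (Fin d) (Fin d) R) i j = 0

/-- A matrix in `GL_d(R)` is upper unitriangular (i.e. lies in `U_d(R)`). -/
def IsUniTri {d : ℕ} {R : Type} [CommRing R] (g : GL (Fin d) R) : Prop :=
  IsUpperTri g ∧ ∀ i : Fin d, (g : Matrix (Fin d) (Fin d) R) i i = 1

set_option linter.unusedSectionVars false

section

open Polynomial

theorem prod_range_shift_of_periodic {M : Type*} [CommMonoid M] {n : ℕ} (g : ℕ → M)
    (hg : ∀ m, g (m + n) = g m) (j : ℕ) :
    ∏ i ∈ Finset.range n, g (i + j) = ∏ i ∈ Finset.range n, g i := by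
  induction j with
  | zero => simp
  | succ j ih =>
    rw [← ih]
    cases n with
    | zero => simp
    | succ m =>
      rw [Finset.prod_range_succ, Finset.prod_range_succ']
      congr 1
      · exact Finset.prod_congr rfl fun i _ => by congr 1; ring
      · rw [← hg (0 + j)]; congr 1; ring

/-- `u` is a norm from `k[X]/(X^n - b)`, where the conjugates of `X` are the `ζ^i X`. -/
def IsKNorm {k : Type*} [Field k] (n : ℕ) (ζ b u : k) : Prop :=
  ∃ f : k[X], (X ^ n - C b) ∣ (∏ i ∈ Finset.range n, f.comp (C (ζ ^ i) * X)) - C u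

namespace IsKNorm
variable {k : Type*} [Field k] {n : ℕ} {ζ b : k}

theorem mul {u v : k} (hu : IsKNorm n ζ b u) (hv : IsKNorm n ζ b v) :
    IsKNorm n ζ b (u * v) := by
  obtain ⟨f, hf⟩ := hu
  obtain ⟨g, hg⟩ := hv
  refine ⟨f * g, ?_⟩
  simp only [mul_comp, Finset.prod_mul_distrib, C_mul]
  exact dvd_mul_sub_mul hf hg

theorem pow_self (x : k) : IsKNorm n ζ b (x ^ n) :=
  ⟨C x, by simp⟩

theorem one : IsKNorm n ζ b 1 := ⟨1, by simp⟩

theorem pow {u : k} (hu : IsKNorm n ζ b u) (m : ℕ) : IsKNorm n ζ b (u ^ m) := by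
  induction m with
  | zero => simpa using one
  | succ m ih => rw [pow_succ]; exact ih.mul hu

theorem inv {u : k} (hn : n ≠ 0) (hu : IsKNorm n ζ b u) : IsKNorm n ζ b u⁻¹ := by
  rcases eq_or_ne u 0 with rfl | h0
  · simpa using hu
  have := (hu.pow (n - 1)).mul (pow_self (n := n) (ζ := ζ) (b := b) u⁻¹)
  convert this using 1
  obtain ⟨m, rfl⟩ := Nat.exists_eq_succ_of_ne_zero hn
  simp only [Nat.succ_eq_add_one, Nat.add_sub_cancel]
  rw [pow_succ, ← mul_assoc, ← mul_pow, mul_inv_cancel₀ h0, one_pow, one_mul]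

theorem map {K : Type*} [Field K] (φ : k →+* K) {u : k} (hu : IsKNorm n ζ b u) :
    IsKNorm n (φ ζ) (φ b) (φ u) := by
  obtain ⟨f, hf⟩ := hu
  refine ⟨f.map φ, ?_⟩
  have := Polynomial.map_dvd φ hf
  simpa [Polynomial.map_prod, Polynomial.map_comp] using this

theorem exists_eval {K : Type*} [Field K] [Algebra k K] {u : k} (hu : IsKNorm n ζ b u) :
    ∃ f : k[X], ∀ β : K, β ^ n = algebraMap k K b →
      ∏ i ∈ Finset.range n, aeval (algebraMap k K ζ ^ i * β) f = algebraMap k K u := by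
  obtain ⟨f, hf⟩ := hu
  refine ⟨f, fun β hβ => ?_⟩
  obtain ⟨g, hg⟩ := hf
  have := congrArg (aeval β) hg
  simp only [map_sub, map_prod, aeval_comp, map_mul, aeval_C, aeval_X, map_pow, hβ, sub_self,
    zero_mul] at this
  exact sub_eq_zero.mp this

theorem of_eval {K : Type*} [Field K] [Algebra k K] {u : k} (f : k[X]) (β : K)
    (hirr : Irreducible (X ^ n - C b)) (hn : n ≠ 0) (hβ : β ^ n = algebraMap k K b)
    (h : ∏ i ∈ Finset.range n, aeval (algebraMap k K ζ ^ i * β) f = algebraMap k K u) :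
    IsKNorm n ζ b u := by
  refine ⟨f, ?_⟩
  rw [minpoly.eq_of_irreducible_of_monic hirr (x := β) (by simp [hβ]) (monic_X_pow_sub_C b hn)]
  apply minpoly.dvd
  simp only [map_sub, map_prod, aeval_comp, map_mul, aeval_C, aeval_X, map_pow, h, sub_self]

theorem of_pow (hn : n ≠ 0) (hζ : IsPrimitiveRoot ζ n) {y : k} (hy : y ≠ 0) (u : k) :
    IsKNorm n ζ (y ^ n) u := by
  have hinj : Set.InjOn (fun i => ζ ^ i * y) (Finset.range n : Set ℕ) := by
    intro i hi j hj h
    exact hζ.pow_inj (by simpa using hi) (by simpa using hj) (mul_right_cancel₀ hy h)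
  let f := Lagrange.interpolate (Finset.range n) (fun i => ζ ^ i * y)
    (fun i => if i = 0 then u else 1)
  have hev : ∀ i ∈ Finset.range n, f.eval (ζ ^ i * y) = if i = 0 then u else 1 := fun i hi =>
    Lagrange.eval_interpolate_at_node _ hinj hi
  refine ⟨f, ?_⟩
  have hn0 : 0 < n := Nat.pos_of_ne_zero hn
  have hmod : ∀ m, f.eval (ζ ^ m * y) = if m % n = 0 then u else 1 := by
    intro m
    rw [← hev (m % n) (by simpa using Nat.mod_lt _ hn0)]
    congr 2
    conv_lhs => rw [← Nat.mod_add_div m n, pow_add, pow_mul, hζ.pow_eq_one, one_pow, mul_one]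
  have hfac : (X ^ n - C (y ^ n) : k[X]) = ∏ j ∈ Finset.range n, (X - C (ζ ^ j * y)) :=
    X_pow_sub_C_eq_prod hζ hn0 rfl
  rw [hfac]
  apply Finset.prod_dvd_of_coprime
  · intro i hi j hj hij
    exact isCoprime_X_sub_C_of_isUnit_sub (sub_ne_zero.mpr fun h => hij (hinj hi hj h)).isUnit
  · intro j hj
    rw [dvd_iff_isRoot]
    simp only [IsRoot, eval_sub, eval_prod, eval_comp, eval_mul, eval_C, eval_X]
    rw [sub_eq_zero]
    have h1 : ∀ i, eval (ζ ^ i * (ζ ^ j * y)) f = if (i + j) % n = 0 then u else 1 := fun i => by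
      rw [← hmod, pow_add, mul_assoc]
    simp only [h1]
    rw [prod_range_shift_of_periodic (fun m => if m % n = 0 then u else 1) (by simp) j,
      Finset.prod_eq_single_of_mem 0 (by simpa using hn0)]
    · simp
    · intro i hi h0
      rw [Nat.mod_eq_of_lt (by simpa using hi), if_neg h0]

end IsKNorm

section cup
variable {k Ω : Type*} [Field k] [Field Ω] [Algebra k Ω] {n : ℕ} [NeZero n] {ζ : k}

/-- The power of `ζ` (a root of unity of order dividing `n`) with exponent in `ZMod n`. -/
def zpw (ζ : k) (c : ZMod n) : k := ζ ^ c.val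

theorem zpw_natCast (hζ : ζ ^ n = 1) (m : ℕ) : zpw ζ (m : ZMod n) = ζ ^ m := by
  rw [zpw, ZMod.val_natCast]
  conv_rhs => rw [← Nat.mod_add_div m n, pow_add, pow_mul, hζ, one_pow, mul_one]

theorem zpw_zero : zpw ζ (0 : ZMod n) = 1 := by simp [zpw]

theorem zpw_add (hζ : ζ ^ n = 1) (c d : ZMod n) : zpw ζ (c + d) = zpw ζ c * zpw ζ d := by
  rw [← ZMod.natCast_zmod_val c, ← ZMod.natCast_zmod_val d, ← Nat.cast_add,
    zpw_natCast hζ, zpw_natCast hζ, zpw_natCast hζ, pow_add]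

theorem zpw_ne_zero (hζ : ζ ^ n = 1) (c : ZMod n) : zpw ζ c ≠ 0 := by
  refine pow_ne_zero _ ?_
  rintro rfl
  simp [NeZero.ne n] at hζ

theorem zpw_neg (hζ : ζ ^ n = 1) (c : ZMod n) : zpw ζ (-c) = (zpw ζ c)⁻¹ := by
  apply eq_inv_of_mul_eq_one_left
  rw [← zpw_add hζ, neg_add_cancel, zpw_zero]

theorem zpw_pow (hζ : ζ ^ n = 1) (c : ZMod n) : zpw ζ c ^ n = 1 := by
  rw [zpw, ← pow_mul, mul_comm, pow_mul, hζ, one_pow]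

theorem zpw_pow' (hζ : ζ ^ n = 1) (c : ZMod n) (m : ℕ) : zpw ζ c ^ m = zpw ζ ((m : ZMod n) * c) := by
  rw [← ZMod.natCast_zmod_val c, ← Nat.cast_mul, zpw_natCast hζ, zpw_natCast hζ, ← pow_mul,
    mul_comm]

theorem zpw_injective (hζ : IsPrimitiveRoot ζ n) : Function.Injective (zpw (n := n) ζ) :=
  fun c d h => ZMod.val_injective n (hζ.pow_inj (ZMod.val_lt c) (ZMod.val_lt d) h)

theorem exists_zpw_eq {K : Type*} [Field K] [Algebra k K] (hζ : IsPrimitiveRoot ζ n) {x : K}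
    (hx : x ^ n = 1) : ∃ c : ZMod n, x = algebraMap k K (zpw ζ c) := by
  have h := hζ.map_of_injective (algebraMap k K).injective
  obtain ⟨i, -, hi⟩ := h.eq_pow_of_pow_eq_one hx
  exact ⟨i, by rw [zpw_natCast hζ.pow_eq_one, map_pow, hi]⟩

/-- A function on the Galois group that only depends on the action on finitely many elements. -/
def FinDet {X : Type*} (φ : (Ω ≃ₐ[k] Ω) → X) : Prop :=
  ∃ s : Finset Ω, ∀ g h : Ω ≃ₐ[k] Ω, (∀ x ∈ s, g x = h x) → φ g = φ h

theorem FinDet.comp₂ {X Y Z : Type*} {φ : (Ω ≃ₐ[k] Ω) → X} {ψ : (Ω ≃ₐ[k] Ω) → Y}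
    (hφ : FinDet φ) (hψ : FinDet ψ) (F : X → Y → Z) : FinDet fun g => F (φ g) (ψ g) := by
  classical
  obtain ⟨s, hs⟩ := hφ
  obtain ⟨t, ht⟩ := hψ
  refine ⟨s ∪ t, fun g h hgh => ?_⟩
  show F _ _ = F _ _
  rw [hs g h fun x hx => hgh x (Finset.mem_union_left _ hx),
    ht g h fun x hx => hgh x (Finset.mem_union_right _ hx)]

theorem FinDet.comp {X Z : Type*} {φ : (Ω ≃ₐ[k] Ω) → X}
    (hφ : FinDet φ) (F : X → Z) : FinDet fun g => F (φ g) := hφ.comp₂ hφ fun x _ => F x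

/-- `χ` is the Kummer character attached to the radical `β`. -/
def IsKum (ζ : k) (β : Ω) (χ : (Ω ≃ₐ[k] Ω) → ZMod n) : Prop :=
  ∀ g : Ω ≃ₐ[k] Ω, g β = algebraMap k Ω (zpw ζ (χ g)) * β

theorem IsKum.pow_apply {β : Ω} {χ : (Ω ≃ₐ[k] Ω) → ZMod n} (h : IsKum ζ β χ) (g) :
    g β = algebraMap k Ω ζ ^ (χ g).val * β := by rw [h g, zpw, map_pow]

theorem exists_isKum (hζ : IsPrimitiveRoot ζ n) {β : Ω} {b : k} (hβ : β ^ n = algebraMap k Ω b)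
    (hb : b ≠ 0) : ∃ χ : (Ω ≃ₐ[k] Ω) → ZMod n, IsKum ζ β χ := by
  have hβ0 : β ≠ 0 := by
    rintro rfl
    rw [zero_pow (NeZero.ne n), eq_comm, map_eq_zero] at hβ
    exact hb hβ
  have : ∀ g : Ω ≃ₐ[k] Ω, ∃ c : ZMod n, g β = algebraMap k Ω (zpw ζ c) * β := fun g => by
    obtain ⟨c, hc⟩ := exists_zpw_eq (K := Ω) hζ (x := g β / β) (by
      rw [div_pow, ← map_pow, hβ, AlgEquiv.commutes, div_self]
      simpa using hb)
    exact ⟨c, by rw [← hc, div_mul_cancel₀ _ hβ0]⟩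
  choose χ hχ using this
  exact ⟨χ, hχ⟩

theorem IsKum.map_mul {β : Ω} {χ : (Ω ≃ₐ[k] Ω) → ZMod n} (h : IsKum ζ β χ)
    (hζ : IsPrimitiveRoot ζ n) (hβ : β ≠ 0) (g g') : χ (g * g') = χ g + χ g' := by
  apply zpw_injective hζ
  apply (algebraMap k Ω).injective
  apply mul_right_cancel₀ hβ
  rw [← h, AlgEquiv.mul_apply, h g', _root_.map_mul, AlgEquiv.commutes, h g,
    zpw_add hζ.pow_eq_one, _root_.map_mul]
  ring

theorem IsKum.finDet {β : Ω} {χ : (Ω ≃ₐ[k] Ω) → ZMod n} (h : IsKum ζ β χ)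
    (hζ : IsPrimitiveRoot ζ n) (hβ : β ≠ 0) : FinDet χ := by
  refine ⟨{β}, fun g g' hg => ?_⟩
  apply zpw_injective hζ
  apply (algebraMap k Ω).injective
  apply mul_right_cancel₀ hβ
  rw [← h, ← h]
  simpa using hg

theorem prod_pow_shift {n : ℕ} {z : ℕ → Ω} {B : Ω} (hz : ∀ m, z (m + n) = z m)
    (hB : ∏ i ∈ Finset.range n, z i = B) (c : ℕ) :
    (∏ i ∈ Finset.range n, z (i + c) ^ i) * B ^ c =
      (∏ i ∈ Finset.range n, z i ^ i) * (∏ j ∈ Finset.range c, z j) ^ n := by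
  induction c with
  | zero => simp
  | succ c ih =>
    have h1 : (∏ i ∈ Finset.range n, z (i + (c + 1)) ^ i) * B =
        (∏ i ∈ Finset.range n, z (i + c) ^ i) * z c ^ n := by
      rw [← hB, ← prod_range_shift_of_periodic z hz (c + 1), ← Finset.prod_mul_distrib]
      have h2 := Finset.prod_range_succ' (fun i => z (i + c) ^ i) n
      rw [Finset.prod_range_succ] at h2
      simp only [pow_zero, mul_one] at h2
      rw [← hz c, add_comm c n, h2]
      exact Finset.prod_congr rfl fun i _ => by rw [← pow_succ, add_right_comm, add_assoc]
    rw [pow_succ', ← mul_assoc, h1, Finset.prod_range_succ, mul_pow, mul_right_comm, ih]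
    ring

theorem exists_cochain_of_isKNorm [IsSepClosed Ω] [NeZero (n : Ω)] (hζ : IsPrimitiveRoot ζ n)
    {a b : k} (ha : a ≠ 0) (hb : b ≠ 0)
    {α β : Ω} (hα : α ^ n = algebraMap k Ω a) (hβ : β ^ n = algebraMap k Ω b)
    {χa χb : (Ω ≃ₐ[k] Ω) → ZMod n} (hχa : IsKum ζ α χa) (hχb : IsKum ζ β χb)
    (hN : IsKNorm n ζ a b) :
    ∃ φ : (Ω ≃ₐ[k] Ω) → ZMod n, FinDet φ ∧
      ∀ g h, φ (g * h) = φ g + φ h - χb g * χa h := by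
  have hn : n ≠ 0 := NeZero.ne n
  obtain ⟨f, hf⟩ := hN.exists_eval (K := Ω)
  set Z : Ω := algebraMap k Ω ζ with hZ
  have hZn : Z ^ n = 1 := by rw [hZ, ← map_pow, hζ.pow_eq_one, map_one]
  set z : ℕ → Ω := fun i => aeval (Z ^ i * α) f with hzdef
  have hz : ∀ m, z (m + n) = z m := fun m => by simp only [hzdef, pow_add, hZn, mul_one]
  have hB : ∏ i ∈ Finset.range n, z i = algebraMap k Ω b := hf α hα
  have hb' : algebraMap k Ω b ≠ 0 := by simpa using hb
  have hz0 : ∀ m, z m ≠ 0 := by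
    intro m h
    rw [← prod_range_shift_of_periodic z hz m] at hB
    rw [Finset.prod_eq_zero (i := 0) (by simpa using Nat.pos_of_ne_zero hn) (by simpa using h)]
      at hB
    exact hb' hB.symm
  have hα0 : α ≠ 0 := by
    rintro rfl
    rw [zero_pow hn, eq_comm, map_eq_zero] at hα
    exact ha hα
  have hβ0 : β ≠ 0 := by
    rintro rfl
    rw [zero_pow hn] at hβ
    exact hb' hβ.symm
  have hgz : ∀ (g : Ω ≃ₐ[k] Ω) i, g (z i) = z (i + (χa g).val) := fun g i => by
    simp only [hzdef]
    rw [← AlgEquiv.coe_toAlgHom, ← aeval_algHom_apply]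
    congr 1
    simp only [AlgEquiv.coe_toAlgHom, map_mul, map_pow, hχa.pow_apply g, pow_add]
    rw [hZ, AlgEquiv.commutes, mul_assoc]
  -- the twisting factor
  set w : ℕ → Ω := fun c => (β ^ c)⁻¹ * ∏ j ∈ Finset.range c, z j with hw
  have hw0 : ∀ c, w c ≠ 0 := fun c =>
    mul_ne_zero (inv_ne_zero (pow_ne_zero _ hβ0)) (Finset.prod_ne_zero_iff.mpr fun j _ => hz0 j)
  have hwn : ∀ c, w (c + n) = w c := fun c => by
    simp only [hw]
    rw [Finset.prod_range_add, pow_add, hβ]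
    rw [show ∏ x ∈ Finset.range n, z (c + x) = algebraMap k Ω b by
      rw [← hB, ← prod_range_shift_of_periodic z hz c]; simp only [add_comm]]
    field_simp
  have hwmod : ∀ c, w (c % n) = w c := fun c => by
    conv_rhs => rw [← Nat.mod_add_div c n]
    generalize c / n = d
    induction d with
    | zero => simp
    | succ d ih => rw [ih, mul_add, mul_one, ← add_assoc, hwn]
  set Δ : Ω := ∏ i ∈ Finset.range n, z i ^ i with hΔ
  have hΔ0 : Δ ≠ 0 := Finset.prod_ne_zero_iff.mpr fun j _ => pow_ne_zero _ (hz0 j)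
  obtain ⟨δ, hδ⟩ := IsSepClosed.exists_pow_nat_eq Δ n
  have hδ0 : δ ≠ 0 := by rintro rfl; rw [zero_pow hn] at hδ; exact hΔ0 hδ.symm
  have hgΔ : ∀ g : Ω ≃ₐ[k] Ω, g Δ = Δ * w (χa g).val ^ n := fun g => by
    have := prod_pow_shift hz hB (χa g).val
    rw [hΔ, map_prod]
    simp only [map_pow, hgz]
    rw [hw]
    simp only [mul_pow, inv_pow]
    rw [← pow_mul, mul_comm (χa g).val n, pow_mul, hβ, mul_left_comm,
      eq_inv_mul_iff_mul_eq₀ (pow_ne_zero _ hb'), mul_comm, this]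
  have hex : ∀ g : Ω ≃ₐ[k] Ω, ∃ c : ZMod n,
      g δ = δ * w (χa g).val * algebraMap k Ω (zpw ζ c) := fun g => by
    have hne := mul_ne_zero hδ0 (hw0 (χa g).val)
    obtain ⟨c, hc⟩ := exists_zpw_eq (K := Ω) hζ (x := g δ / (δ * w (χa g).val)) (by
      rw [div_pow, ← map_pow, hδ, mul_pow, hδ, hgΔ, div_self]
      exact mul_ne_zero hΔ0 (pow_ne_zero _ (hw0 _)))
    exact ⟨c, by rw [← hc, mul_div_cancel₀ _ hne]⟩
  choose φ hφ using hex
  classical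
  refine ⟨φ, ⟨{δ, α}, fun g h hgh => ?_⟩, fun g h => ?_⟩
  · have h1 : g δ = h δ := hgh δ (by simp)
    have h2 : χa g = χa h := by
      apply zpw_injective hζ
      apply (algebraMap k Ω).injective
      apply mul_right_cancel₀ hα0
      rw [← hχa, ← hχa]
      exact hgh α (by simp)
    rw [hφ g, hφ h, h2] at h1
    exact zpw_injective hζ ((algebraMap k Ω).injective
      (mul_left_cancel₀ (mul_ne_zero hδ0 (hw0 _)) h1))
  · have hgw : ∀ c : ℕ, g (w c) * w (χa g).val =
        algebraMap k Ω (zpw ζ (-(χb g * (c : ZMod n)))) * w ((χa g).val + c) := fun c => by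
      simp only [hw]
      rw [map_mul, map_inv₀, map_pow, map_prod, hχb g, Finset.prod_range_add, mul_pow, pow_add]
      simp only [hgz]
      rw [← map_pow, zpw_pow' hζ.pow_eq_one, zpw_neg hζ.pow_eq_one, map_inv₀,
        mul_comm (c : ZMod n)]
      simp only [add_comm, mul_inv]
      ring
    have h1 := congrArg g (hφ h)
    rw [map_mul, map_mul, AlgEquiv.commutes, hφ g, ← AlgEquiv.mul_apply, hφ (g * h),
      hχa.map_mul hζ hα0] at h1
    apply zpw_injective hζ
    apply (algebraMap k Ω).injective
    apply mul_left_cancel₀ (mul_ne_zero hδ0 (hw0 (χa g + χa h).val))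
    rw [h1, sub_eq_add_neg, zpw_add hζ.pow_eq_one, zpw_add hζ.pow_eq_one]
    have h2 := hgw (χa h).val
    rw [ZMod.natCast_zmod_val] at h2
    clear_value w
    rw [ZMod.val_add, hwmod, map_mul (algebraMap k Ω), map_mul (algebraMap k Ω)]
    linear_combination
      (δ * algebraMap k Ω (zpw ζ (φ g)) * algebraMap k Ω (zpw ζ (φ h))) * h2
end cup

section kummer
variable {k Ω : Type*} [Field k] [Field Ω] [Algebra k Ω] {n : ℕ} [NeZero n] {ζ : k}

theorem exists_kummer_generator [IsGalois k Ω] (hζ : ζ ^ n = 1) (H : Subgroup (Ω ≃ₐ[k] Ω))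
    {φ : (Ω ≃ₐ[k] Ω) → ZMod n} (hφ : FinDet φ)
    (hadd : ∀ g ∈ H, ∀ h ∈ H, φ (g * h) = φ g + φ h) :
    ∃ δ : Ω, δ ≠ 0 ∧ ∀ h ∈ H, h δ = algebraMap k Ω (zpw ζ (φ h)) * δ := by
  classical
  obtain ⟨s, hs⟩ := hφ
  let E := FiniteGaloisIntermediateField.adjoin k (s : Set Ω)
  have hsE : ∀ x ∈ s, x ∈ E.toIntermediateField :=
    FiniteGaloisIntermediateField.subset_adjoin k (s : Set Ω)
  let r := AlgEquiv.restrictNormalHom (F := k) (K₁ := Ω) E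
  have hr : ∀ g (x : E), ((r g x : E) : Ω) = g x := fun g x =>
    AlgEquiv.restrictNormal_commutes g E x
  let H' := H.map r
  have hlift : ∀ τ : H', ∃ h ∈ H, r h = τ := fun τ => τ.2
  choose l hlH hl using hlift
  have hdet : ∀ g h, r g = r h → φ g = φ h := fun g h hgh => hs g h fun x hx => by
    have := congrArg (fun τ => ((τ ⟨x, hsE x hx⟩ : E) : Ω)) hgh
    simpa only [hr] using this
  let ch : H' → (E →* Ω) := fun τ => (algebraMap E Ω : E →* Ω).comp (τ.1 : E ≃ₐ[k] E)
  have hch : Function.Injective ch := by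
    intro τ τ' h
    ext x
    exact DFunLike.congr_fun h x
  have hli := (linearIndependent_monoidHom E Ω).comp ch hch
  have : Fintype H' := Fintype.ofFinite _
  rw [Fintype.linearIndependent_iff] at hli
  by_contra! hcon
  have h0 : ∑ τ : H', algebraMap k Ω (zpw ζ (-φ (l τ))) • ((fun f : E →* Ω => (f : E → Ω)) ∘ ch) τ
      = 0 := by
    funext e
    simp only [Finset.sum_apply, Pi.smul_apply, Function.comp_apply, Pi.zero_apply, smul_eq_mul]
    by_contra hne
    obtain ⟨h, hh, hneq⟩ := hcon _ hne
    apply hneq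
    rw [map_sum, Finset.mul_sum]
    let h' : H' := ⟨r h, Subgroup.mem_map_of_mem r hh⟩
    refine Fintype.sum_equiv (Equiv.mulLeft h') _ _ fun τ => ?_
    have e1 : ch (h' * τ) e = h (ch τ e) := (hr h (τ.1 e))
    have e2 : φ (l (h' * τ)) = φ h + φ (l τ) := by
      rw [← hadd h hh _ (hlH τ)]
      apply hdet
      rw [hl, map_mul, hl]
      rfl
    rw [Equiv.coe_mulLeft, e1, e2, map_mul, AlgEquiv.commutes, ← mul_assoc, ← map_mul,
      ← zpw_add hζ, neg_add, add_neg_cancel_left]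
  have := hli _ h0 1
  rw [map_eq_zero] at this
  exact zpw_ne_zero hζ _ this

theorem isKNorm_of_cochain [IsGalois k Ω] {p : ℕ} [Fact p.Prime] (hp : p ≠ 2)
    (hζ : IsPrimitiveRoot ζ p)
    {a b : k} (ha : a ≠ 0) (hb : b ≠ 0)
    {α β : Ω} (hα : α ^ p = algebraMap k Ω a) (hβ : β ^ p = algebraMap k Ω b)
    {χa χb : (Ω ≃ₐ[k] Ω) → ZMod p} (hχa : IsKum ζ α χa) (hχb : IsKum ζ β χb)
    {φ : (Ω ≃ₐ[k] Ω) → ZMod p} (hφ : FinDet φ)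
    (hcup : ∀ g h, φ (g * h) = φ g + φ h + χb g * χa h) :
    IsKNorm p ζ a b := by
  have hpp : p.Prime := Fact.out
  have hn : p ≠ 0 := hpp.ne_zero
  by_cases hpow : ∃ y, y ^ p = a
  · obtain ⟨y, rfl⟩ := hpow
    exact IsKNorm.of_pow hn hζ (by rintro rfl; simp [hn] at ha) b
  push Not at hpow
  have hirr : Irreducible (X ^ p - C a) :=
    X_pow_sub_C_irreducible_of_prime hpp hpow
  have hα0 : α ≠ 0 := by
    rintro rfl
    rw [zero_pow hn, eq_comm, map_eq_zero] at hα
    exact ha hα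
  have hβ0 : β ≠ 0 := by
    rintro rfl
    rw [zero_pow hn, eq_comm, map_eq_zero] at hβ
    exact hb hβ
  have haddA := hχa.map_mul hζ hα0
  have haddB := hχb.map_mul hζ hβ0
  have hA1 : χa 1 = 0 := by simpa using haddA 1 1
  have hAinv : ∀ g, χa g⁻¹ = - χa g := fun g => by
    have := haddA g g⁻¹
    rw [mul_inv_cancel, hA1] at this
    exact eq_neg_of_add_eq_zero_right this.symm
  let H : Subgroup (Ω ≃ₐ[k] Ω) :=
    { carrier := {g | χa g = 0}
      mul_mem' := fun {g h} hg hh => by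
        simp only [Set.mem_ofPred_eq] at *
        rw [haddA, hg, hh, add_zero]
      one_mem' := hA1
      inv_mem' := fun {g} hg => by
        simp only [Set.mem_ofPred_eq] at *
        rw [hAinv, hg, neg_zero] }
  have hH : ∀ g, g ∈ H ↔ χa g = 0 := fun g => Iff.rfl
  -- an element on which `χa` does not vanish
  obtain ⟨σ₀, hσ₀⟩ : ∃ σ, χa σ ≠ 0 := by
    by_contra! hall
    have : α ∈ Set.range (algebraMap k Ω) := by
      rw [InfiniteGalois.mem_range_algebraMap_iff_fixed]
      intro g
      rw [hχa g, hall g, zpw_zero, map_one, one_mul]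
    obtain ⟨y, rfl⟩ := this
    rw [← map_pow] at hα
    exact hpow y ((algebraMap k Ω).injective hα)
  have hApow : ∀ (g) (m : ℕ), χa (g ^ m) = m * χa g := fun g m => by
    induction m with
    | zero => simpa using hA1
    | succ m ih => rw [pow_succ, haddA, ih]; push_cast; ring
  obtain ⟨σ, hσ⟩ : ∃ σ, χa σ = 1 := ⟨σ₀ ^ (χa σ₀)⁻¹.val, by
    rw [hApow, ZMod.natCast_zmod_val, inv_mul_cancel₀ hσ₀]⟩
  obtain ⟨δ, hδ0, hδ⟩ := exists_kummer_generator hζ.pow_eq_one H hφ (fun g _ h hh => by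
    rw [hcup, (hH h).mp hh, mul_zero, add_zero])
  have hσδ0 : σ δ ≠ 0 := by simpa using hδ0
  have hσδ : ∀ h ∈ H, h (σ δ) = algebraMap k Ω (zpw ζ (φ h + χb h)) * σ δ := fun h hh => by
    have hm : σ⁻¹ * h * σ ∈ H := by
      rw [hH, haddA, haddA, (hH h).mp hh, hAinv]; ring
    have e1 : φ (σ⁻¹ * h * σ) = φ h + χb h := by
      have h1 := hcup h σ
      have h2 := hcup σ (σ⁻¹ * h * σ)
      rw [(hH _).mp hm, show σ * (σ⁻¹ * h * σ) = h * σ by group, h1, hσ] at h2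
      linear_combination -h2
    rw [← e1]
    calc h (σ δ) = σ ((σ⁻¹ * h * σ) δ) := by
          rw [← AlgEquiv.mul_apply, ← AlgEquiv.mul_apply]; congr 1; group
      _ = _ := by rw [hδ _ hm, map_mul, AlgEquiv.commutes]
  set z : Ω := β * (σ δ / δ)⁻¹ with hz
  have hzfix : ∀ h ∈ H, h z = z := fun h hh => by
    have n1 : algebraMap k Ω (zpw ζ (φ h)) ≠ 0 := by simpa using zpw_ne_zero hζ.pow_eq_one _
    have n2 : algebraMap k Ω (zpw ζ (χb h)) ≠ 0 := by simpa using zpw_ne_zero hζ.pow_eq_one _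
    rw [hz, map_mul, map_inv₀, map_div₀, hσδ h hh, hδ h hh, hχb h, zpw_add hζ.pow_eq_one,
      map_mul (algebraMap k Ω)]
    field_simp
  -- so `z` is a polynomial in `α`
  have hzmem : z ∈ IntermediateField.adjoin k {α} := by
    rw [← InfiniteGalois.fixedField_fixingSubgroup (IntermediateField.adjoin k {α}),
      IntermediateField.mem_fixedField_iff]
    intro g hg
    apply hzfix
    rw [hH]
    have h1 : g α = α := (mem_fixingSubgroup_iff _).mp hg α
      (IntermediateField.mem_adjoin_simple_self k α)
    have h2 := hχa g
    rw [h1] at h2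
    have h3 : (1 : Ω) = algebraMap k Ω (zpw ζ (χa g)) :=
      mul_right_cancel₀ hα0 (by rw [one_mul]; exact h2)
    rw [← map_one (algebraMap k Ω), ← zpw_zero (n := p) (ζ := ζ)] at h3
    exact (zpw_injective hζ ((algebraMap k Ω).injective h3)).symm
  have hint : IsIntegral k α := ⟨X ^ p - C a, monic_X_pow_sub_C a hn, by simp [hα]⟩
  rw [← IntermediateField.mem_toSubalgebra,
    IntermediateField.adjoin_simple_toSubalgebra_of_isAlgebraic hint.isAlgebraic,
    Algebra.adjoin_singleton_eq_range_aeval] at hzmem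
  obtain ⟨f, hf⟩ := hzmem
  have hσpow : ∀ i : ℕ, (σ ^ i) α = algebraMap k Ω ζ ^ i * α := fun i => by
    rw [hχa, hApow, hσ, mul_one, zpw_natCast hζ.pow_eq_one, map_pow]
  refine IsKNorm.of_eval f α hirr hn hα ?_
  have hprod : ∀ m : ℕ, ∏ i ∈ Finset.range m, (σ ^ i) z =
      (∏ i ∈ Finset.range m, (σ ^ i) β) * ((σ ^ m) δ / δ)⁻¹ := fun m => by
    induction m with
    | zero => simp [hδ0]
    | succ m ih =>
      have : (σ ^ m) δ ≠ 0 := (map_ne_zero (σ ^ m)).mpr hδ0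
      have : (σ ^ (m + 1)) δ ≠ 0 := (map_ne_zero (σ ^ (m + 1))).mpr hδ0
      rw [Finset.prod_range_succ, ih, Finset.prod_range_succ, hz, map_mul, map_inv₀, map_div₀,
        ← AlgEquiv.mul_apply, ← pow_succ]
      field_simp
  have e1 : ∀ i ∈ Finset.range p, aeval (algebraMap k Ω ζ ^ i * α) f = (σ ^ i) z := fun i _ => by
    rw [← hσpow, ← hf]
    exact (aeval_algHom_apply (σ ^ i : Ω ≃ₐ[k] Ω).toAlgHom α f)
  rw [Finset.prod_congr rfl e1, hprod]
  have hφpow : ∀ m : ℕ, 2 * φ (σ ^ m) = m * (2 * φ σ) + χb σ * (m * (m - 1)) := fun m => by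
    have h1 : φ 1 = 0 := by simpa [hA1] using hcup 1 1
    induction m with
    | zero => simp [h1]
    | succ m ih =>
      rw [pow_succ', hcup, hApow, hσ, mul_add, mul_add, ih]; push_cast; ring
  have h2 : (2 : ZMod p) ≠ 0 := by
    intro h
    have : ((2 : ℕ) : ZMod p) = 0 := by exact_mod_cast h
    rw [ZMod.natCast_eq_zero_iff] at this
    exact hp ((Nat.prime_dvd_prime_iff_eq hpp Nat.prime_two).mp this)
  have hφp : φ (σ ^ p) = 0 := by
    have := hφpow p
    simp only [CharP.cast_eq_zero, zero_mul, mul_zero, add_zero] at this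
    exact (mul_eq_zero.mp this).resolve_left h2
  have hσp : σ ^ p ∈ H := by rw [hH, hApow]; simp
  rw [hδ _ hσp, hφp, zpw_zero, map_one, one_mul, div_self hδ0, inv_one, mul_one]
  have hBpow : ∀ m : ℕ, χb (σ ^ m) = m * χb σ := fun m => by
    induction m with
    | zero => simpa using haddB 1 1
    | succ m ih => rw [pow_succ, haddB, ih]; push_cast; ring
  have e2 : ∀ i ∈ Finset.range p, (σ ^ i) β = algebraMap k Ω (zpw ζ (χb σ)) ^ i * β :=
    fun i _ => by rw [hχb, hBpow, ← map_pow, zpw_pow' hζ.pow_eq_one]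
  rw [Finset.prod_congr rfl e2, Finset.prod_mul_distrib, Finset.prod_const, Finset.card_range, hβ,
    Finset.prod_pow_eq_pow_sum, Finset.sum_range_id, ← map_pow]
  have hdvd : p ∣ p * (p - 1) / 2 := by
    have hodd : 2 ∣ p - 1 := by
      rcases hpp.eq_two_or_odd with h | h
      · exact absurd h hp
      · omega
    rw [Nat.mul_div_assoc _ hodd]
    exact dvd_mul_right _ _
  obtain ⟨q, hq⟩ := hdvd
  rw [hq, pow_mul, zpw_pow hζ.pow_eq_one, one_pow, map_one, one_mul]

theorem IsKNorm.symm {k : Type*} [Field k] {ζ : k} {p : ℕ} [Fact p.Prime] (hp : p ≠ 2)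
    (hζ : IsPrimitiveRoot ζ p)
    {a b : k} (ha : a ≠ 0) (hb : b ≠ 0) (h : IsKNorm p ζ a b) : IsKNorm p ζ b a := by
  have : NeZero (p : k) := hζ.neZero'
  let Ω := SeparableClosure k
  have : NeZero (p : Ω) := ⟨by
    rw [← map_natCast (algebraMap k Ω)]
    exact (_root_.map_ne_zero _).mpr (NeZero.ne (p : k))⟩
  obtain ⟨α, hα⟩ := IsSepClosed.exists_pow_nat_eq (algebraMap k Ω a) p
  obtain ⟨β, hβ⟩ := IsSepClosed.exists_pow_nat_eq (algebraMap k Ω b) p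
  obtain ⟨χa, hχa⟩ := exists_isKum hζ hα ha
  obtain ⟨χb, hχb⟩ := exists_isKum hζ hβ hb
  have hn : p ≠ 0 := NeZero.ne p
  have hα0 : α ≠ 0 := by
    rintro rfl
    rw [zero_pow hn, eq_comm, map_eq_zero] at hα
    exact ha hα
  have hβ0 : β ≠ 0 := by
    rintro rfl
    rw [zero_pow hn, eq_comm, map_eq_zero] at hβ
    exact hb hβ
  obtain ⟨φ, hφ, hc⟩ := exists_cochain_of_isKNorm hζ ha hb hα hβ hχa hχb h
  refine isKNorm_of_cochain hp hζ hb ha hβ hα hχb hχa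
    (φ := fun g => φ g + χa g * χb g)
    (hφ.comp₂ ((hχa.finDet hζ hα0).comp₂ (hχb.finDet hζ hβ0) (· * ·)) (· + ·)) fun g h => ?_
  rw [hc, hχa.map_mul hζ hα0, hχb.map_mul hζ hβ0]
  ring

/-- The Steinberg relation. -/
theorem IsKNorm.steinberg {k : Type*} [Field k] {ζ : k} {n : ℕ} (hn : n ≠ 0)
    (hζ : IsPrimitiveRoot ζ n) (a : k) : IsKNorm n ζ a (1 - a) := by
  refine ⟨1 - X, ?_⟩
  have h := X_pow_sub_C_eq_prod (R := k[X]) (hζ.map_of_injective (f := C) C_injective)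
    (Nat.pos_of_ne_zero hn) (α := X) rfl
  have h1 := congrArg (eval (1 : k[X])) h
  simp only [eval_sub, eval_pow, eval_X, eval_C, one_pow, eval_prod] at h1
  simp only [sub_comp, one_comp, X_comp]
  simp only [C_pow]
  rw [← h1, C_sub, C_1]
  exact ⟨-1, by ring⟩
end kummer

end

section

open Polynomial IsLocalRing

section local_lemmas
variable {O k : Type*} [CommRing O] [IsDomain O] [IsDiscreteValuationRing O] [Field k]
  [Algebra O k] [IsFractionRing O k]

theorem exists_C_mul_map_eq (r : k[X]) (hr : r ≠ 0) :
    ∃ (c : k) (r₀ : O[X]), c ≠ 0 ∧ r = C c * r₀.map (algebraMap O k) ∧ ∃ j, r₀.coeff j = 1 := by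
  obtain ⟨j, hj, hmax⟩ := Finset.exists_max_image r.support
    (fun i => ValuationRing.valuation O k (r.coeff i)) (by simpa using hr)
  have hc : r.coeff j ≠ 0 := by simpa using hj
  have hint : ∀ i, ∃ a : O, algebraMap O k a = r.coeff i / r.coeff j := fun i => by
    rw [← ValuationRing.mem_integer_iff, Valuation.mem_integer_iff, map_div₀]
    by_cases hi : i ∈ r.support
    · exact div_le_one_of_le₀ (hmax i hi) zero_le
    · rw [notMem_support_iff.mp hi]; simp
  have hpoly : C (r.coeff j)⁻¹ * r ∈ Polynomial.lifts (algebraMap O k) := by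
    rw [lifts_iff_coeff_lifts]
    intro i
    obtain ⟨a, ha⟩ := hint i
    exact ⟨a, by rw [ha, coeff_C_mul]; field_simp⟩
  obtain ⟨r₀, hr₀⟩ := (mem_lifts _).mp hpoly
  refine ⟨r.coeff j, r₀, hc, ?_, j, ?_⟩
  · rw [hr₀, ← mul_assoc, ← C_mul, mul_inv_cancel₀ hc, C_1, one_mul]
  · apply FaithfulSMul.algebraMap_injective O k
    rw [← coeff_map, hr₀, coeff_C_mul, inv_mul_cancel₀ hc, map_one]

theorem exists_pow_mul_unit_of_dvd_prod_comp {n : ℕ} {P : O[X]} (hP : P.Monic)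
    (hirr : Irreducible (P.map (residue O))) (s w : ℕ → O) (hw : ∀ i, IsUnit (w i))
    (hPτ : ∀ i, P ∣ P.comp (C (s i) + C (w i) * X)) {h : k[X]} {u : k} (hu : u ≠ 0)
    (hdvd : P.map (algebraMap O k) ∣
      (∏ i ∈ Finset.range n, h.comp ((C (s i) + C (w i) * X : O[X]).map (algebraMap O k))) - C u) :
    ∃ (c : k) (x : O), IsUnit x ∧ u = c ^ n * algebraMap O k x := by
  set φ := algebraMap O k with hφ
  have hPk : (P.map φ).Monic := hP.map _
  have hdeg : 0 < P.natDegree := by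
    rw [← hP.natDegree_map (residue O)]
    exact hirr.natDegree_pos
  have hnu : ¬ IsUnit (P.map φ) := fun hh => by
    have := natDegree_eq_zero_of_isUnit hh
    rw [hP.natDegree_map] at this
    omega
  set r := h %ₘ (P.map φ) with hrdef
  have hcong : P.map φ ∣ (∏ i ∈ Finset.range n,
      r.comp ((C (s i) + C (w i) * X : O[X]).map φ)) - C u := by
    have h1 : P.map φ ∣ (∏ i ∈ Finset.range n, h.comp ((C (s i) + C (w i) * X : O[X]).map φ)) -
        ∏ i ∈ Finset.range n, r.comp ((C (s i) + C (w i) * X : O[X]).map φ) := by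
      rw [← Ideal.mem_span_singleton, ← Ideal.Quotient.mk_eq_mk_iff_sub_mem, map_prod, map_prod]
      refine Finset.prod_congr rfl fun i _ => ?_
      rw [Ideal.Quotient.mk_eq_mk_iff_sub_mem, Ideal.mem_span_singleton, ← sub_comp]
      obtain ⟨q, hq⟩ : P.map φ ∣ h - r := by
        rw [hrdef]
        exact ⟨h /ₘ P.map φ, by rw [sub_eq_iff_eq_add]; exact (by
          rw [add_comm]; exact (modByMonic_add_div h (P.map φ)).symm)⟩
      rw [hq, mul_comp, ← map_comp]
      exact (Polynomial.map_dvd φ (hPτ i)).mul_right _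
    have := dvd_sub hdvd h1
    simpa using this
  have hn : 0 < n ∨ n = 0 := by omega
  rcases hn with hn | rfl
  swap
  · obtain ⟨q, hq⟩ := hcong
    have h2 : C (1 - u) = P.map φ * q := by simpa using hq
    have : q = 0 := by
      by_contra hq0
      have := congrArg natDegree h2
      rw [natDegree_C, hPk.natDegree_mul' hq0, hP.natDegree_map] at this
      omega
    rw [this, mul_zero, C_eq_zero, sub_eq_zero] at h2
    exact ⟨1, 1, isUnit_one, by simp [← h2]⟩
  have hr : r ≠ 0 := by
    intro h0
    rw [h0] at hcong
    simp only [zero_comp, Finset.prod_const, Finset.card_range, zero_pow hn.ne', zero_sub,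
      dvd_neg] at hcong
    exact hnu (isUnit_of_dvd_unit hcong (isUnit_C.mpr hu.isUnit))
  obtain ⟨c, r₀, hc, hr₀, j, hj⟩ := exists_C_mul_map_eq (O := O) r hr
  set R : O[X] := ∏ i ∈ Finset.range n, r₀.comp (C (s i) + C (w i) * X) with hR
  have hcong2 : P.map φ ∣ R.map φ - C (u / c ^ n) := by
    have h1 : C (c ^ n)⁻¹ * ((∏ i ∈ Finset.range n,
      r.comp ((C (s i) + C (w i) * X : O[X]).map φ)) - C u) = R.map φ - C (u / c ^ n) := by
      rw [hR, Polynomial.map_prod, hr₀]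
      simp only [mul_comp, C_comp, Polynomial.map_comp, Finset.prod_mul_distrib, Finset.prod_const,
        Finset.card_range]
      rw [mul_sub, ← mul_assoc, ← C_pow, ← C_mul, ← C_mul, inv_mul_cancel₀ (pow_ne_zero _ hc), C_1,
        one_mul, div_eq_inv_mul]
    rw [← h1]
    exact hcong.mul_left _
  have hmod : (R %ₘ P).map φ = C (u / c ^ n) := by
    rw [map_modByMonic _ hP]
    have h1 := (modByMonic_eq_zero_iff_dvd hPk).mpr hcong2
    rw [sub_modByMonic, sub_eq_zero] at h1
    rw [h1, modByMonic_eq_self_iff hPk, degree_eq_natDegree hPk.ne_zero, hP.natDegree_map]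
    exact degree_C_le.trans_lt (by exact_mod_cast hdeg)
  have hinj := FaithfulSMul.algebraMap_injective O k
  set u₀ := (R %ₘ P).coeff 0 with hu₀
  have hu0φ : φ u₀ = u / c ^ n := by
    rw [hu₀, ← coeff_map, hmod, coeff_C_zero]
  have hρ : R %ₘ P = C u₀ := by
    apply Polynomial.map_injective φ hinj
    rw [hmod, map_C, hu0φ]
  refine ⟨c, u₀, ?_, by rw [hu0φ, mul_div_cancel₀ _ (pow_ne_zero _ hc)]⟩
  by_contra hnon
  have hres : residue O u₀ = 0 := by
    rw [residue_eq_zero_iff]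
    exact hnon
  have hd : P.map (residue O) ∣ ∏ i ∈ Finset.range n,
      (r₀.comp (C (s i) + C (w i) * X)).map (residue O) := by
    have h1 : P ∣ R - C u₀ := by
      rw [← hρ]
      exact ⟨R /ₘ P, by rw [sub_eq_iff_eq_add, add_comm]; exact (modByMonic_add_div R P).symm⟩
    have h2 := Polynomial.map_dvd (residue O) h1
    rwa [Polynomial.map_sub, map_C, hres, C_0, sub_zero, hR, Polynomial.map_prod] at h2
  obtain ⟨i, -, hi⟩ := (hirr.prime.dvd_finsetProd_iff _).mp hd
  have hwi : residue O (w i) ≠ 0 := by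
    rw [Ne, residue_eq_zero_iff, mem_maximalIdeal, mem_nonunits_iff, not_not]
    exact hw i
  have hnd : (C (residue O (s i)) + C (residue O (w i)) * X).natDegree = 1 := by
    rw [add_comm]; exact natDegree_linear hwi
  have hr00 : r₀.map (residue O) ≠ 0 := by
    intro h0
    have := congrArg (fun q => coeff q j) h0
    simp [hj] at this
  have hlt : (r₀.map (residue O)).natDegree < P.natDegree := by
    refine natDegree_map_le.trans_lt ?_
    have h1 : r.natDegree = r₀.natDegree := by
      rw [hr₀, natDegree_C_mul hc, natDegree_map_eq_of_injective hinj]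
    rw [← h1, hrdef, ← hP.natDegree_map φ]
    exact natDegree_modByMonic_lt _ hPk (fun h1 => hnu (h1 ▸ isUnit_one))
  rw [map_comp] at hi
  simp only [Polynomial.map_add, map_C, Polynomial.map_mul, map_X] at hi
  have hne : (r₀.map (residue O)).comp (C (residue O (s i)) + C (residue O (w i)) * X) ≠ 0 := by
    intro h0
    rcases comp_eq_zero_iff.mp h0 with h1 | ⟨-, h1⟩
    · exact hr00 h1
    · rw [h1, natDegree_C] at hnd
      omega
  have := natDegree_le_of_dvd hi hne
  rw [natDegree_comp, hnd, mul_one, hP.natDegree_map] at this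
  omega

theorem artinSchreier_irreducible {κ : Type*} [Field κ] {p : ℕ} [Fact p.Prime] [CharP κ p] {c : κ}
    (hc : ∀ y : κ, y ^ p - y ≠ c) : Irreducible (X ^ p - X - C c : κ[X]) := by
  have hp1 : 1 < p := (Fact.out : p.Prime).one_lt
  set P : κ[X] := X ^ p - X - C c with hP
  have hdegX : (X + C c : κ[X]).degree < (p : ℕ) := by
    rw [degree_X_add_C]; exact_mod_cast hp1
  have hPe : P = X ^ p - (X + C c) := by rw [hP]; ring
  have hmon : P.Monic := by
    rw [hPe]; exact monic_X_pow_sub (by simpa using hdegX)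
  have hnd : P.natDegree = p := by
    rw [hPe]
    apply natDegree_eq_of_degree_eq_some
    rw [degree_sub_eq_left_of_degree_lt (by rwa [degree_X_pow]), degree_X_pow]
  let E := AlgebraicClosure κ
  have : CharP E p := charP_of_injective_algebraMap (algebraMap κ E).injective p
  obtain ⟨y, hy⟩ := IsAlgClosed.exists_aeval_eq_zero E P (by
    rw [degree_eq_natDegree hmon.ne_zero, hnd]; exact_mod_cast (by omega : p ≠ 0))
  have hy' : y ^ p - y = algebraMap κ E c := by
    have := hy
    simp only [hP, map_sub, map_pow, aeval_X, aeval_C] at this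
    exact sub_eq_zero.mp this
  have hroots : ∀ x : E, aeval x P = 0 → ∃ m : ℕ, x = y + m := by
    intro x hx
    have hx' : x ^ p - x = algebraMap κ E c := by
      simp only [hP, map_sub, map_pow, aeval_X, aeval_C] at hx
      exact sub_eq_zero.mp hx
    have h1 : (x - y) ^ p = x - y := by
      rw [sub_pow_char]; linear_combination hx' - hy'
    let _ := ZMod.algebra E p
    obtain ⟨m, hm⟩ : ∃ m : ZMod p, algebraMap (ZMod p) E m = x - y := by
      have h2 := (Subfield.mem_bot_iff_pow_eq_self E p).mpr h1
      rw [← ZMod.fieldRange_castHom_eq_bot p] at h2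
      obtain ⟨m, hm⟩ := h2
      exact ⟨m, hm⟩
    refine ⟨m.val, ?_⟩
    rw [← ZMod.natCast_zmod_val m, map_natCast] at hm
    rw [hm]; ring
  rw [hmon.irreducible_iff_natDegree']
  refine ⟨fun h => by rw [h, natDegree_one] at hnd; omega, ?_⟩
  intro f g hf hg hfg hmem
  rw [hnd, Finset.mem_Ioc] at hmem
  have hgd : 0 < g.natDegree ∧ g.natDegree < p := by omega
  have hsp : (g.map (algebraMap κ E)).Splits := IsAlgClosed.splits _
  have hcard := hsp.natDegree_eq_card_roots
  rw [natDegree_map] at hcard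
  have hsum : ∀ s : Multiset E, (∀ x ∈ s, ∃ m : ℕ, x = y + m) →
      ∃ m : ℕ, s.sum = s.card * y + m := by
    intro s
    induction s using Multiset.induction with
    | empty => exact fun _ => ⟨0, by simp⟩
    | cons a s ih =>
      intro h
      obtain ⟨m, hm⟩ := ih fun x hx => h x (Multiset.mem_cons_of_mem hx)
      obtain ⟨m', hm'⟩ := h a (Multiset.mem_cons_self _ _)
      refine ⟨m + m', ?_⟩
      rw [Multiset.sum_cons, hm, hm', Multiset.card_cons]; push_cast; ring
  obtain ⟨m, hm⟩ := hsum (g.map (algebraMap κ E)).roots (by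
    intro x hx
    apply hroots
    rw [mem_roots (hg.map _).ne_zero, IsRoot, eval_map_algebraMap] at hx
    rw [← hfg, map_mul, hx, mul_zero])
  have hnc : (g.map (algebraMap κ E)).nextCoeff = -(g.map (algebraMap κ E)).roots.sum :=
    hsp.nextCoeff_eq_neg_sum_roots_of_monic (hg.map _)
  rw [nextCoeff_map (algebraMap κ E).injective, hm, ← hcard] at hnc
  have hdne : (g.natDegree : κ) ≠ 0 := by
    rw [Ne, CharP.cast_eq_zero_iff κ p]
    exact Nat.not_dvd_of_pos_of_lt hgd.1 hgd.2
  have hyk : y = algebraMap κ E (-(g.nextCoeff + m) / g.natDegree) := by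
    have h2 : (g.natDegree : E) ≠ 0 := by
      rw [← map_natCast (algebraMap κ E)]; exact (_root_.map_ne_zero _).mpr hdne
    simp only [map_div₀, map_neg, map_add, map_natCast]
    rw [eq_div_iff h2, hnc]; ring
  refine hc (-(g.nextCoeff + m) / g.natDegree) ((algebraMap κ E).injective ?_)
  rw [map_sub, map_pow, ← hyk, hy']
end local_lemmas

section kummer_poly
variable {O : Type*} [CommRing O] [IsDomain O] {p : ℕ} [hp : Fact p.Prime] {z : O}

theorem sub_one_pow_dvd_prime (hz : IsPrimitiveRoot z p) : ∃ μ, (p : O) = (z - 1) ^ (p - 1) * μ := by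
  have hp1 := hp.out.one_lt
  obtain ⟨q, hq⟩ : ∃ q, p = q + 1 := ⟨p - 1, by omega⟩
  have h := (hq ▸ hz : IsPrimitiveRoot z (q + 1)).prod_one_sub_pow_eq_order
  have h1 : ∀ i ∈ Finset.range q, (z - 1) ∣ (1 - z ^ (i + 1)) := fun i _ => by
    rw [← dvd_neg, neg_sub]
    simpa using sub_dvd_pow_sub_pow z 1 (i + 1)
  have h2 := Finset.prod_dvd_prod_of_dvd _ _ h1
  rw [h, Finset.prod_const, Finset.card_range] at h2
  obtain ⟨μ, hμ⟩ := h2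
  refine ⟨μ, ?_⟩
  rw [hq, Nat.add_sub_cancel, ← hμ]; push_cast; ring

/-- The polynomial `((1 + l X) ^ p - 1) / l ^ p`, where `p = l ^ (p - 1) * m`. -/
noncomputable def kumPoly (p : ℕ) (l m : O) : O[X] :=
  X ^ p + ∑ j ∈ Finset.Ico 1 p, C (m * l ^ (j - 1) * ((p.choose j / p : ℕ) : O)) * X ^ j

theorem C_mul_kumPoly {l m : O} (h : (p : O) = l ^ (p - 1) * m) :
    C (l ^ p) * kumPoly p l m = (1 + C l * X) ^ p - 1 := by
  have hp1 := hp.out.one_lt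
  rw [add_comm (1 : O[X]), add_pow, Finset.sum_range_succ, ← Finset.sum_range_add_sum_Ico _ hp1.le,
    kumPoly, mul_add, Finset.mul_sum]
  simp only [Finset.range_one, Finset.sum_singleton, one_pow, mul_one, pow_zero, Nat.choose_zero_right,
    Nat.choose_self, Nat.cast_one, mul_pow, C_pow]
  have : ∀ j ∈ Finset.Ico 1 p, C l ^ p * (C (m * l ^ (j - 1) * ((p.choose j / p : ℕ) : O)) * X ^ j) =
      C l ^ j * X ^ j * (p.choose j : O[X]) := by
    intro j hj
    rw [Finset.mem_Ico] at hj
    obtain ⟨t, ht⟩ := hp.out.dvd_choose_self (by omega) hj.2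
    have h1 : p.choose j / p = t := by rw [ht, Nat.mul_div_cancel_left _ hp.out.pos]
    have h2 : (p : O[X]) = C l ^ (p - 1) * C m := by
      rw [← C_pow, ← C_mul, ← h]; simp
    have h3 : (p.choose j : O[X]) = C l ^ (p - 1) * C m * (t : O[X]) := by
      rw [ht, ← h2]; push_cast; ring
    have h4 : (C l ^ p : O[X]) = C l ^ (p - 1) * C l := by
      rw [← pow_succ]; congr 1; omega
    have h5 : (C l ^ j : O[X]) = C l ^ (j - 1) * C l := by
      rw [← pow_succ]; congr 1; omega
    rw [h1, h3, h4, h5]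
    simp only [C_mul, C_pow, map_natCast]; ring
  rw [Finset.sum_congr rfl this]
  ring

theorem kumPoly_degree_aux (l m : O) :
    (∑ j ∈ Finset.Ico 1 p, C (m * l ^ (j - 1) * ((p.choose j / p : ℕ) : O)) * X ^ j).degree
      < ((p : ℕ) : WithBot ℕ) := by
  rw [degree_lt_iff_coeff_zero]
  intro k hk
  rw [finsetSum_coeff]
  refine Finset.sum_eq_zero fun j hj => ?_
  rw [Finset.mem_Ico] at hj
  rw [coeff_C_mul, coeff_X_pow, if_neg (by omega), mul_zero]

theorem kumPoly_sub_C_monic (l m c : O) : (kumPoly p l m - C c).Monic := by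
  have h0 := hp.out.pos
  rw [kumPoly, add_sub_assoc]
  refine monic_X_pow_add ((degree_sub_le _ _).trans_lt (max_lt (kumPoly_degree_aux l m) ?_))
  exact degree_C_le.trans_lt (by exact_mod_cast h0)

theorem kumPoly_eval {l m : O} (h : (p : O) = l ^ (p - 1) * m) (y : O) :
    l ^ p * (kumPoly p l m).eval y = (1 + l * y) ^ p - 1 := by
  have := congrArg (eval y) (C_mul_kumPoly h)
  simpa using this

theorem kumPoly_eval_zero (l m : O) : (kumPoly p l m).eval 0 = 0 := by
  rw [kumPoly, eval_add, eval_finsetSum]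
  rw [Finset.sum_eq_zero]
  · simp [hp.out.ne_zero]
  · intro j hj
    rw [Finset.mem_Ico] at hj
    simp [show j ≠ 0 by omega]

theorem kumPoly_eval_one (hz : IsPrimitiveRoot z p) {m : O} (h : (p : O) = (z - 1) ^ (p - 1) * m) :
    (kumPoly p (z - 1) m).eval 1 = 0 := by
  have h1 := kumPoly_eval h 1
  rw [mul_one, add_sub_cancel, hz.pow_eq_one, sub_self] at h1
  exact (mul_eq_zero.mp h1).resolve_left
    (pow_ne_zero _ (sub_ne_zero.mpr (hz.ne_one hp.out.one_lt)))

theorem kumPoly_comp (hz : IsPrimitiveRoot z p) {m : O} (h : (p : O) = (z - 1) ^ (p - 1) * m) {s : O}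
    {i : ℕ} (hs : (z - 1) * s = z ^ i - 1) :
    (kumPoly p (z - 1) m).comp (C s + C (z ^ i) * X) = kumPoly p (z - 1) m := by
  have hl : C ((z - 1) ^ p) ≠ 0 := by
    rw [Ne, C_eq_zero]
    exact pow_ne_zero _ (sub_ne_zero.mpr (hz.ne_one hp.out.one_lt))
  apply mul_left_cancel₀ hl
  have h1 := congrArg (fun q => q.comp (C s + C (z ^ i) * X)) (C_mul_kumPoly h)
  simp only [mul_comp, C_comp, sub_comp, pow_comp, add_comp, one_comp, X_comp] at h1
  rw [h1, C_mul_kumPoly h]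
  have h2 : (1 + C (z - 1) * (C s + C (z ^ i) * X) : O[X]) = C (z ^ i) * (1 + C (z - 1) * X) := by
    have : (C (z - 1) * C s : O[X]) = C (z ^ i) - 1 := by rw [← C_mul, hs]; simp
    rw [mul_add, this]; ring
  rw [h2, mul_pow, ← C_pow, ← pow_mul, mul_comm i p, pow_mul, hz.pow_eq_one, one_pow, C_1, one_mul]

end kummer_poly

section dvr
variable {O k : Type*} [CommRing O] [IsDomain O] [IsDiscreteValuationRing O] [Field k]
  [Algebra O k] [IsFractionRing O k] {p : ℕ} [hp : Fact p.Prime] {z π : O}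

theorem exists_zpow_mul_unit (hπ : Irreducible π) {u : k} (hu : u ≠ 0) :
    ∃ (m : ℤ) (w : Oˣ), u = algebraMap O k π ^ m * algebraMap O k w := by
  obtain ⟨a, b, hb, rfl⟩ := IsFractionRing.div_surjective O u
  have hb0 : b ≠ 0 := nonZeroDivisors.ne_zero hb
  have ha0 : a ≠ 0 := by rintro rfl; simp at hu
  obtain ⟨n, v, rfl⟩ := IsDiscreteValuationRing.eq_unit_mul_pow_irreducible ha0 hπ
  obtain ⟨n', v', rfl⟩ := IsDiscreteValuationRing.eq_unit_mul_pow_irreducible hb0 hπ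
  have hπ0 : algebraMap O k π ≠ 0 :=
    (_root_.map_ne_zero_iff _ (FaithfulSMul.algebraMap_injective O k)).mpr hπ.ne_zero
  have hv' : algebraMap O k v' ≠ 0 :=
    (_root_.map_ne_zero_iff _ (FaithfulSMul.algebraMap_injective O k)).mpr v'.ne_zero
  have hv'' : algebraMap O k ((v'⁻¹ : Oˣ) : O) * algebraMap O k v' = 1 := by
    rw [← map_mul, Units.inv_mul, map_one]
  refine ⟨n - n', v * v'⁻¹, ?_⟩
  rw [zpow_sub₀ hπ0, zpow_natCast, zpow_natCast]
  simp only [map_mul, map_pow, Units.val_mul]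
  field_simp
  linear_combination -hv''

theorem eq_zero_of_zpow_eq_unit (hπ : Irreducible π) {m : ℤ} {w : Oˣ}
    (h : algebraMap O k π ^ m = algebraMap O k w) : m = 0 := by
  have key : ∀ (n : ℕ) (w : Oˣ), algebraMap O k π ^ n = algebraMap O k w → n = 0 := by
    intro n w h
    rw [← map_pow] at h
    have h1 := FaithfulSMul.algebraMap_injective O k h
    by_contra hn
    exact hπ.not_isUnit ((isUnit_pow_iff hn).mp (h1 ▸ w.isUnit))
  rcases Int.eq_nat_or_neg m with ⟨n, rfl | rfl⟩
  · rw [zpow_natCast] at h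
    exact_mod_cast key n w h
  · rw [zpow_neg, zpow_natCast] at h
    have : algebraMap O k π ^ n = algebraMap O k ((w⁻¹ : Oˣ) : O) := by
      rw [← inv_inv (algebraMap O k π ^ n), h]
      apply inv_eq_of_mul_eq_one_right
      rw [← map_mul, Units.mul_inv, map_one]
    have := key n _ this
    simp [this]

theorem dvd_of_zpow_mul_unit_eq_pow_mul (hπ : Irreducible π) {m : ℤ} {w x : Oˣ} {c : k} {n : ℕ}
    (h : algebraMap O k π ^ m * algebraMap O k w = c ^ n * algebraMap O k x) : (n : ℤ) ∣ m := by
  have hinj := FaithfulSMul.algebraMap_injective O k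
  have hπ0 : algebraMap O k π ≠ 0 := (_root_.map_ne_zero_iff _ hinj).mpr hπ.ne_zero
  have hne : ∀ v : Oˣ, algebraMap O k v ≠ 0 := fun v => (_root_.map_ne_zero_iff _ hinj).mpr v.ne_zero
  rcases eq_or_ne n 0 with rfl | hn
  · have : m = 0 := by
      apply eq_zero_of_zpow_eq_unit (k := k) hπ (w := x * w⁻¹)
      have hv : algebraMap O k w * algebraMap O k ((w⁻¹ : Oˣ) : O) = 1 := by
        rw [← map_mul, Units.mul_inv, map_one]
      rw [Units.val_mul, map_mul]
      linear_combination (algebraMap O k ((w⁻¹ : Oˣ) : O)) * h - algebraMap O k π ^ m * hv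
    simp [this]
  have hc : c ≠ 0 := by
    rintro rfl
    rw [zero_pow hn, zero_mul] at h
    exact mul_ne_zero (zpow_ne_zero _ hπ0) (hne w) h
  obtain ⟨j, v, rfl⟩ := exists_zpow_mul_unit hπ hc
  have : m - n * j = 0 := by
    apply eq_zero_of_zpow_eq_unit (k := k) hπ (w := v ^ n * x * w⁻¹)
    have hv : algebraMap O k w * algebraMap O k ((w⁻¹ : Oˣ) : O) = 1 := by
      rw [← map_mul, Units.mul_inv, map_one]
    rw [zpow_sub₀ hπ0, mul_comm (n : ℤ), zpow_mul, zpow_natCast, Units.val_mul, Units.val_mul, map_mul,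
      map_mul, Units.val_pow_eq_pow_val, map_pow, div_eq_iff (pow_ne_zero _ (zpow_ne_zero _ hπ0))]
    linear_combination (algebraMap O k ((w⁻¹ : Oˣ) : O)) * h - algebraMap O k π ^ m * hv
  exact ⟨j, by linarith⟩
end dvr

section dvr
variable {O k : Type*} [CommRing O] [IsDomain O] [IsDiscreteValuationRing O] [Field k]
  [Algebra O k] [IsFractionRing O k] {p : ℕ} [hp : Fact p.Prime] {z π μ c : O}

theorem residue_eq_zero_iff_dvd (hπ : Irreducible π) (x : O) : residue O x = 0 ↔ π ∣ x := by
  rw [residue_eq_zero_iff, hπ.maximalIdeal_eq, Ideal.mem_span_singleton]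

theorem residue_charP_of_dvd (hπ : Irreducible π) (h : π ∣ (p : O)) : CharP (ResidueField O) p := by
  have h0 : ((p : ℕ) : ResidueField O) = 0 := by
    rw [← map_natCast (residue O), residue_eq_zero_iff_dvd hπ]; exact h
  exact (CharP.charP_iff_prime_eq_zero hp.out).mpr h0

theorem kumPoly_sub_irreducible (hz : IsPrimitiveRoot z p) (hπ : Irreducible π)
    (hμ : (p : O) = (z - 1) ^ (p - 1) * μ)
    (hc : ∀ y, ¬ π ∣ (kumPoly p (z - 1) μ).eval y - c) :
    Irreducible ((kumPoly p (z - 1) μ - C c).map (residue O)) := by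
  set l := z - 1 with hl
  by_cases hlu : IsUnit l
  · have hlr : residue O l ≠ 0 := by
      rw [Ne, residue_eq_zero_iff, mem_maximalIdeal, mem_nonunits_iff, not_not]; exact hlu
    have h1 : C (residue O l ^ p) * (kumPoly p l μ - C c).map (residue O) =
        (X ^ p - C (residue O (1 + l ^ p * c))).comp (C (residue O l) * X + C 1) := by
      have h2 := congrArg (Polynomial.map (residue O)) (C_mul_kumPoly hμ)
      simp only [Polynomial.map_mul, Polynomial.map_sub, Polynomial.map_pow, Polynomial.map_add,
        Polynomial.map_one, Polynomial.map_C, Polynomial.map_X, map_pow] at h2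
      simp only [Polynomial.map_sub, Polynomial.map_C, mul_sub, sub_comp, pow_comp, X_comp, C_comp]
      rw [map_pow, h2, map_add, map_mul, map_pow, map_one, C_add, C_mul, C_pow]
      simp only [map_one]; ring
    have h3 : Irreducible (X ^ p - C (residue O (1 + l ^ p * c))) := by
      apply X_pow_sub_C_irreducible_of_prime hp.out
      intro b hb
      obtain ⟨b, rfl⟩ := residue_surjective b
      obtain ⟨y, hy⟩ := residue_surjective ((residue O l)⁻¹ * (residue O b - 1))
      apply hc y
      rw [← residue_eq_zero_iff_dvd hπ]
      have h4 := congrArg (residue O) (kumPoly_eval hμ y)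
      rw [map_mul, map_sub, map_pow, map_pow, map_add, map_mul, hy, map_one, ← mul_assoc,
        mul_inv_cancel₀ hlr, one_mul, add_sub_cancel, hb, map_add, map_mul, map_one, map_pow,
        add_sub_cancel_left] at h4
      rw [map_sub, mul_left_cancel₀ (pow_ne_zero p hlr) h4, sub_self]
    have h4 : Irreducible ((X ^ p - C (residue O (1 + l ^ p * c))).comp
        (C (residue O l) * X + C 1)) := by
      let _ := invertibleOfNonzero hlr
      have h5 := (MulEquiv.irreducible_iff (algEquivCMulXAddC (residue O l) 1)).mpr h3
      rwa [algEquivCMulXAddC_apply, ← comp_eq_aeval] at h5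
    rw [← h1] at h4
    exact (irreducible_isUnit_mul (isUnit_C.mpr (pow_ne_zero p hlr).isUnit)).mp h4
  · have hld : π ∣ l := by
      rw [← residue_eq_zero_iff_dvd hπ, residue_eq_zero_iff]; exact hlu
    have hpd : π ∣ (p : O) := by
      rw [hμ]; exact (hld.trans (dvd_pow_self _ (by have := hp.out.one_lt; omega))).mul_right _
    have hch := residue_charP_of_dvd hπ hpd
    have hlr : residue O l = 0 := (residue_eq_zero_iff_dvd hπ _).mpr hld
    have hform : ∃ e, (kumPoly p l μ).map (residue O) = X ^ p + C e * X := by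
      refine ⟨residue O μ, ?_⟩
      rw [kumPoly, Polynomial.map_add, Polynomial.map_sum, Finset.sum_eq_single 1]
      · simp [Nat.div_self hp.out.pos]
      · intro j hj hj1
        rw [Finset.mem_Ico] at hj
        simp [hlr, zero_pow (show j - 1 ≠ 0 by omega)]
      · intro h
        exact absurd (Finset.mem_Ico.mpr ⟨le_rfl, hp.out.one_lt⟩) h
    obtain ⟨e, he⟩ := hform
    have he1 : e = -1 := by
      have h5 := congrArg (residue O) (kumPoly_eval_one hz hμ)
      rw [← hl, map_zero, ← eval_map_apply, he] at h5
      simp at h5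
      linear_combination h5
    have h6 : (kumPoly p l μ - C c).map (residue O) = X ^ p - X - C (residue O c) := by
      rw [Polynomial.map_sub, he, he1, Polynomial.map_C]; simp [sub_eq_add_neg]
    rw [h6]
    apply artinSchreier_irreducible
    intro y hy
    obtain ⟨y, rfl⟩ := residue_surjective y
    apply hc y
    rw [← residue_eq_zero_iff_dvd hπ, map_sub, ← eval_map_apply, he, he1]
    simp [← hy, sub_eq_add_neg]

theorem exists_rootless [Finite (ResidueField O)] (hz : IsPrimitiveRoot z p) (hπ : Irreducible π)
    (hμ : (p : O) = (z - 1) ^ (p - 1) * μ) :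
    ∃ c, (∀ y, ¬ π ∣ (kumPoly p (z - 1) μ).eval y - c) ∧ IsUnit c := by
  have hns : ¬ Function.Surjective fun y : ResidueField O =>
      ((kumPoly p (z - 1) μ).map (residue O)).eval y := by
    rw [← Finite.injective_iff_surjective]
    intro h
    apply zero_ne_one (α := ResidueField O)
    apply h
    simp only
    rw [← map_zero (residue O), ← map_one (residue O), eval_map_apply, eval_map_apply,
      kumPoly_eval_zero, kumPoly_eval_one hz hμ]
  simp only [Function.Surjective, not_forall, not_exists] at hns
  obtain ⟨c, hc⟩ := hns
  obtain ⟨c, rfl⟩ := residue_surjective c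
  have h1 : ∀ y, ¬ π ∣ (kumPoly p (z - 1) μ).eval y - c := by
    intro y hy
    rw [← residue_eq_zero_iff_dvd hπ, map_sub, sub_eq_zero] at hy
    apply hc (residue O y)
    rw [eval_map_apply, hy]
  refine ⟨c, h1, ?_⟩
  by_contra hu
  apply h1 0
  rw [kumPoly_eval_zero, zero_sub, dvd_neg, ← residue_eq_zero_iff_dvd hπ, residue_eq_zero_iff]
  exact hu

theorem dvd_of_isKNorm_rootless (hz : IsPrimitiveRoot z p) (hπ : Irreducible π)
    (hμ : (p : O) = (z - 1) ^ (p - 1) * μ)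
    (hc : ∀ y, ¬ π ∣ (kumPoly p (z - 1) μ).eval y - c) {m : ℤ} {w : Oˣ}
    (h : IsKNorm p (algebraMap O k z) (algebraMap O k (1 + (z - 1) ^ p * c))
      (algebraMap O k π ^ m * algebraMap O k w)) : (p : ℤ) ∣ m := by
  have hinj := FaithfulSMul.algebraMap_injective O k
  set φ := algebraMap O k with hφ
  set l := z - 1 with hl
  have hl0 : l ≠ 0 := sub_ne_zero.mpr (hz.ne_one hp.out.one_lt)
  have hzu : IsUnit z := hz.isUnit hp.out.ne_zero
  obtain ⟨f, hf⟩ := h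
  have hs : ∀ i, ∃ s, l * s = z ^ i - 1 := fun i => by
    obtain ⟨s, hs⟩ : l ∣ z ^ i - 1 := by simpa using sub_dvd_pow_sub_pow z 1 i
    exact ⟨s, hs.symm⟩
  choose s hs using hs
  have hu : φ π ^ m * φ w ≠ 0 :=
    mul_ne_zero (zpow_ne_zero _ ((_root_.map_ne_zero_iff _ hinj).mpr hπ.ne_zero))
      ((_root_.map_ne_zero_iff _ hinj).mpr w.ne_zero)
  obtain ⟨c', x, hx, hcx⟩ := exists_pow_mul_unit_of_dvd_prod_comp (n := p)
    (kumPoly_sub_C_monic l μ c) (kumPoly_sub_irreducible hz hπ hμ hc) s (fun i => z ^ i)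
    (fun i => hzu.pow i) (fun i => by
      rw [sub_comp, kumPoly_comp hz hμ (hs i), C_comp]) (h := f.comp (1 + C (φ l) * X)) hu (by
      have h1 : C (φ l ^ p) * (kumPoly p l μ - C c).map φ =
          (X ^ p - C (φ (1 + l ^ p * c))).comp (1 + C (φ l) * X) := by
        have h2 := congrArg (Polynomial.map φ) (C_mul_kumPoly hμ)
        simp only [Polynomial.map_mul, Polynomial.map_sub, Polynomial.map_pow, Polynomial.map_add,
          Polynomial.map_one, Polynomial.map_C, Polynomial.map_X, map_pow] at h2
        simp only [Polynomial.map_sub, Polynomial.map_C, mul_sub, sub_comp, pow_comp, X_comp, C_comp]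
        rw [map_pow, h2, map_add, map_mul, map_pow, map_one, C_add, C_mul, C_1, C_pow]; ring
      obtain ⟨q, hq⟩ := hf
      have h3 := congrArg (fun t => t.comp (1 + C (φ l) * X)) hq
      simp only [sub_comp, C_comp, mul_comp, prod_comp] at h3
      have h4 : ∀ i, (f.comp (C (φ z ^ i) * X)).comp (1 + C (φ l) * X) =
          (f.comp (1 + C (φ l) * X)).comp ((C (s i) + C (z ^ i) * X : O[X]).map φ) := by
        intro i
        rw [comp_assoc, comp_assoc]
        congr 1
        simp only [mul_comp, C_comp, X_comp, add_comp, one_comp, Polynomial.map_add, Polynomial.map_C,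
          Polynomial.map_mul, Polynomial.map_X]
        have h5 : φ l * φ (s i) = φ z ^ i - 1 := by rw [← map_mul, hs, map_sub, map_pow, map_one]
        have h6 := congrArg (C : k → k[X]) h5
        simp only [C_mul, C_sub, C_pow, C_1] at h6
        simp only [map_pow]
        linear_combination -h6
      rw [Finset.prod_congr rfl fun i _ => (h4 i)] at h3
      rw [h3, ← C_comp (a := φ (1 + l ^ p * c)) (p := (1 + C (φ l) * X)), ← sub_comp, ← h1, mul_assoc]
      exact (dvd_mul_right _ _).mul_left _)
  exact dvd_of_zpow_mul_unit_eq_pow_mul (x := hx.unit) hπ hcx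
end dvr

theorem IsKNorm.self {k : Type*} [Field k] {n : ℕ} (hn : Odd n) {ζ : k} (hζ : ζ ^ n = 1) (a : k) :
    IsKNorm n ζ a a := by
  refine ⟨X, ?_⟩
  simp only [X_comp]
  rw [Finset.prod_mul_distrib, Finset.prod_const, Finset.card_range]
  have h1 : ∏ i ∈ Finset.range n, (C (ζ ^ i) : k[X]) = 1 := by
    rw [← map_prod, Finset.prod_pow_eq_pow_sum, Finset.sum_range_id]
    obtain ⟨m, rfl⟩ := hn
    rw [show (2 * m + 1) * (2 * m + 1 - 1) / 2 = (2 * m + 1) * m by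
      rw [Nat.add_sub_cancel, mul_comm 2 m, ← mul_assoc, Nat.mul_div_cancel _ two_pos],
      pow_mul, hζ, one_pow, C_1]
  rw [h1, one_mul]

theorem IsKNorm.of_isKNorm_pow_mul {k : Type*} [Field k] {p : ℕ} [Fact p.Prime] (hp2 : p ≠ 2) {ζ : k}
    (hζ : IsPrimitiveRoot ζ p) {b u d : k} (hb : b ≠ 0) (hu : u ≠ 0) (hd : d ≠ 0)
    (h : IsKNorm p ζ (b * d ^ p) u) : IsKNorm p ζ b u := by
  have h1 := h.symm hp2 hζ (mul_ne_zero hb (pow_ne_zero _ hd)) hu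
  have h2 := h1.mul (IsKNorm.pow_self (n := p) (ζ := ζ) (b := u) d⁻¹)
  rw [mul_assoc, ← mul_pow, mul_inv_cancel₀ hd, one_pow, mul_one] at h2
  exact h2.symm hp2 hζ hu hb

section dvr
variable {O k : Type*} [CommRing O] [IsDomain O] [IsDiscreteValuationRing O] [Field k]
  [Algebra O k] [IsFractionRing O k] {p : ℕ} [hp : Fact p.Prime] {z π μ c : O}

theorem rootless_of_not_pow (hπ : Irreducible π)
    (hμ : (p : O) = (z - 1) ^ (p - 1) * μ)
    (hens : ∀ x, π * (z - 1) ^ p ∣ x → ∃ y, 1 + x = y ^ p)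
    (hu : IsUnit (1 + (z - 1) ^ p * c)) (hb : ∀ y, y ^ p ≠ 1 + (z - 1) ^ p * c) :
    ∀ y, ¬ π ∣ (kumPoly p (z - 1) μ).eval y - c := by
  intro y hy
  have h1 := kumPoly_eval hμ y
  set l := z - 1 with hl
  obtain ⟨t, ht⟩ := hy
  have h2 : (1 + l * y) ^ p = (1 + l ^ p * c) + π * l ^ p * t := by
    linear_combination -h1 + l ^ p * ht
  obtain ⟨v, hv⟩ := hu
  have h3 : (v⁻¹ : Oˣ) * (1 + l * y) ^ p = 1 + π * l ^ p * (t * (v⁻¹ : Oˣ)) := by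
    rw [h2, ← hv, mul_add, Units.inv_mul]; ring
  obtain ⟨x, hx⟩ := hens _ (dvd_mul_right (π * l ^ p) (t * (v⁻¹ : Oˣ)))
  have hxu : IsUnit x := by
    rw [← isUnit_pow_iff hp.out.ne_zero, ← hx, ← h3]
    refine (Units.isUnit _).mul ?_
    rw [h2, ← hv]
    apply of_not_not
    intro hn
    have h4 : residue O ((v : O) + π * l ^ p * t) = 0 := by
      rw [residue_eq_zero_iff]; exact hn
    rw [map_add, map_mul, map_mul, (residue_eq_zero_iff_dvd hπ π).mpr dvd_rfl, zero_mul, zero_mul,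
      add_zero, residue_eq_zero_iff] at h4
    exact h4 v.isUnit
  obtain ⟨x, rfl⟩ := hxu
  apply hb ((1 + l * y) * (x⁻¹ : Oˣ))
  rw [mul_pow, ← hv]
  have h5 : (1 + l * y) ^ p = v * (x : O) ^ p := by
    rw [← hx, ← h3, ← mul_assoc, Units.mul_inv, one_mul]
  rw [h5, mul_assoc, ← mul_pow, Units.mul_inv, one_pow, mul_one]

theorem exists_not_isKNorm_aux (hp2 : p ≠ 2) (hz : IsPrimitiveRoot z p) (hπ : Irreducible π)
    [Finite (ResidueField O)] (hμ : (p : O) = (z - 1) ^ (p - 1) * μ) {b x : O}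
    {m M : ℕ} {ux ul : Oˣ} (hx : x = π ^ m * ux) (hlM : (z - 1) ^ p = π ^ M * ul) (hm : m < M) (h0 : 0 < m)
    (hpm : ¬ p ∣ m) (hpM : p ∣ M)
    (hb : b = 1 - x) (hall : ∀ u : k, u ≠ 0 → IsKNorm p (algebraMap O k z) (algebraMap O k b) u) :
    False := by
  have hinj := FaithfulSMul.algebraMap_injective O k
  set φ := algebraMap O k with hφ
  have hne : ∀ {t : O}, t ≠ 0 → φ t ≠ 0 := fun ht => (_root_.map_ne_zero_iff _ hinj).mpr ht
  have hζ : IsPrimitiveRoot (φ z) p := hz.map_of_injective hinj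
  have hodd : Odd p := hp.out.odd_of_ne_two hp2
  obtain ⟨c, hc, hcu⟩ := exists_rootless hz hπ hμ
  obtain ⟨cu, rfl⟩ := hcu
  set y : O := -(π ^ (M - m) * (ul * cu * ux⁻¹ : Oˣ)) with hy
  have hxy : x * y = -((z - 1) ^ p * cu) := by
    have h1 : π ^ M = π ^ m * π ^ (M - m) := by rw [← pow_add]; congr 1; omega
    rw [hlM, hx, hy, h1]
    have : (ux : O) * (ux⁻¹ : Oˣ) = 1 := Units.mul_inv _
    push_cast
    linear_combination (-(π ^ m * π ^ (M - m) * ul * cu)) * this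
  have hunit : ∀ t, π ∣ t → 1 - t ≠ 0 := by
    intro t ht h
    rw [sub_eq_zero] at h
    exact hπ.not_isUnit (isUnit_of_dvd_one (h ▸ ht))
  have hπx : π ∣ x := hx ▸ (dvd_pow_self π h0.ne').mul_right _
  have hπy : π ∣ y := by
    rw [hy, dvd_neg]; exact (dvd_pow_self π (by omega)).mul_right _
  have hy0 : y ≠ 0 := by
    rw [hy, neg_ne_zero]; exact mul_ne_zero (pow_ne_zero _ hπ.ne_zero) (Units.ne_zero _)
  set A := φ (1 - y) with hA
  set B := φ (y * (1 - x)) with hB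
  set C' := φ (1 - x * y) with hC
  have hA0 : A ≠ 0 := hne (hunit _ hπy)
  have hB0 : B ≠ 0 := hne (mul_ne_zero hy0 (hunit _ hπx))
  have hC0 : C' ≠ 0 := hne (hunit _ (hπx.mul_right _))
  have hABC : A + B = C' := by rw [hA, hB, hC, ← map_add]; congr 1; ring
  have e1 : IsKNorm p (φ z) (A / C') (B / C') := by
    have := IsKNorm.steinberg hp.out.ne_zero hζ (A / C')
    rwa [show 1 - A / C' = B / C' by field_simp; linear_combination -hABC] at this
  have e2 : IsKNorm p (φ z) (A / C') (B / A) := by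
    have := e1.mul ((IsKNorm.self hodd hζ.pow_eq_one (A / C')).inv hp.out.ne_zero)
    rwa [show B / C' * (A / C')⁻¹ = B / A by field_simp] at this
  have hb0 : φ b ≠ 0 := hb ▸ hne (hunit _ hπx)
  have e3 : IsKNorm p (φ z) A B := by
    have h1 : IsKNorm p (φ z) A (φ y) := by
      have := IsKNorm.steinberg hp.out.ne_zero hζ (φ y)
      rw [← map_one φ, ← map_sub] at this
      exact this.symm hp2 hζ (hne hy0) hA0
    have h2 := h1.mul ((hall A hA0).symm hp2 hζ hb0 hA0)
    rwa [← map_mul, hb] at h2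
  have e4 : IsKNorm p (φ z) A (B / A) := by
    have := e3.mul ((IsKNorm.self hodd hζ.pow_eq_one A).inv hp.out.ne_zero)
    rwa [← div_eq_mul_inv] at this
  have hBA : B / A ≠ 0 := div_ne_zero hB0 hA0
  have e5 : IsKNorm p (φ z) (B / A) C' := by
    have := (e4.symm hp2 hζ hA0 hBA).mul
      ((e2.symm hp2 hζ (div_ne_zero hA0 hC0) hBA).inv hp.out.ne_zero)
    rwa [show A * (A / C')⁻¹ = C' by field_simp] at this
  have e6 := e5.symm hp2 hζ hBA hC0
  have huA : IsUnit (1 - y) := by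
    apply of_not_not
    intro hn
    have h4 : residue O (1 - y) = 0 := by rw [residue_eq_zero_iff]; exact hn
    rw [map_sub, (residue_eq_zero_iff_dvd hπ y).mpr hπy, map_one, sub_zero] at h4
    exact one_ne_zero h4
  have hux : IsUnit (1 - x) := by
    apply of_not_not
    intro hn
    have h4 : residue O (1 - x) = 0 := by rw [residue_eq_zero_iff]; exact hn
    rw [map_sub, (residue_eq_zero_iff_dvd hπ x).mpr hπx, map_one, sub_zero] at h4
    exact one_ne_zero h4
  obtain ⟨va, hva⟩ := huA
  obtain ⟨vx, hvx⟩ := hux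
  have h7 : B / A = φ π ^ ((M - m : ℕ) : ℤ) * φ ((-(ul * cu * ux⁻¹) * vx * va⁻¹ : Oˣ) : O) := by
    rw [div_eq_iff hA0, zpow_natCast, ← map_pow, ← map_mul, hA, ← map_mul, hB]
    congr 1
    rw [← hva, ← hvx, hy]
    have : (va : O) * (va⁻¹ : Oˣ) = 1 := Units.mul_inv _
    push_cast
    linear_combination (π ^ (M - m) * (ul * cu * (ux⁻¹ : Oˣ)) * vx) * this
  have h8 : C' = φ (1 + (z - 1) ^ p * cu) := by rw [hC, hxy]; ring_nf
  rw [h7, h8] at e6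
  have h9 := dvd_of_isKNorm_rootless hz hπ hμ hc e6
  rw [Int.natCast_dvd_natCast] at h9
  apply hpm
  have := (Nat.dvd_sub hpM h9)
  rwa [show M - (M - m) = m by omega] at this

theorem exists_unit_mul_pow_sub_one_dvd (hp2 : p ≠ 2) (hπ : Irreducible π) [Finite (ResidueField O)]
    (hμ : (p : O) = (z - 1) ^ (p - 1) * μ) {e : ℕ} {ul : Oˣ} (hl : z - 1 = π ^ e * ul) {j : ℕ}
    (hj : j < e) (w : O) : ∃ v : O, IsUnit (1 + π ^ (p * j) * w) →
      IsUnit v ∧ π ^ (p * j + 1) ∣ (1 + π ^ (p * j) * w) * v ^ p - 1 := by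
  have hpd : π ∣ (p : O) := by
    rw [hμ, hl]
    exact (((dvd_pow_self π (by omega)).mul_right _).trans
      (dvd_pow_self _ (by have := hp.out.one_lt; omega))).mul_right _
  have hch := residue_charP_of_dvd hπ hpd
  have hodd : Odd p := hp.out.odd_of_ne_two hp2
  have hperf : ∀ w : O, ∃ t, π ∣ w - t ^ p := by
    intro w
    obtain ⟨t, ht⟩ : ∃ t : ResidueField O, t ^ p = residue O w := by
      have : Function.Injective (frobenius (ResidueField O) p) := frobenius_inj _ p
      exact (Finite.injective_iff_surjective.mp this) _
    obtain ⟨t, rfl⟩ := residue_surjective t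
    exact ⟨t, by rw [← residue_eq_zero_iff_dvd hπ, map_sub, map_pow, ht, sub_self]⟩
  rcases Nat.eq_zero_or_pos j with rfl | hj0
  · simp only [mul_zero, pow_zero, one_mul, zero_add, pow_one]
    obtain ⟨t, ht⟩ := hperf (1 + w)
    by_cases hu : IsUnit (1 + w)
    swap
    · exact ⟨1, fun h => absurd h hu⟩
    have htu : IsUnit t := by
      apply of_not_not
      intro hn
      rw [← residue_eq_zero_iff_dvd hπ, map_sub, map_pow] at ht
      have h4 : residue O t = 0 := by rw [residue_eq_zero_iff]; exact hn
      rw [h4, zero_pow hp.out.ne_zero, sub_zero, residue_eq_zero_iff] at ht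
      exact ht hu
    obtain ⟨t, rfl⟩ := htu
    refine ⟨(t⁻¹ : Oˣ), fun _ => ⟨Units.isUnit _, ?_⟩⟩
    have h5 : (1 + w) * ((t⁻¹ : Oˣ) : O) ^ p - 1 = ((1 + w) - t ^ p) * ((t⁻¹ : Oˣ) : O) ^ p := by
      rw [sub_mul, ← mul_pow, Units.mul_inv, one_pow]
    rw [h5]
    exact ht.mul_right _
  · obtain ⟨t, ht⟩ := hperf w
    refine ⟨1 - π ^ j * t, fun _ => ⟨?_, ?_⟩⟩
    · apply of_not_not
      intro hn
      have h4 : residue O (1 - π ^ j * t) = 0 := by rw [residue_eq_zero_iff]; exact hn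
      rw [map_sub, (residue_eq_zero_iff_dvd hπ _).mpr ((dvd_pow_self π hj0.ne').mul_right _), map_one,
        sub_zero] at h4
      exact one_ne_zero h4
    · have h1 : π ^ (p * j + 1) ∣ (1 - π ^ j * t) ^ p - (1 - π ^ (p * j) * t ^ p) := by
        obtain ⟨r, hr⟩ := exists_add_pow_prime_eq hp.out (1 : O) (-(π ^ j * t))
        have h2 : (1 - π ^ j * t) ^ p - (1 - π ^ (p * j) * t ^ p) = p * (-(π ^ j * t)) * r := by
          rw [sub_eq_add_neg 1 (π ^ j * t), hr, hodd.neg_pow, mul_pow, ← pow_mul, mul_comm j p]; ring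
        rw [h2]
        refine Dvd.dvd.mul_right ?_ _
        rw [mul_neg, dvd_neg, hμ, hl, mul_pow, ← pow_mul]
        have h3 : π ^ (p * j + 1) ∣ π ^ (e * (p - 1)) * π ^ j := by
          rw [← pow_add]
          apply pow_dvd_pow
          obtain ⟨q, hq⟩ : ∃ q, p = q + 1 := ⟨p - 1, by have := hp.out.pos; omega⟩
          have hq1 : 1 ≤ q := by have := hp.out.one_lt; omega
          rw [hq, Nat.add_sub_cancel]
          nlinarith
        obtain ⟨s, hs⟩ := h3
        exact ⟨s * ul ^ (p - 1) * μ * t, by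
          linear_combination ((ul : O) ^ (p - 1) * μ * t) * hs⟩
      obtain ⟨s, hs⟩ := h1
      obtain ⟨r, hr⟩ := ht
      have h6 : π ^ (p * j + 1) ∣ π ^ (p * j) * π ^ (p * j) := by
        rw [← pow_add]
        apply pow_dvd_pow
        have : 0 < p * j := Nat.mul_pos hp.out.pos hj0
        omega
      obtain ⟨s', hs'⟩ := h6
      refine ⟨(1 + π ^ (p * j) * w) * s + r - s' * w * t ^ p, ?_⟩
      have h7 : π ^ (p * j + 1) = π ^ (p * j) * π := pow_succ _ _
      linear_combination (1 + π ^ (p * j) * w) * hs + π ^ (p * j) * hr - w * t ^ p * hs' - r * h7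

theorem exists_not_isKNorm_unit (hp2 : p ≠ 2) (hz : IsPrimitiveRoot z p) (hπ : Irreducible π)
    [Finite (ResidueField O)]
    (hens : ∀ x, π * (z - 1) ^ p ∣ x → ∃ y, 1 + x = y ^ p) {b : O} (hbu : IsUnit b)
    (hb : ∀ y, y ^ p ≠ b) :
    ∃ u : k, u ≠ 0 ∧ ¬ IsKNorm p (algebraMap O k z) (algebraMap O k b) u := by
  have hinj := FaithfulSMul.algebraMap_injective O k
  obtain ⟨μ, hμ⟩ := sub_one_pow_dvd_prime hz
  by_contra! hall
  have hl0 : z - 1 ≠ 0 := sub_ne_zero.mpr (hz.ne_one hp.out.one_lt)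
  obtain ⟨e, ul, hl⟩ := IsDiscreteValuationRing.eq_unit_mul_pow_irreducible hl0 hπ
  rw [mul_comm] at hl
  have hζ : IsPrimitiveRoot (algebraMap O k z) p := hz.map_of_injective hinj
  have hne : ∀ {t : O}, IsUnit t → algebraMap O k t ≠ 0 := fun ht =>
    (_root_.map_ne_zero_iff _ hinj).mpr ht.ne_zero
  -- all the hypotheses are stable under multiplication by a `p`-th power of a unit
  have hall' : ∀ v : O, IsUnit v → ∀ u : k, u ≠ 0 →
      IsKNorm p (algebraMap O k z) (algebraMap O k (b * v ^ p)) u := by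
    intro v hv u hu
    apply IsKNorm.of_isKNorm_pow_mul hp2 hζ (hne (hbu.mul (hv.pow p))) hu (inv_ne_zero (hne hv))
    rw [map_mul, map_pow, mul_assoc, ← mul_pow, mul_inv_cancel₀ (hne hv), one_pow, mul_one]
    exact hall u hu
  have hb' : ∀ v : O, IsUnit v → ∀ y, y ^ p ≠ b * v ^ p := by
    rintro _ ⟨v, rfl⟩ y hy
    apply hb (y * (v⁻¹ : Oˣ))
    rw [mul_pow, hy, mul_assoc, ← mul_pow, Units.mul_inv, one_pow, mul_one]
  -- no such multiple is congruent to one modulo `(z - 1) ^ p`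
  have hM : ∀ v : O, IsUnit v → ¬ π ^ (p * e) ∣ b * v ^ p - 1 := by
    rintro v hv ⟨t, ht⟩
    have hb1 : b * v ^ p = 1 + (z - 1) ^ p * (t * (ul⁻¹ : Oˣ) ^ p) := by
      have : (ul : O) ^ p * ((ul⁻¹ : Oˣ) : O) ^ p = 1 := by rw [← mul_pow, Units.mul_inv, one_pow]
      rw [hl, mul_pow, ← pow_mul, mul_comm e p]
      linear_combination ht - π ^ (p * e) * t * this
    have hc := rootless_of_not_pow hπ hμ hens (c := t * (ul⁻¹ : Oˣ) ^ p)
      (hb1 ▸ hbu.mul (hv.pow p)) (hb1 ▸ hb' v hv)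
    have h1 := hall' v hv (algebraMap O k π ^ (1 : ℤ) * algebraMap O k (1 : Oˣ)) (by
      simpa using hπ.ne_zero)
    rw [hb1] at h1
    have h2 := dvd_of_isKNorm_rootless hz hπ hμ hc h1
    have : p ∣ 1 := by exact_mod_cast h2
    exact hp.out.one_lt.ne' (Nat.dvd_one.mp this)
  classical
  let P : ℕ → Prop := fun m => ∃ v, IsUnit v ∧ π ^ m ∣ b * v ^ p - 1
  have hP0 : P 0 := ⟨1, isUnit_one, by simp⟩
  have hPM : ∀ m, P m → m < p * e := fun m ⟨v, hv, hd⟩ => by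
    by_contra! h
    exact hM v hv ((pow_dvd_pow π h).trans hd)
  set m := Nat.findGreatest P (p * e) with hmdef
  have hPm : P m := Nat.findGreatest_spec (Nat.zero_le _) hP0
  have hmax : ¬ P (m + 1) := fun h => by
    have := Nat.le_findGreatest (hPM _ h).le h
    omega
  obtain ⟨v, hv, t, ht⟩ := hPm
  have hmlt := hPM m ⟨v, hv, t, ht⟩
  have htu : IsUnit t := by
    apply of_not_not
    intro hn
    have h4 : residue O t = 0 := by rw [residue_eq_zero_iff]; exact hn
    rw [residue_eq_zero_iff_dvd hπ] at h4
    exact hmax ⟨v, hv, by rw [ht, pow_succ]; exact mul_dvd_mul_left _ h4⟩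
  have hpm : ¬ p ∣ m := by
    rintro ⟨j, hj⟩
    obtain ⟨w, hw⟩ := exists_unit_mul_pow_sub_one_dvd hp2 hπ hμ hl (j := j)
      (by rw [hj] at hmlt; exact lt_of_mul_lt_mul_left hmlt (Nat.zero_le _)) t
    have hb1 : b * v ^ p = 1 + π ^ (p * j) * t := by rw [← hj]; linear_combination ht
    obtain ⟨hwu, hwd⟩ := hw (hb1 ▸ hbu.mul (hv.pow p))
    apply hmax
    refine ⟨v * w, hv.mul hwu, ?_⟩
    rw [mul_pow, ← mul_assoc, hb1, hj]
    exact hwd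
  obtain ⟨t, rfl⟩ := htu
  refine exists_not_isKNorm_aux (k := k) hp2 hz hπ hμ (x := -(π ^ m * t)) (ux := -t) (ul := ul ^ p)
    (M := p * e) (by push_cast; ring) ?_ hmlt ?_ hpm (dvd_mul_right _ _) ?_ (hall' v hv)
  · rw [hl, mul_pow, ← pow_mul, mul_comm e p]; push_cast; ring
  · exact Nat.pos_of_ne_zero fun h => hpm (h ▸ dvd_zero _)
  · linear_combination ht

theorem exists_not_isKNorm_of_not_pow (hp2 : p ≠ 2) (hz : IsPrimitiveRoot z p)
    [Finite (ResidueField O)] (hπ : Irreducible π)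
    (hens : ∀ x, π * (z - 1) ^ p ∣ x → ∃ y, 1 + x = y ^ p) {b : k} (hb0 : b ≠ 0)
    (hb : ∀ y, y ^ p ≠ b) : ∃ u : k, u ≠ 0 ∧ ¬ IsKNorm p (algebraMap O k z) b u := by
  have hinj := FaithfulSMul.algebraMap_injective O k
  obtain ⟨μ, hμ⟩ := sub_one_pow_dvd_prime hz
  have hπ0 : algebraMap O k π ≠ 0 := (_root_.map_ne_zero_iff _ hinj).mpr hπ.ne_zero
  have hζ : IsPrimitiveRoot (algebraMap O k z) p := hz.map_of_injective hinj
  obtain ⟨m, w, hw⟩ := exists_zpow_mul_unit hπ hb0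
  by_cases hpm : (p : ℤ) ∣ m
  · obtain ⟨j, rfl⟩ := hpm
    have hw' : b = algebraMap O k w * (algebraMap O k π ^ j) ^ p := by
      rw [hw, mul_comm, mul_comm (p : ℤ), zpow_mul, zpow_natCast]
    have hw0 : algebraMap O k w ≠ 0 := (_root_.map_ne_zero_iff _ hinj).mpr w.ne_zero
    obtain ⟨u, hu0, hu⟩ := exists_not_isKNorm_unit (k := k) hp2 hz hπ hens w.isUnit (by
      intro y hy
      apply hb (algebraMap O k y * algebraMap O k π ^ j)
      rw [mul_pow, ← map_pow, hy, hw'])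
    refine ⟨u, hu0, fun h => hu ?_⟩
    rw [hw'] at h
    exact h.of_isKNorm_pow_mul hp2 hζ hw0 hu0 (zpow_ne_zero _ hπ0)
  · obtain ⟨c, hc, -⟩ := exists_rootless hz hπ hμ
    by_cases hC : algebraMap O k (1 + (z - 1) ^ p * c) = 0
    · exfalso
      -- then the reduction has the root `(-1) / (z - 1)`
      rw [map_eq_zero_iff _ hinj] at hC
      have hl : IsUnit (z - 1) := by
        have : IsUnit ((z - 1) ^ p * c) := by
          rw [show (z - 1) ^ p * c = -1 by linear_combination hC]; exact isUnit_one.neg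
        exact (isUnit_pow_iff hp.out.ne_zero).mp (isUnit_of_mul_isUnit_left this)
      obtain ⟨lu, hlu⟩ := hl
      have h1 := kumPoly_eval hμ (-(lu⁻¹ : Oˣ))
      rw [← hlu] at h1 hC
      rw [mul_neg, Units.mul_inv, add_neg_cancel, zero_pow hp.out.ne_zero] at h1
      apply hc (-(lu⁻¹ : Oˣ))
      rw [← hlu]
      have h2 : (lu : O) ^ p * (eval (-((lu⁻¹ : Oˣ) : O)) (kumPoly p (lu : O) μ) - c) = 0 := by
        linear_combination h1 - hC
      rw [(mul_eq_zero.mp h2).resolve_left (pow_ne_zero _ lu.ne_zero)]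
      exact dvd_zero _
    · refine ⟨_, hC, fun h => hpm ?_⟩
      have h2 := h.symm hp2 hζ hb0 hC
      rw [hw] at h2
      exact dvd_of_isKNorm_rootless hz hπ hμ hc h2
end dvr

end

section

open Polynomial IsLocalRing IsDedekindDomain NumberField WithZero
open scoped Topology

section completion
variable {F : Type*} [Field F] [NumberField F] (v : HeightOneSpectrum (𝓞 F))

theorem nhds_zero_iff_of_completion {s : Set (v.adicCompletion F)} :
    s ∈ 𝓝 (0 : v.adicCompletion F) ↔
      ∃ n : ℕ, {x | Valued.v x ≤ exp (-(n : ℤ))} ⊆ s := by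
  rw [Valued.mem_nhds_zero]
  constructor
  · rintro ⟨γ, hγ⟩
    have h0 : MonoidWithZeroHom.ValueGroup₀.embedding γ.1 ≠ 0 :=
      (_root_.map_ne_zero _).mpr γ.ne_zero
    obtain ⟨m, hm⟩ : ∃ m : ℤ, MonoidWithZeroHom.ValueGroup₀.embedding γ.1 = exp m :=
      ⟨log _, (exp_log h0).symm⟩
    refine ⟨(1 - m).toNat, fun x hx => hγ ?_⟩
    rw [Set.mem_ofPred_eq] at hx ⊢
    rw [Valuation.restrict_lt_iff_lt_embedding, hm]
    refine hx.trans_lt ?_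
    rw [exp_lt_exp]; omega
  · rintro ⟨n, hn⟩
    obtain ⟨π, hπ⟩ := v.valuation_exists_uniformizer F
    have h1 : Valued.v ((π ^ (n) : F) : v.adicCompletion F) = exp (-(n:ℤ)) := by
      rw [HeightOneSpectrum.valuedAdicCompletion_eq_valuation', map_pow, hπ, ← exp_nsmul]
      simp
    refine ⟨Units.mk0 ((Valued.v : Valuation (v.adicCompletion F) _).restrict
      ((π ^ (n) : F) : v.adicCompletion F)) ?_, fun x hx => hn ?_⟩
    · rw [Ne, Valuation.restrict_eq_zero_iff, h1]; exact exp_ne_zero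
    · rw [Set.mem_ofPred_eq] at hx ⊢
      rw [Units.val_mk0, Valuation.restrict_lt_iff, h1] at hx
      exact hx.le

theorem mem_maximalIdeal_pow_iff_of_completion (n : ℕ) (x : v.adicCompletionIntegers F) :
    x ∈ maximalIdeal (v.adicCompletionIntegers F) ^ n ↔
      Valued.v (x : v.adicCompletion F) ≤ exp (-(n : ℤ)) := by
  obtain ⟨π, hπ⟩ := v.valuation_exists_uniformizer F
  have hπ1 : Valued.v (π : v.adicCompletion F) = exp (-1 : ℤ) := by
    rw [HeightOneSpectrum.valuedAdicCompletion_eq_valuation', hπ]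
  have hmem : (π : v.adicCompletion F) ∈ v.adicCompletionIntegers F := by
    rw [HeightOneSpectrum.mem_adicCompletionIntegers, hπ1, ← exp_zero, exp_le_exp]; norm_num
  have hgen : maximalIdeal (v.adicCompletionIntegers F) = Ideal.span {⟨_, hmem⟩} := by
    ext y
    rw [Ideal.mem_span_singleton, IsLocalRing.mem_maximalIdeal, mem_nonunits_iff,
      HeightOneSpectrum.adicCompletionIntegers.isUnit_iff_valued_eq_one,
      (HeightOneSpectrum.adicCompletionIntegers.integers (R := 𝓞 F) (K := F) v).dvd_iff_le]
    change _ ↔ Valued.v (y : v.adicCompletion F) ≤ Valued.v (π : v.adicCompletion F)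
    have hy := (HeightOneSpectrum.mem_adicCompletionIntegers _ _ _).mp y.2
    rw [hπ1]
    constructor
    · intro h
      have := lt_of_le_of_ne hy h
      by_cases h0 : Valued.v (y : v.adicCompletion F) = 0
      · rw [h0]; exact zero_le
      · rw [← exp_log h0, ← exp_zero, exp_lt_exp] at this
        rw [← exp_log h0, exp_le_exp]; omega
    · intro h h'
      rw [h', ← exp_zero, exp_le_exp] at h; norm_num at h
  rw [hgen, Ideal.span_singleton_pow, Ideal.mem_span_singleton,
    (HeightOneSpectrum.adicCompletionIntegers.integers (R := 𝓞 F) (K := F) v).dvd_iff_le]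
  change Valued.v (x : v.adicCompletion F) ≤ Valued.v ((π : v.adicCompletion F) ^ n) ↔ _
  rw [map_pow, hπ1, ← exp_nsmul]
  simp

theorem isAdic_of_completion : IsAdic (maximalIdeal (v.adicCompletionIntegers F)) := by
  rw [isAdic_iff]
  constructor
  · intro n
    refine (maximalIdeal (v.adicCompletionIntegers F) ^ n).toAddSubgroup.isOpen_of_mem_nhds
      (g := 0) ?_
    rw [nhds_subtype_eq_comap]
    refine ⟨{x | Valued.v x ≤ exp (-(n : ℤ))}, ?_, fun x hx => ?_⟩
    · exact (nhds_zero_iff_of_completion v).mpr ⟨n, le_rfl⟩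
    · exact (mem_maximalIdeal_pow_iff_of_completion v n x).mpr hx
  · intro s hs
    rw [nhds_subtype_eq_comap] at hs
    obtain ⟨t, ht, hts⟩ := hs
    obtain ⟨n, hn⟩ := (nhds_zero_iff_of_completion v).mp ht
    exact ⟨n, fun x hx => hts (hn ((mem_maximalIdeal_pow_iff_of_completion v n x).mp hx))⟩

instance : IsAdicComplete (maximalIdeal (v.adicCompletionIntegers F))
    (v.adicCompletionIntegers F) := by
  rw [(isAdic_of_completion v).isAdicComplete_iff]
  refine ⟨?_, inferInstance⟩
  exact (Valued.isClosed_valuationSubring (v.adicCompletion F)).isComplete.completeSpace_coe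

theorem exists_sub_valued_le (x : v.adicCompletion F) (n : ℕ) :
    ∃ y : F, Valued.v (x - (y : v.adicCompletion F)) ≤ exp (-(n : ℤ)) := by
  have h := HeightOneSpectrum.denseRange_algebraMap (K := F) (v := v) x
  rw [mem_closure_iff_nhds] at h
  obtain ⟨_, hy, y, rfl⟩ := h ((fun t => x - t) ⁻¹' {t | Valued.v t ≤ exp (-(n : ℤ))}) (by
    apply (continuous_sub_left x).continuousAt.preimage_mem_nhds
    rw [sub_self]
    exact (nhds_zero_iff_of_completion v).mpr ⟨n, le_rfl⟩)
  exact ⟨y, hy⟩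

instance : Finite (ResidueField (v.adicCompletionIntegers F)) := by
  have : Finite (𝓞 F ⧸ v.asIdeal) := Ideal.finiteQuotientOfFreeOfNeBot _ v.ne_bot
  have hsurj : ∀ x : v.adicCompletionIntegers F, ∃ a : 𝓞 F,
      residue _ (algebraMap (𝓞 F) (v.adicCompletionIntegers F) a) = residue _ x := by
    intro x
    obtain ⟨y, hy⟩ := exists_sub_valued_le v (x : v.adicCompletion F) 1
    have hx := (HeightOneSpectrum.mem_adicCompletionIntegers _ _ _).mp x.2
    have hy1 : v.valuation F y ≤ 1 := by
      rw [← HeightOneSpectrum.valuedAdicCompletion_eq_valuation']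
      have : (y : v.adicCompletion F) = x - (x - y) := by ring
      rw [this]
      refine (Valuation.map_sub _ _ _).trans (max_le hx (hy.trans ?_))
      rw [← exp_zero, exp_le_exp]; norm_num
    obtain ⟨a, ha⟩ := v.exists_valuation_sub_lt_of_integer hy1
      (γ := Units.mk0 (exp (0 : ℤ) : ℤᵐ⁰) exp_ne_zero)
    refine ⟨a, ?_⟩
    rw [← sub_eq_zero, ← map_sub, residue_eq_zero_iff, ← pow_one (maximalIdeal _),
      mem_maximalIdeal_pow_iff_of_completion]
    have h1 : Valued.v (((algebraMap (𝓞 F) F a - y : F)) : v.adicCompletion F) ≤ exp (-1 : ℤ) := by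
      rw [HeightOneSpectrum.valuedAdicCompletion_eq_valuation']
      by_cases h0 : v.valuation F (algebraMap (𝓞 F) F a - y) = 0
      · rw [h0]; exact zero_le
      · rw [← exp_log h0, Units.val_mk0, exp_lt_exp] at ha
        rw [← exp_log h0, exp_le_exp]; omega
    have h2 : ((algebraMap (𝓞 F) (v.adicCompletionIntegers F) a - x :
        v.adicCompletionIntegers F) : v.adicCompletion F) =
        ((algebraMap (𝓞 F) F a - y : F) : v.adicCompletion F) - (x - y) := by
      have h3 : ((algebraMap (𝓞 F) F a - y : F) : v.adicCompletion F) =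
          ((algebraMap (𝓞 F) F a : F) : v.adicCompletion F) - y :=
        map_sub (algebraMap F (v.adicCompletion F)) _ _
      rw [h3]
      change ((algebraMap (𝓞 F) F a : F) : v.adicCompletion F) - (x : v.adicCompletion F) = _
      ring
    rw [h2]
    exact (Valuation.map_sub _ _ _).trans (max_le h1 hy)
  refine Finite.of_surjective (Ideal.Quotient.lift v.asIdeal ((residue _).comp
    (algebraMap (𝓞 F) (v.adicCompletionIntegers F))) ?_) ?_
  · intro a ha
    rw [RingHom.comp_apply, residue_eq_zero_iff, ← pow_one (maximalIdeal _),
      mem_maximalIdeal_pow_iff_of_completion]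
    change Valued.v ((algebraMap (𝓞 F) F a : F) : v.adicCompletion F) ≤ _
    rw [HeightOneSpectrum.valuedAdicCompletion_eq_valuation', v.valuation_of_algebraMap]
    exact (v.intValuation_le_pow_iff_mem a 1).mpr (by rwa [pow_one])
  · intro t
    obtain ⟨x, rfl⟩ := residue_surjective t
    obtain ⟨a, ha⟩ := hsurj x
    exact ⟨Ideal.Quotient.mk _ a, by simpa using ha⟩
end completion

section hensel
variable {O : Type*} [CommRing O] [IsDomain O] {p : ℕ} [hp : Fact p.Prime] {z μ : O}

theorem isUnit_of_kumPoly (hz : IsPrimitiveRoot z p) (hμ : (p : O) = (z - 1) ^ (p - 1) * μ) :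
    IsUnit μ := by
  have h := kumPoly_eval_one hz hμ
  rw [kumPoly, eval_add, eval_finsetSum] at h
  simp only [eval_mul, eval_pow, eval_C, eval_X, one_pow, mul_one, mul_assoc] at h
  rw [← Finset.mul_sum] at h
  exact IsUnit.of_mul_eq_one (-(∑ i ∈ Finset.Ico 1 p, (z - 1) ^ (i - 1) * ↑(p.choose i / p)))
    (by linear_combination -h)

theorem kumPoly_derivative_eval_zero (l m : O) : (derivative (kumPoly p l m)).eval 0 = m := by
  rw [← coeff_zero_eq_eval_zero, coeff_derivative, kumPoly, coeff_add, finsetSum_coeff,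
    Finset.sum_eq_single 1]
  · simp [coeff_X_pow, hp.out.one_lt.ne, Nat.div_self hp.out.pos]
  · intro j _ hj
    rw [coeff_C_mul, coeff_X_pow, if_neg hj.symm, mul_zero]
  · intro h
    exact absurd (Finset.mem_Ico.mpr ⟨le_rfl, hp.out.one_lt⟩) h

theorem exists_pow_eq_of_henselian [IsDiscreteValuationRing O] {π : O} (hπ : Irreducible π)
    [hh : HenselianRing O (maximalIdeal O)] (hz : IsPrimitiveRoot z p) (x : O)
    (hx : π * (z - 1) ^ p ∣ x) : ∃ y, 1 + x = y ^ p := by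
  obtain ⟨μ, hμ⟩ := sub_one_pow_dvd_prime hz
  obtain ⟨d, rfl⟩ := hx
  obtain ⟨a, ha, -⟩ := hh.is_henselian (kumPoly p (z - 1) μ - C (π * d))
    (kumPoly_sub_C_monic _ _ _) 0 (by
      rw [eval_sub, kumPoly_eval_zero, eval_C, zero_sub, neg_mem_iff]
      exact Ideal.mul_mem_right _ _ (by rw [hπ.maximalIdeal_eq]; exact Ideal.mem_span_singleton_self π))
    (by
      rw [derivative_sub, derivative_C, sub_zero, kumPoly_derivative_eval_zero]
      exact (isUnit_of_kumPoly hz hμ).map _)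
  refine ⟨1 + (z - 1) * a, ?_⟩
  have h1 := kumPoly_eval hμ a
  rw [IsRoot.def, eval_sub, eval_C, sub_eq_zero] at ha
  rw [ha] at h1
  linear_combination h1
end hensel

section loc
variable {F : Type*} [Field F] [NumberField F] {p : ℕ} [hp : Fact p.Prime]

/-- Elements of `Fˣ` which are `p`-th powers in the completion at `v`. -/
noncomputable def locPow (p : ℕ) (v : HeightOneSpectrum (𝓞 F)) : Subgroup Fˣ :=
  (powMonoidHom p : (v.adicCompletion F)ˣ →* _).range.comap
    (Units.map (algebraMap F (v.adicCompletion F)).toMonoidHom)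

theorem mem_locPow_iff {v : HeightOneSpectrum (𝓞 F)} {x : Fˣ} :
    x ∈ locPow p v ↔ ∃ y, y ^ p = algebraMap F (v.adicCompletion F) x := by
  rw [locPow, Subgroup.mem_comap, MonoidHom.mem_range]
  constructor
  · rintro ⟨y, hy⟩
    exact ⟨y, by simpa using congrArg Units.val hy⟩
  · rintro ⟨y, hy⟩
    have hy0 : y ≠ 0 := by
      rintro rfl
      rw [zero_pow hp.out.ne_zero] at hy
      exact x.ne_zero ((map_eq_zero _).mp hy.symm)
    exact ⟨Units.mk0 y hy0, Units.ext (by simpa using hy)⟩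

theorem pow_mem_locPow (v : HeightOneSpectrum (𝓞 F)) (x : Fˣ) : x ^ p ∈ locPow p v :=
  mem_locPow_iff.mpr ⟨algebraMap F _ x, by simp⟩

theorem valued_algebraMap_completion (v : HeightOneSpectrum (𝓞 F)) (x : F) :
    Valued.v (algebraMap F (v.adicCompletion F) x) = v.valuation F x :=
  HeightOneSpectrum.valuedAdicCompletion_eq_valuation' v x

theorem exists_integer_root_of_completion (v : HeightOneSpectrum (𝓞 F)) {z : F}
    (hz : IsPrimitiveRoot z p) : ∃ z' : v.adicCompletionIntegers F,
      algebraMap _ (v.adicCompletion F) z' = algebraMap F (v.adicCompletion F) z ∧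
      IsPrimitiveRoot z' p := by
  have h1 : IsPrimitiveRoot (algebraMap F (v.adicCompletion F) z) p :=
    hz.map_of_injective (algebraMap F (v.adicCompletion F)).injective
  have h2 : Valued.v (algebraMap F (v.adicCompletion F) z) ≤ 1 := by
    have := congrArg Valued.v h1.pow_eq_one
    rw [map_pow, map_one] at this
    exact ((pow_eq_one_iff_of_nonneg zero_le hp.out.ne_zero).mp this).le
  refine ⟨⟨_, (HeightOneSpectrum.mem_adicCompletionIntegers _ _ _).mpr h2⟩, rfl, ?_⟩
  exact IsPrimitiveRoot.of_map_of_injective (f := algebraMap (v.adicCompletionIntegers F)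
    (v.adicCompletion F)) h1 (FaithfulSMul.algebraMap_injective _ _)

theorem exists_pow_eq_of_completion {v : HeightOneSpectrum (𝓞 F)} {z' : v.adicCompletionIntegers F}
    {π : v.adicCompletionIntegers F} (hπ : Irreducible π) (hz : IsPrimitiveRoot z' p)
    (x : v.adicCompletionIntegers F) (hx : π * (z' - 1) ^ p ∣ x) : ∃ y, 1 + x = y ^ p :=
  exists_pow_eq_of_henselian hπ hz x hx

theorem exists_pow_eq_one_add_of_lt {v : HeightOneSpectrum (𝓞 F)} {z : F}
    (hz : IsPrimitiveRoot z p) {t : v.adicCompletion F}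
    (htv : Valued.v t < v.valuation F (z - 1) ^ p) : ∃ s, 1 + t = s ^ p := by
  obtain ⟨z', hz', hzp⟩ := exists_integer_root_of_completion v hz
  obtain ⟨π, hπ⟩ := IsDiscreteValuationRing.exists_irreducible (v.adicCompletionIntegers F)
  have hl : Valued.v (algebraMap _ (v.adicCompletion F) (z' - 1)) = v.valuation F (z - 1) := by
    rw [← valued_algebraMap_completion, _root_.map_sub (algebraMap _ _) z' 1, hz',
      _root_.map_sub (algebraMap F _) z 1, map_one, map_one]
  have hint := HeightOneSpectrum.adicCompletionIntegers.integers (R := 𝓞 F) (K := F) v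
  have hl1 : v.valuation F (z - 1) ≤ 1 := by
    rw [← hl]; exact (z' - 1).2
  have htm : t ∈ v.adicCompletionIntegers F := by
    rw [HeightOneSpectrum.mem_adicCompletionIntegers]
    exact htv.le.trans (pow_le_one₀ zero_le hl1)
  obtain ⟨d, hd⟩ : (z' - 1) ^ p ∣ (⟨t, htm⟩ : v.adicCompletionIntegers F) := by
    rw [hint.dvd_iff_le, map_pow, map_pow, hl]; exact htv.le
  have hdm : π ∣ d := by
    rw [← Ideal.mem_span_singleton, ← hπ.maximalIdeal_eq, IsLocalRing.mem_maximalIdeal,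
      mem_nonunits_iff]
    intro hu
    have h1 : Valued.v (algebraMap _ (v.adicCompletion F) d) = 1 := hint.valuation_unit hu.unit
    have h2 := congrArg (fun s => Valued.v (algebraMap _ (v.adicCompletion F) s)) hd
    simp only [map_mul, map_pow, h1, hl, mul_one] at h2
    exact htv.ne h2
  obtain ⟨s, hs⟩ := exists_pow_eq_of_completion hπ hzp (⟨t, htm⟩ : v.adicCompletionIntegers F) (by
    rw [hd, mul_comm]; exact mul_dvd_mul_left _ hdm)
  refine ⟨algebraMap _ (v.adicCompletion F) s, ?_⟩
  rw [← map_pow, ← hs, map_add, map_one]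
  rfl

theorem mem_locPow_of_lt {v : HeightOneSpectrum (𝓞 F)} {z : F} (hz : IsPrimitiveRoot z p)
    {x y : Fˣ} (h : v.valuation F (x / y ^ p - 1) < v.valuation F (z - 1) ^ p) :
    x ∈ locPow p v := by
  obtain ⟨s, hs⟩ := exists_pow_eq_one_add_of_lt (t := algebraMap F (v.adicCompletion F)
    (x / y ^ p - 1)) hz (by rwa [valued_algebraMap_completion])
  refine mem_locPow_iff.mpr ⟨s * algebraMap F _ y, ?_⟩
  rw [mul_pow, ← hs, ← map_pow, ← map_one (algebraMap F (v.adicCompletion F)), ← map_add,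
    ← map_mul]
  congr 1
  field_simp
  ring

theorem exists_approx_of_mem_locPow {v : HeightOneSpectrum (𝓞 F)} {x : Fˣ}
    (h : x ∈ locPow p v) (n : ℕ) :
    ∃ y : Fˣ, v.valuation F (x / y ^ p - 1) ≤ exp (-(n : ℤ)) := by
  obtain ⟨Y, hY⟩ := mem_locPow_iff.mp h
  set ι := algebraMap F (v.adicCompletion F)
  have hx0 : ι x ≠ 0 := (_root_.map_ne_zero _).mpr x.ne_zero
  have hY0 : Y ≠ 0 := by
    rintro rfl
    rw [zero_pow hp.out.ne_zero] at hY; exact hx0 hY.symm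
  have hcont : ContinuousAt (fun t : v.adicCompletion F => ι x / t ^ p - 1) Y :=
    ((continuousAt_const.div (continuousAt_id.pow p) (pow_ne_zero _ hY0)).sub continuousAt_const)
  have hnh : (fun t : v.adicCompletion F => ι x / t ^ p - 1) ⁻¹' {t | Valued.v t ≤ exp (-(n : ℤ))}
      ∈ 𝓝 Y := by
    apply hcont.preimage_mem_nhds
    simp only [hY, div_self hx0, sub_self]
    exact (nhds_zero_iff_of_completion v).mpr ⟨n, le_rfl⟩
  have hd := HeightOneSpectrum.denseRange_algebraMap (K := F) (v := v) Y
  rw [mem_closure_iff_nhds] at hd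
  obtain ⟨_, ⟨hy1, hy2⟩, y, rfl⟩ := hd _ (Filter.inter_mem hnh (isOpen_ne.mem_nhds hY0))
  have hy0 : y ≠ 0 := by rintro rfl; exact hy2 (map_zero _)
  refine ⟨Units.mk0 y hy0, ?_⟩
  rw [← valued_algebraMap_completion]
  simpa using hy1
end loc

section approx
variable {F : Type*} [Field F] [NumberField F]

/-- Simultaneous approximation at finitely many finite places. -/
theorem exists_approx_add (S : Finset (HeightOneSpectrum (𝓞 F)))
    (x : HeightOneSpectrum (𝓞 F) → F) (n : ℕ) :
    ∃ y : F, ∀ v ∈ S, v.valuation F (y - x v) ≤ exp (-(n : ℤ)) := by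
  classical
  obtain ⟨⟨d, hd⟩, hdx⟩ := IsLocalization.exist_integer_multiples (nonZeroDivisors (𝓞 F)) S x
  have hd0 : d ≠ 0 := nonZeroDivisors.ne_zero hd
  choose! c hc using hdx
  have hm : ∀ v : HeightOneSpectrum (𝓞 F), ∃ m : ℕ, exp (-(m : ℤ)) = v.valuation F (d : F) := by
    intro v
    rw [HeightOneSpectrum.valuation_of_algebraMap]
    exact ⟨_, (v.intValuation_if_neg hd0).symm⟩
  choose m hm using hm
  obtain ⟨a, ha⟩ := IsDedekindDomain.exists_forall_sub_mem_ideal (s := S)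
    (fun v : HeightOneSpectrum (𝓞 F) => v.asIdeal) (fun v => n + m v) (fun v _ => v.prime)
    (fun v _ w _ hvw h => hvw (HeightOneSpectrum.ext h)) (fun v => c v)
  have hdF : (algebraMap (𝓞 F) F d) ≠ 0 := by
    simpa using hd0
  refine ⟨a / d, fun v hv => ?_⟩
  have h1 := ha v hv
  rw [← HeightOneSpectrum.intValuation_le_pow_iff_mem, ← HeightOneSpectrum.valuation_of_algebraMap
    (K := F), Algebra.cast, _root_.map_sub (algebraMap (𝓞 F) F), hc v hv] at h1
  have h2 : (a : F) / d - x v = (a - d * x v) / d := by field_simp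
  rw [h2, map_div₀, ← hm v, div_le_iff₀ (by simp [exp_pos]), ← exp_add]
  refine le_trans (le_of_eq ?_) (h1.trans (le_of_eq ?_))
  · simp [Algebra.smul_def]
  · congr 1; push_cast; ring

theorem exists_exp_neg_le {w : ℤᵐ⁰} (hw : w ≠ 0) : ∃ m : ℕ, exp (-(m : ℤ)) ≤ w := by
  rw [← exp_log hw]
  refine ⟨(log w).natAbs, exp_le_exp.mpr ?_⟩
  omega

theorem exists_approx_units (S : Finset (HeightOneSpectrum (𝓞 F)))
    (x : HeightOneSpectrum (𝓞 F) → Fˣ) (n : ℕ) :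
    ∃ y : Fˣ, ∀ v ∈ S, v.valuation F (y / x v - 1) ≤ exp (-((n : ℤ) + 1)) := by
  choose m hm using fun v : HeightOneSpectrum (𝓞 F) =>
    exists_exp_neg_le ((Valuation.ne_zero_iff (v.valuation F)).mpr (x v).ne_zero)
  obtain ⟨y, hy⟩ := exists_approx_add S (fun v => (x v : F)) (n + 1 + S.sup m)
  have key : ∀ v ∈ S, v.valuation F (y / x v - 1) ≤ exp (-((n : ℤ) + 1)) := by
    intro v hv
    have h2 : y / x v - 1 = (y - x v) / x v := by field_simp
    have h3 : exp (-(m v : ℤ)) ≠ 0 := exp_ne_zero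
    rw [h2, map_div₀]
    calc _ ≤ exp (-((n + 1 + S.sup m : ℕ) : ℤ)) / exp (-(m v : ℤ)) := by
          rw [div_eq_mul_inv, div_eq_mul_inv]
          exact mul_le_mul' (hy v hv) (inv_anti₀ exp_pos (hm v))
      _ ≤ _ := by
          rw [← exp_sub, exp_le_exp]
          have := Finset.le_sup (f := m) hv
          push_cast
          omega
  by_cases hy0 : y = 0
  · refine ⟨1, fun v hv => ?_⟩
    have := key v hv
    rw [hy0, zero_div, zero_sub, Valuation.map_neg, map_one, ← exp_zero, exp_le_exp] at this
    omega
  · exact ⟨Units.mk0 y hy0, key⟩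
end approx

section index
variable {A : Type*} [CommGroup A]

theorem index_inf_of_sup_eq_top {H K : Subgroup A} (h : H ⊔ K = ⊤) :
    (H ⊓ K).index = H.index * K.index := by
  rw [← Subgroup.relIndex_mul_index (inf_le_right : H ⊓ K ≤ K), Subgroup.inf_relIndex_right,
    ← Subgroup.relIndex_sup_left, h, Subgroup.relIndex_top_right]

theorem relIndex_eq_index_of_sup_eq_top {H K : Subgroup A} (h : H ⊔ K = ⊤) :
    H.relIndex K = H.index := by
  rw [← Subgroup.relIndex_sup_left, h, Subgroup.relIndex_top_right]

theorem relIndex_mul_index_sup (H K : Subgroup A) :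
    H.relIndex K * (H ⊔ K).index = H.index := by
  rw [← Subgroup.relIndex_sup_left, Subgroup.relIndex_mul_index le_sup_left]

theorem index_iInf_eq_prod {ι : Type*} {P Q : ι → Subgroup A} (S : Finset ι)
    (hP : ∀ x : ι → A, ∃ y, ∀ i ∈ S, y / x i ∈ P i) (hPQ : ∀ i ∈ S, P i ≤ Q i) :
    (⨅ i ∈ S, Q i).index = ∏ i ∈ S, (Q i).index := by
  classical
  induction S using Finset.induction_on with
  | empty => simp
  | insert i S hi ih =>
    rw [Finset.iInf_insert, index_inf_of_sup_eq_top, Finset.prod_insert hi, ih]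
    · exact fun x => (hP x).imp fun y hy j hj => hy j (Finset.mem_insert_of_mem hj)
    · exact fun j hj => hPQ j (Finset.mem_insert_of_mem hj)
    · rw [eq_top_iff]
      intro x _
      obtain ⟨y, hy⟩ := hP (fun j => if j = i then x else 1)
      have h1 : x / y ∈ Q i := by
        have := hPQ i (Finset.mem_insert_self i S) (hy i (Finset.mem_insert_self i S))
        rw [if_pos rfl] at this
        simpa using inv_mem this
      have h2 : y ∈ ⨅ j ∈ S, Q j := by
        simp only [Subgroup.mem_iInf]
        intro j hj
        have := hPQ j (Finset.mem_insert_of_mem hj) (hy j (Finset.mem_insert_of_mem hj))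
        rwa [if_neg (by rintro rfl; exact hi hj), div_one] at this
      have := Subgroup.mul_mem_sup h1 h2
      rwa [div_mul_cancel] at this

theorem prime_dvd_index {p : ℕ} [hp : Fact p.Prime] {H : Subgroup A} (h : ∀ x, x ^ p ∈ H)
    (h0 : H.index ≠ 0) (h1 : H ≠ ⊤) : p ∣ H.index := by
  have hfin : Finite (A ⧸ H) := Subgroup.index_ne_zero_iff_finite.mp h0
  have hpg : IsPGroup p (A ⧸ H) := by
    intro x
    induction x using QuotientGroup.induction_on with
    | H x => exact ⟨1, by
        rw [pow_one, ← QuotientGroup.mk_pow, QuotientGroup.eq_one_iff]; exact h x⟩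
  obtain ⟨n, hn⟩ := IsPGroup.iff_card.mp hpg
  rw [Subgroup.index, hn]
  refine dvd_pow_self p ?_
  rintro rfl
  rw [pow_zero] at hn
  exact h1 (Subgroup.index_eq_one.mp hn)
end index

section locNm
variable {k : Type*} [Field k] {p : ℕ} [hp : Fact p.Prime]

/-- The group of norms of `k(b^{1/p})`. -/
def nmGroup (p : ℕ) [hp : Fact p.Prime] (ζ b : k) : Subgroup kˣ where
  carrier := {u | IsKNorm p ζ b (u : k)}
  mul_mem' := fun hx hy => by simpa using IsKNorm.mul hx hy
  one_mem' := by simpa using IsKNorm.one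
  inv_mem' := fun hx => by simpa using IsKNorm.inv hp.out.ne_zero hx

variable {F : Type*} [Field F] [NumberField F]

/-- The elements of `Fˣ` which are norms from `F_v(b^{1/p})`. -/
noncomputable def locNm (p : ℕ) [hp : Fact p.Prime] (ζ : F) (v : HeightOneSpectrum (𝓞 F)) (b : F) :
    Subgroup Fˣ :=
  (nmGroup p (algebraMap F (v.adicCompletion F) ζ) (algebraMap F (v.adicCompletion F) b)).comap
    (Units.map (algebraMap F (v.adicCompletion F)).toMonoidHom)

variable {ζ : F} {v : HeightOneSpectrum (𝓞 F)}

theorem mem_locNm {b : F} {u : Fˣ} : u ∈ locNm p ζ v b ↔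
    IsKNorm p (algebraMap F (v.adicCompletion F) ζ) (algebraMap F (v.adicCompletion F) b)
      (algebraMap F (v.adicCompletion F) u) := Iff.rfl

theorem nmGroup_le_locNm (b : F) : nmGroup p ζ b ≤ locNm p ζ v b :=
  fun _ hu => IsKNorm.map _ hu

theorem locPow_le_locNm (b : F) : locPow p v ≤ locNm p ζ v b := by
  intro u hu
  obtain ⟨y, hy⟩ := mem_locPow_iff.mp hu
  rw [mem_locNm, ← hy]
  exact IsKNorm.pow_self y

theorem mem_locNm_symm (hp2 : p ≠ 2) (hζ : IsPrimitiveRoot ζ p) {a b : Fˣ} :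
    b ∈ locNm p ζ v a → a ∈ locNm p ζ v b := by
  intro h
  rw [mem_locNm] at h ⊢
  exact IsKNorm.symm hp2 (hζ.map_of_injective (algebraMap F (v.adicCompletion F)).injective)
    ((_root_.map_ne_zero _).mpr a.ne_zero) ((_root_.map_ne_zero _).mpr b.ne_zero) h

theorem exists_mul_pow_eq_algebraMap (hz : IsPrimitiveRoot ζ p) {t : v.adicCompletion F}
    (ht : t ≠ 0) : ∃ y : Fˣ, ∃ s, algebraMap F (v.adicCompletion F) y * s ^ p = t := by
  have hl0 : v.valuation F (ζ - 1) ^ p ≠ 0 := pow_ne_zero p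
    ((Valuation.ne_zero_iff _).mpr (sub_ne_zero.mpr (hz.ne_one hp.out.one_lt)))
  have ht0 : Valued.v t ≠ 0 := (Valuation.ne_zero_iff _).mpr ht
  obtain ⟨m, hm⟩ := exists_exp_neg_le (mul_ne_zero hl0 ht0)
  obtain ⟨n, hn⟩ := exists_exp_neg_le ht0
  obtain ⟨y, hy⟩ := exists_sub_valued_le v t (m + n + 1)
  have hyn : Valued.v (t - (y : v.adicCompletion F)) < Valued.v t := by
    refine (hy.trans_lt (exp_lt_exp.mpr ?_)).trans_le hn
    push_cast; omega
  have hym : Valued.v (t - (y : v.adicCompletion F)) < v.valuation F (ζ - 1) ^ p * Valued.v t := by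
    refine (hy.trans_lt (exp_lt_exp.mpr ?_)).trans_le hm
    push_cast; omega
  have hyv : Valued.v (y : v.adicCompletion F) = Valued.v t := by
    rw [Valuation.map_sub_swap] at hyn
    exact Valuation.map_eq_of_sub_lt _ hyn
  have hy0 : (y : v.adicCompletion F) ≠ 0 := by
    intro h
    rw [h, map_zero] at hyv
    exact ht0 hyv.symm
  have hy0' : y ≠ 0 := by
    rintro rfl
    exact hy0 (map_zero (algebraMap F (v.adicCompletion F)))
  obtain ⟨s, hs⟩ := exists_pow_eq_one_add_of_lt (v := v) (t := (t - y) / y) hz (by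
    rw [map_div₀, hyv, div_lt_iff₀ (zero_lt_iff.mpr ht0)]
    exact hym)
  refine ⟨Units.mk0 y hy0', s, ?_⟩
  rw [← hs]
  change (y : v.adicCompletion F) * _ = t
  field_simp
  ring

theorem locNm_ne_top (hp2 : p ≠ 2) (hz : IsPrimitiveRoot ζ p) {b : Fˣ} (hb : b ∉ locPow p v) :
    locNm p ζ v (b : F) ≠ ⊤ := by
  obtain ⟨z', hz', hzp⟩ := exists_integer_root_of_completion v hz
  obtain ⟨π, hπ⟩ := IsDiscreteValuationRing.exists_irreducible (v.adicCompletionIntegers F)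
  obtain ⟨u, hu, hn⟩ := exists_not_isKNorm_of_not_pow hp2 hzp hπ
    (exists_pow_eq_of_completion hπ hzp) (b := algebraMap F (v.adicCompletion F) b)
    ((_root_.map_ne_zero _).mpr b.ne_zero) (fun y hy => hb (mem_locPow_iff.mpr ⟨y, hy⟩))
  obtain ⟨y, s, hys⟩ := exists_mul_pow_eq_algebraMap (v := v) hz hu
  intro htop
  apply hn
  have : y ∈ locNm p ζ v (b : F) := htop ▸ Subgroup.mem_top y
  rw [hz', ← hys]
  exact IsKNorm.mul this (IsKNorm.pow_self s)

theorem exists_div_mem_locPow (hz : IsPrimitiveRoot ζ p) (S : Finset (HeightOneSpectrum (𝓞 F)))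
    (x : HeightOneSpectrum (𝓞 F) → Fˣ) : ∃ y : Fˣ, ∀ v ∈ S, y / x v ∈ locPow p v := by
  have hl0 : ζ - 1 ≠ 0 := sub_ne_zero.mpr (hz.ne_one hp.out.one_lt)
  choose m hm using fun v : HeightOneSpectrum (𝓞 F) =>
    exists_exp_neg_le (pow_ne_zero p ((Valuation.ne_zero_iff (v.valuation F)).mpr hl0))
  obtain ⟨y, hy⟩ := exists_approx_units S x (S.sup m)
  refine ⟨y, fun v hv => mem_locPow_of_lt hz (y := 1) ?_⟩
  have h1 := hy v hv
  rw [Units.val_one, one_pow, div_one, Units.val_div_eq_div_val]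
  refine (h1.trans_lt (exp_lt_exp.mpr ?_)).trans_le (hm v)
  have := Finset.le_sup (f := m) hv
  omega
end locNm

section unitsAt
variable {F : Type*} [Field F] [NumberField F] {p : ℕ} [hp : Fact p.Prime] {ζ : F}

/-- The elements of `Fˣ` which are units at `v`. -/
noncomputable def unitsAt (v : HeightOneSpectrum (𝓞 F)) : Subgroup Fˣ :=
  (v.valuationOfNeZero (K := F)).ker

theorem mem_unitsAt {v : HeightOneSpectrum (𝓞 F)} {x : Fˣ} :
    x ∈ unitsAt v ↔ v.valuation F x = 1 := by
  rw [unitsAt, MonoidHom.mem_ker, ← HeightOneSpectrum.valuationOfNeZero_eq, ← WithZero.coe_one,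
    WithZero.coe_inj]

/-- Reduction of units at `v` to the residue field. -/
noncomputable def unitsAtResidue (v : HeightOneSpectrum (𝓞 F)) :
    unitsAt v →* (ResidueField (v.adicCompletionIntegers F))ˣ :=
  MonoidHom.toHomUnits
    { toFun := fun x => residue (v.adicCompletionIntegers F) ⟨algebraMap F (v.adicCompletion F) x.1,
        (HeightOneSpectrum.mem_adicCompletionIntegers _ _ _).mpr
          (by rw [valued_algebraMap_completion, mem_unitsAt.mp x.2])⟩
      map_one' := by
        rw [← map_one (residue (v.adicCompletionIntegers F))]
        exact congrArg _ (Subtype.ext (map_one (algebraMap F (v.adicCompletion F))))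
      map_mul' := fun x y => by
        rw [← map_mul (residue (v.adicCompletionIntegers F))]
        exact congrArg _ (Subtype.ext (map_mul (algebraMap F (v.adicCompletion F)) _ _)) }

theorem card_ker_powMonoidHom_le {k : Type*} [Field k] :
    Nat.card (powMonoidHom p : kˣ →* kˣ).ker ≤ p := by
  have : NeZero p := ⟨hp.out.ne_zero⟩
  exact card_rootsOfUnity k p

theorem index_range_powMonoidHom {B : Type*} [CommGroup B] [Finite B] (n : ℕ) :
    (powMonoidHom n : B →* B).range.index = Nat.card (powMonoidHom n : B →* B).ker := by
  have h1 := (powMonoidHom n : B →* B).range.card_mul_index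
  have h2 := (powMonoidHom n : B →* B).ker.card_mul_index
  rw [Subgroup.index_ker, mul_comm] at h2
  exact Nat.eq_of_mul_eq_mul_left Nat.card_pos (h1.trans h2.symm)

theorem relIndex_locPow_unitsAt {v : HeightOneSpectrum (𝓞 F)} (hz : IsPrimitiveRoot ζ p)
    (hv : v.valuation F (ζ - 1) = 1) :
    (locPow p v).relIndex (unitsAt v) ≠ 0 ∧ (locPow p v).relIndex (unitsAt v) ≤ p := by
  set k := ResidueField (v.adicCompletionIntegers F)
  set R : Subgroup kˣ := (powMonoidHom p : kˣ →* kˣ).range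
  have h1 : R.comap (unitsAtResidue v) ≤ (locPow p v).subgroupOf (unitsAt v) := by
    rintro x ⟨y, hy⟩
    rw [Subgroup.mem_subgroupOf, mem_locPow_iff]
    obtain ⟨c, hc⟩ := residue_surjective (y : k)
    have hcu : IsUnit c := by
      rw [← residue_ne_zero_iff_isUnit, hc]; exact y.ne_zero
    have hint := HeightOneSpectrum.adicCompletionIntegers.integers (R := 𝓞 F) (K := F) v
    have hcv : Valued.v (c : v.adicCompletion F) = 1 := hint.valuation_unit hcu.unit
    have hc0 : (c : v.adicCompletion F) ≠ 0 := by
      intro h; rw [h, map_zero] at hcv; exact zero_ne_one hcv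
    obtain ⟨X, hX1, hX2⟩ : ∃ X : v.adicCompletionIntegers F,
        (X : v.adicCompletion F) = algebraMap F (v.adicCompletion F) x.1 ∧
        residue (v.adicCompletionIntegers F) X = (unitsAtResidue v x : k) := ⟨⟨_, _⟩, rfl, rfl⟩
    have h3 : residue (v.adicCompletionIntegers F) (X - c ^ p) = 0 := by
      rw [map_sub, map_pow, hc, hX2, ← hy, powMonoidHom_apply, Units.val_pow_eq_pow_val, sub_self]
    rw [residue_eq_zero_iff, mem_maximalIdeal, mem_nonunits_iff] at h3
    have h5 : ((X - c ^ p : v.adicCompletionIntegers F) : v.adicCompletion F) =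
        algebraMap F (v.adicCompletion F) x.1 - (c : v.adicCompletion F) ^ p := by
      rw [← hX1]; rfl
    have h4 : Valued.v (algebraMap F (v.adicCompletion F) x.1 - (c : v.adicCompletion F) ^ p)
        < 1 := by
      rw [← h5]
      exact lt_of_le_of_ne ((HeightOneSpectrum.mem_adicCompletionIntegers _ _ _).mp
        (X - c ^ p).2) fun h => h3 (hint.isUnit_of_one' h)
    obtain ⟨s, hs⟩ := exists_pow_eq_one_add_of_lt (v := v)
      (t := (algebraMap F (v.adicCompletion F) x.1 - (c : v.adicCompletion F) ^ p) / c ^ p) hz (by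
        rw [map_div₀, map_pow, hcv, one_pow, div_one, hv, one_pow]; exact h4)
    refine ⟨s * c, ?_⟩
    rw [mul_pow, ← hs]
    field_simp
    ring
  have h0 : R.index ≠ 0 := Subgroup.index_ne_zero_of_finite
  have h2 : (R.comap (unitsAtResidue v)).index ≠ 0 ∧ (R.comap (unitsAtResidue v)).index ≤ p := by
    rw [Subgroup.index_comap]
    constructor
    · intro h
      exact h0 (Subgroup.relIndex_top_right R ▸ Subgroup.relIndex_eq_zero_of_le_right le_top h)
    · calc _ ≤ R.relIndex ⊤ := Subgroup.relIndex_le_of_le_right le_top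
            (by rwa [Subgroup.relIndex_top_right])
        _ ≤ p := by
          rw [Subgroup.relIndex_top_right, index_range_powMonoidHom]
          exact card_ker_powMonoidHom_le
  have : (R.comap (unitsAtResidue v)).FiniteIndex := ⟨h2.1⟩
  exact ⟨(Subgroup.finiteIndex_of_le h1).index_ne_zero, (Subgroup.index_antitone h1).trans h2.2⟩
end unitsAt

section modVal
variable {F : Type*} [Field F] [NumberField F] {p : ℕ} [hp : Fact p.Prime] {ζ : F}

/-- The elements of `Fˣ` whose valuation at `v` is divisible by `p`. -/
noncomputable def modVal (p : ℕ) (v : HeightOneSpectrum (𝓞 F)) : Subgroup Fˣ :=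
  (powMonoidHom p : Multiplicative ℤ →* Multiplicative ℤ).range.comap
    (v.valuationOfNeZero (K := F))

theorem index_modVal_le (v : HeightOneSpectrum (𝓞 F)) :
    (modVal (F := F) p v).index ≠ 0 ∧ (modVal (F := F) p v).index ≤ p := by
  set R := (powMonoidHom p : Multiplicative ℤ →* Multiplicative ℤ).range with hR
  have h1 : R.index = p := by
    have h : R = AddSubgroup.toSubgroup (AddSubgroup.zmultiples (p : ℤ)) := by
      ext x
      rw [hR, MonoidHom.mem_range]
      exact ⟨fun ⟨y, hy⟩ => ⟨y.toAdd, by rw [← hy]; exact mul_comm _ _⟩,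
        fun ⟨y, hy⟩ => ⟨Multiplicative.ofAdd y, by
          rw [powMonoidHom_apply]; exact (mul_comm _ _).trans hy⟩⟩
    rw [h, AddSubgroup.index_toSubgroup, Int.index_zmultiples, Int.natAbs_natCast]
  have hp0 := hp.out.ne_zero
  rw [modVal, Subgroup.index_comap]
  constructor
  · intro h
    have := Subgroup.relIndex_eq_zero_of_le_right le_top h
    rw [Subgroup.relIndex_top_right] at this
    exact hp0 (h1.symm.trans this)
  · calc _ ≤ R.relIndex ⊤ := Subgroup.relIndex_le_of_le_right le_top
          (by rw [Subgroup.relIndex_top_right, h1]; exact hp0)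
      _ = p := by rw [Subgroup.relIndex_top_right, h1]

theorem valuationOfNeZero_surjective (v : HeightOneSpectrum (𝓞 F)) :
    Function.Surjective (v.valuationOfNeZero (K := F)) := by
  obtain ⟨π, hπ⟩ := v.valuation_exists_uniformizer F
  have hπ0 : π ≠ 0 := by
    rintro rfl
    rw [map_zero] at hπ
    exact exp_ne_zero hπ.symm
  have h1 : v.valuationOfNeZero (Units.mk0 π hπ0) = Multiplicative.ofAdd (-1) := by
    rw [← WithZero.coe_inj, HeightOneSpectrum.valuationOfNeZero_eq]
    exact hπ
  intro m
  refine ⟨Units.mk0 π hπ0 ^ (-m.toAdd), ?_⟩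
  rw [map_zpow, h1, ← ofAdd_zsmul, smul_eq_mul, neg_mul_neg, mul_one, ofAdd_toAdd]

theorem valuation_eq_of_div_sub_one_lt {v : HeightOneSpectrum (𝓞 F)} {x y : F} (hy : y ≠ 0)
    (h : v.valuation F (x / y - 1) < 1) : v.valuation F x = v.valuation F y := by
  have h1 := Valuation.map_eq_of_sub_lt (v.valuation F) (x := 1) (y := x / y) (by rwa [map_one])
  rw [map_one, map_div₀] at h1
  exact (div_eq_one_iff_eq ((Valuation.ne_zero_iff _).mpr hy)).mp h1

theorem mem_modVal {v : HeightOneSpectrum (𝓞 F)} {x : Fˣ} :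
    x ∈ modVal p v ↔ ∃ y : Fˣ, v.valuation F (x / y ^ p) = 1 := by
  have h1 : ∀ y : Fˣ, v.valuation F (x / y ^ p) = 1 ↔
      v.valuationOfNeZero x = v.valuationOfNeZero y ^ p := by
    intro y
    rw [← Units.val_pow_eq_pow_val, ← Units.val_div_eq_div_val, ← mem_unitsAt, unitsAt,
      MonoidHom.mem_ker, _root_.map_div, map_pow, div_eq_one]
  simp only [h1]
  constructor
  · rintro ⟨m, hm⟩
    obtain ⟨y, hy⟩ := valuationOfNeZero_surjective v m
    exact ⟨y, by rw [hy, ← hm, powMonoidHom_apply]⟩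
  · rintro ⟨y, hy⟩
    exact ⟨v.valuationOfNeZero y, hy.symm⟩

theorem locPow_le_modVal (v : HeightOneSpectrum (𝓞 F)) :
    locPow p v ≤ modVal p v := by
  intro x hx
  obtain ⟨y, hy⟩ := exists_approx_of_mem_locPow hx 1
  refine mem_modVal.mpr ⟨y, ?_⟩
  have h0 : exp (-((1 : ℕ) : ℤ)) < (1 : ℤᵐ⁰) := by rw [← exp_zero, exp_lt_exp]; omega
  have h1 := valuation_eq_of_div_sub_one_lt (x := (x : F)) (pow_ne_zero p y.ne_zero)
    (hy.trans_lt h0)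
  rw [map_div₀, h1, div_self ((Valuation.ne_zero_iff _).mpr (pow_ne_zero p y.ne_zero))]

theorem iInf_modVal_le (S : Finset (HeightOneSpectrum (𝓞 F))) :
    (⨅ v ∈ S, modVal (F := F) p v) ≤ (⨅ v ∈ S, locPow p v) ⊔ ⨅ v ∈ S, unitsAt v := by
  intro x hx
  simp only [Subgroup.mem_iInf, mem_modVal] at hx
  choose! y hy using hx
  obtain ⟨w, hw⟩ := exists_approx_units S y 1
  have h1 : ∀ v ∈ S, v.valuation F w = v.valuation F (y v) := fun v hv =>
    valuation_eq_of_div_sub_one_lt (y v).ne_zero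
      ((hw v hv).trans_lt (by rw [← exp_zero, exp_lt_exp]; omega))
  have h2 : w ^ p ∈ ⨅ v ∈ S, locPow p v := by
    simp only [Subgroup.mem_iInf]
    exact fun v _ => pow_mem_locPow v w
  have h3 : x / w ^ p ∈ ⨅ v ∈ S, unitsAt v := by
    simp only [Subgroup.mem_iInf]
    intro v hv
    rw [mem_unitsAt, Units.val_div_eq_div_val, Units.val_pow_eq_pow_val, map_div₀, map_pow, h1 v hv,
      ← map_pow, ← map_div₀, hy v hv]
  have := Subgroup.mul_mem_sup h2 h3
  rwa [mul_div_cancel] at this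

theorem index_locPow_sup_unitsAt_le (hz : IsPrimitiveRoot ζ p)
    (S : Finset (HeightOneSpectrum (𝓞 F))) :
    ((⨅ v ∈ S, locPow p v) ⊔ ⨅ v ∈ S, unitsAt (F := F) v).index ≠ 0 ∧
    ((⨅ v ∈ S, locPow p v) ⊔ ⨅ v ∈ S, unitsAt (F := F) v).index ≤ p ^ S.card := by
  have h1 : (⨅ v ∈ S, modVal (F := F) p v).index = ∏ v ∈ S, (modVal (F := F) p v).index :=
    index_iInf_eq_prod S (exists_div_mem_locPow hz S) fun v _ => locPow_le_modVal v
  have h2 : (⨅ v ∈ S, modVal (F := F) p v).index ≠ 0 := by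
    rw [h1]
    exact Finset.prod_ne_zero_iff.mpr fun v _ => (index_modVal_le v).1
  have : (⨅ v ∈ S, modVal (F := F) p v).FiniteIndex := ⟨h2⟩
  refine ⟨(Subgroup.finiteIndex_of_le (iInf_modVal_le S)).index_ne_zero,
    (Subgroup.index_antitone (iInf_modVal_le S)).trans ?_⟩
  rw [h1]
  exact Finset.prod_le_pow_card S _ _ fun v _ => (index_modVal_le v).2
end modVal

section approxInteger
variable {F : Type*} [Field F] [NumberField F]

theorem exists_approx_integer (S : Finset (HeightOneSpectrum (𝓞 F)))
    (x : HeightOneSpectrum (𝓞 F) → F) (hx : ∀ v ∈ S, v.valuation F (x v) ≤ 1) (n : ℕ) :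
    ∃ y : 𝓞 F, ∀ v ∈ S, v.valuation F (algebraMap (𝓞 F) F y - x v) ≤ exp (-(n : ℤ)) := by
  classical
  have h1 : ∀ v ∈ S, ∃ a : 𝓞 F, v.valuation F (algebraMap (𝓞 F) F a - x v) ≤ exp (-(n : ℤ)) := by
    intro v hv
    obtain ⟨a, ha⟩ := v.exists_valuation_sub_lt_of_integer (hx v hv)
      (Units.mk0 (exp (-(n : ℤ))) exp_ne_zero)
    exact ⟨a, ha.le⟩
  choose! c hc using h1
  obtain ⟨a, ha⟩ := IsDedekindDomain.exists_forall_sub_mem_ideal (s := S)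
    (fun v : HeightOneSpectrum (𝓞 F) => v.asIdeal) (fun _ => n) (fun v _ => v.prime)
    (fun v _ w _ hvw h => hvw (HeightOneSpectrum.ext h)) (fun v => c v)
  refine ⟨a, fun v hv => ?_⟩
  have h1 := ha v hv
  rw [← HeightOneSpectrum.intValuation_le_pow_iff_mem, ← HeightOneSpectrum.valuation_of_algebraMap
    (K := F), Algebra.cast, _root_.map_sub (algebraMap (𝓞 F) F)] at h1
  rw [← sub_add_sub_cancel _ (algebraMap (𝓞 F) F (c v))]
  exact Valuation.map_add_le _ h1 (hc v hv)

/-- The product of the primes in a finite set. -/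
noncomputable def primeProd (S : Finset (HeightOneSpectrum (𝓞 F))) : Ideal (𝓞 F) :=
  ∏ v ∈ S, v.asIdeal

theorem primeProd_ne_bot (S : Finset (HeightOneSpectrum (𝓞 F))) : primeProd S ≠ ⊥ :=
  Finset.prod_ne_zero_iff.mpr fun v _ => v.ne_bot

theorem mem_primeProd {S : Finset (HeightOneSpectrum (𝓞 F))} {a : 𝓞 F} :
    a ∈ primeProd S ↔ ∀ v ∈ S, v.valuation F (algebraMap (𝓞 F) F a) < 1 := by
  have h := IsDedekindDomain.inf_pow_eq_prod_of_prime (s := S)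
    (fun v : HeightOneSpectrum (𝓞 F) => v.asIdeal) (fun _ => 1) (fun v _ => v.prime)
    (fun v _ w _ hvw h => hvw (HeightOneSpectrum.ext h))
  simp only [pow_one] at h
  rw [primeProd, ← h, Submodule.mem_finsetInf]
  simp only [HeightOneSpectrum.valuation_lt_one_iff_mem]

theorem lt_one_iff_le_exp {x : ℤᵐ⁰} : x < 1 ↔ x ≤ exp (-1) := by
  rw [← exp_zero]
  rcases eq_or_ne x 0 with rfl | hx
  · simp
  · rw [← exp_log hx, exp_lt_exp, exp_le_exp]; omega

/-- Membership in `d · ∏_{v ∈ S} v` in terms of valuations, if `d` is a unit outside of `S`. -/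
theorem mem_span_mul_primeProd {S : Finset (HeightOneSpectrum (𝓞 F))} {a d : 𝓞 F} (hd : d ≠ 0)
    (hS : ∀ v ∉ S, v.valuation F (algebraMap (𝓞 F) F d) = 1) :
    a ∈ Ideal.span {d} * primeProd S ↔
    ∀ v ∈ S, v.valuation F (algebraMap (𝓞 F) F a) < v.valuation F (algebraMap (𝓞 F) F d) := by
  have hd' : algebraMap (𝓞 F) F d ≠ 0 := by simpa using hd
  have hv0 : ∀ v : HeightOneSpectrum (𝓞 F), 0 < v.valuation F (algebraMap (𝓞 F) F d) := fun v =>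
    zero_lt_iff.mpr ((Valuation.ne_zero_iff _).mpr hd')
  rw [Ideal.mem_span_singleton_mul]
  constructor
  · rintro ⟨b, hb, rfl⟩ v hv
    rw [_root_.map_mul, _root_.map_mul]
    exact mul_lt_of_lt_one_right (hv0 v) (mem_primeProd.mp hb v hv)
  · intro h
    obtain ⟨b, hb⟩ := HeightOneSpectrum.mem_integers_of_valuation_le_one F
      (algebraMap (𝓞 F) F a / algebraMap (𝓞 F) F d) (by
        intro v
        rw [map_div₀]
        by_cases hv : v ∈ S
        · exact (div_le_one₀ (hv0 v)).mpr (h v hv).le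
        · rw [hS v hv, div_one]
          exact v.valuation_le_one a)
    refine ⟨b, mem_primeProd.mpr fun v hv => ?_, ?_⟩
    · rw [hb, map_div₀]
      exact (div_lt_one₀ (hv0 v)).mpr (h v hv)
    · apply FaithfulSMul.algebraMap_injective (𝓞 F) F
      rw [_root_.map_mul, hb]
      field_simp
end approxInteger

section index
theorem index_le_of_map {A B : Type*} [CommGroup A] [CommGroup B] {H : Subgroup A}
    {R : Subgroup B} (f : A → B) (hf : ∀ x y, f x / f y ∈ R → x / y ∈ H) (hR : R.index ≠ 0) :
    H.index ≠ 0 ∧ H.index ≤ R.index := by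
  have hfin : Finite (B ⧸ R) := Subgroup.index_ne_zero_iff_finite.mp hR
  let g : A ⧸ H → B ⧸ R := fun q => (f q.out : B)
  have hg : Function.Injective g := by
    intro q r hqr
    have h1 := hf _ _ (QuotientGroup.eq_iff_div_mem.mp hqr)
    rw [← QuotientGroup.out_eq' q, ← QuotientGroup.out_eq' r]
    exact QuotientGroup.eq_iff_div_mem.mpr h1
  have := Finite.of_injective g hg
  exact ⟨Subgroup.index_ne_zero_of_finite, Nat.card_le_card_of_injective g hg⟩
end index

section torsion
variable {F : Type*} [Field F] [NumberField F] {p : ℕ} [hp : Fact p.Prime] {z : 𝓞 F}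

theorem absNorm_sub_one_pow_le (hz : IsPrimitiveRoot z p) :
    Ideal.absNorm (Ideal.span {(z - 1) ^ (p - 1)}) ≤ p ^ Module.finrank ℚ F := by
  obtain ⟨μ, hμ⟩ := sub_one_pow_dvd_prime hz
  rw [← RingOfIntegers.rank F, ← Ideal.absNorm_span_natCast (S := 𝓞 F) p]
  have h0 : Ideal.absNorm (Ideal.span {((p : ℕ) : 𝓞 F)}) ≠ 0 := by
    rw [Ne, Ideal.absNorm_eq_zero_iff, Ideal.span_singleton_eq_bot]
    exact_mod_cast hp.out.ne_zero
  refine Nat.le_of_dvd (Nat.pos_of_ne_zero h0) (Ideal.absNorm_dvd_absNorm_of_le ?_)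
  rw [Ideal.span_singleton_le_span_singleton, hμ]
  exact dvd_mul_right _ _

theorem card_ker_factor_eq {I J m : Ideal (𝓞 F)} (hJ : J ≠ ⊥) (hm : m = I * J) (h : m ≤ J) :
    Nat.card (Ideal.Quotient.factor h).toAddMonoidHom.ker = Ideal.absNorm I := by
  set f := (Ideal.Quotient.factor h).toAddMonoidHom
  have h1 := f.ker.card_mul_index
  have hf : Function.Surjective f := Ideal.Quotient.factor_surjective h
  rw [AddSubgroup.index_ker, AddMonoidHom.range_eq_top.mpr hf, AddSubgroup.card_top] at h1
  have h2 : Nat.card (𝓞 F ⧸ m) = Ideal.absNorm I * Ideal.absNorm J := by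
    rw [← _root_.map_mul, ← hm]; rfl
  have h3 : Nat.card (𝓞 F ⧸ J) = Ideal.absNorm J := rfl
  rw [h2, h3] at h1
  exact Nat.eq_of_mul_eq_mul_right (Nat.pos_of_ne_zero (by rwa [Ne, Ideal.absNorm_eq_zero_iff])) h1

theorem card_ker_pow_le (hz : IsPrimitiveRoot z p) {S : Finset (HeightOneSpectrum (𝓞 F))}
    (hS : ∀ v ∉ S, v.valuation F (algebraMap (𝓞 F) F (z - 1)) = 1) :
    Finite (𝓞 F ⧸ Ideal.span {(z - 1) ^ p} * primeProd S) ∧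
    Nat.card (powMonoidHom p : (𝓞 F ⧸ Ideal.span {(z - 1) ^ p} * primeProd S)ˣ →* _).ker ≤
      p ^ (S.card + Module.finrank ℚ F) := by
  classical
  have hl0 : z - 1 ≠ 0 := sub_ne_zero.mpr (hz.ne_one hp.out.one_lt)
  have hfin : ∀ I : Ideal (𝓞 F), I ≠ ⊥ → Finite (𝓞 F ⧸ I) :=
    fun I hI => Ideal.finiteQuotientOfFreeOfNeBot I hI
  have hI : Ideal.span {(z - 1) ^ p} * primeProd S =
      Ideal.span {(z - 1) ^ (p - 1)} * (Ideal.span {z - 1} * primeProd S) := by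
    rw [← mul_assoc, Ideal.span_singleton_mul_span_singleton, ← pow_succ,
      Nat.sub_add_cancel hp.out.one_le]
  have hJ0 : Ideal.span {z - 1} * primeProd S ≠ ⊥ :=
    mul_ne_zero (by rwa [Ne, Ideal.zero_eq_bot, Ideal.span_singleton_eq_bot]) (primeProd_ne_bot S)
  have hSp : ∀ v ∉ S, v.valuation F (algebraMap (𝓞 F) F ((z - 1) ^ p)) = 1 := fun v hv => by
    rw [map_pow, map_pow, hS v hv, one_pow]
  set m := Ideal.span {(z - 1) ^ p} * primeProd S with hm
  set J := Ideal.span {z - 1} * primeProd S with hJ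
  have hm0 : m ≠ ⊥ := mul_ne_zero (by
    rw [Ne, Ideal.zero_eq_bot, Ideal.span_singleton_eq_bot]; exact pow_ne_zero _ hl0)
    (primeProd_ne_bot S)
  have hmf := hfin m hm0
  have hmJ : m ≤ J := by rw [hI]; exact Ideal.mul_le_right
  have hK := card_ker_factor_eq hJ0 hI hmJ
  refine ⟨hmf, ?_⟩
  set T := (powMonoidHom p : (𝓞 F ⧸ m)ˣ →* (𝓞 F ⧸ m)ˣ).ker with hT
  choose e he using fun q : T => Ideal.Quotient.mk_surjective (I := m) ((q : (𝓞 F ⧸ m)ˣ) : 𝓞 F ⧸ m)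
  have h1 : ∀ (q : T) (v : S), ∃ ξ : Polynomial.nthRootsFinset p (1 : 𝓞 F),
      v.1.valuation F (algebraMap (𝓞 F) F (e q - ξ)) <
        v.1.valuation F (algebraMap (𝓞 F) F (z - 1)) := by
    intro q v
    by_contra! hcon
    have h2 : e q ^ p - 1 ∈ m := by
      rw [← Ideal.Quotient.eq_zero_iff_mem, map_sub, map_pow, he, map_one, sub_eq_zero,
        ← Units.val_pow_eq_pow_val]
      have h : (q : (𝓞 F ⧸ m)ˣ) ^ p = 1 := q.2
      rw [h, Units.val_one]
    have h3 := (mem_span_mul_primeProd (pow_ne_zero p hl0) hSp).mp h2 v v.2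
    have h4 := hz.pow_sub_pow_eq_prod_sub_mul (e q) 1 hp.out.pos
    rw [one_pow] at h4
    rw [h4, _root_.map_prod, _root_.map_prod, map_pow, map_pow] at h3
    refine h3.not_ge ?_
    calc _ = ∏ _ξ ∈ Polynomial.nthRootsFinset p (1 : 𝓞 F),
          v.1.valuation F (algebraMap (𝓞 F) F (z - 1)) := by
          rw [Finset.prod_const, hz.card_nthRootsFinset]
      _ ≤ _ := Finset.prod_le_prod' fun ξ hξ => by
          rw [mul_one]
          exact hcon ⟨ξ, hξ⟩
  choose Φ hΦ using h1
  let r : (S → Polynomial.nthRootsFinset p (1 : 𝓞 F)) → T := fun f =>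
    if h : ∃ q, Φ q = f then h.choose else 1
  have hr : ∀ q, Φ (r (Φ q)) = Φ q := by
    intro q
    have h : ∃ q', Φ q' = Φ q := ⟨q, rfl⟩
    simp only [r, dif_pos h]
    exact h.choose_spec
  set K := (Ideal.Quotient.factor hmJ).toAddMonoidHom.ker with hKd
  have hker : ∀ q : T, (((q : (𝓞 F ⧸ m)ˣ) : 𝓞 F ⧸ m) - ((r (Φ q) : (𝓞 F ⧸ m)ˣ) : 𝓞 F ⧸ m)) ∈ K := by
    intro q
    rw [← he, ← he, ← map_sub]
    change Ideal.Quotient.factor hmJ (Ideal.Quotient.mk m (e q - e (r (Φ q)))) = 0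
    rw [Ideal.Quotient.factor_mk, Ideal.Quotient.eq_zero_iff_mem, mem_span_mul_primeProd hl0 hS]
    intro v hv
    have h5 := hΦ q ⟨v, hv⟩
    have h6 := hΦ (r (Φ q)) ⟨v, hv⟩
    rw [hr] at h6
    rw [← sub_sub_sub_cancel_right _ _ ((Φ q ⟨v, hv⟩ : 𝓞 F)), _root_.map_sub (algebraMap (𝓞 F) F)]
    exact Valuation.map_sub_lt _ h5 h6
  let Ψ : T → (S → Polynomial.nthRootsFinset p (1 : 𝓞 F)) × K := fun q => (Φ q, ⟨_, hker q⟩)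
  have hΨ : Function.Injective Ψ := by
    intro q q' h
    have h7 : Φ q = Φ q' := congrArg Prod.fst h
    have h8 := congrArg (fun t => (t.2 : 𝓞 F ⧸ m)) h
    simp only [Ψ, h7] at h8
    exact Subtype.ext (Units.ext (sub_left_injective h8))
  have hcard := Nat.card_le_card_of_injective Ψ hΨ
  refine hcard.trans ?_
  rw [Nat.card_prod, Nat.card_fun, pow_add]
  have h9 : Nat.card (Polynomial.nthRootsFinset p (1 : 𝓞 F)) = p := by
    rw [Nat.card_eq_fintype_card, Fintype.card_coe, hz.card_nthRootsFinset]
  have h10 : Nat.card S = S.card := by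
    rw [Nat.card_eq_fintype_card, Fintype.card_coe]
  rw [h9, h10]
  exact Nat.mul_le_mul_left _ (hK.trans_le (absNorm_sub_one_pow_le hz))
end torsion

section localIndex
variable {F : Type*} [Field F] [NumberField F] {p : ℕ} [hp : Fact p.Prime] {ζ : F}

theorem isUnit_mk_of_valuation_eq_one {S : Finset (HeightOneSpectrum (𝓞 F))} {d a : 𝓞 F}
    (hd : d ≠ 0) (hS : ∀ v ∉ S, v.valuation F (algebraMap (𝓞 F) F d) = 1)
    (ha : ∀ v ∈ S, v.valuation F (algebraMap (𝓞 F) F a) = 1) :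
    IsUnit (Ideal.Quotient.mk (Ideal.span {d} * primeProd S) a) := by
  have h1 : Ideal.span {a} ⊔ Ideal.span {d} * primeProd S = ⊤ := by
    by_contra hne
    obtain ⟨M, hM, hle⟩ := Ideal.exists_le_maximal _ hne
    have hmM : Ideal.span {d} * primeProd S ≤ M := le_sup_right.trans hle
    have haM : a ∈ M := hle (Ideal.mem_sup_left (Ideal.mem_span_singleton_self a))
    have hM0 : M ≠ ⊥ := by
      rintro rfl
      have h2 : Ideal.span {d} * primeProd S = 0 := le_bot_iff.mp hmM
      rcases mul_eq_zero.mp h2 with h | h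
      · exact hd (Ideal.span_singleton_eq_bot.mp h)
      · exact primeProd_ne_bot S h
    let w : HeightOneSpectrum (𝓞 F) := ⟨M, hM.isPrime, hM0⟩
    by_cases hw : w ∈ S
    · exact ((HeightOneSpectrum.valuation_lt_one_iff_mem (K := F) w a).mpr haM).ne (ha w hw)
    · rcases hM.isPrime.mul_le.mp hmM with h | h
      · exact ((HeightOneSpectrum.valuation_lt_one_iff_mem (K := F) w d).mpr
          ((Ideal.span_singleton_le_iff_mem _).mp h)).ne (hS w hw)
      · obtain ⟨v, hv, hvM⟩ := (Ideal.IsPrime.prod_le hM.isPrime).mp h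
        have h3 : v.asIdeal = M := v.isMaximal.eq_of_le hM.ne_top hvM
        exact hw ((HeightOneSpectrum.ext h3 : v = w) ▸ hv)
  obtain ⟨x, hx, y, hy, hxy⟩ := Submodule.mem_sup.mp
    ((Ideal.eq_top_iff_one _).mp h1)
  obtain ⟨c, rfl⟩ := Ideal.mem_span_singleton'.mp hx
  refine IsUnit.of_mul_eq_one (Ideal.Quotient.mk _ c) ?_
  rw [← map_mul, ← map_one (Ideal.Quotient.mk _), Ideal.Quotient.mk_eq_mk_iff_sub_mem, ← hxy]
  rw [mul_comm c a, sub_add_cancel_left]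
  exact neg_mem hy

theorem relIndex_iInf_locPow_unitsAt (hz : IsPrimitiveRoot ζ p)
    {S : Finset (HeightOneSpectrum (𝓞 F))} (hS : ∀ v ∉ S, v.valuation F (ζ - 1) = 1) :
    (⨅ v ∈ S, locPow p v).relIndex (⨅ v ∈ S, unitsAt (F := F) v) ≠ 0 ∧
    (⨅ v ∈ S, locPow p v).relIndex (⨅ v ∈ S, unitsAt (F := F) v) ≤
      p ^ (S.card + Module.finrank ℚ F) := by
  have : NeZero p := ⟨hp.out.ne_zero⟩
  set z : 𝓞 F := hz.toInteger with hzd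
  have hzO : IsPrimitiveRoot z p := hz.toInteger_isPrimitiveRoot
  have hzF : algebraMap (𝓞 F) F (z - 1) = ζ - 1 := by
    rw [_root_.map_sub (algebraMap (𝓞 F) F), map_one]; rfl
  have hl0 : z - 1 ≠ 0 := sub_ne_zero.mpr (hzO.ne_one hp.out.one_lt)
  have hl0' : ζ - 1 ≠ 0 := sub_ne_zero.mpr (hz.ne_one hp.out.one_lt)
  have hSp : ∀ v ∉ S, v.valuation F (algebraMap (𝓞 F) F ((z - 1) ^ p)) = 1 := fun v hv => by
    rw [map_pow, map_pow, hzF, hS v hv, one_pow]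
  obtain ⟨hmf, hcard⟩ := card_ker_pow_le hzO (S := S) (fun v hv => by rw [hzF, hS v hv])
  set m := Ideal.span {(z - 1) ^ p} * primeProd S with hm
  have hm_iff : ∀ a : 𝓞 F, a ∈ m ↔ ∀ v ∈ S, v.valuation F (algebraMap (𝓞 F) F a) <
      v.valuation F (ζ - 1) ^ p := by
    intro a
    rw [hm, mem_span_mul_primeProd (pow_ne_zero p hl0) hSp]
    simp only [map_pow, hzF]
  have hlv : ∀ v : HeightOneSpectrum (𝓞 F), v.valuation F (ζ - 1) ^ p ≤ 1 := by
    intro v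
    rw [← hzF]
    exact pow_le_one₀ zero_le (v.valuation_le_one _)
  obtain ⟨N, hN⟩ : ∃ N : ℕ, ∀ v ∈ S, exp (-(N : ℤ)) < v.valuation F (ζ - 1) ^ p := by
    have h1 : ∀ v : HeightOneSpectrum (𝓞 F), ∃ m : ℕ,
        exp (-(m : ℤ)) ≤ v.valuation F (ζ - 1) ^ p := fun v => exists_exp_neg_le
      (pow_ne_zero p ((Valuation.ne_zero_iff _).mpr hl0'))
    choose M hM using h1
    refine ⟨S.sup M + 1, fun v hv => lt_of_lt_of_le ?_ (hM v)⟩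
    have := Finset.le_sup (f := M) hv
    rw [exp_lt_exp]; push_cast; omega
  have h2 : ∀ x : (⨅ v ∈ S, unitsAt (F := F) v : Subgroup Fˣ), ∃ a : 𝓞 F,
      (∀ v ∈ S, v.valuation F (algebraMap (𝓞 F) F a - x.1) < v.valuation F (ζ - 1) ^ p) ∧
      (∀ v ∈ S, v.valuation F (algebraMap (𝓞 F) F a) = 1) := by
    intro x
    have hx : ∀ v ∈ S, v.valuation F (x.1 : F) = 1 := by
      have := x.2
      simp only [Subgroup.mem_iInf, mem_unitsAt] at this
      exact this
    obtain ⟨a, ha⟩ := exists_approx_integer S (fun _ => (x.1 : F)) (fun v hv => (hx v hv).le) N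
    have ha' : ∀ v ∈ S, v.valuation F (algebraMap (𝓞 F) F a - x.1) < v.valuation F (ζ - 1) ^ p :=
      fun v hv => (ha v hv).trans_lt (hN v hv)
    refine ⟨a, ha', fun v hv => ?_⟩
    rw [← hx v hv]
    exact Valuation.map_eq_of_sub_lt _ (by rw [hx v hv]; exact (ha' v hv).trans_le (hlv v))
  choose a ha ha1 using h2
  have hu : ∀ x, IsUnit (Ideal.Quotient.mk m (a x)) := fun x =>
    isUnit_mk_of_valuation_eq_one (pow_ne_zero p hl0) hSp (ha1 x)
  choose f hf using hu
  have key := index_le_of_map (A := (⨅ v ∈ S, unitsAt (F := F) v : Subgroup Fˣ))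
    (H := (⨅ v ∈ S, locPow p v).subgroupOf (⨅ v ∈ S, unitsAt (F := F) v))
    (R := (powMonoidHom p : (𝓞 F ⧸ m)ˣ →* _).range) f (by
      rintro x y ⟨e, he⟩
      rw [Subgroup.mem_subgroupOf]
      simp only [Subgroup.mem_iInf]
      intro v hv
      obtain ⟨c, hc⟩ := Ideal.Quotient.mk_surjective (I := m) (e : 𝓞 F ⧸ m)
      have h3 : a x - a y * c ^ p ∈ m := by
        rw [← Ideal.Quotient.eq_zero_iff_mem, map_sub, map_mul, map_pow, hc, ← hf, ← hf, sub_eq_zero,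
          ← Units.val_pow_eq_pow_val, ← Units.val_mul, Units.val_inj]
        rw [powMonoidHom_apply] at he
        rw [he, mul_div_cancel]
      have h4 := (hm_iff _).mp h3 v hv
      rw [_root_.map_sub (algebraMap (𝓞 F) F), _root_.map_mul (algebraMap (𝓞 F) F),
        map_pow (algebraMap (𝓞 F) F)] at h4
      have hx1 : v.valuation F (x.1 : F) = 1 := by
        have := x.2
        simp only [Subgroup.mem_iInf, mem_unitsAt] at this
        exact this v hv
      have hy1 : v.valuation F (y.1 : F) = 1 := by
        have := y.2
        simp only [Subgroup.mem_iInf, mem_unitsAt] at this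
        exact this v hv
      set A := algebraMap (𝓞 F) F (a x) with hA
      set B := algebraMap (𝓞 F) F (a y) with hB
      set C := algebraMap (𝓞 F) F c with hC
      have hC1 : v.valuation F C ≤ 1 := v.valuation_le_one c
      have h5 : v.valuation F ((x.1 : F) - y.1 * C ^ p) < v.valuation F (ζ - 1) ^ p := by
        have e1 : (x.1 : F) - y.1 * C ^ p = -(A - x.1) + (A - B * C ^ p) + (B - y.1) * C ^ p := by
          ring
        rw [e1]
        refine Valuation.map_add_lt _ (Valuation.map_add_lt _ ?_ h4) ?_
        · rw [Valuation.map_neg]; exact ha x v hv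
        · rw [map_mul, map_pow]
          exact (mul_le_of_le_one_right' (pow_le_one₀ zero_le hC1)).trans_lt (ha y v hv)
      have hyC : v.valuation F (y.1 * C ^ p) = 1 := by
        rw [← hx1]
        refine Valuation.map_eq_of_sub_lt _ ?_
        rw [Valuation.map_sub_swap, hx1]
        exact h5.trans_le (hlv v)
      have hC1' : v.valuation F C = 1 := by
        rw [map_mul, map_pow, hy1, one_mul] at hyC
        exact (pow_eq_one_iff_of_nonneg zero_le hp.out.ne_zero).mp hyC
      have hC0 : C ≠ 0 := by
        intro h; rw [h, map_zero] at hC1'; exact zero_ne_one hC1'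
      refine mem_locPow_of_lt hz (y := Units.mk0 C hC0) ?_
      rw [Subgroup.coe_div, Units.val_div_eq_div_val, Units.val_mk0]
      have e2 : (x.1 : F) / y.1 / C ^ p - 1 = (x.1 - y.1 * C ^ p) / (y.1 * C ^ p) := by
        have := y.1.ne_zero
        field_simp
      rw [e2, map_div₀, hyC, div_one]
      exact h5) Subgroup.index_ne_zero_of_finite
  rw [index_range_powMonoidHom] at key
  exact ⟨key.1, key.2.trans hcard⟩

/-- The global count of classes modulo local `p`-th powers. -/
theorem index_iInf_locPow (hz : IsPrimitiveRoot ζ p)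
    {S : Finset (HeightOneSpectrum (𝓞 F))} (hS : ∀ v ∉ S, v.valuation F (ζ - 1) = 1) :
    (⨅ v ∈ S, locPow (F := F) p v).index ≠ 0 ∧
    (⨅ v ∈ S, locPow (F := F) p v).index ≤ p ^ (2 * S.card + Module.finrank ℚ F) := by
  have h1 := index_locPow_sup_unitsAt_le hz S
  have h2 := relIndex_iInf_locPow_unitsAt hz hS
  rw [← relIndex_mul_index_sup _ (⨅ v ∈ S, unitsAt (F := F) v)]
  refine ⟨mul_ne_zero h2.1 h1.1, (Nat.mul_le_mul h2.2 h1.2).trans ?_⟩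
  rw [← pow_add]
  exact (congrArg (p ^ ·) (by ring)).le
end localIndex

end

section

open Polynomial IsLocalRing IsDedekindDomain NumberField WithZero
open scoped Topology DirectSum

section nsmulIndex
theorem index_range_nsmul_congr {A B : Type*} [AddCommGroup A] [AddCommGroup B] (e : A ≃+ B)
    (n : ℕ) : (nsmulAddMonoidHom n : A →+ A).range.index =
      (nsmulAddMonoidHom n : B →+ B).range.index ∧
    Nat.card (nsmulAddMonoidHom n : A →+ A).ker = Nat.card (nsmulAddMonoidHom n : B →+ B).ker := by
  have h1 : (nsmulAddMonoidHom n : B →+ B).range =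
      (nsmulAddMonoidHom n : A →+ A).range.map e.toAddMonoidHom := by
    ext x
    simp only [AddMonoidHom.mem_range, AddSubgroup.mem_map, nsmulAddMonoidHom_apply]
    constructor
    · rintro ⟨y, rfl⟩
      exact ⟨n • e.symm y, ⟨_, rfl⟩, by simp⟩
    · rintro ⟨_, ⟨y, rfl⟩, rfl⟩
      exact ⟨e y, by simp⟩
  refine ⟨?_, ?_⟩
  · rw [h1, AddSubgroup.index_map_of_bijective e.bijective]
  · refine Nat.card_congr (e.toEquiv.subtypeEquiv fun x => ?_)
    simp only [AddMonoidHom.mem_ker, nsmulAddMonoidHom_apply]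
    change _ ↔ n • e x = 0
    rw [← map_nsmul, EmbeddingLike.map_eq_zero_iff]

theorem index_range_nsmul_finite (B : Type*) [AddCommGroup B] [Finite B] (n : ℕ) :
    (nsmulAddMonoidHom n : B →+ B).range.index = Nat.card (nsmulAddMonoidHom n : B →+ B).ker := by
  have h1 := (nsmulAddMonoidHom n : B →+ B).range.card_mul_index
  have h2 := (nsmulAddMonoidHom n : B →+ B).ker.card_mul_index
  rw [AddSubgroup.index_ker, mul_comm] at h2
  exact Nat.eq_of_mul_eq_mul_left Nat.card_pos (h1.trans h2.symm)

theorem index_range_nsmul_free (L : Type*) [AddCommGroup L] [Module.Free ℤ L] [Module.Finite ℤ L]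
    (n : ℕ) [NeZero n] : (nsmulAddMonoidHom n : L →+ L).range.index = n ^ Module.finrank ℤ L := by
  rw [← ModN.natCard_eq L n, AddSubgroup.index]
  have h : (nsmulAddMonoidHom n : L →+ L).range =
      (LinearMap.range (LinearMap.lsmul ℤ L (n : ℤ))).toAddSubgroup := by
    ext x
    simp [AddMonoidHom.mem_range]
  rw [h]
  rfl

theorem finrank_range_add_finrank_ker_int {A B : Type*} [AddCommGroup A] [AddCommGroup B]
    [Module.Finite ℤ A] (f : A →ₗ[ℤ] B) :
    Module.finrank ℤ f.range + Module.finrank ℤ f.ker = Module.finrank ℤ A := by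
  rw [← f.quotKerEquivRange.finrank_eq]
  exact Submodule.finrank_quotient_add_finrank _

theorem finrank_eq_zero_of_finite (B : Type*) [AddCommGroup B] [Finite B] :
    Module.finrank ℤ B = 0 := by
  rw [Module.finrank_eq_zero_iff]
  intro x
  exact ⟨Nat.card B, by exact_mod_cast Nat.card_pos.ne', by
    rw [natCast_zsmul]; exact card_nsmul_eq_zero'⟩

theorem index_range_nsmul (A : Type*) [AddCommGroup A] [Module.Finite ℤ A] (n : ℕ) [NeZero n] :
    (nsmulAddMonoidHom n : A →+ A).range.index =
      n ^ Module.finrank ℤ A * Nat.card (nsmulAddMonoidHom n : A →+ A).ker ∧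
    Finite (nsmulAddMonoidHom n : A →+ A).ker := by
  have : AddGroup.FG A := Module.Finite.iff_addGroup_fg.mp inferInstance
  obtain ⟨r, ι, _, q, hq, k, ⟨e⟩⟩ := AddCommGroup.equiv_free_prod_directSum_zmod A
  have hfin : Finite (⨁ i : ι, ZMod (q i ^ k i)) := by
    classical
    have : ∀ i, NeZero (q i ^ k i) := fun i => ⟨pow_ne_zero _ (hq i).ne_zero⟩
    exact Finite.of_equiv _ (DirectSum.addEquivProd fun i => ZMod (q i ^ k i)).symm.toEquiv
  have hrank : Module.finrank ℤ A = r := by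
    rw [LinearEquiv.finrank_eq e.toIntLinearEquiv]
    have h0 := finrank_range_add_finrank_ker_int
      (LinearMap.fst ℤ (Fin r →₀ ℤ) (⨁ i : ι, ZMod (q i ^ k i)))
    have : Finite (LinearMap.fst ℤ (Fin r →₀ ℤ) (⨁ i : ι, ZMod (q i ^ k i))).ker :=
      Finite.of_injective (fun x => x.1.2) fun x y hxy =>
        Subtype.ext (Prod.ext ((x.2 : x.1.1 = 0).trans (y.2 : y.1.1 = 0).symm) hxy)
    rw [finrank_eq_zero_of_finite (LinearMap.fst ℤ (Fin r →₀ ℤ) (⨁ i : ι, ZMod (q i ^ k i))).ker,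
      LinearMap.range_eq_top.mpr LinearMap.fst_surjective, finrank_top, add_zero,
      Module.finrank_finsupp_self, Fintype.card_fin] at h0
    have : Module.Finite ℤ (⨁ i : ι, ZMod (q i ^ k i)) := Module.Finite.of_finite
    rw [← h0]
  have h1 := index_range_nsmul_congr e n
  have h2 : (nsmulAddMonoidHom n : (Fin r →₀ ℤ) × (⨁ i : ι, ZMod (q i ^ k i)) →+ _) =
    (nsmulAddMonoidHom n : (Fin r →₀ ℤ) →+ _).prodMap (nsmulAddMonoidHom n) := rfl
  have h4 : (nsmulAddMonoidHom n : (Fin r →₀ ℤ) →+ _).ker = ⊥ := by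
    rw [eq_bot_iff]
    intro x hx
    have hx' : n • x = 0 := hx
    exact (smul_eq_zero.mp hx').resolve_left (NeZero.ne n)
  have h5 : Nat.card (nsmulAddMonoidHom n : (Fin r →₀ ℤ) × (⨁ i : ι, ZMod (q i ^ k i)) →+ _).ker =
      Nat.card (nsmulAddMonoidHom n : (⨁ i : ι, ZMod (q i ^ k i)) →+ _).ker := by
    rw [h2, AddMonoidHom.ker_prodMap, h4]
    rw [Nat.card_congr (AddSubgroup.prodEquiv _ _).toEquiv, Nat.card_prod]
    simp
  constructor
  · rw [h1.1, h1.2, h5, h2, AddMonoidHom.range_prodMap, AddSubgroup.index_prod,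
      index_range_nsmul_free, index_range_nsmul_finite, hrank, Module.finrank_finsupp_self,
      Fintype.card_fin]
  · refine (Nat.finite_of_card_ne_zero ?_)
    rw [h1.2, h5]
    exact Nat.card_pos.ne'
end nsmulIndex

section cyclicNorm
theorem exists_sub_one_pow_eq (p : ℕ) [hp : Fact p.Prime] :
    ∃ g : ℤ[X], (X - 1 : ℤ[X]) ^ (p - 1) = ∑ i ∈ Finset.range p, X ^ i + C (p : ℤ) * g := by
  have h1 : (C (p : ℤ) : ℤ[X]) ∣ (X - 1 : ℤ[X]) ^ (p - 1) - ∑ i ∈ Finset.range p, X ^ i := by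
    rw [C_dvd_iff_dvd_coeff]
    intro i
    rw [← ZMod.intCast_zmod_eq_zero_iff_dvd, ← eq_intCast (Int.castRingHom (ZMod p)), ← coeff_map]
    suffices h : ((X - 1 : ℤ[X]) ^ (p - 1) - ∑ i ∈ Finset.range p, X ^ i).map
        (Int.castRingHom (ZMod p)) = 0 by rw [h, coeff_zero]
    have hX : (X - 1 : (ZMod p)[X]) ≠ 0 := by
      rw [← C_1]; exact X_sub_C_ne_zero 1
    apply mul_right_cancel₀ hX
    simp only [Polynomial.map_sub, Polynomial.map_pow, Polynomial.map_sum, map_X, Polynomial.map_one]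
    rw [sub_mul, ← pow_succ, Nat.sub_add_cancel hp.out.one_le, sub_pow_char, geom_sum_mul, one_pow,
      sub_self, zero_mul]
  obtain ⟨g, hg⟩ := h1
  exact ⟨g, by rw [← hg]; ring⟩

variable {M : Type*} [AddCommGroup M] [Module.Finite ℤ M] {p : ℕ} [hp : Fact p.Prime]

theorem index_range_pow_le (δ : Module.End ℤ M) (h0 : (LinearMap.range δ).toAddSubgroup.index ≠ 0)
    (k : ℕ) : (LinearMap.range (δ ^ k)).toAddSubgroup.index ≠ 0 ∧
      (LinearMap.range (δ ^ k)).toAddSubgroup.index ≤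
        (LinearMap.range δ).toAddSubgroup.index ^ k := by
  induction k with
  | zero =>
    have : (LinearMap.range (δ ^ 0)).toAddSubgroup = ⊤ := by
      rw [pow_zero, Module.End.one_eq_id, LinearMap.range_id]; rfl
    exact ⟨by rw [this]; simp, by rw [this]; simp⟩
  | succ k ih =>
    have h1 : (LinearMap.range (δ ^ (k + 1))).toAddSubgroup =
        (LinearMap.range δ).toAddSubgroup.map (δ ^ k).toAddMonoidHom := by
      ext x
      rw [pow_succ]
      simp [AddSubgroup.mem_map]
    have h2 : (LinearMap.range (δ ^ k)).toAddSubgroup =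
        (⊤ : AddSubgroup M).map (δ ^ k).toAddMonoidHom := by
      ext x
      simp [AddSubgroup.mem_map]
    have hle : (LinearMap.range (δ ^ (k + 1))).toAddSubgroup ≤
        (LinearMap.range (δ ^ k)).toAddSubgroup := by
      rw [h1, h2]; exact AddSubgroup.map_mono le_top
    rw [← AddSubgroup.relIndex_mul_index hle]
    have h3 : (LinearMap.range (δ ^ (k + 1))).toAddSubgroup.relIndex
        (LinearMap.range (δ ^ k)).toAddSubgroup ≠ 0 ∧
        (LinearMap.range (δ ^ (k + 1))).toAddSubgroup.relIndex
        (LinearMap.range (δ ^ k)).toAddSubgroup ≤ (LinearMap.range δ).toAddSubgroup.index := by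
      rw [h1, h2, AddSubgroup.relIndex_map_map, top_sup_eq, AddSubgroup.relIndex_top_right]
      have : (LinearMap.range δ).toAddSubgroup.FiniteIndex := ⟨h0⟩
      exact ⟨(AddSubgroup.finiteIndex_of_le le_sup_left).index_ne_zero,
        AddSubgroup.index_antitone le_sup_left⟩
    refine ⟨mul_ne_zero h3.1 ih.1, ?_⟩
    rw [pow_succ, mul_comm]
    exact Nat.mul_le_mul ih.2 h3.2

theorem nsmul_index_ne_zero : (nsmulAddMonoidHom p : M →+ M).range.index ≠ 0 := by
  have : NeZero p := ⟨hp.out.ne_zero⟩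
  have h := index_range_nsmul M p
  have := h.2
  rw [h.1]
  exact mul_ne_zero (pow_ne_zero _ hp.out.ne_zero) Nat.card_pos.ne'

theorem index_range_sub_one_of_norm_eq_zero (τ : Module.End ℤ M)
    (hN : ∑ i ∈ Finset.range p, τ ^ i = 0) :
    (LinearMap.range (τ - 1)).toAddSubgroup.index ≠ 0 ∧
    ∀ m : ℕ, p ^ ((p - 1) * m + 1) ≤ (nsmulAddMonoidHom p : M →+ M).range.index →
      p ^ (m + 1) ≤ (LinearMap.range (τ - 1)).toAddSubgroup.index := by
  have h1 : ∀ x : M, p • x ∈ LinearMap.range (τ - 1) := by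
    intro x
    have h2 : p • x = -∑ i ∈ Finset.range p, (τ ^ i - 1) x := by
      simp only [LinearMap.sub_apply, Finset.sum_sub_distrib, Module.End.one_apply,
        Finset.sum_const, Finset.card_range]
      rw [← LinearMap.sum_apply, hN]
      simp
    rw [h2]
    refine neg_mem (Submodule.sum_mem _ fun i _ => ?_)
    rw [← mul_geom_sum]
    exact ⟨_, rfl⟩
  have hle : (nsmulAddMonoidHom p : M →+ M).range ≤ (LinearMap.range (τ - 1)).toAddSubgroup := by
    rintro _ ⟨x, rfl⟩
    exact h1 x
  have hfi : (nsmulAddMonoidHom p : M →+ M).range.FiniteIndex := ⟨nsmul_index_ne_zero⟩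
  have hfi' := AddSubgroup.finiteIndex_of_le hle
  refine ⟨hfi'.index_ne_zero, fun m hm => ?_⟩
  have h3 : (LinearMap.range ((τ - 1) ^ (p - 1))).toAddSubgroup ≤
      (nsmulAddMonoidHom p : M →+ M).range := by
    obtain ⟨g, hg⟩ := exists_sub_one_pow_eq p
    have h4 := congrArg (aeval τ) hg
    simp only [map_pow, _root_.map_sub, aeval_X, _root_.map_one, _root_.map_add, map_sum,
      _root_.map_mul, aeval_C, hN, zero_add] at h4
    rintro _ ⟨x, rfl⟩
    refine ⟨aeval τ g x, ?_⟩
    rw [h4]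
    simp
  have h5 := index_range_pow_le (τ - 1) hfi'.index_ne_zero (p - 1)
  have h6 : ∃ r, (LinearMap.range (τ - 1)).toAddSubgroup.index = p ^ r := by
    have hf : Finite (M ⧸ (LinearMap.range (τ - 1)).toAddSubgroup) :=
      AddSubgroup.index_ne_zero_iff_finite.mp hfi'.index_ne_zero
    have h7 : IsPGroup p (Multiplicative (M ⧸ (LinearMap.range (τ - 1)).toAddSubgroup)) := by
      intro q
      obtain ⟨x, hx⟩ := QuotientAddGroup.mk_surjective q.toAdd
      refine ⟨1, ?_⟩
      rw [pow_one]
      apply Multiplicative.toAdd.injective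
      rw [toAdd_pow, ← hx, ← QuotientAddGroup.mk_nsmul, toAdd_one, QuotientAddGroup.eq_zero_iff]
      exact h1 x
    have : Finite (Multiplicative (M ⧸ (LinearMap.range (τ - 1)).toAddSubgroup)) := hf
    obtain ⟨r, hr⟩ := IsPGroup.iff_card.mp h7
    exact ⟨r, hr⟩
  obtain ⟨r, hr⟩ := h6
  have h8 : p ^ ((p - 1) * m + 1) ≤ p ^ (r * (p - 1)) := by
    rw [pow_mul, ← hr]
    have : (LinearMap.range ((τ - 1) ^ (p - 1))).toAddSubgroup.FiniteIndex := ⟨h5.1⟩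
    exact hm.trans ((AddSubgroup.index_antitone h3).trans h5.2)
  rw [hr]
  refine Nat.pow_le_pow_right hp.out.pos ?_
  have h9 := (Nat.pow_le_pow_iff_right hp.out.one_lt).mp h8
  by_contra! hlt
  have : r * (p - 1) ≤ m * (p - 1) := Nat.mul_le_mul_right _ (by omega)
  rw [mul_comm m] at this
  omega

/-- The index of norms for a cyclic group of prime order acting on a finitely generated abelian
group with trivial `H^{-1}`. -/
theorem index_norm_le (τ : Module.End ℤ M) (hτ : τ ^ p = 1)
    (H90 : ∀ x, (∑ i ∈ Finset.range p, τ ^ i) x = 0 → ∃ y, τ y - y = x)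
    {z : M} (hz0 : z ≠ 0) (hz : p • z = 0) (hzτ : τ z = z) {s m : ℕ}
    (hU : (nsmulAddMonoidHom p : LinearMap.ker (τ - 1) →+ _).range.index ≤ p ^ s)
    (hr : Module.finrank ℤ (LinearMap.ker (τ - 1)) + (p - 1) * m ≤ Module.finrank ℤ M) :
    (LinearMap.range (∑ i ∈ Finset.range p, τ ^ i)).toAddSubgroup.relIndex
      (LinearMap.ker (τ - 1)).toAddSubgroup ≠ 0 ∧
    (LinearMap.range (∑ i ∈ Finset.range p, τ ^ i)).toAddSubgroup.relIndex
      (LinearMap.ker (τ - 1)).toAddSubgroup * p ^ (m + 1) ≤ p ^ s := by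
  set N := ∑ i ∈ Finset.range p, τ ^ i with hNd
  have hδN : (τ - 1) * N = 0 := by rw [hNd, mul_geom_sum, hτ, sub_self]
  have hNδ : N * (τ - 1) = 0 := by rw [hNd, geom_sum_mul, hτ, sub_self]
  have hτN : τ * N = N * τ := by
    rw [sub_mul, one_mul, sub_eq_zero] at hδN
    rw [mul_sub, mul_one, sub_eq_zero] at hNδ
    rw [hδN, hNδ]
  set U := LinearMap.ker (τ - 1) with hUd
  set D := LinearMap.ker N with hDd
  have hfix : ∀ u ∈ U, τ u = u := fun u hu => sub_eq_zero.mp hu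
  have hNU : ∀ u ∈ U, N u = p • u := by
    intro u hu
    have h1 : ∀ i : ℕ, (τ ^ i) u = u := fun i => by
      induction i with
      | zero => simp
      | succ i ih => rw [pow_succ, Module.End.mul_apply, hfix u hu, ih]
    rw [hNd, LinearMap.sum_apply]
    simp [h1]
  -- the restriction to `D`
  have hstab : ∀ x ∈ D, τ x ∈ D := by
    intro x hx
    have hx' : N x = 0 := hx
    change (N * τ) x = 0
    rw [← hτN, Module.End.mul_apply, hx', map_zero]
  set τD : Module.End ℤ D := τ.restrict hstab with hτD
  have hpow : ∀ (i : ℕ) (x : D), (((τD ^ i) x : D) : M) = (τ ^ i) x := by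
    intro i x
    rw [hτD, Module.End.pow_restrict]
    rfl
  have hND : ∑ i ∈ Finset.range p, τD ^ i = 0 := by
    ext x
    rw [LinearMap.sum_apply]
    simp only [AddSubmonoidClass.coe_finsetSum, hpow, LinearMap.zero_apply, ZeroMemClass.coe_zero]
    have hx : N x = 0 := x.2
    rwa [hNd, LinearMap.sum_apply] at hx
  have hDfin : Module.Finite ℤ D := inferInstance
  have hq := index_range_sub_one_of_norm_eq_zero τD hND
  have hNle : N.range ≤ U := by
    rintro _ ⟨x, rfl⟩
    exact LinearMap.congr_fun hδN x
  have hrD : (p - 1) * m ≤ Module.finrank ℤ D := by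
    have h1 := finrank_range_add_finrank_ker_int N
    have h2 : Module.finrank ℤ N.range ≤ Module.finrank ℤ U := Submodule.finrank_mono hNle
    rw [← hDd] at h1
    omega
  have hzD : z ∈ D := by
    change N z = 0
    rw [hNU z (by rw [hUd, LinearMap.mem_ker, LinearMap.sub_apply, hzτ, Module.End.one_apply,
      sub_self]), hz]
  have hindD : p ^ ((p - 1) * m + 1) ≤ (nsmulAddMonoidHom p : D →+ D).range.index := by
    have : NeZero p := ⟨hp.out.ne_zero⟩
    have h1 := index_range_nsmul D p
    have := h1.2
    rw [h1.1, pow_succ]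
    refine Nat.mul_le_mul (Nat.pow_le_pow_right hp.out.pos hrD) ?_
    have hcard : Nat.card (AddSubgroup.zmultiples z) = p := by
      rw [Nat.card_zmultiples]
      exact addOrderOf_eq_prime hz hz0
    refine hcard.symm.le.trans ?_
    refine Nat.card_le_card_of_injective (fun x : AddSubgroup.zmultiples z =>
      (⟨⟨x.1, ?_⟩, ?_⟩ : (nsmulAddMonoidHom p : D →+ D).ker)) ?_
    · exact (AddSubgroup.zmultiples_le_of_mem (H := D.toAddSubgroup) hzD) x.2
    · obtain ⟨_, ⟨k, rfl⟩⟩ := x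
      rw [AddMonoidHom.mem_ker, nsmulAddMonoidHom_apply]
      apply Subtype.ext
      change p • (k • z) = 0
      rw [smul_comm, hz, smul_zero]
    · intro x y hxy
      exact Subtype.ext (congrArg (fun t => ((t.1 : D) : M)) hxy)
  have hq2 := hq.2 m hindD
  -- transfer to indices in `M`
  set E : AddSubgroup M := D.toAddSubgroup.map (τ - 1).toAddMonoidHom with hE
  set P : AddSubgroup M := U.toAddSubgroup.map (nsmulAddMonoidHom p) with hP
  have hE1 : (LinearMap.range (τD - 1)).toAddSubgroup.index = E.relIndex D.toAddSubgroup := by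
    have : (LinearMap.range (τD - 1)).toAddSubgroup = E.addSubgroupOf D.toAddSubgroup := by
      ext x
      rw [AddSubgroup.mem_addSubgroupOf]
      constructor
      · rintro ⟨y, rfl⟩
        exact ⟨y, y.2, rfl⟩
      · rintro ⟨y, hy, hyx⟩
        exact ⟨⟨y, hy⟩, Subtype.ext hyx⟩
    rw [this]; rfl
  have hD1 : D.toAddSubgroup = (⊤ : AddSubgroup M).map (τ - 1).toAddMonoidHom := by
    ext x
    constructor
    · intro hx
      obtain ⟨y, hy⟩ := H90 x hx
      exact ⟨y, trivial, hy⟩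
    · rintro ⟨y, -, rfl⟩
      exact LinearMap.congr_fun hNδ y
  have hN1 : N.range.toAddSubgroup = (⊤ : AddSubgroup M).map N.toAddMonoidHom := by
    ext x
    simp [AddSubgroup.mem_map]
  have hP1 : P.relIndex U.toAddSubgroup = (nsmulAddMonoidHom p : U →+ U).range.index := by
    have : (nsmulAddMonoidHom p : U →+ U).range = P.addSubgroupOf U.toAddSubgroup := by
      ext x
      rw [AddSubgroup.mem_addSubgroupOf]
      constructor
      · rintro ⟨y, rfl⟩
        exact ⟨y, y.2, rfl⟩
      · rintro ⟨y, hy, hyx⟩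
        exact ⟨⟨y, hy⟩, Subtype.ext hyx⟩
    rw [this]; rfl
  have hPN : P ≤ N.range.toAddSubgroup := by
    rintro _ ⟨u, hu, rfl⟩
    exact ⟨u, hNU u hu⟩
  have hNU' : N.range.toAddSubgroup ≤ U.toAddSubgroup := hNle
  have hmul := AddSubgroup.relIndex_mul_relIndex P _ _ hPN hNU'
  have hPU0 : P.relIndex U.toAddSubgroup ≠ 0 := by
    rw [hP1]; exact nsmul_index_ne_zero
  have hne := mul_ne_zero_iff.mp (hmul.trans_ne hPU0)
  have hcomap : P.comap N.toAddMonoidHom ≤ E.comap (τ - 1).toAddMonoidHom := by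
    rintro x ⟨u, hu, hux⟩
    have hux' : p • u = N x := hux
    refine ⟨x - u, ?_, ?_⟩
    · change N (x - u) = 0
      rw [map_sub, hNU u hu, hux', sub_self]
    · change (τ - 1) (x - u) = (τ - 1) x
      have : (τ - 1) u = 0 := hu
      rw [map_sub, this, sub_zero]
  have hkey : E.relIndex D.toAddSubgroup ≤ P.relIndex N.range.toAddSubgroup := by
    have h1 := hne.1
    rw [hN1, ← AddSubgroup.relIndex_comap, AddSubgroup.relIndex_top_right] at h1 ⊢
    rw [hD1, ← AddSubgroup.relIndex_comap, AddSubgroup.relIndex_top_right]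
    have : (P.comap N.toAddMonoidHom).FiniteIndex := ⟨h1⟩
    exact AddSubgroup.index_antitone hcomap
  refine ⟨hne.2, ?_⟩
  calc _ ≤ N.range.toAddSubgroup.relIndex U.toAddSubgroup * P.relIndex N.range.toAddSubgroup :=
        Nat.mul_le_mul_left _ ((hq2.trans_eq hE1).trans hkey)
    _ = P.relIndex U.toAddSubgroup := by rw [mul_comm, hmul]
    _ ≤ p ^ s := by rw [hP1]; exact hU
end cyclicNorm

section sUnits
variable {F : Type*} [Field F] [NumberField F]

/-- The group of `S`-units. -/
def sUnits (S : Finset (HeightOneSpectrum (𝓞 F))) : Subgroup Fˣ where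
  carrier := {x | ∀ v ∉ S, v.valuation F x = 1}
  mul_mem' := fun {x y} hx hy v hv => by
    rw [Units.val_mul, map_mul, hx v hv, hy v hv, one_mul]
  one_mem' := fun v _ => by rw [Units.val_one, map_one]
  inv_mem' := fun {x} hx v hv => by
    rw [Units.val_inv_eq_inv_val, map_inv₀, hx v hv, inv_one]

theorem mem_sUnits {S : Finset (HeightOneSpectrum (𝓞 F))} {x : Fˣ} :
    x ∈ sUnits S ↔ ∀ v ∉ S, v.valuation F x = 1 := Iff.rfl

theorem sUnits_mono {S T : Finset (HeightOneSpectrum (𝓞 F))} (h : S ⊆ T) :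
    sUnits S ≤ sUnits T := fun _ hx v hv => hx v fun hvS => hv (h hvS)

theorem mem_sUnits_of_pow_mem {S : Finset (HeightOneSpectrum (𝓞 F))} {x : Fˣ} {n : ℕ} (hn : n ≠ 0)
    (h : x ^ n ∈ sUnits S) : x ∈ sUnits S := fun v hv => by
  have h1 := h v hv
  rw [Units.val_pow_eq_pow_val, map_pow] at h1
  exact (pow_eq_one_iff_of_nonneg zero_le hn).mp h1

/-- The valuations in `S` of an `S`-unit. -/
noncomputable def sUnitsVal (S : Finset (HeightOneSpectrum (𝓞 F))) :
    Additive (sUnits S) →ₗ[ℤ] (S → ℤ) :=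
  AddMonoidHom.toIntLinearMap
    { toFun := fun x v => (v.1.valuationOfNeZero (x.toMul : Fˣ)).toAdd
      map_zero' := by ext v; simp
      map_add' := fun x y => by ext v; simp }

theorem sUnitsVal_eq_zero_iff {S : Finset (HeightOneSpectrum (𝓞 F))} {x : Additive (sUnits S)}
    {v : S} : sUnitsVal S x v = 0 ↔ v.1.valuation F (x.toMul : Fˣ) = 1 := by
  rw [← mem_unitsAt, unitsAt, MonoidHom.mem_ker]
  exact toAdd_eq_zero

theorem exists_valuation_lt_one_only (v : HeightOneSpectrum (𝓞 F)) :
    ∃ f : Fˣ, v.valuation F f < 1 ∧ ∀ w, w ≠ v → w.valuation F f = 1 := by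
  have hv0 : v.asIdeal ∈ nonZeroDivisors (Ideal (𝓞 F)) :=
    mem_nonZeroDivisors_of_ne_zero v.ne_bot
  set n := Fintype.card (ClassGroup (𝓞 F)) with hn
  have hn0 : n ≠ 0 := Fintype.card_ne_zero
  have h1 : ClassGroup.mk0 (⟨v.asIdeal, hv0⟩ ^ n : nonZeroDivisors (Ideal (𝓞 F))) = 1 := by
    rw [_root_.map_pow]
    exact pow_card_eq_one
  have h2 : (v.asIdeal ^ n).IsPrincipal := by
    refine (ClassGroup.mk0_eq_one_iff (pow_mem hv0 n)).mp ?_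
    exact h1
  obtain ⟨f, hf⟩ := h2
  change v.asIdeal ^ n = Ideal.span {f} at hf
  have hf0 : f ≠ 0 := by
    rintro rfl
    rw [Ideal.span_singleton_eq_bot.mpr rfl] at hf
    exact pow_ne_zero n v.ne_bot hf
  have hf0' : algebraMap (𝓞 F) F f ≠ 0 := by simpa using hf0
  refine ⟨Units.mk0 _ hf0', ?_, fun w hw => ?_⟩
  · rw [Units.val_mk0, HeightOneSpectrum.valuation_lt_one_iff_mem]
    exact Ideal.pow_le_self hn0 (hf ▸ Ideal.mem_span_singleton_self f)
  · rw [Units.val_mk0]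
    refine le_antisymm (w.valuation_le_one f) (not_lt.mp fun hlt => hw ?_)
    rw [HeightOneSpectrum.valuation_lt_one_iff_mem] at hlt
    have h3 : v.asIdeal ^ n ≤ w.asIdeal := by
      rw [hf]; exact (Ideal.span_singleton_le_iff_mem _).mpr hlt
    have h4 : v.asIdeal ≤ w.asIdeal := w.isPrime.le_of_pow_le h3
    exact HeightOneSpectrum.ext (v.isMaximal.eq_of_le w.isPrime.ne_top h4).symm

theorem finrank_range_sUnitsVal (S : Finset (HeightOneSpectrum (𝓞 F))) :
    Module.finrank ℤ (sUnitsVal S).range = S.card := by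
  classical
  apply le_antisymm
  · have := Submodule.finrank_le (sUnitsVal S).range
    rwa [Module.finrank_fintype_fun_eq_card, Fintype.card_coe] at this
  · have h1 : ∀ v : S, ∃ f : Additive (sUnits S), sUnitsVal S f v ≠ 0 ∧
        ∀ w, w ≠ v → sUnitsVal S f w = 0 := by
      intro v
      obtain ⟨f, hf1, hf2⟩ := exists_valuation_lt_one_only v.1
      refine ⟨Additive.ofMul ⟨f, fun w hw => hf2 w fun h => hw (h ▸ v.2)⟩, ?_, fun w hw => ?_⟩
      · rw [Ne, sUnitsVal_eq_zero_iff]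
        exact hf1.ne
      · rw [sUnitsVal_eq_zero_iff]
        exact hf2 w fun h => hw (Subtype.ext h)
    choose f hf1 hf2 using h1
    have hli : LinearIndependent ℤ (fun v : S => (⟨sUnitsVal S (f v), ⟨_, rfl⟩⟩ :
        (sUnitsVal S).range)) := by
      refine LinearIndependent.of_comp (sUnitsVal S).range.subtype ?_
      rw [Fintype.linearIndependent_iff]
      intro g hg v
      have h2 := congrFun hg v
      rw [Finset.sum_apply, Finset.sum_eq_single v] at h2
      · exact (mul_eq_zero.mp h2).resolve_right (hf1 v)
      · intro w _ hw
        change g w * sUnitsVal S (f w) v = 0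
        rw [hf2 w v hw.symm, mul_zero]
      · simp
    have := hli.fintype_card_le_finrank
    rwa [Fintype.card_coe] at this

/-- The inclusion of the units into the `S`-units. -/
noncomputable def unitsToSUnits (S : Finset (HeightOneSpectrum (𝓞 F))) :
    Additive (𝓞 F)ˣ →ₗ[ℤ] Additive (sUnits S) :=
  AddMonoidHom.toIntLinearMap <| MonoidHom.toAdditive <|
    (Units.map (algebraMap (𝓞 F) F).toMonoidHom).codRestrict (sUnits S) fun x v _ => by
      refine le_antisymm (v.valuation_le_one _) ?_
      have h1 := v.valuation_le_one (K := F) ((x⁻¹ : (𝓞 F)ˣ) : 𝓞 F)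
      have h2 : v.valuation F (algebraMap (𝓞 F) F x) *
          v.valuation F (algebraMap (𝓞 F) F ((x⁻¹ : (𝓞 F)ˣ) : 𝓞 F)) = 1 := by
        rw [← _root_.map_mul, ← _root_.map_mul, Units.mul_inv, _root_.map_one, _root_.map_one]
      rw [← h2]
      exact mul_le_of_le_one_right' h1

theorem unitsToSUnits_injective (S : Finset (HeightOneSpectrum (𝓞 F))) :
    Function.Injective (unitsToSUnits S) := by
  intro x y h
  have h1 : algebraMap (𝓞 F) F (x.toMul : (𝓞 F)ˣ) = algebraMap (𝓞 F) F (y.toMul : (𝓞 F)ˣ) :=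
    congrArg (fun t : Additive (sUnits S) => ((t.toMul : Fˣ) : F)) h
  exact Additive.toMul.injective (Units.ext (FaithfulSMul.algebraMap_injective (𝓞 F) F h1))

theorem exists_unit_of_forall_valuation_eq_one (y : Fˣ)
    (h1 : ∀ v : HeightOneSpectrum (𝓞 F), v.valuation F (y : F) = 1) :
    ∃ u : (𝓞 F)ˣ, algebraMap (𝓞 F) F u = y := by
  obtain ⟨a, ha⟩ := HeightOneSpectrum.mem_integers_of_valuation_le_one F (y : F)
    fun v => (h1 v).le
  obtain ⟨b, hb⟩ := HeightOneSpectrum.mem_integers_of_valuation_le_one F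
    ((y : F)⁻¹) fun v => by rw [map_inv₀, h1 v, inv_one]
  have hab : a * b = 1 := FaithfulSMul.algebraMap_injective (𝓞 F) F (by
    rw [_root_.map_mul, ha, hb, mul_inv_cancel₀ y.ne_zero, _root_.map_one])
  exact ⟨Units.mkOfMulEqOne a b hab, ha⟩

theorem range_unitsToSUnits (S : Finset (HeightOneSpectrum (𝓞 F))) :
    (unitsToSUnits S).range = (sUnitsVal S).ker := by
  ext x
  constructor
  · rintro ⟨y, rfl⟩
    rw [LinearMap.mem_ker]
    ext v
    rw [Pi.zero_apply, sUnitsVal_eq_zero_iff]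
    have h : ∀ z : (𝓞 F)ˣ, v.1.valuation F (algebraMap (𝓞 F) F z) = 1 := fun z =>
      ((unitsToSUnits (F := F) ∅ (Additive.ofMul z)).toMul).2 v.1 (Finset.notMem_empty _)
    exact h y.toMul
  · intro hx
    obtain ⟨⟨y, hy⟩, rfl⟩ := Additive.ofMul.surjective x
    have hx0 : ∀ v : S, v.1.valuation F (y : F) = 1 := fun v => by
      have h2 : sUnitsVal S (Additive.ofMul ⟨y, hy⟩) v = 0 := by
        rw [LinearMap.mem_ker.mp hx, Pi.zero_apply]
      exact sUnitsVal_eq_zero_iff.mp h2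
    have h1 : ∀ v : HeightOneSpectrum (𝓞 F), v.valuation F (y : F) = 1 := by
      intro v
      by_cases hv : v ∈ S
      · exact hx0 ⟨v, hv⟩
      · exact mem_sUnits.mp hy v hv
    obtain ⟨u, hu⟩ := exists_unit_of_forall_valuation_eq_one _ h1
    refine ⟨Additive.ofMul u, ?_⟩
    apply Additive.toMul.injective
    apply Subtype.ext
    apply Units.ext
    exact hu

instance sUnits_moduleFinite (S : Finset (HeightOneSpectrum (𝓞 F))) :
    Module.Finite ℤ (Additive (sUnits S)) := by
  refine ⟨Submodule.fg_of_fg_map_of_fg_inf_ker (sUnitsVal S) ?_ ?_⟩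
  · exact IsNoetherian.noetherian _
  · rw [top_inf_eq, ← range_unitsToSUnits]
    rw [LinearMap.range_eq_map]
    exact Module.Finite.fg_top.map _

theorem finrank_sUnits (S : Finset (HeightOneSpectrum (𝓞 F))) :
    Module.finrank ℤ (Additive (sUnits S)) + 1 = S.card + Fintype.card (InfinitePlace F) := by
  rw [← finrank_range_add_finrank_ker_int (sUnitsVal S), finrank_range_sUnitsVal,
    ← range_unitsToSUnits, LinearMap.finrank_range_of_inj (unitsToSUnits_injective S),
    Units.finrank_eq, Units.rank]
  have : 0 < Fintype.card (InfinitePlace F) := Fintype.card_pos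
  omega

theorem card_ker_nsmul_sUnits {p : ℕ} [hp : Fact p.Prime] {ζ : F} (hζ : IsPrimitiveRoot ζ p)
    (S : Finset (HeightOneSpectrum (𝓞 F))) :
    Nat.card (nsmulAddMonoidHom p : Additive (sUnits S) →+ _).ker = p := by
  have : NeZero p := ⟨hp.out.ne_zero⟩
  have h1 : Nat.card (rootsOfUnity p F) = p := by
    exact hζ.card_rootsOfUnity
  refine Eq.trans (Nat.card_congr ⟨?_, ?_, ?_, ?_⟩) h1
  · refine fun x => ⟨((x.1.toMul : sUnits S) : Fˣ), ?_⟩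
    have h2 : p • x.1 = 0 := x.2
    exact congrArg (fun t : Additive (sUnits S) => ((t.toMul : sUnits S) : Fˣ)) h2
  · refine fun y => ⟨Additive.ofMul ⟨y.1, mem_sUnits_of_pow_mem (n := p) hp.out.ne_zero
        ((show y.1 ^ p = 1 from y.2) ▸ one_mem _)⟩, ?_⟩
    have h2 : y.1 ^ p = 1 := y.2
    apply Additive.toMul.injective
    apply Subtype.ext
    exact h2
  · exact fun x => rfl
  · exact fun y => rfl

theorem index_range_nsmul_sUnits {p : ℕ} [hp : Fact p.Prime] {ζ : F} (hζ : IsPrimitiveRoot ζ p)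
    (S : Finset (HeightOneSpectrum (𝓞 F))) :
    (nsmulAddMonoidHom p : Additive (sUnits S) →+ _).range.index =
      p ^ (S.card + Fintype.card (InfinitePlace F)) := by
  have : NeZero p := ⟨hp.out.ne_zero⟩
  rw [(index_range_nsmul _ p).1, card_ker_nsmul_sUnits hζ, ← finrank_sUnits, pow_succ]
end sUnits

end

section

open Polynomial IsLocalRing IsDedekindDomain NumberField WithZero
open scoped Topology

section principal
variable {F : Type*} [Field F] [NumberField F]

/-- Away from `S`, every fractional ideal (given by a family of generators) is principal. -/
def IsPrincipalAway (S : Finset (HeightOneSpectrum (𝓞 F))) : Prop :=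
  ∀ (c : ℕ → F) (n : ℕ), (∃ i < n, c i ≠ 0) → ∃ f : Fˣ, ∀ v ∉ S,
    (∀ i < n, v.valuation F (c i) ≤ v.valuation F f) ∧
      ∃ i < n, v.valuation F (c i) = v.valuation F f

theorem IsPrincipalAway.mono {S T : Finset (HeightOneSpectrum (𝓞 F))} (hS : IsPrincipalAway S)
    (h : S ⊆ T) : IsPrincipalAway T := fun c n hc => by
  obtain ⟨f, hf⟩ := hS c n hc
  exact ⟨f, fun v hv => hf v fun hvS => hv (h hvS)⟩

variable (F) in
theorem exists_isPrincipalAway : ∃ S : Finset (HeightOneSpectrum (𝓞 F)), IsPrincipalAway S := by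
  classical
  choose J hJ using ClassGroup.mk0_surjective (R := 𝓞 F)
  have hfin : ∀ κ, {v : HeightOneSpectrum (𝓞 F) | v.asIdeal ∣ (J κ : Ideal (𝓞 F))}.Finite :=
    fun κ => Ideal.finite_factors (nonZeroDivisors.ne_zero (J κ).2)
  refine ⟨Finset.univ.biUnion fun κ => (hfin κ).toFinset, fun c n hc => ?_⟩
  obtain ⟨d, hd⟩ := IsLocalization.exist_integer_multiples (nonZeroDivisors (𝓞 F))
    (Finset.range n) c
  have hd0 : algebraMap (𝓞 F) F d ≠ 0 := by
    simp
  have hd' : ∀ i, ∃ a : 𝓞 F, i < n → algebraMap (𝓞 F) F a = algebraMap (𝓞 F) F d * c i := by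
    intro i
    by_cases hi : i < n
    · obtain ⟨a, ha⟩ := hd i (Finset.mem_range.mpr hi)
      exact ⟨a, fun _ => by rw [ha, Algebra.smul_def]⟩
    · exact ⟨0, fun h => absurd h hi⟩
  choose a ha using hd'
  set I : Ideal (𝓞 F) := Ideal.span (a '' {i | i < n}) with hI
  have haI : ∀ i < n, a i ∈ I := fun i hi => Ideal.subset_span ⟨i, hi, rfl⟩
  have hI0 : I ≠ 0 := by
    obtain ⟨i, hi, hci⟩ := hc
    intro h0
    have h1 : a i = 0 := by
      have := haI i hi
      rwa [h0] at this
    have h2 := ha i hi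
    rw [h1, _root_.map_zero] at h2
    exact mul_ne_zero hd0 hci h2.symm
  have hIm := mem_nonZeroDivisors_of_ne_zero hI0
  set κ := ClassGroup.mk0 (⟨I, hIm⟩ : nonZeroDivisors (Ideal (𝓞 F)))
  obtain ⟨x, y, hx, hy, hxy⟩ := ClassGroup.mk0_eq_mk0_iff.mp (hJ κ).symm
  change Ideal.span {x} * I = Ideal.span {y} * (J κ : Ideal (𝓞 F)) at hxy
  have hx' : algebraMap (𝓞 F) F x ≠ 0 := by simpa using hx
  have hy' : algebraMap (𝓞 F) F y ≠ 0 := by simpa using hy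
  have hj : ∀ i, ∃ j : 𝓞 F, i < n → j ∈ (J κ : Ideal (𝓞 F)) ∧ x * a i = y * j := by
    intro i
    by_cases hi : i < n
    · have : x * a i ∈ Ideal.span {y} * (J κ : Ideal (𝓞 F)) :=
        hxy ▸ Ideal.mul_mem_mul (Ideal.mem_span_singleton_self x) (haI i hi)
      obtain ⟨j, hjm, hj⟩ := Ideal.mem_span_singleton_mul.mp this
      exact ⟨j, fun _ => ⟨hjm, hj.symm⟩⟩
    · exact ⟨0, fun h => absurd h hi⟩
  choose j hjm using hj
  have hcj : ∀ i < n, c i = algebraMap (𝓞 F) F y / (algebraMap (𝓞 F) F x *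
      algebraMap (𝓞 F) F d) * algebraMap (𝓞 F) F (j i) := by
    intro i hi
    have h1 := congrArg (algebraMap (𝓞 F) F) (hjm i hi).2
    rw [_root_.map_mul, _root_.map_mul, ha i hi] at h1
    field_simp
    linear_combination h1
  refine ⟨Units.mk0 _ (div_ne_zero hy' (mul_ne_zero hx' hd0)), fun v hv => ⟨fun i hi => ?_, ?_⟩⟩
  · rw [hcj i hi, _root_.map_mul, Units.val_mk0]
    exact mul_le_of_le_one_right' (v.valuation_le_one _)
  · by_contra! hne
    refine hv (Finset.mem_biUnion.mpr ⟨κ, Finset.mem_univ _, ?_⟩)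
    rw [Set.Finite.mem_toFinset]
    have h1 : ∀ i < n, j i ∈ v.asIdeal := by
      intro i hi
      rw [← HeightOneSpectrum.valuation_lt_one_iff_mem (K := F)]
      refine lt_of_le_of_ne (v.valuation_le_one _) fun h => hne i hi ?_
      rw [hcj i hi, _root_.map_mul, h, mul_one, Units.val_mk0]
    have h2 : Ideal.span {x} * I ≤ Ideal.span {y} * v.asIdeal := by
      rw [hI, Ideal.span_mul_span', Ideal.span_le]
      rintro _ ⟨_, hx1, _, ⟨i, hi, rfl⟩, rfl⟩
      rw [Set.mem_singleton_iff.mp hx1]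
      change x * a i ∈ _
      rw [(hjm i hi).2]
      exact Ideal.mul_mem_mul (Ideal.mem_span_singleton_self y) (h1 i hi)
    rw [hxy] at h2
    exact Ideal.dvd_iff_le.mpr ((Ideal.span_singleton_mul_right_mono hy).mp h2)

/-- A uniformizer at `v` that is a unit outside `S ∪ {v}`. -/
theorem IsPrincipalAway.exists_uniformizer {S : Finset (HeightOneSpectrum (𝓞 F))}
    (hS : IsPrincipalAway S) {v : HeightOneSpectrum (𝓞 F)} (hv : v ∉ S) :
    ∃ f : Fˣ, v.valuation F f = exp (-1 : ℤ) ∧ ∀ w ∉ S, w ≠ v → w.valuation F f = 1 := by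
  obtain ⟨π, hπ⟩ := v.intValuation_exists_uniformizer
  obtain ⟨b, hb1, hb2⟩ := exists_valuation_lt_one_only v
  have hπv : v.valuation F (algebraMap (𝓞 F) F π) = exp (-1 : ℤ) := by
    rw [HeightOneSpectrum.valuation_of_algebraMap, hπ]
  have hbv : v.valuation F (b : F) ≤ exp (-1 : ℤ) := by
    exact lt_one_iff_le_exp.mp hb1
  obtain ⟨f, hf⟩ := hS (fun i => if i = 0 then algebraMap (𝓞 F) F π else b) 2
    ⟨1, one_lt_two, by simp⟩
  refine ⟨f, ?_, fun w hw hwv => ?_⟩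
  · obtain ⟨h1, i, hi, h2⟩ := hf v hv
    refine le_antisymm ?_ ?_
    · rw [← h2]
      split_ifs
      · exact hπv.le
      · exact hbv
    · rw [← hπv]
      simpa using h1 0 two_pos
  · obtain ⟨h1, i, hi, h2⟩ := hf w hw
    refine le_antisymm ?_ ?_
    · rw [← h2]
      split_ifs
      · exact w.valuation_le_one _
      · exact (hb2 w hwv).le
    · rw [← hb2 w hwv]
      simpa using h1 1 one_lt_two

theorem IsPrincipalAway.exists_sUnit [DecidableEq (HeightOneSpectrum (𝓞 F))]
    {S T : Finset (HeightOneSpectrum (𝓞 F))}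
    (hS : IsPrincipalAway S) (hT : Disjoint S T) (x : Fˣ) :
    ∃ u ∈ sUnits (S ∪ T), ∀ v ∈ T, v.valuation F (x / u : Fˣ) = 1 := by
  induction T using Finset.induction_on with
  | empty => exact ⟨1, one_mem _, fun v hv => absurd hv (Finset.notMem_empty _)⟩
  | insert v T hvT ih =>
    rw [Finset.disjoint_insert_right] at hT
    obtain ⟨u, hu, hxu⟩ := ih hT.2
    obtain ⟨f, hf1, hf2⟩ := hS.exists_uniformizer hT.1
    have h0 : v.valuation F ((x / u : Fˣ) : F) ≠ 0 := by simp
    obtain ⟨k, hk⟩ : ∃ k : ℤ, v.valuation F ((x / u : Fˣ) : F) = exp k :=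
      ⟨_, (exp_log h0).symm⟩
    refine ⟨u * f ^ (-k), ?_, fun w hw => ?_⟩
    · intro w hw
      rw [Finset.union_insert, Finset.mem_insert, Finset.mem_union, not_or, not_or] at hw
      rw [Units.val_mul, _root_.map_mul, hu w (by simp [hw.2]), one_mul, Units.val_zpow_eq_zpow_val,
        map_zpow₀, hf2 w hw.2.1 hw.1, one_zpow]
    · rw [← div_div, Units.val_div_eq_div_val, map_div₀, Units.val_zpow_eq_zpow_val, map_zpow₀]
      rcases Finset.mem_insert.mp hw with rfl | hw
      · rw [hk, hf1, ← exp_zsmul]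
        simp
      · rw [hxu w hw, hf2 w (fun h => Finset.disjoint_left.mp hT.2 h hw)
          (fun h => hvT (h ▸ hw)), one_zpow, div_one]

theorem finrank_eq_two_mul_card_infinitePlace {k : ℕ} (hk : 2 < k) {ζ : F}
    (hζ : IsPrimitiveRoot ζ k) :
    Module.finrank ℚ F = 2 * Fintype.card (InfinitePlace F) := by
  have h1 := InfinitePlace.card_add_two_mul_card_eq_rank F
  have h2 := InfinitePlace.card_eq_nrRealPlaces_add_nrComplexPlaces F
  have h3 : InfinitePlace.nrRealPlaces F = 0 := NumberField.InfinitePlace.IsPrimitiveRoot.nrRealPlaces_eq_zero_of_two_lt hk hζ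
  omega
end principal

section extension
variable {F K : Type*} [Field F] [NumberField F] [Field K] [NumberField K] [Algebra F K]

/-- The prime of `F` below a prime of `K`. -/
noncomputable abbrev primeBelow (F : Type*) [Field F] [NumberField F] [Algebra F K]
    (w : HeightOneSpectrum (𝓞 K)) : HeightOneSpectrum (𝓞 F) :=
  HeightOneSpectrum.under (𝓞 F) w

theorem exists_primeBelow_valuation (w : HeightOneSpectrum (𝓞 K)) : ∃ e ≠ 0, ∀ c : F,
    w.valuation K (algebraMap F K c) = (primeBelow F w).valuation F c ^ e := by
  have : w.asIdeal.LiesOver (primeBelow F w).asIdeal := ⟨rfl⟩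
  exact ⟨_, Ideal.IsDedekindDomain.ramificationIdx'_ne_zero_of_liesOver w.asIdeal
    (primeBelow F w).ne_bot,
    fun c => (HeightOneSpectrum.valuation_liesOver K (primeBelow F w) w c).symm⟩

theorem valuation_algebraMap_le_iff (w : HeightOneSpectrum (𝓞 K)) (c d : F) :
    w.valuation K (algebraMap F K c) ≤ w.valuation K (algebraMap F K d) ↔
      (primeBelow F w).valuation F c ≤ (primeBelow F w).valuation F d := by
  obtain ⟨e, he, h⟩ := exists_primeBelow_valuation (F := F) w
  rw [h, h, pow_le_pow_iff_left₀ zero_le zero_le he]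

theorem valuation_algebraMap_lt_iff (w : HeightOneSpectrum (𝓞 K)) (c d : F) :
    w.valuation K (algebraMap F K c) < w.valuation K (algebraMap F K d) ↔
      (primeBelow F w).valuation F c < (primeBelow F w).valuation F d := by
  rw [← not_le, valuation_algebraMap_le_iff, not_le]

theorem valuation_algebraMap_eq_iff (w : HeightOneSpectrum (𝓞 K)) (c d : F) :
    w.valuation K (algebraMap F K c) = w.valuation K (algebraMap F K d) ↔
      (primeBelow F w).valuation F c = (primeBelow F w).valuation F d := by
  rw [le_antisymm_iff, le_antisymm_iff, valuation_algebraMap_le_iff, valuation_algebraMap_le_iff]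

theorem valuation_algebraMap_eq_one_iff (w : HeightOneSpectrum (𝓞 K)) (c : F) :
    w.valuation K (algebraMap F K c) = 1 ↔ (primeBelow F w).valuation F c = 1 := by
  have := valuation_algebraMap_eq_iff w c 1
  rwa [_root_.map_one, _root_.map_one, _root_.map_one] at this

variable (K) in
theorem exists_primeBelow_eq (v : HeightOneSpectrum (𝓞 F)) :
    ∃ w : HeightOneSpectrum (𝓞 K), primeBelow F w = v := by
  have := v.isMaximal
  obtain ⟨Q, hQ, hQv⟩ := Ideal.exists_maximal_ideal_liesOver_of_isIntegral (S := 𝓞 K) v.asIdeal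
  refine ⟨⟨Q, hQ.isPrime, Ideal.ne_bot_of_liesOver_of_ne_bot v.ne_bot Q⟩, ?_⟩
  ext1
  exact hQv.over.symm

variable (K) in
theorem finite_primeBelow_eq (v : HeightOneSpectrum (𝓞 F)) :
    {w : HeightOneSpectrum (𝓞 K) | primeBelow F w = v}.Finite := by
  have := v.isMaximal
  have h := IsDedekindDomain.primesOver_finite v.asIdeal (𝓞 K)
  refine Set.Finite.of_finite_image (h.subset ?_) (f := HeightOneSpectrum.asIdeal)
    (fun x _ y _ hxy => HeightOneSpectrum.ext hxy)
  rintro _ ⟨w, hw, rfl⟩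
  exact ⟨w.isPrime, ⟨by rw [← (show primeBelow F w = v from hw)]; rfl⟩⟩

variable (K) in
/-- The primes of `K` above the primes in `S`. -/
noncomputable def primesAbove (S : Finset (HeightOneSpectrum (𝓞 F))) :
    Finset (HeightOneSpectrum (𝓞 K)) :=
  (S.finite_toSet.biUnion fun v _ => finite_primeBelow_eq K v).toFinset

theorem mem_primesAbove {S : Finset (HeightOneSpectrum (𝓞 F))} {w : HeightOneSpectrum (𝓞 K)} :
    w ∈ primesAbove K S ↔ primeBelow F w ∈ S := by
  simp [primesAbove]

/-- The conjugate prime. -/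
noncomputable def conjPrime (σ : K ≃ₐ[F] K) (w : HeightOneSpectrum (𝓞 K)) :
    HeightOneSpectrum (𝓞 K) :=
  HeightOneSpectrum.comap (RingOfIntegers.mapRingEquiv σ.toRingEquiv : 𝓞 K →+* 𝓞 K)
    (RingOfIntegers.mapRingEquiv σ.toRingEquiv).surjective w

theorem conjPrime_valuation (σ : K ≃ₐ[F] K) (w : HeightOneSpectrum (𝓞 K)) (x : K) :
    (conjPrime σ w).valuation K x = w.valuation K (σ x) := by
  set e := RingOfIntegers.mapRingEquiv σ.toRingEquiv with he
  have h1 : ∀ (a : 𝓞 K) (n : ℕ), a ∈ (conjPrime σ w).asIdeal ^ n ↔ e a ∈ w.asIdeal ^ n := by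
    intro a n
    have h : (conjPrime σ w).asIdeal = Ideal.map (e.symm : 𝓞 K →+* 𝓞 K) w.asIdeal :=
      (Ideal.map_symm e).symm
    rw [h, ← Ideal.map_pow]
    exact Ideal.symm_apply_mem_of_equiv_iff.symm
  have h2 : ∀ a : 𝓞 K, (conjPrime σ w).intValuation a = w.intValuation (e a) := by
    intro a
    rcases eq_or_ne a 0 with rfl | ha
    · simp
    have key : ∀ (u : HeightOneSpectrum (𝓞 K)) (b : 𝓞 K), b ≠ 0 →
        ∃ n : ℕ, u.intValuation b = exp (-(n : ℤ)) := fun u b hb =>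
      ⟨_, HeightOneSpectrum.intValuation_if_neg u hb⟩
    obtain ⟨n, hn⟩ := key (conjPrime σ w) a ha
    obtain ⟨m, hm⟩ := key w (e a) (by simpa using ha)
    apply le_antisymm
    · rw [hm, HeightOneSpectrum.intValuation_le_pow_iff_mem, h1,
        ← HeightOneSpectrum.intValuation_le_pow_iff_mem, hm]
    · rw [hn, HeightOneSpectrum.intValuation_le_pow_iff_mem, ← h1,
        ← HeightOneSpectrum.intValuation_le_pow_iff_mem, hn]
  obtain ⟨a, d, hd, rfl⟩ := IsFractionRing.div_surjective (A := 𝓞 K) x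
  have h3 : ∀ a : 𝓞 K, σ (algebraMap (𝓞 K) K a) = algebraMap (𝓞 K) K (e a) := fun a => rfl
  rw [map_div₀, map_div₀, map_div₀, h3, h3]
  simp only [HeightOneSpectrum.valuation_of_algebraMap, h2]

theorem primeBelow_conjPrime (σ : K ≃ₐ[F] K) (w : HeightOneSpectrum (𝓞 K)) :
    primeBelow F (conjPrime σ w) = primeBelow F w := by
  ext x
  rw [← HeightOneSpectrum.valuation_lt_one_iff_mem (K := F), ← HeightOneSpectrum.valuation_lt_one_iff_mem (K := F)]
  have h1 := valuation_algebraMap_lt_iff (K := K) (conjPrime σ w) (algebraMap (𝓞 F) F x) 1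
  have h2 := valuation_algebraMap_lt_iff (K := K) w (algebraMap (𝓞 F) F x) 1
  rw [conjPrime_valuation, conjPrime_valuation, AlgEquiv.commutes, AlgEquiv.commutes] at h1
  simp only [_root_.map_one] at h1 h2
  rw [← h1, h2]

end extension

section kummer
variable {F K : Type*} [Field F] [Field K] [Algebra F K] {n : ℕ} {ζ b : F} {σ : K ≃ₐ[F] K} {β : K}

theorem sum_zpow_mul_zpow_inv {k : Type*} [Field k] {ζ : k} {n : ℕ} (hζ : IsPrimitiveRoot ζ n)
    {i j : ℕ} (hi : i < n) (hj : j < n) :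
    ∑ m ∈ Finset.range n, (ζ ^ i * (ζ ^ j)⁻¹) ^ m = if i = j then (n : k) else 0 := by
  have hζ0 : ζ ≠ 0 := hζ.ne_zero (by omega)
  split_ifs with h
  · subst h
    rw [mul_inv_cancel₀ (pow_ne_zero _ hζ0)]
    simp
  · have h1 : ζ ^ i * (ζ ^ j)⁻¹ ≠ 1 := by
      intro h1
      exact h (hζ.pow_inj hi hj (by rwa [mul_inv_eq_one₀ (pow_ne_zero _ hζ0)] at h1))
    have h2 : (ζ ^ i * (ζ ^ j)⁻¹) ^ n = 1 := by
      rw [mul_pow, inv_pow, ← pow_mul, ← pow_mul, mul_comm i, mul_comm j, pow_mul, pow_mul,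
        hζ.pow_eq_one, one_pow, one_pow, inv_one, one_mul]
    have h3 := mul_neg_geom_sum (ζ ^ i * (ζ ^ j)⁻¹) n
    rw [h2, sub_self] at h3
    exact (mul_eq_zero.mp h3).resolve_left (sub_ne_zero.mpr h1.symm)

/-- `K = F(β)` is the Kummer extension of degree `n` with `β ^ n = b`, and `σ` is the
generator of its Galois group with `σ β = ζ β`. -/
structure IsKumExt (n : ℕ) (ζ b : F) (σ : K ≃ₐ[F] K) (β : K) : Prop where
  root : IsPrimitiveRoot ζ n
  ne_zero : (n : F) ≠ 0
  b_ne_zero : b ≠ 0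
  irr : Irreducible (X ^ n - C b)
  pow_eq : β ^ n = algebraMap F K b
  apply_eq : σ β = algebraMap F K ζ * β
  surj : ∀ y : K, ∃ f : F[X], aeval β f = y

namespace IsKumExt
variable (h : IsKumExt n ζ b σ β)
include h

theorem n_ne_zero : n ≠ 0 := by
  rintro rfl
  exact h.ne_zero Nat.cast_zero

theorem beta_ne_zero : β ≠ 0 := by
  rintro rfl
  have := h.pow_eq
  rw [zero_pow h.n_ne_zero] at this
  exact h.b_ne_zero ((map_eq_zero (algebraMap F K)).mp this.symm)

theorem pow_apply (i : ℕ) : (σ ^ i) β = algebraMap F K ζ ^ i * β := by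
  induction i with
  | zero => simp
  | succ i ih =>
    rw [pow_succ', AlgEquiv.mul_apply, ih, map_mul, map_pow, AlgEquiv.commutes, h.apply_eq]
    ring

theorem pow_apply_aeval (i : ℕ) (f : F[X]) :
    (σ ^ i) (aeval β f) = aeval (algebraMap F K ζ ^ i * β) f := by
  rw [← h.pow_apply, aeval_algHom_apply]

theorem pow_eq_one : σ ^ n = 1 := by
  ext y
  obtain ⟨f, rfl⟩ := h.surj y
  rw [h.pow_apply_aeval, ← map_pow, h.root.pow_eq_one, map_one, one_mul, AlgEquiv.one_apply]

theorem exists_coeff (y : K) : ∃ c : ℕ → F,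
    ∀ j, (σ ^ j) y = ∑ i ∈ Finset.range n, algebraMap F K (c i) *
      (algebraMap F K ζ ^ (i * j) * β ^ i) := by
  obtain ⟨f, rfl⟩ := h.surj y
  have hmon := monic_X_pow_sub_C b h.n_ne_zero
  have h1 : aeval β (f %ₘ (X ^ n - C b)) = aeval β f := by
    refine aeval_modByMonic_eq_self_of_root ?_
    simp [h.pow_eq]
  refine ⟨(f %ₘ (X ^ n - C b)).coeff, fun j => ?_⟩
  rw [← h1, h.pow_apply_aeval, aeval_eq_sum_range' (n := n)]
  · refine Finset.sum_congr rfl fun i _ => ?_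
    rw [Algebra.smul_def, mul_pow, ← pow_mul, mul_comm j]
  · have h2 := natDegree_modByMonic_lt f hmon (fun h3 => by
      have h4 := congrArg natDegree h3
      rw [natDegree_X_pow_sub_C, natDegree_one] at h4
      exact h.irr.not_isUnit (h3 ▸ isUnit_one))
    rwa [natDegree_X_pow_sub_C] at h2

theorem sum_conj (y : K) {c : ℕ → F} (hc : ∀ j, (σ ^ j) y = ∑ i ∈ Finset.range n,
    algebraMap F K (c i) * (algebraMap F K ζ ^ (i * j) * β ^ i)) {l : ℕ} (hl : l < n) :
    ∑ j ∈ Finset.range n, (algebraMap F K ζ ^ (l * j))⁻¹ * (σ ^ j) y =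
      n * (algebraMap F K (c l) * β ^ l) := by
  have hζ := h.root.map_of_injective (algebraMap F K).injective
  have h1 : ∀ j, (algebraMap F K ζ ^ (l * j))⁻¹ * (σ ^ j) y = ∑ i ∈ Finset.range n,
      algebraMap F K (c i) * β ^ i * (algebraMap F K ζ ^ i * (algebraMap F K ζ ^ l)⁻¹) ^ j := by
    intro j
    rw [hc, Finset.mul_sum]
    refine Finset.sum_congr rfl fun i _ => ?_
    rw [mul_pow, inv_pow, ← pow_mul, ← pow_mul]
    ring
  simp_rw [h1]
  rw [Finset.sum_comm]
  simp_rw [← Finset.mul_sum]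
  rw [Finset.sum_eq_single l]
  · rw [sum_zpow_mul_zpow_inv hζ hl hl, if_pos rfl]
    ring
  · intro i hi hil
    rw [sum_zpow_mul_zpow_inv hζ (Finset.mem_range.mp hi) hl, if_neg hil, mul_zero]
  · exact fun h => absurd (Finset.mem_range.mpr hl) h

theorem cast_ne_zero : (n : K) ≠ 0 := by
  rw [← map_natCast (algebraMap F K), Ne, map_eq_zero]
  exact h.ne_zero

theorem mem_base_of_fixed {y : K} (hy : σ y = y) : ∃ c : F, algebraMap F K c = y := by
  obtain ⟨c, hc⟩ := h.exists_coeff y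
  have hy' : ∀ j, (σ ^ j) y = y := by
    intro j
    induction j with
    | zero => simp
    | succ j ih => rw [pow_succ, AlgEquiv.mul_apply, hy, ih]
  have hn : 0 < n := Nat.pos_of_ne_zero h.n_ne_zero
  have h1 := h.sum_conj y hc hn
  simp only [hy', zero_mul, pow_zero, inv_one, one_mul, mul_one, Finset.sum_const,
    Finset.card_range, nsmul_eq_mul] at h1
  exact ⟨c 0, (mul_left_cancel₀ h.cast_ne_zero h1).symm⟩

/-- Hilbert's theorem 90. -/
theorem exists_eq_div {x : K} (hx : ∏ i ∈ Finset.range n, (σ ^ i) x = 1) :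
    ∃ y ≠ 0, σ y = x * y := by
  have hn : 0 < n := Nat.pos_of_ne_zero h.n_ne_zero
  have hζ := h.root.map_of_injective (algebraMap F K).injective
  have hx0 : x ≠ 0 := by
    rintro rfl
    rw [Finset.prod_eq_zero (Finset.mem_range.mpr hn) (map_zero (σ ^ 0))] at hx
    exact zero_ne_one hx
  set a : ℕ → K := fun i => (∏ j ∈ Finset.range i, (σ ^ j) x)⁻¹ with ha
  have ha0 : a 0 = 1 := by simp [ha]
  have han : a n = 1 := by rw [ha]; dsimp only; rw [hx, inv_one]
  have hσa : ∀ i, σ (a i) = x * a (i + 1) := by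
    intro i
    simp only [ha]
    rw [map_inv₀, map_prod, Finset.prod_range_succ', pow_zero, AlgEquiv.one_apply, mul_inv,
      mul_left_comm, mul_inv_cancel₀ hx0, mul_one]
    congr 1
    exact Finset.prod_congr rfl fun j _ => by rw [pow_succ', AlgEquiv.mul_apply]
  by_contra! hne
  have h1 : ∀ k, ∑ i ∈ Finset.range n, a i * (σ ^ i) (β ^ k) = 0 := by
    intro k
    by_contra h0
    refine hne _ h0 ?_
    rw [map_sum, Finset.mul_sum]
    have h2 : ∀ i, σ (a i * (σ ^ i) (β ^ k)) = x * (a (i + 1) * (σ ^ (i + 1)) (β ^ k)) := by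
      intro i
      rw [map_mul, hσa, pow_succ' σ, AlgEquiv.mul_apply, mul_assoc]
    simp_rw [h2]
    rw [← Finset.mul_sum, ← Finset.mul_sum]
    congr 1
    have h3 := Finset.sum_range_succ (fun i => a i * (σ ^ i) (β ^ k)) n
    rw [Finset.sum_range_succ', h.pow_eq_one, han, ha0, pow_zero] at h3
    exact add_right_cancel h3
  have h2 : ∀ k, ∑ i ∈ Finset.range n, a i * algebraMap F K ζ ^ (i * k) = 0 := by
    intro k
    have h3 := h1 k
    have h4 : ∀ i, a i * (σ ^ i) (β ^ k) = a i * algebraMap F K ζ ^ (i * k) * β ^ k := by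
      intro i
      rw [map_pow, h.pow_apply, mul_pow, ← pow_mul, mul_assoc]
    simp_rw [h4] at h3
    rw [← Finset.sum_mul] at h3
    exact (mul_eq_zero.mp h3).resolve_right (pow_ne_zero _ h.beta_ne_zero)
  have h3 : ∑ k ∈ Finset.range n, ∑ i ∈ Finset.range n, a i * algebraMap F K ζ ^ (i * k) = n := by
    rw [Finset.sum_comm]
    simp_rw [← Finset.mul_sum]
    rw [Finset.sum_eq_single 0]
    · simp [ha0]
    · intro i hi hi0
      have h4 := sum_zpow_mul_zpow_inv hζ (Finset.mem_range.mp hi) hn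
      rw [if_neg hi0, pow_zero, inv_one, mul_one] at h4
      simp_rw [pow_mul]
      rw [h4, mul_zero]
    · exact fun h => absurd (Finset.mem_range.mpr hn) h
  rw [Finset.sum_eq_zero fun k _ => h2 k] at h3
  exact h.cast_ne_zero h3.symm

theorem isKNorm_of_prod {u : F} {y : K} (hy : ∏ i ∈ Finset.range n, (σ ^ i) y = algebraMap F K u) :
    IsKNorm n ζ b u := by
  obtain ⟨f, rfl⟩ := h.surj y
  refine IsKNorm.of_eval f β h.irr h.n_ne_zero h.pow_eq ?_
  rw [← hy]
  exact Finset.prod_congr rfl fun i _ => (h.pow_apply_aeval i f).symm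

theorem exists_prod_of_isKNorm {u : F} (hu : IsKNorm n ζ b u) :
    ∃ y : K, ∏ i ∈ Finset.range n, (σ ^ i) y = algebraMap F K u := by
  obtain ⟨f, hf⟩ := hu
  refine ⟨aeval β f, ?_⟩
  have h1 : aeval β (X ^ n - C b) = 0 := by simp [h.pow_eq]
  have h2 := aeval_eq_zero_of_dvd_aeval_eq_zero hf h1
  rw [map_sub, aeval_C, sub_eq_zero, map_prod] at h2
  rw [← h2]
  refine Finset.prod_congr rfl fun i _ => ?_
  rw [h.pow_apply_aeval, aeval_comp]
  simp

theorem finrank_eq : Module.finrank F K = n := by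
  have h1 : minpoly F β = X ^ n - C b :=
    (minpoly.eq_of_irreducible_of_monic h.irr (by simp [h.pow_eq])
      (monic_X_pow_sub_C b h.n_ne_zero)).symm
  have h2 : IsIntegral F β := by
    by_contra h3
    rw [minpoly.eq_zero h3] at h1
    exact h.irr.ne_zero h1.symm
  have h3 : IntermediateField.adjoin F {β} = ⊤ := by
    rw [eq_top_iff]
    intro y _
    obtain ⟨f, rfl⟩ := h.surj y
    exact IntermediateField.algebra_adjoin_le_adjoin F _ (aeval_mem_adjoin_singleton F β)
  rw [← IntermediateField.finrank_top', ← h3, IntermediateField.adjoin.finrank h2, h1,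
    natDegree_X_pow_sub_C]

end IsKumExt

theorem exists_isKumExt {F : Type*} [Field F] {n : ℕ} {ζ b : F} (hζ : IsPrimitiveRoot ζ n)
    (hn : (n : F) ≠ 0) (hb : b ≠ 0) (hirr : Irreducible (X ^ n - C b)) :
    haveI := Fact.mk hirr
    ∃ (σ : AdjoinRoot (X ^ n - C b) ≃ₐ[F] AdjoinRoot (X ^ n - C b)),
      IsKumExt n ζ b σ (AdjoinRoot.root (X ^ n - C b)) := by
  have := Fact.mk hirr
  have hn0 : n ≠ 0 := by rintro rfl; exact hn Nat.cast_zero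
  have hζ0 : ζ ≠ 0 := hζ.ne_zero hn0
  set β := AdjoinRoot.root (X ^ n - C b) with hβ
  have hpow : β ^ n = algebraMap F _ b := by
    have h1 := AdjoinRoot.eval₂_root (X ^ n - C b)
    rw [eval₂_sub, eval₂_X_pow, eval₂_C, sub_eq_zero] at h1
    exact h1
  have key : ∀ c : F, c ^ n = 1 → aeval (algebraMap F (AdjoinRoot (X ^ n - C b)) c * β)
      (X ^ n - C b) = 0 := by
    intro c hc
    rw [map_sub, map_pow, aeval_X, aeval_C, mul_pow, ← map_pow, hc, map_one, one_mul, hpow,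
      sub_self]
  let f := AdjoinRoot.liftAlgHom (X ^ n - C b) (Algebra.ofId F (AdjoinRoot (X ^ n - C b)))
    (algebraMap F (AdjoinRoot (X ^ n - C b)) ζ * β) (key ζ hζ.pow_eq_one)
  let g := AdjoinRoot.liftAlgHom (X ^ n - C b) (Algebra.ofId F (AdjoinRoot (X ^ n - C b)))
    (algebraMap F (AdjoinRoot (X ^ n - C b)) ζ⁻¹ * β)
    (key ζ⁻¹ (by rw [inv_pow, hζ.pow_eq_one, inv_one]))
  have hf : f β = algebraMap F (AdjoinRoot (X ^ n - C b)) ζ * β := by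
    simp only [f, hβ, AdjoinRoot.liftAlgHom_root]
  have hg : g β = algebraMap F (AdjoinRoot (X ^ n - C b)) ζ⁻¹ * β := by
    simp only [g, hβ, AdjoinRoot.liftAlgHom_root]
  refine ⟨AlgEquiv.ofAlgHom f g ?_ ?_, hζ, hn, hb, hirr, hpow, hf, fun y => ?_⟩
  · refine AdjoinRoot.algHom_ext ?_
    change f (g β) = β
    rw [hg, map_mul, AlgHom.commutes, hf, ← mul_assoc, ← map_mul, inv_mul_cancel₀ hζ0, map_one,
      one_mul]
  · refine AdjoinRoot.algHom_ext ?_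
    change g (f β) = β
    rw [hf, map_mul, AlgHom.commutes, hg, ← mul_assoc, ← map_mul, mul_inv_cancel₀ hζ0, map_one,
      one_mul]
  · obtain ⟨f, rfl⟩ := AdjoinRoot.mk_surjective y
    exact ⟨f, by rw [AdjoinRoot.aeval_eq]⟩

end kummer

section above
variable {F K : Type*} [Field F] [NumberField F] [Field K] [NumberField K] [Algebra F K]
  {p : ℕ} [hp : Fact p.Prime] {ζ : F}

theorem map_mem_locPow (hζ : IsPrimitiveRoot ζ p) (w : HeightOneSpectrum (𝓞 K)) {x : Fˣ}
    (hx : x ∈ locPow p (primeBelow F w)) :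
    Units.map (algebraMap F K).toMonoidHom x ∈ locPow p w := by
  have hl0 : ζ - 1 ≠ 0 := sub_ne_zero.mpr (hζ.ne_one hp.out.one_lt)
  obtain ⟨m, hm⟩ := exists_exp_neg_le (pow_ne_zero p
    ((Valuation.ne_zero_iff ((primeBelow F w).valuation F)).mpr hl0))
  obtain ⟨y, hy⟩ := exists_approx_of_mem_locPow hx (m + 1)
  refine mem_locPow_of_lt (hζ.map_of_injective (algebraMap F K).injective)
    (y := Units.map (algebraMap F K).toMonoidHom y) ?_
  have h1 : (primeBelow F w).valuation F (x / y ^ p - 1) <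
      (primeBelow F w).valuation F ((ζ - 1) ^ p) := by
    rw [_root_.map_pow]
    refine lt_of_le_of_lt hy (lt_of_lt_of_le ?_ hm)
    rw [exp_lt_exp]
    push_cast
    linarith
  rw [← valuation_algebraMap_lt_iff] at h1
  simpa using h1

theorem valuation_root_eq_one (w : HeightOneSpectrum (𝓞 F)) {z : F} {n : ℕ} (hn : n ≠ 0)
    (hz : z ^ n = 1) : w.valuation F z = 1 := by
  have h1 := congrArg (w.valuation F) hz
  rw [_root_.map_pow, _root_.map_one] at h1
  exact (pow_eq_one_iff_of_nonneg zero_le hn).mp h1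

theorem valuation_one_sub_le (w : HeightOneSpectrum (𝓞 F)) (hζ : IsPrimitiveRoot ζ p)
    {i j : ℕ} (h : ζ ^ i ≠ ζ ^ j) :
    w.valuation F (ζ - 1) ≤ w.valuation F (ζ ^ i - ζ ^ j) := by
  wlog hij : j ≤ i generalizing i j
  · rw [Valuation.map_sub_swap _ (ζ ^ i)]
    exact this h.symm (by omega)
  obtain ⟨k, rfl⟩ := Nat.exists_eq_add_of_le hij
  have hw : ∀ k, w.valuation F (ζ ^ k) = 1 := fun k => by
    rw [_root_.map_pow, valuation_root_eq_one w hp.out.ne_zero hζ.pow_eq_one, one_pow]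
  have h1 : ζ ^ (j + k) - ζ ^ j = ζ ^ j * (ζ ^ k - 1) := by ring
  rw [h1, _root_.map_mul, hw, one_mul]
  have hk1 : ζ ^ k ≠ 1 := fun hk => h (by rw [pow_add, hk, mul_one])
  have hcop : k.Coprime p := by
    rw [Nat.coprime_comm, hp.out.coprime_iff_not_dvd]
    exact fun hd => hk1 ((hζ.pow_eq_one_iff_dvd k).mpr hd)
  have hprim := hζ.pow_of_coprime k hcop
  obtain ⟨m, -, hm⟩ := hprim.eq_pow_of_pow_eq_one hζ.pow_eq_one
  have h2 : ζ - 1 = (∑ l ∈ Finset.range m, (ζ ^ k) ^ l) * (ζ ^ k - 1) := by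
    rw [geom_sum_mul, hm]
  rw [h2, _root_.map_mul]
  refine mul_le_of_le_one_left' ?_
  refine Valuation.map_sum_le _ fun l _ => ?_
  rw [← pow_mul, hw]

namespace IsKumExt
variable {b : Fˣ} {σ : K ≃ₐ[F] K} {β : K} (h : IsKumExt p ζ (b : F) σ β)
include h

theorem le_card_primeBelow_eq {v : HeightOneSpectrum (𝓞 F)} (hb : b ∈ locPow p v) :
    p ≤ (finite_primeBelow_eq K v).toFinset.card := by
  classical
  have hζ' := h.root.map_of_injective (algebraMap F K).injective
  obtain ⟨w, hw⟩ := exists_primeBelow_eq K v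
  have hl0 : ζ - 1 ≠ 0 := sub_ne_zero.mpr (h.root.ne_one hp.out.one_lt)
  obtain ⟨m, hm⟩ := exists_exp_neg_le (pow_ne_zero p
    ((Valuation.ne_zero_iff (v.valuation F)).mpr hl0))
  obtain ⟨y, hy⟩ := exists_approx_of_mem_locPow hb (m + 1)
  have h1 : v.valuation F (b / y ^ p - 1) < v.valuation F ((ζ - 1) ^ p) := by
    rw [_root_.map_pow]
    refine lt_of_le_of_lt hy (lt_of_lt_of_le ?_ hm)
    rw [exp_lt_exp]
    push_cast
    linarith
  rw [← hw, ← valuation_algebraMap_lt_iff] at h1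
  set Z := algebraMap F K ζ with hZ
  set γ := β / algebraMap F K y with hγ
  have h2 : algebraMap F K (b / y ^ p - 1) = ∏ i ∈ Finset.range p, (γ - Z ^ i) := by
    have h3 := hζ'.pow_sub_pow_eq_prod_sub_mul γ 1 hp.out.pos
    rw [one_pow] at h3
    rw [map_sub, map_div₀, map_one, map_pow, ← h.pow_eq, ← div_pow, h3]
    have h4 : Polynomial.nthRootsFinset p (1 : K) = (Finset.range p).image (Z ^ ·) := by
      symm
      refine Finset.eq_of_subset_of_card_le (fun u hu => ?_) ?_
      · obtain ⟨i, -, rfl⟩ := Finset.mem_image.mp hu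
        rw [Polynomial.mem_nthRootsFinset hp.out.pos, ← pow_mul, mul_comm, pow_mul,
          hζ'.pow_eq_one, one_pow]
      · rw [Finset.card_image_of_injOn, Finset.card_range, hζ'.card_nthRootsFinset]
        exact fun i hi j hj hij => hζ'.pow_inj (Finset.mem_range.mp hi) (Finset.mem_range.mp hj) hij
    rw [h4, Finset.prod_image]
    · simp
    · exact fun i hi j hj hij => hζ'.pow_inj (Finset.mem_range.mp hi) (Finset.mem_range.mp hj) hij
  rw [h2, _root_.map_prod, _root_.map_pow, _root_.map_pow] at h1
  obtain ⟨i, hi, hlt⟩ : ∃ i ∈ Finset.range p, w.valuation K (γ - Z ^ i) <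
      w.valuation K (algebraMap F K (ζ - 1)) := by
    by_contra! hge
    refine absurd h1 (not_lt.mpr ?_)
    have := Finset.prod_le_prod' hge
    rwa [Finset.prod_const, Finset.card_range] at this
  have key : ∀ k, (conjPrime (σ ^ k) w).valuation K (γ - Z ^ (i + k)) <
      (conjPrime (σ ^ k) w).valuation K (Z - 1) := by
    intro k
    have hwZ : w.valuation K (Z ^ k) = 1 := by
      rw [_root_.map_pow, valuation_root_eq_one w hp.out.ne_zero hζ'.pow_eq_one, one_pow]
    have h3 : (σ ^ k) (γ - Z ^ (i + k)) = Z ^ k * (γ - Z ^ i) := by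
      rw [map_sub, hγ, map_div₀, h.pow_apply, map_pow, hZ, AlgEquiv.commutes, AlgEquiv.commutes]
      ring
    have h4 : (σ ^ k) (Z - 1) = algebraMap F K (ζ - 1) := by
      rw [map_sub, hZ, AlgEquiv.commutes, map_one, map_sub, map_one]
    rw [conjPrime_valuation, conjPrime_valuation, h3, h4, _root_.map_mul, hwZ, one_mul]
    exact hlt
  have hinj : Set.InjOn (fun k => conjPrime (σ ^ k) w) (Finset.range p : Set ℕ) := by
    intro k hk l hl hkl
    by_contra hne
    simp only at hkl
    have h5 := key l
    rw [← hkl] at h5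
    have h6 : Z ^ (i + k) ≠ Z ^ (i + l) := by
      rw [pow_add, pow_add]
      intro h7
      refine hne (hζ'.pow_inj (Finset.mem_range.mp hk) (Finset.mem_range.mp hl)
        (mul_left_cancel₀ (pow_ne_zero i ?_) h7))
      exact hζ'.ne_zero hp.out.ne_zero
    have h7 := valuation_one_sub_le (conjPrime (σ ^ k) w) hζ' h6
    refine absurd h7 (not_le.mpr ?_)
    have h8 : Z ^ (i + k) - Z ^ (i + l) = (γ - Z ^ (i + l)) - (γ - Z ^ (i + k)) := by ring
    rw [h8]
    exact Valuation.map_sub_lt _ h5 (key k)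
  rw [← Finset.card_range p, ← Finset.card_image_of_injOn hinj]
  refine Finset.card_le_card fun u hu => ?_
  obtain ⟨k, -, rfl⟩ := Finset.mem_image.mp hu
  rw [Set.Finite.mem_toFinset]
  exact (primeBelow_conjPrime _ w).trans hw

open Classical in
theorem le_card_primesAbove (S : Finset (HeightOneSpectrum (𝓞 F))) :
    p * S.card ≤ (primesAbove K S).card + (p - 1) * (S.filter fun v => b ∉ locPow p v).card := by
  have h1 : (primesAbove K S).card =
      ∑ v ∈ S, (finite_primeBelow_eq K v).toFinset.card := by
    rw [Finset.card_eq_sum_card_fiberwise (f := primeBelow F) (t := S)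
      (fun w hw => mem_primesAbove.mp hw)]
    refine Finset.sum_congr rfl fun v hv => ?_
    congr 1
    ext w
    rw [Finset.mem_filter, mem_primesAbove, Set.Finite.mem_toFinset]
    exact ⟨fun h => h.2, fun h => ⟨h ▸ hv, h⟩⟩
  rw [h1, Finset.card_filter, Finset.mul_sum, ← Finset.sum_add_distrib, mul_comm,
    ← smul_eq_mul, ← Finset.sum_const]
  refine Finset.sum_le_sum fun v hv => ?_
  by_cases hb : b ∈ locPow p v
  · simpa [hb] using h.le_card_primeBelow_eq hb
  · have : 0 < (finite_primeBelow_eq K v).toFinset.card := by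
      obtain ⟨w, hw⟩ := exists_primeBelow_eq K v
      exact Finset.card_pos.mpr ⟨w, (Set.Finite.mem_toFinset _).mpr hw⟩
    have := hp.out.pos
    simp only [hb, not_false_eq_true, if_true, mul_one]
    omega

end IsKumExt
end above

section conj
variable {F K : Type*} [Field F] [NumberField F] [Field K] [NumberField K] [Algebra F K]
  {p : ℕ} [hp : Fact p.Prime] {ζ : F}

theorem valuation_prime_eq_one (v : HeightOneSpectrum (𝓞 F)) (hζ : IsPrimitiveRoot ζ p)
    (hv : v.valuation F (ζ - 1) = 1) : v.valuation F (p : F) = 1 := by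
  obtain ⟨n, hn⟩ := Nat.exists_eq_succ_of_ne_zero hp.out.ne_zero
  have h1 : ∏ k ∈ Finset.range n, (1 - ζ ^ (k + 1)) = (p : F) := by
    rw [hn] at hζ
    rw [hζ.prod_one_sub_pow_eq_order, hn]
    push_cast
    rfl
  rw [← h1, _root_.map_prod]
  refine Finset.prod_eq_one fun k hk => ?_
  have hk := Finset.mem_range.mp hk
  refine le_antisymm ?_ ?_
  · refine (Valuation.map_sub _ _ _).trans (max_le (_root_.map_one _).le ?_)
    rw [_root_.map_pow, valuation_root_eq_one v hp.out.ne_zero hζ.pow_eq_one, one_pow]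
  · rw [← hv]
    have h2 := valuation_one_sub_le v hζ (i := 0) (j := k + 1) (by
      rw [pow_zero]
      exact (hζ.pow_ne_one_of_pos_of_lt (by omega) (by omega)).symm)
    rwa [pow_zero] at h2

theorem map_mem_sUnits (σ : K ≃ₐ[F] K) {S : Finset (HeightOneSpectrum (𝓞 F))} {x : Kˣ}
    (hx : x ∈ sUnits (primesAbove K S)) :
    Units.map (σ : K →* K) x ∈ sUnits (primesAbove K S) := fun w hw => by
  change w.valuation K (σ x) = 1
  rw [← conjPrime_valuation]
  refine hx _ fun h => hw ?_
  rw [mem_primesAbove] at h ⊢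
  rwa [primeBelow_conjPrime] at h

/-- The action of a Galois automorphism on `S`-units. -/
noncomputable def sUnitsConj (S : Finset (HeightOneSpectrum (𝓞 F))) (σ : K ≃ₐ[F] K) :
    Module.End ℤ (Additive (sUnits (primesAbove K S))) :=
  AddMonoidHom.toIntLinearMap (MonoidHom.toAdditive
    { toFun := fun x => ⟨Units.map (σ : K →* K) x, map_mem_sUnits σ x.2⟩
      map_one' := by ext; simp
      map_mul' := fun x y => by ext; simp })

/-- The underlying field element of an `S`-unit. -/
def sUnitVal {T : Finset (HeightOneSpectrum (𝓞 K))} (x : Additive (sUnits T)) : K :=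
  ((x.toMul : Kˣ) : K)

theorem sUnitVal_injective {T : Finset (HeightOneSpectrum (𝓞 K))} :
    Function.Injective (sUnitVal (T := T)) := fun _ _ h =>
  Additive.toMul.injective (Subtype.ext (Units.ext h))

theorem sUnitVal_zero {T : Finset (HeightOneSpectrum (𝓞 K))} :
    sUnitVal (0 : Additive (sUnits T)) = 1 := rfl

theorem sUnitVal_add {T : Finset (HeightOneSpectrum (𝓞 K))} (x y : Additive (sUnits T)) :
    sUnitVal (x + y) = sUnitVal x * sUnitVal y := rfl

theorem sUnitVal_sum {T : Finset (HeightOneSpectrum (𝓞 K))} (s : Finset ℕ)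
    (f : ℕ → Additive (sUnits T)) : sUnitVal (∑ i ∈ s, f i) = ∏ i ∈ s, sUnitVal (f i) := by
  classical
  induction s using Finset.induction_on with
  | empty => rfl
  | insert a s ha ih => rw [Finset.sum_insert ha, Finset.prod_insert ha, sUnitVal_add, ih]

theorem sUnitVal_nsmul {T : Finset (HeightOneSpectrum (𝓞 K))} (n : ℕ) (x : Additive (sUnits T)) :
    sUnitVal (n • x) = sUnitVal x ^ n := by
  induction n with
  | zero => rw [zero_smul, pow_zero, sUnitVal_zero]
  | succ n ih => rw [succ_nsmul, sUnitVal_add, ih, pow_succ]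

theorem sUnitVal_conj (S : Finset (HeightOneSpectrum (𝓞 F))) (σ : K ≃ₐ[F] K)
    (x : Additive (sUnits (primesAbove K S))) :
    sUnitVal (sUnitsConj S σ x) = σ (sUnitVal x) := rfl

theorem sUnitVal_conj_pow (S : Finset (HeightOneSpectrum (𝓞 F))) (σ : K ≃ₐ[F] K) (i : ℕ)
    (x : Additive (sUnits (primesAbove K S))) :
    sUnitVal ((sUnitsConj S σ ^ i) x) = (σ ^ i) (sUnitVal x) := by
  induction i generalizing x with
  | zero => rfl
  | succ n ih =>
    rw [pow_succ, Module.End.mul_apply, ih, sUnitVal_conj, pow_succ, AlgEquiv.mul_apply]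

theorem sUnitVal_conj_sum (S : Finset (HeightOneSpectrum (𝓞 F))) (σ : K ≃ₐ[F] K) (s : Finset ℕ)
    (x : Additive (sUnits (primesAbove K S))) :
    sUnitVal ((∑ i ∈ s, sUnitsConj S σ ^ i) x) = ∏ i ∈ s, (σ ^ i) (sUnitVal x) := by
  rw [LinearMap.sum_apply, sUnitVal_sum]
  exact Finset.prod_congr rfl fun i _ => sUnitVal_conj_pow S σ i x

namespace IsKumExt
variable {b : F} {σ : K ≃ₐ[F] K} {β : K} (h : IsKumExt p ζ b σ β)
include h

theorem exists_sUnit_eq_div {S : Finset (HeightOneSpectrum (𝓞 F))}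
    (hSp : ∀ v ∉ S, v.valuation F (ζ - 1) = 1) (hSb : ∀ v ∉ S, v.valuation F b = 1)
    (hS : IsPrincipalAway S) {x : Kˣ} (hx : x ∈ sUnits (primesAbove K S))
    (hN : ∏ i ∈ Finset.range p, (σ ^ i) (x : K) = 1) :
    ∃ y ∈ sUnits (primesAbove K S), σ (y : K) = x * y := by
  obtain ⟨y, hy0, hy⟩ := h.exists_eq_div hN
  obtain ⟨c, hc⟩ := h.exists_coeff y
  have hc0 : ∃ i < p, c i ≠ 0 := by
    by_contra! hall
    refine hy0 ?_
    have h1 := hc 0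
    rw [pow_zero, AlgEquiv.one_apply] at h1
    rw [h1]
    refine Finset.sum_eq_zero fun i hi => ?_
    rw [hall i (Finset.mem_range.mp hi), _root_.map_zero, zero_mul]
  obtain ⟨f, hf⟩ := hS c p hc0
  have hf0 : algebraMap F K f ≠ 0 := (map_ne_zero_iff _ (algebraMap F K).injective).mpr f.ne_zero
  refine ⟨Units.mk0 (y / algebraMap F K f) (div_ne_zero hy0 hf0), fun w hw => ?_, ?_⟩
  swap
  · rw [Units.val_mk0, map_div₀, AlgEquiv.commutes, hy, mul_div_assoc]
  rw [mem_primesAbove] at hw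
  obtain ⟨hle, l, hl, hlf⟩ := hf _ hw
  have hζw : w.valuation K (algebraMap F K ζ) = 1 :=
    (valuation_algebraMap_eq_one_iff w ζ).mpr
      (valuation_root_eq_one _ hp.out.ne_zero h.root.pow_eq_one)
  have hpw : w.valuation K (p : K) = 1 := by
    rw [← map_natCast (algebraMap F K), valuation_algebraMap_eq_one_iff]
    exact valuation_prime_eq_one _ h.root (hSp _ hw)
  have hβw : w.valuation K β = 1 := by
    have h1 := (valuation_algebraMap_eq_one_iff w b).mpr (hSb _ hw)
    rw [← h.pow_eq, _root_.map_pow] at h1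
    exact (pow_eq_one_iff_of_nonneg zero_le hp.out.ne_zero).mp h1
  have hconj : ∀ j, w.valuation K ((σ ^ j) y) = w.valuation K y := by
    intro j
    induction j with
    | zero => rfl
    | succ j ih =>
      have h1 : w.valuation K ((σ ^ j) x) = 1 := by
        rw [← conjPrime_valuation]
        refine hx _ fun h2 => hw ?_
        rwa [mem_primesAbove, primeBelow_conjPrime] at h2
      rw [pow_succ, AlgEquiv.mul_apply, hy, map_mul, _root_.map_mul, h1, one_mul, ih]
  rw [Units.val_mk0, map_div₀]
  suffices hs : w.valuation K y = w.valuation K (algebraMap F K f) by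
    rw [hs, div_self ((Valuation.ne_zero_iff _).mpr hf0)]
  refine le_antisymm ?_ ?_
  · have h1 := hc 0
    rw [pow_zero, AlgEquiv.one_apply] at h1
    rw [h1]
    refine Valuation.map_sum_le _ fun i hi => ?_
    rw [_root_.map_mul, _root_.map_mul, _root_.map_pow, _root_.map_pow, hζw, hβw, one_pow,
      one_pow, mul_one, mul_one]
    exact (valuation_algebraMap_le_iff w _ _).mpr (hle i (Finset.mem_range.mp hi))
  · rw [← (valuation_algebraMap_eq_iff w _ _).mpr hlf]
    have h1 := congrArg (w.valuation K) (h.sum_conj y hc hl)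
    rw [_root_.map_mul, _root_.map_mul, _root_.map_pow, hpw, hβw, one_pow, one_mul, mul_one] at h1
    rw [← h1]
    refine Valuation.map_sum_le _ fun j _ => ?_
    rw [_root_.map_mul, map_inv₀, _root_.map_pow, hζw, one_pow, inv_one, one_mul, hconj]

end IsKumExt
end conj

namespace IsKumExt
variable {F K : Type*} [Field F] [NumberField F] [Field K] [NumberField K] [Algebra F K]
  {p : ℕ} [hp : Fact p.Prime] {ζ : F} {b : F} {σ : K ≃ₐ[F] K} {β : K} (h : IsKumExt p ζ b σ β)

theorem algebraMap_mem_sUnits (S : Finset (HeightOneSpectrum (𝓞 F))) {x : Fˣ} :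
    Units.map (algebraMap F K : F →* K) x ∈ sUnits (primesAbove K S) ↔ x ∈ sUnits S := by
  refine ⟨fun hx v hv => ?_, fun hx w hw => ?_⟩
  · obtain ⟨w, rfl⟩ := exists_primeBelow_eq K v
    exact (valuation_algebraMap_eq_one_iff w _).mp (hx w fun h => hv (mem_primesAbove.mp h))
  · exact (valuation_algebraMap_eq_one_iff w _).mpr (hx _ fun h => hw (mem_primesAbove.mpr h))

/-- The inclusion of `S`-units of the base field. -/
noncomputable def sUnitsIncl (K : Type*) [Field K] [NumberField K] [Algebra F K]
    (S : Finset (HeightOneSpectrum (𝓞 F))) :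
    Additive (sUnits S) →+ Additive (sUnits (primesAbove K S)) :=
  MonoidHom.toAdditive
    { toFun := fun x => ⟨Units.map (algebraMap F K : F →* K) x, (algebraMap_mem_sUnits S).mpr x.2⟩
      map_one' := by ext; simp
      map_mul' := fun x y => by ext; simp }

theorem sUnitVal_incl (S : Finset (HeightOneSpectrum (𝓞 F))) (x : Additive (sUnits S)) :
    sUnitVal (sUnitsIncl K S x) = algebraMap F K (sUnitVal x) := rfl

theorem sUnitsIncl_injective (S : Finset (HeightOneSpectrum (𝓞 F))) :
    Function.Injective (sUnitsIncl K S) := fun x y hxy => by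
  refine sUnitVal_injective ((algebraMap F K).injective ?_)
  rw [← sUnitVal_incl, ← sUnitVal_incl, hxy]

include h in
theorem mem_ker_conj_iff (S : Finset (HeightOneSpectrum (𝓞 F)))
    (x : Additive (sUnits (primesAbove K S))) :
    x ∈ LinearMap.ker (sUnitsConj S σ - 1) ↔ x ∈ (sUnitsIncl K S).range := by
  rw [LinearMap.mem_ker, LinearMap.sub_apply, Module.End.one_apply, sub_eq_zero]
  refine ⟨fun hx => ?_, ?_⟩
  · have h1 := congrArg sUnitVal hx
    rw [sUnitVal_conj] at h1
    obtain ⟨c, hc⟩ := h.mem_base_of_fixed h1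
    have hc0 : c ≠ 0 := by
      rintro rfl
      rw [_root_.map_zero] at hc
      exact (x.toMul : Kˣ).ne_zero hc.symm
    have hmem : Units.mk0 c hc0 ∈ sUnits S := by
      rw [← algebraMap_mem_sUnits (K := K)]
      have h2 : Units.map (algebraMap F K : F →* K) (Units.mk0 c hc0) = (x.toMul : Kˣ) :=
        Units.ext hc
      rw [h2]
      exact x.toMul.2
    exact ⟨Additive.ofMul ⟨_, hmem⟩, sUnitVal_injective hc⟩
  · rintro ⟨y, rfl⟩
    refine sUnitVal_injective ?_
    rw [sUnitVal_conj, sUnitVal_incl, AlgEquiv.commutes]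

/-- `S`-units of the base field are the invariants. -/
noncomputable def sUnitsEquivKer (h : IsKumExt p ζ b σ β) (S : Finset (HeightOneSpectrum (𝓞 F))) :
    Additive (sUnits S) ≃+ LinearMap.ker (sUnitsConj (K := K) S σ - 1) :=
  AddEquiv.ofBijective
    ((sUnitsIncl K S).codRestrict (LinearMap.ker (sUnitsConj (K := K) S σ - 1))
      fun x => (h.mem_ker_conj_iff S _).mpr ⟨x, rfl⟩)
    ⟨fun x y hxy => sUnitsIncl_injective S (congrArg Subtype.val hxy), fun y => by
      obtain ⟨x, hx⟩ := (h.mem_ker_conj_iff S _).mp y.2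
      exact ⟨x, Subtype.ext hx⟩⟩

end IsKumExt

section F1
variable {F : Type*} [Field F] [NumberField F] {p : ℕ} [hp : Fact p.Prime] {ζ : F}

open Classical in
theorem IsKumExt.relIndex_nmGroup_sUnits (hp2 : p ≠ 2) {K : Type*} [Field K] [NumberField K]
    [Algebra F K] {b : Fˣ} {σ : K ≃ₐ[F] K} {β : K} (h : IsKumExt p ζ (b : F) σ β)
    {S : Finset (HeightOneSpectrum (𝓞 F))} (hSp : ∀ v ∉ S, v.valuation F (ζ - 1) = 1)
    (hSb : b ∈ sUnits S) (hS : IsPrincipalAway S) :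
    (nmGroup p ζ (b : F)).relIndex (sUnits S) ≠ 0 ∧
    (nmGroup p ζ (b : F)).relIndex (sUnits S) * p ≤
      p ^ (S.filter fun v => b ∉ locPow p v).card := by
  have h2p : 2 < p := lt_of_le_of_ne hp.out.two_le hp2.symm
  have hζ' := h.root.map_of_injective (algebraMap F K).injective
  set t := (S.filter fun v => b ∉ locPow p v).card with ht
  set r := Fintype.card (InfinitePlace F) with hr
  have htS : t ≤ S.card := Finset.card_filter_le _ _
  have hrK : Fintype.card (InfinitePlace K) = p * r := by
    have h1 := finrank_eq_two_mul_card_infinitePlace h2p h.root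
    have h2 := finrank_eq_two_mul_card_infinitePlace h2p hζ'
    have h3 := Module.finrank_mul_finrank ℚ F K
    rw [h.finrank_eq, h1, h2] at h3
    linarith
  set τ := sUnitsConj (K := K) S σ with hτ
  have hτp : τ ^ p = 1 := by
    refine LinearMap.ext fun x => sUnitVal_injective ?_
    rw [sUnitVal_conj_pow, h.pow_eq_one]
    rfl
  have H90 : ∀ x, (∑ i ∈ Finset.range p, τ ^ i) x = 0 → ∃ y, τ y - y = x := by
    intro x hx
    have h1 := congrArg sUnitVal hx
    rw [sUnitVal_conj_sum, sUnitVal_zero] at h1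
    obtain ⟨y, hy, hyx⟩ := h.exists_sUnit_eq_div hSp hSb hS x.toMul.2 h1
    refine ⟨Additive.ofMul ⟨y, hy⟩, ?_⟩
    rw [sub_eq_iff_eq_add]
    exact sUnitVal_injective hyx
  have hζu : IsUnit ζ := (h.root.ne_zero hp.out.ne_zero).isUnit
  obtain ⟨Z, rfl⟩ := hζu
  have hZmem : Z ∈ sUnits S := fun v _ =>
    valuation_root_eq_one v hp.out.ne_zero h.root.pow_eq_one
  set z : Additive (sUnits (primesAbove K S)) :=
    sUnitsIncl K S (Additive.ofMul ⟨Z, hZmem⟩) with hz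
  have hzv : sUnitVal z = algebraMap F K Z := rfl
  have hz0 : z ≠ 0 := fun h0 => by
    rw [h0, sUnitVal_zero] at hzv
    exact hζ'.ne_one hp.out.one_lt hzv.symm
  have hpz : p • z = 0 := sUnitVal_injective (by
    rw [sUnitVal_nsmul, hzv, hζ'.pow_eq_one, sUnitVal_zero])
  have hzτ : τ z = z := sUnitVal_injective (by
    rw [hτ, sUnitVal_conj, hzv, AlgEquiv.commutes])
  have hU : (nsmulAddMonoidHom p : LinearMap.ker (τ - 1) →+ _).range.index ≤ p ^ (S.card + r) := by
    rw [← (index_range_nsmul_congr (h.sUnitsEquivKer S) p).1, index_range_nsmul_sUnits h.root S]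
  have hrank : Module.finrank ℤ (LinearMap.ker (τ - 1)) + (p - 1) * (S.card + r - t) ≤
      Module.finrank ℤ (Additive (sUnits (primesAbove K S))) := by
    have h1 := (h.sUnitsEquivKer S).toIntLinearEquiv.finrank_eq
    rw [← h1]
    have h2 := finrank_sUnits S
    have h3 := finrank_sUnits (primesAbove K S)
    have h4 := h.le_card_primesAbove S
    rw [hrK] at h3
    rw [← ht] at h4
    obtain ⟨q, hq⟩ := Nat.exists_eq_add_of_le hp.out.one_le
    obtain ⟨d, hd⟩ := Nat.exists_eq_add_of_le htS
    have h5 : S.card + r - t = d + r := by omega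
    have h6 : p - 1 = q := by omega
    rw [h6] at h4
    rw [h5, h6]
    rw [hd] at h2 h4
    rw [hq] at h3 h4
    nlinarith
  obtain ⟨hne, hle⟩ := index_norm_le τ hτp H90 hz0 hpz hzτ hU hrank
  set R := (LinearMap.range (∑ i ∈ Finset.range p, τ ^ i)).toAddSubgroup with hR
  have hidx : ((R.addSubgroupOf (LinearMap.ker (τ - 1)).toAddSubgroup).comap
      (h.sUnitsEquivKer S).toAddMonoidHom).index =
      R.relIndex (LinearMap.ker (τ - 1)).toAddSubgroup :=
    AddSubgroup.index_comap_of_surjective _ (h.sUnitsEquivKer S).surjective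
  set H := (R.addSubgroupOf (LinearMap.ker (τ - 1)).toAddSubgroup).comap
      (h.sUnitsEquivKer S).toAddMonoidHom with hH
  have hH2 : (AddSubgroup.toSubgroup' H).index = H.index := rfl
  have hsub : AddSubgroup.toSubgroup' H ≤ (nmGroup p (Z : F) (b : F)).subgroupOf (sUnits S) := by
    intro x hx
    obtain ⟨y, hy⟩ : Additive.ofMul x ∈ H := hx
    have h1 := congrArg sUnitVal hy
    rw [sUnitVal_conj_sum] at h1
    exact h.isKNorm_of_prod h1
  have hdvd := Subgroup.index_dvd_of_le hsub
  rw [hH2, hidx] at hdvd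
  rw [← Subgroup.relIndex] at hdvd
  refine ⟨ne_zero_of_dvd_ne_zero hne hdvd, ?_⟩
  have hle2 := Nat.le_of_dvd (Nat.pos_of_ne_zero hne) hdvd
  have h7 : p ^ (S.card + r) = p ^ t * p ^ (S.card + r - t) := by
    rw [← pow_add]
    congr 1
    omega
  rw [h7, pow_succ', ← mul_assoc] at hle
  exact (Nat.mul_le_mul_right p hle2).trans
    (Nat.le_of_mul_le_mul_right hle (pow_pos hp.out.pos _))

open Classical in
/-- The number of classes of `S`-units modulo norms from `F(b^{1/p})`. -/
theorem relIndex_nmGroup_sUnits (hp2 : p ≠ 2) (hζ : IsPrimitiveRoot ζ p) {b : Fˣ}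
    (hb : ∀ y : Fˣ, y ^ p ≠ b)
    {S : Finset (HeightOneSpectrum (𝓞 F))} (hSp : ∀ v ∉ S, v.valuation F (ζ - 1) = 1)
    (hSb : b ∈ sUnits S) (hS : IsPrincipalAway S) :
    (nmGroup p ζ (b : F)).relIndex (sUnits S) ≠ 0 ∧
    (nmGroup p ζ (b : F)).relIndex (sUnits S) * p ≤
      p ^ (S.filter fun v => b ∉ locPow p v).card := by
  have hirr : Irreducible (X ^ p - C (b : F)) := by
    refine X_pow_sub_C_irreducible_of_prime hp.out fun y hy => ?_
    have hy0 : y ≠ 0 := by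
      rintro rfl
      rw [zero_pow hp.out.ne_zero] at hy
      exact b.ne_zero hy.symm
    exact hb (Units.mk0 y hy0) (Units.ext hy)
  have := Fact.mk hirr
  obtain ⟨σ, h⟩ := exists_isKumExt hζ (Nat.cast_ne_zero.mpr hp.out.ne_zero) b.ne_zero hirr
  have : Module.Finite F (AdjoinRoot (X ^ p - C (b : F))) :=
    (monic_X_pow_sub_C _ hp.out.ne_zero).finite_adjoinRoot
  have : NumberField (AdjoinRoot (X ^ p - C (b : F))) := NumberField.of_module_finite F _
  exact h.relIndex_nmGroup_sUnits hp2 hSp hSb hS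
end F1

section large
variable {F : Type*} [Field F] [NumberField F] {p : ℕ} [hp : Fact p.Prime] {ζ : F}

/-- `S` contains the primes dividing `ζ - 1` and generators of the class group. -/
structure IsLarge (ζ : F) (S : Finset (HeightOneSpectrum (𝓞 F))) : Prop where
  sub_one : ∀ v ∉ S, v.valuation F (ζ - 1) = 1
  principal : IsPrincipalAway S

theorem IsLarge.mono {S T : Finset (HeightOneSpectrum (𝓞 F))} (hS : IsLarge ζ S) (h : S ⊆ T) :
    IsLarge ζ T := ⟨fun v hv => hS.sub_one v fun hvS => hv (h hvS), hS.principal.mono h⟩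

theorem exists_mem_sUnits (x : Fˣ) : ∃ S, x ∈ sUnits (F := F) S := by
  classical
  have h1 := HeightOneSpectrum.Support.finite (𝓞 F) (x : F)
  have h2 := HeightOneSpectrum.Support.finite (𝓞 F) ((x⁻¹ : Fˣ) : F)
  refine ⟨h1.toFinset ∪ h2.toFinset, fun v hv => ?_⟩
  rw [Finset.mem_union, Set.Finite.mem_toFinset, Set.Finite.mem_toFinset, not_or] at hv
  obtain ⟨h3, h4⟩ := hv
  have h3 : v.valuation F x ≤ 1 := not_lt.mp h3
  have h4 : v.valuation F ((x⁻¹ : Fˣ) : F) ≤ 1 := not_lt.mp h4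
  rw [Units.val_inv_eq_inv_val, map_inv₀] at h4
  exact le_antisymm h3 ((inv_le_one₀ (zero_lt_iff.mpr
    ((Valuation.ne_zero_iff _).mpr x.ne_zero))).mp h4)

theorem exists_isLarge (hζ : IsPrimitiveRoot ζ p) : ∃ S, IsLarge ζ S := by
  classical
  obtain ⟨S, hS⟩ := exists_isPrincipalAway F
  obtain ⟨T, hT⟩ := exists_mem_sUnits
    (Units.mk0 (ζ - 1) (sub_ne_zero.mpr (hζ.ne_one hp.out.one_lt)))
  exact ⟨S ∪ T, fun v hv => hT v fun h => hv (Finset.mem_union_right _ h),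
    hS.mono Finset.subset_union_left⟩

theorem exists_sUnits_sup_eq_top {Q : Subgroup Fˣ} (hQ : Q.index ≠ 0) :
    ∃ S, ∀ T, S ⊆ T → Q ⊔ sUnits T = ⊤ := by
  classical
  have hfin : Finite (Fˣ ⧸ Q) := Subgroup.index_ne_zero_iff_finite.mp hQ
  have := Fintype.ofFinite (Fˣ ⧸ Q)
  choose f hf using fun x : Fˣ => exists_mem_sUnits x
  refine ⟨Finset.univ.biUnion fun c : Fˣ ⧸ Q => f c.out, fun T hT => ?_⟩
  rw [eq_top_iff]
  intro x _
  have h1 : (QuotientGroup.mk (s := Q) (QuotientGroup.mk (s := Q) x).out) = QuotientGroup.mk x :=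
    QuotientGroup.out_eq' _
  set y := (QuotientGroup.mk (s := Q) x).out with hy
  have h2 : y ∈ sUnits T := by
    refine sUnits_mono (subset_trans ?_ hT) (hf y)
    exact Finset.subset_biUnion_of_mem (fun c : Fˣ ⧸ Q => f c.out) (Finset.mem_univ _)
  have h3 : y⁻¹ * x ∈ Q := QuotientGroup.eq.mp h1
  have h4 : x = (y⁻¹ * x) * y := by
    rw [mul_comm y⁻¹, inv_mul_cancel_right]
  rw [h4]
  exact Subgroup.mul_mem_sup h3 h2

theorem pow_mem_powRange (x : Fˣ) : x ^ p ∈ (powMonoidHom p : Fˣ →* Fˣ).range := ⟨x, rfl⟩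

theorem powRange_le_locPow (v : HeightOneSpectrum (𝓞 F)) :
    (powMonoidHom p : Fˣ →* Fˣ).range ≤ locPow p v := by
  rintro _ ⟨x, rfl⟩
  exact pow_mem_locPow v x

theorem relIndex_powRange_sUnits (hζ : IsPrimitiveRoot ζ p)
    (S : Finset (HeightOneSpectrum (𝓞 F))) :
    (powMonoidHom p : Fˣ →* Fˣ).range.relIndex (sUnits S) =
      p ^ (S.card + Fintype.card (InfinitePlace F)) := by
  rw [← index_range_nsmul_sUnits hζ S]
  have h1 : (powMonoidHom p : Fˣ →* Fˣ).range.subgroupOf (sUnits S) =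
      (powMonoidHom p : sUnits S →* sUnits S).range := by
    ext x
    refine ⟨fun ⟨y, hy⟩ => ?_, fun ⟨y, hy⟩ => ⟨y, congrArg Subtype.val hy⟩⟩
    have hyS : y ∈ sUnits S := by
      refine mem_sUnits_of_pow_mem hp.out.ne_zero (n := p) ?_
      have : y ^ p = x := hy
      rw [this]
      exact x.2
    exact ⟨⟨y, hyS⟩, Subtype.ext hy⟩
  rw [Subgroup.relIndex, h1]
  rfl

theorem index_locPow_ne_zero (hζ : IsPrimitiveRoot ζ p) (v : HeightOneSpectrum (𝓞 F)) :
    (locPow p v).index ≠ 0 := by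
  classical
  obtain ⟨S, hS⟩ := exists_isLarge hζ
  have h1 := (index_iInf_locPow hζ (hS.mono (Finset.subset_insert v S)).sub_one).1
  refine ne_zero_of_dvd_ne_zero h1 (Subgroup.index_dvd_of_le ?_)
  exact iInf₂_le v (Finset.mem_insert_self v S)

open Classical in
theorem pow_card_le_index_iInf (hζ : IsPrimitiveRoot ζ p) {S : Finset (HeightOneSpectrum (𝓞 F))}
    {R : HeightOneSpectrum (𝓞 F) → Subgroup Fˣ}
    (hRP : ∀ v ∈ S, locPow p v ≤ R v) (hR : ∀ v ∈ S, R v ≠ ⊤) :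
    (⨅ v ∈ S, R v).index = ∏ v ∈ S, (R v).index ∧ (∀ v ∈ S, p ≤ (R v).index) ∧
    p ^ S.card ≤ (⨅ v ∈ S, R v).index ∧ (⨅ v ∈ S, R v).index ≠ 0 := by
  have h1 := index_iInf_eq_prod S (exists_div_mem_locPow hζ S) hRP
  have h0 : ∀ v ∈ S, (R v).index ≠ 0 := fun v hv =>
    ne_zero_of_dvd_ne_zero (index_locPow_ne_zero hζ v) (Subgroup.index_dvd_of_le (hRP v hv))
  have h2 : ∀ v ∈ S, p ≤ (R v).index := fun v hv =>
    Nat.le_of_dvd (Nat.pos_of_ne_zero (h0 v hv))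
      (prime_dvd_index (fun x => hRP v hv (pow_mem_locPow v x)) (h0 v hv) (hR v hv))
  refine ⟨h1, h2, ?_, ?_⟩
  · rw [h1]
    exact Finset.pow_card_le_prod _ _ _ h2
  · rw [h1]
    exact Finset.prod_ne_zero_iff.mpr h0

open Classical in
theorem relIndex_iInf_mul_le (hp2 : p ≠ 2) (hζ : IsPrimitiveRoot ζ p) {b : Fˣ}
    (hb : b ∉ (powMonoidHom p : Fˣ →* Fˣ).range)
    {S : Finset (HeightOneSpectrum (𝓞 F))} (hS : IsLarge ζ S) (hSb : b ∈ sUnits S)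
    {Q : Subgroup Fˣ} (hQ : nmGroup p ζ (b : F) ≤ Q) :
    (nmGroup p ζ (b : F)).relIndex (sUnits S) ≠ 0 ∧
    Q.relIndex (sUnits S) ≤ (nmGroup p ζ (b : F)).relIndex (sUnits S) ∧
    (nmGroup p ζ (b : F)).relIndex (sUnits S) * p ≤
      p ^ (S.filter fun v => b ∉ locPow p v).card := by
  obtain ⟨h1, h2⟩ := relIndex_nmGroup_sUnits hp2 hζ (fun y hy => hb ⟨y, hy⟩) hS.sub_one hSb
    hS.principal
  exact ⟨h1, Nat.le_of_dvd (Nat.pos_of_ne_zero h1) (Subgroup.relIndex_dvd_of_le_left _ hQ), h2⟩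

open Classical in
/-- A weak form of reciprocity. -/
theorem iInf_locNm_sup_sUnits_ne_top (hp2 : p ≠ 2) (hζ : IsPrimitiveRoot ζ p) {b : Fˣ}
    (hb : b ∉ (powMonoidHom p : Fˣ →* Fˣ).range)
    {S : Finset (HeightOneSpectrum (𝓞 F))} (hS : IsLarge ζ S) (hSb : b ∈ sUnits S) :
    (⨅ v ∈ S.filter fun v => b ∉ locPow p v, locNm p ζ v (b : F)) ⊔ sUnits S ≠ ⊤ := by
  intro htop
  obtain ⟨-, -, h1, -⟩ := pow_card_le_index_iInf hζ (S := S.filter fun v => b ∉ locPow p v)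
    (R := fun v => locNm p ζ v (b : F)) (fun v _ => locPow_le_locNm _)
    (fun v hv => locNm_ne_top hp2 hζ (Finset.mem_filter.mp hv).2)
  obtain ⟨h0, h2, h3⟩ := relIndex_iInf_mul_le hp2 hζ hb hS hSb
    (Q := ⨅ v ∈ S.filter fun v => b ∉ locPow p v, locNm p ζ v (b : F))
    (le_iInf₂ fun v _ => nmGroup_le_locNm _)
  rw [relIndex_eq_index_of_sup_eq_top htop] at h2
  have h4 := hp.out.two_le
  have h5 := Nat.pos_of_ne_zero h0
  nlinarith

/-- A non-`p`-th power fails to be a `p`-th power locally at infinitely many primes. -/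
theorem exists_not_mem_locPow (hp2 : p ≠ 2) (hζ : IsPrimitiveRoot ζ p) {b : Fˣ}
    (hb : b ∉ (powMonoidHom p : Fˣ →* Fˣ).range) (A : Finset (HeightOneSpectrum (𝓞 F))) :
    ∃ v ∉ A, b ∉ locPow p v := by
  classical
  by_contra! hall
  set E := A.filter fun v => b ∉ locPow p v with hE
  obtain ⟨-, -, -, h1⟩ := pow_card_le_index_iInf hζ (S := E)
    (R := fun v => locNm p ζ v (b : F)) (fun v _ => locPow_le_locNm _)
    (fun v hv => locNm_ne_top hp2 hζ (Finset.mem_filter.mp hv).2)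
  obtain ⟨S₁, hS₁⟩ := exists_sUnits_sup_eq_top h1
  obtain ⟨S₂, hS₂⟩ := exists_isLarge hζ
  obtain ⟨S₃, hS₃⟩ := exists_mem_sUnits b
  set S := A ∪ S₁ ∪ S₂ ∪ S₃ with hS
  have hES : (S.filter fun v => b ∉ locPow p v) = E := by
    ext v
    rw [hE, Finset.mem_filter, Finset.mem_filter]
    refine ⟨fun h => ⟨by_contra fun hA => h.2 (hall v hA), h.2⟩, fun h => ⟨?_, h.2⟩⟩
    simp [hS, h.1]
  refine iInf_locNm_sup_sUnits_ne_top hp2 hζ hb (S := S) (hS₂.mono fun v hv => by simp [hS, hv])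
    (sUnits_mono (fun v hv => by simp [hS, hv]) hS₃) ?_
  rw [hES]
  exact hS₁ S fun v hv => by simp [hS, hv]

/-- An element which is locally a `p`-th power at `S` and an `S ∪ T`-unit is a `p`-th power. -/
theorem mem_powRange_of_locPow [DecidableEq (HeightOneSpectrum (𝓞 F))]
    (hp2 : p ≠ 2) (hζ : IsPrimitiveRoot ζ p) {S T : Finset (HeightOneSpectrum (𝓞 F))}
    (hS : IsLarge ζ S) (hST : Disjoint S T)
    (hT : (⨅ v ∈ T, unitsAt (F := F) v) ≤ sUnits S ⊔ ⨅ v ∈ T, locPow p v) {x : Fˣ}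
    (hx : x ∈ sUnits (S ∪ T)) (hxS : ∀ v ∈ S, x ∈ locPow p v) :
    x ∈ (powMonoidHom p : Fˣ →* Fˣ).range := by
  classical
  by_contra hxp
  refine iInf_locNm_sup_sUnits_ne_top hp2 hζ hxp (hS.mono Finset.subset_union_left) hx ?_
  rw [eq_top_iff]
  intro y _
  obtain ⟨u, hu, hyu⟩ := hS.principal.exists_sUnit hST y
  have h1 : y / u ∈ sUnits S ⊔ ⨅ v ∈ T, locPow p v :=
    hT (by
      simp only [Subgroup.mem_iInf]
      exact fun v hv => mem_unitsAt.mpr (hyu v hv))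
  obtain ⟨s, hs, g, hg, hsg⟩ := Subgroup.mem_sup.mp h1
  have h2 : y = g * (s * u) := by
    rw [← mul_assoc, mul_comm g, hsg, div_mul_cancel]
  rw [h2]
  refine Subgroup.mul_mem_sup ?_ (mul_mem (sUnits_mono Finset.subset_union_left hs) hu)
  simp only [Subgroup.mem_iInf] at hg ⊢
  intro v hv
  rw [Finset.mem_filter, Finset.mem_union] at hv
  exact locPow_le_locNm _ (hg v (hv.1.resolve_left fun h => hv.2 (hxS v h)))
end large

section groups
variable {A : Type*} [CommGroup A] {p : ℕ} [hp : Fact p.Prime]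

theorem eq_top_of_lt_of_index_le {P H : Subgroup A} (hP : ∀ x, x ^ p ∈ P) (h0 : P.index ≠ 0)
    (hle : P.index ≤ p) (hPH : P < H) : H = ⊤ := by
  by_contra hH
  have h1 := Subgroup.relIndex_mul_index hPH.le
  have hH0 : H.index ≠ 0 := fun h => h0 (by rw [← h1, h, mul_zero])
  have h2 := Nat.le_of_dvd (Nat.pos_of_ne_zero hH0)
    (prime_dvd_index (fun x => hPH.le (hP x)) hH0 hH)
  have h3 : P.relIndex H ≠ 0 := fun h => h0 (by rw [← h1, h, zero_mul])
  have h4 : P.relIndex H = 1 := by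
    have := hp.out.pos
    have : P.relIndex H * H.index ≤ 1 * H.index := by rw [h1]; omega
    have := Nat.le_of_mul_le_mul_right this (Nat.pos_of_ne_zero hH0)
    omega
  exact hPH.not_ge (Subgroup.relIndex_eq_one.mp h4)

theorem le_zpowers_sup_of_relIndex_le {P O : Subgroup A} (hP : ∀ x, x ^ p ∈ P)
    (h0 : P.relIndex O ≠ 0) (hle : P.relIndex O ≤ p) {b : A} (hbO : b ∈ O) (hb : b ∉ P) :
    O ≤ Subgroup.zpowers b ⊔ P := by
  have h1 := eq_top_of_lt_of_index_le (p := p) (P := P.subgroupOf O)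
    (H := (Subgroup.zpowers b ⊔ P).subgroupOf O) (fun x => hP x) h0 hle ?_
  · rwa [Subgroup.subgroupOf_eq_top] at h1
  · refine lt_of_le_of_ne (fun x hx => (le_sup_right : P ≤ _) hx) fun heq => hb ?_
    have h2 : (⟨b, hbO⟩ : O) ∈ (Subgroup.zpowers b ⊔ P).subgroupOf O :=
      (le_sup_left : Subgroup.zpowers b ≤ _) (Subgroup.mem_zpowers b)
    rw [← heq] at h2
    exact h2

theorem relIndex_eq_prime {P U : Subgroup A} (hP : ∀ x, x ^ p ∈ P)
    (h0 : P.relIndex U ≠ 0) (hle : P.relIndex U ≤ p) {u : A} (hu : u ∈ U) (huP : u ∉ P) :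
    P.relIndex U = p := by
  refine le_antisymm hle (Nat.le_of_dvd (Nat.pos_of_ne_zero h0)
    (prime_dvd_index (H := P.subgroupOf U) (fun x => hP x) h0 ?_))
  rw [ne_eq, Subgroup.subgroupOf_eq_top]
  exact fun h => huP (h hu)

theorem relIndex_zpowers_sup_le {P : Subgroup A} (hP : ∀ x, x ^ p ∈ P) (b : A) :
    P.relIndex (Subgroup.zpowers b ⊔ P) ≠ 0 ∧ P.relIndex (Subgroup.zpowers b ⊔ P) ≤ p := by
  rw [Subgroup.relIndex_sup_right, Subgroup.relIndex, Subgroup.index]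
  set g : Subgroup.zpowers b ⧸ P.subgroupOf (Subgroup.zpowers b) :=
    QuotientGroup.mk ⟨b, Subgroup.mem_zpowers b⟩ with hg
  have h1 : ∀ x, x ∈ Subgroup.zpowers g := by
    intro x
    obtain ⟨⟨y, hy⟩, rfl⟩ := QuotientGroup.mk_surjective x
    obtain ⟨n, rfl⟩ := hy
    exact ⟨n, rfl⟩
  have h2 : g ^ p = 1 := (QuotientGroup.eq_one_iff _).mpr (hP b)
  rw [← orderOf_eq_card_of_forall_mem_zpowers h1]
  exact ⟨((isOfFinOrder_iff_pow_eq_one).mpr ⟨p, hp.out.pos, h2⟩).orderOf_pos.ne',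
    orderOf_le_of_pow_eq_one hp.out.pos h2⟩

theorem relIndex_iInf_le {ι : Type*} {P O : ι → Subgroup A} (T : Finset ι)
    (h : ∀ i ∈ T, (P i).relIndex (O i) ≠ 0 ∧ (P i).relIndex (O i) ≤ p) :
    (⨅ i ∈ T, P i).relIndex (⨅ i ∈ T, O i) ≠ 0 ∧
    (⨅ i ∈ T, P i).relIndex (⨅ i ∈ T, O i) ≤ p ^ T.card := by
  classical
  induction T using Finset.induction_on with
  | empty => simp
  | insert a T ha ih =>
    obtain ⟨h1, h2⟩ := ih fun i hi => h i (Finset.mem_insert_of_mem hi)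
    obtain ⟨h3, h4⟩ := h a (Finset.mem_insert_self a T)
    rw [Finset.iInf_insert, Finset.iInf_insert, Finset.card_insert_of_notMem ha]
    set G := ⨅ i ∈ T, P i
    set N := ⨅ i ∈ T, O i
    have h5 := Subgroup.relIndex_le_of_le_right (inf_le_left : O a ⊓ N ≤ O a) h3
    have h6 := Subgroup.relIndex_le_of_le_right (inf_le_right : O a ⊓ N ≤ N) h1
    refine ⟨?_, ?_⟩
    · exact Subgroup.relIndex_inf_ne_zero
        (fun h => h3 (Subgroup.relIndex_eq_zero_of_le_right inf_le_left h))
        (fun h => h1 (Subgroup.relIndex_eq_zero_of_le_right inf_le_right h))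
    · refine Subgroup.relIndex_inf_le.trans ?_
      rw [pow_succ']
      exact Nat.mul_le_mul (h5.trans h4) (h6.trans h2)

theorem le_sup_of_relIndex_ge {G U O : Subgroup A} (hUO : U ≤ O) (h0 : G.relIndex O ≠ 0)
    (hle : G.relIndex O ≤ G.relIndex U) : O ≤ U ⊔ G := by
  have h1 := Subgroup.relIndex_inf_mul_relIndex G (G ⊔ U) O
  rw [inf_eq_left.mpr (le_sup_left : G ≤ G ⊔ U)] at h1
  have h2 : G.relIndex ((G ⊔ U) ⊓ O) ≠ 0 := fun h => h0 (by rw [← h1, h, zero_mul])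
  have h3 : G.relIndex U ≤ G.relIndex ((G ⊔ U) ⊓ O) :=
    Subgroup.relIndex_le_of_le_right (le_inf le_sup_right hUO) h2
  have h4 : (G ⊔ U).relIndex O ≠ 0 := fun h => h0 (by rw [← h1, h, mul_zero])
  have h5 : (G ⊔ U).relIndex O = 1 := by
    have h6 : G.relIndex ((G ⊔ U) ⊓ O) * (G ⊔ U).relIndex O ≤ G.relIndex ((G ⊔ U) ⊓ O) * 1 := by
      rw [h1, mul_one]
      exact hle.trans h3
    have := Nat.le_of_mul_le_mul_left h6 (Nat.pos_of_ne_zero h2)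
    omega
  rw [sup_comm]
  exact Subgroup.relIndex_eq_one.mp h5

end groups

theorem IsKumExt.exists_pow_mul_pow_eq {F K : Type*} [Field F] [Field K] [Algebra F K] {n : ℕ}
    {ζ b : F} {σ : K ≃ₐ[F] K} {β : K} (h : IsKumExt n ζ b σ β) {u : F} {y : K} (hu : u ≠ 0)
    (hy : y ^ n = algebraMap F K u) : ∃ (c : F) (i : ℕ), c ^ n * b ^ i = u := by
  have hζ' := h.root.map_of_injective (algebraMap F K).injective
  have hn : NeZero n := ⟨h.n_ne_zero⟩
  have hy0 : y ≠ 0 := by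
    rintro rfl
    rw [zero_pow h.n_ne_zero] at hy
    exact hu ((map_eq_zero_iff _ (algebraMap F K).injective).mp hy.symm)
  have h1 : (σ y / y) ^ n = 1 := by
    rw [div_pow, ← map_pow, hy, AlgEquiv.commutes, div_self]
    rw [← hy]
    exact pow_ne_zero n hy0
  obtain ⟨i, -, hi⟩ := hζ'.eq_pow_of_pow_eq_one h1
  have h2 : σ (y / β ^ i) = y / β ^ i := by
    have hζ0 : algebraMap F K ζ ≠ 0 := hζ'.ne_zero h.n_ne_zero
    have hβ0 := h.beta_ne_zero
    rw [eq_div_iff hy0] at hi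
    rw [map_div₀, map_pow, h.apply_eq, ← hi, mul_pow]
    field_simp
  obtain ⟨c, hc⟩ := h.mem_base_of_fixed h2
  refine ⟨c, i, (algebraMap F K).injective ?_⟩
  rw [map_mul, map_pow, map_pow, hc, ← h.pow_eq, div_pow, hy, ← pow_mul, ← pow_mul, mul_comm n i,
    div_mul_cancel₀ _ (pow_ne_zero _ h.beta_ne_zero)]

section hasse
variable {F : Type*} [Field F] [NumberField F] {p : ℕ} [hp : Fact p.Prime] {ζ : F}

theorem irreducible_X_pow_sub_C {b : Fˣ} (hb : b ∉ (powMonoidHom p : Fˣ →* Fˣ).range) :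
    Irreducible (X ^ p - C (b : F)) := by
  refine X_pow_sub_C_irreducible_of_prime hp.out fun y hy => ?_
  have hy0 : y ≠ 0 := by
    rintro rfl
    rw [zero_pow hp.out.ne_zero] at hy
    exact b.ne_zero hy.symm
  exact hb ⟨Units.mk0 y hy0, Units.ext hy⟩

theorem IsKumExt.mem_zpowers_sup {K : Type*} [Field K] [Algebra F K] {b : Fˣ} {σ : K ≃ₐ[F] K}
    {β : K} (h : IsKumExt p ζ (b : F) σ β) {u : Fˣ}
    (hu : Units.map (algebraMap F K : F →* K) u ∈ (powMonoidHom p : Kˣ →* Kˣ).range) :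
    u ∈ Subgroup.zpowers b ⊔ (powMonoidHom p : Fˣ →* Fˣ).range := by
  obtain ⟨y, hy⟩ := hu
  obtain ⟨c, i, hc⟩ := h.exists_pow_mul_pow_eq u.ne_zero (congrArg Units.val hy)
  have hc0 : c ≠ 0 := by
    rintro rfl
    rw [zero_pow hp.out.ne_zero, zero_mul] at hc
    exact u.ne_zero hc.symm
  have h1 : u = b ^ i * Units.mk0 c hc0 ^ p := Units.ext (by
    rw [← hc, mul_comm]
    simp)
  rw [h1]
  exact Subgroup.mul_mem_sup (Subgroup.npow_mem_zpowers b i) (pow_mem_powRange _)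

theorem exists_mem_locPow_not_mem (hp2 : p ≠ 2) (hζ : IsPrimitiveRoot ζ p) {b u : Fˣ}
    (hu : u ∉ Subgroup.zpowers b ⊔ (powMonoidHom p : Fˣ →* Fˣ).range)
    (A : Finset (HeightOneSpectrum (𝓞 F))) :
    ∃ v ∉ A, b ∈ locPow p v ∧ u ∉ locPow p v := by
  classical
  by_cases hb : b ∈ (powMonoidHom p : Fˣ →* Fˣ).range
  · obtain ⟨v, hv, huv⟩ := exists_not_mem_locPow hp2 hζ (fun h => hu (Subgroup.mem_sup_right h)) A
    exact ⟨v, hv, powRange_le_locPow v hb, huv⟩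
  have hirr := irreducible_X_pow_sub_C hb
  have := Fact.mk hirr
  obtain ⟨σ, h⟩ := exists_isKumExt hζ (Nat.cast_ne_zero.mpr hp.out.ne_zero) b.ne_zero hirr
  have : Module.Finite F (AdjoinRoot (X ^ p - C (b : F))) :=
    (monic_X_pow_sub_C _ hp.out.ne_zero).finite_adjoinRoot
  have : NumberField (AdjoinRoot (X ^ p - C (b : F))) := NumberField.of_module_finite F _
  set K := AdjoinRoot (X ^ p - C (b : F))
  have hζ' := hζ.map_of_injective (algebraMap F K).injective
  obtain ⟨S₁, hS₁⟩ := exists_isLarge hζ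
  obtain ⟨S₂, hS₂⟩ := exists_mem_sUnits b
  obtain ⟨S₃, hS₃⟩ := exists_mem_sUnits u
  obtain ⟨w, hw, huw⟩ := exists_not_mem_locPow hp2 hζ' (fun h' => hu (h.mem_zpowers_sup h'))
    (primesAbove K (A ∪ S₁ ∪ S₂ ∪ S₃))
  simp only [mem_primesAbove, Finset.mem_union, not_or] at hw
  obtain ⟨⟨⟨hwA, hw1⟩, hw2⟩, hw3⟩ := hw
  have huv : u ∉ locPow p (primeBelow F w) := fun h' => huw (map_mem_locPow hζ w h')
  refine ⟨primeBelow F w, hwA, ?_, huv⟩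
  by_contra hbv
  have h1 := relIndex_locPow_unitsAt hζ (hS₁.sub_one _ hw1)
  have h2 := le_zpowers_sup_of_relIndex_le (fun x => pow_mem_locPow (primeBelow F w) x) h1.1 h1.2
    (mem_unitsAt.mpr (hS₂ _ hw2)) hbv (mem_unitsAt.mpr (hS₃ _ hw3))
  obtain ⟨x, hx, y, hy, hxy⟩ := Subgroup.mem_sup.mp h2
  obtain ⟨i, rfl⟩ := hx
  refine huw ?_
  change Units.map (algebraMap F K).toMonoidHom u ∈ _
  rw [← hxy, map_mul]
  refine mul_mem ?_ (map_mem_locPow hζ w hy)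
  have h3 : Units.map (algebraMap F K).toMonoidHom b ∈ locPow p w := by
    refine powRange_le_locPow w ⟨Units.mk0 _ h.beta_ne_zero, Units.ext ?_⟩
    exact h.pow_eq
  simp only [map_zpow]
  exact zpow_mem h3 i

theorem exists_finset_relIndex [DecidableEq (HeightOneSpectrum (𝓞 F))] (hp2 : p ≠ 2) (hζ : IsPrimitiveRoot ζ p)
    {S : Finset (HeightOneSpectrum (𝓞 F))} (hS : IsLarge ζ S) (b : Fˣ)
    (A : Finset (HeightOneSpectrum (𝓞 F))) {j : ℕ}
    (hj : p ^ j ≤ (Subgroup.zpowers b ⊔ (powMonoidHom p : Fˣ →* Fˣ).range).relIndex (sUnits S)) :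
    ∃ T : Finset (HeightOneSpectrum (𝓞 F)), T.card = j ∧ Disjoint T (S ∪ A) ∧
      (∀ v ∈ T, b ∈ locPow p v) ∧ (⨅ v ∈ T, locPow p v).relIndex (sUnits S) = p ^ j := by
  induction j with
  | zero => exact ⟨∅, by simp⟩
  | succ j ih =>
    set D := Subgroup.zpowers b ⊔ (powMonoidHom p : Fˣ →* Fˣ).range with hD
    obtain ⟨T, hTj, hTA, hTb, hT⟩ := ih
      ((Nat.pow_le_pow_right hp.out.pos (Nat.le_succ j)).trans hj)
    set G := ⨅ v ∈ T, locPow (F := F) p v with hG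
    have hlt : p ^ j < p ^ (j + 1) := Nat.pow_lt_pow_right hp.out.one_lt (Nat.lt_succ_self j)
    have h1 : ¬ (G ⊓ sUnits S ≤ D) := by
      intro hle
      have h2 := Subgroup.relIndex_dvd_of_le_left (sUnits S) hle
      rw [Subgroup.inf_relIndex_right, hT] at h2
      have := Nat.le_of_dvd (pow_pos hp.out.pos _) h2
      omega
    obtain ⟨u, ⟨huG, huS⟩, huD⟩ := SetLike.not_le_iff_exists.mp h1
    obtain ⟨v, hv, hvb, hvu⟩ := exists_mem_locPow_not_mem hp2 hζ huD (S ∪ A ∪ T)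
    rw [Finset.mem_union, not_or] at hv
    have hvS : v ∉ S := fun h => hv.1 (Finset.mem_union_left _ h)
    refine ⟨insert v T, ?_, ?_, ?_, ?_⟩
    · rw [Finset.card_insert_of_notMem hv.2, hTj]
    · exact Finset.disjoint_insert_left.mpr ⟨hv.1, hTA⟩
    · intro w hw
      rcases Finset.mem_insert.mp hw with rfl | hw
      · exact hvb
      · exact hTb w hw
    · rw [Finset.iInf_insert, ← Subgroup.relIndex_inf_mul_relIndex, hT, pow_succ']
      congr 1
      have h2 := relIndex_locPow_unitsAt hζ (hS.sub_one v hvS)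
      have h3 : G ⊓ sUnits S ≤ unitsAt v := fun x hx => mem_unitsAt.mpr (hx.2 v hvS)
      exact relIndex_eq_prime (fun x => pow_mem_locPow v x)
        (fun h => h2.1 (Subgroup.relIndex_eq_zero_of_le_right h3 h))
        ((Subgroup.relIndex_le_of_le_right h3 h2.1).trans h2.2) ⟨huG, huS⟩ hvu

theorem pow_le_relIndex_zpowers_sup (hζ : IsPrimitiveRoot ζ p)
    (S : Finset (HeightOneSpectrum (𝓞 F))) (b : Fˣ) :
    p ^ (S.card + Fintype.card (InfinitePlace F) - 1) ≤
      (Subgroup.zpowers b ⊔ (powMonoidHom p : Fˣ →* Fˣ).range).relIndex (sUnits S) := by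
  set D := Subgroup.zpowers b ⊔ (powMonoidHom p : Fˣ →* Fˣ).range with hD
  have h1 := Subgroup.relIndex_inf_mul_relIndex (powMonoidHom p : Fˣ →* Fˣ).range D (sUnits S)
  rw [inf_eq_left.mpr (le_sup_right : _ ≤ D), relIndex_powRange_sUnits hζ] at h1
  have h2 := relIndex_zpowers_sup_le (p := p) (P := (powMonoidHom p : Fˣ →* Fˣ).range)
    (fun x => pow_mem_powRange x) b
  have h3 := (Subgroup.relIndex_le_of_le_right (inf_le_left : D ⊓ sUnits S ≤ D) h2.1).trans h2.2
  have h4 : 0 < Fintype.card (InfinitePlace F) := Fintype.card_pos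
  obtain ⟨m, hm⟩ : ∃ m, S.card + Fintype.card (InfinitePlace F) = m + 1 :=
    ⟨_, (Nat.succ_pred_eq_of_pos (by omega)).symm⟩
  rw [hm, pow_succ'] at h1
  rw [hm, Nat.add_sub_cancel]
  refine Nat.le_of_mul_le_mul_left ?_ hp.out.pos
  rw [← h1]
  exact Nat.mul_le_mul_right _ h3

theorem index_sup_sUnits_mul_le [DecidableEq (HeightOneSpectrum (𝓞 F))]
    (hp2 : p ≠ 2) (hζ : IsPrimitiveRoot ζ p)
    {S T : Finset (HeightOneSpectrum (𝓞 F))} (hS : IsLarge ζ S) (hST : Disjoint S T)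
    (hT : (⨅ v ∈ T, locPow p v).relIndex (sUnits S) = p ^ T.card) :
    ((⨅ v ∈ S, locPow p v) ⊔ sUnits (S ∪ T)).index ≠ 0 ∧
    ((⨅ v ∈ S, locPow p v) ⊔ sUnits (S ∪ T)).index * p ^ T.card ≤
      p ^ (S.card + Fintype.card (InfinitePlace F)) := by
  have h2p : 2 < p := lt_of_le_of_ne hp.out.two_le hp2.symm
  set r := Fintype.card (InfinitePlace F) with hr
  set G := ⨅ v ∈ S, locPow (F := F) p v with hG
  set V := sUnits (F := F) (S ∪ T) with hV
  obtain ⟨h1, h2⟩ := index_iInf_locPow hζ hS.sub_one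
  rw [finrank_eq_two_mul_card_infinitePlace h2p hζ] at h2
  have hTS : ∀ v ∈ T, v ∉ S := fun v hv hvS => Finset.disjoint_left.mp hST hvS hv
  obtain ⟨h3, h4⟩ := relIndex_iInf_le (p := p) (P := fun v => locPow (F := F) p v)
    (O := fun v => unitsAt (F := F) v) T
    fun v hv => relIndex_locPow_unitsAt hζ (hS.sub_one v (hTS v hv))
  have h5 : (⨅ v ∈ T, unitsAt (F := F) v) ≤ sUnits S ⊔ ⨅ v ∈ T, locPow p v := by
    refine le_sup_of_relIndex_ge (le_iInf₂ fun v hv x hx => mem_unitsAt.mpr (hx v (hTS v hv))) h3 ?_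
    rw [hT]
    exact h4
  have h6 : G ⊓ V ≤ (powMonoidHom p : Fˣ →* Fˣ).range := by
    rintro x ⟨hxG, hxV⟩
    have hxG : x ∈ ⨅ v ∈ S, locPow (F := F) p v := hxG
    simp only [Subgroup.mem_iInf] at hxG
    exact mem_powRange_of_locPow hp2 hζ hS hST h5 hxV hxG
  have h7 := relIndex_mul_index_sup G V
  have h8 : G.relIndex V ≠ 0 := fun h => h1 (by rw [← h7, h, zero_mul])
  have h9 : p ^ (S.card + T.card + r) ≤ G.relIndex V := by
    rw [← Finset.card_union_of_disjoint hST, hr, ← relIndex_powRange_sUnits hζ, ← hV,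
      ← Subgroup.inf_relIndex_right G V]
    refine Nat.le_of_dvd ?_ (Subgroup.relIndex_dvd_of_le_left V h6)
    rw [Subgroup.inf_relIndex_right G V]
    exact Nat.pos_of_ne_zero h8
  refine ⟨fun h => h1 (by rw [← h7, h, mul_zero]), ?_⟩
  refine Nat.le_of_mul_le_mul_left ?_ (pow_pos hp.out.pos (S.card + r))
  calc p ^ (S.card + r) * ((G ⊔ V).index * p ^ T.card)
      = p ^ (S.card + T.card + r) * (G ⊔ V).index := by ring
    _ ≤ G.relIndex V * (G ⊔ V).index := Nat.mul_le_mul_right _ h9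
    _ = G.index := h7
    _ ≤ p ^ (2 * S.card + 2 * r) := h2
    _ = p ^ (S.card + r) * p ^ (S.card + r) := by ring
end hasse

section hasse
variable {F : Type*} [Field F] [NumberField F] {p : ℕ} [hp : Fact p.Prime] {ζ : F}

theorem iInf_locPow_sup_sUnits_eq_top [DecidableEq (HeightOneSpectrum (𝓞 F))]
    (hp2 : p ≠ 2) (hζ : IsPrimitiveRoot ζ p)
    {S T : Finset (HeightOneSpectrum (𝓞 F))} (hS : IsLarge ζ S) (hST : Disjoint S T)
    (hcard : T.card = S.card + Fintype.card (InfinitePlace F))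
    (hT : (⨅ v ∈ T, locPow p v).relIndex (sUnits S) = p ^ T.card) :
    (⨅ v ∈ S, locPow p v) ⊔ sUnits (S ∪ T) = ⊤ := by
  obtain ⟨h1, h2⟩ := index_sup_sUnits_mul_le hp2 hζ hS hST hT
  rw [hcard, ← Subgroup.index_eq_one] at *
  have h3 := Nat.le_of_mul_le_mul_right (h2.trans_eq (one_mul _).symm) (pow_pos hp.out.pos _)
  omega

/-- A Hasse norm principle for `F(b^{1/p})`, for `S`-units. -/
theorem mem_nmGroup_of_forall (hp2 : p ≠ 2) (hζ : IsPrimitiveRoot ζ p) {b : Fˣ}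
    (hb : b ∉ (powMonoidHom p : Fˣ →* Fˣ).range)
    {S : Finset (HeightOneSpectrum (𝓞 F))} (hS : IsLarge ζ S) (hSb : b ∈ sUnits S)
    {R : HeightOneSpectrum (𝓞 F) → Subgroup Fˣ}
    (hRP : ∀ v ∈ S, b ∉ locPow p v → locPow p v ≤ R v)
    (hRN : ∀ v ∈ S, b ∉ locPow p v → nmGroup p ζ (b : F) ≤ R v)
    (hR : ∀ v ∈ S, b ∉ locPow p v → R v ≠ ⊤) :
    (∀ v ∈ S, b ∉ locPow p v → (R v).index = p) ∧
    ∀ y ∈ sUnits S, (∀ v ∈ S, b ∉ locPow p v → y ∈ R v) → y ∈ nmGroup p ζ (b : F) := by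
  classical
  obtain ⟨T, hTc, hTS, hTb, hT⟩ := exists_finset_relIndex hp2 hζ hS b ∅
    (pow_le_relIndex_zpowers_sup hζ S b)
  rw [Finset.union_empty, disjoint_comm] at hTS
  rw [← hTc] at hT
  have hr : 0 < Fintype.card (InfinitePlace F) := Fintype.card_pos
  obtain ⟨h1, h2⟩ := index_sup_sUnits_mul_le hp2 hζ hS hTS hT
  set E := S.filter fun v => b ∉ locPow p v with hE
  have hmem : ∀ v ∈ E, v ∈ S ∧ b ∉ locPow p v := fun v hv => Finset.mem_filter.mp hv
  have hE' : ((S ∪ T).filter fun v => b ∉ locPow p v) = E := by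
    rw [Finset.filter_union, Finset.filter_eq_empty_iff.mpr fun v hv => not_not.mpr (hTb v hv),
      Finset.union_empty]
  set Q := ⨅ v ∈ E, R v with hQ
  set V := sUnits (F := F) (S ∪ T) with hV
  obtain ⟨h3, h4, h5, h6⟩ := pow_card_le_index_iInf hζ (S := E) (R := R)
    (fun v hv => hRP v (hmem v hv).1 (hmem v hv).2) (fun v hv => hR v (hmem v hv).1 (hmem v hv).2)
  have hNQ : nmGroup p ζ (b : F) ≤ Q := le_iInf₂ fun v hv => hRN v (hmem v hv).1 (hmem v hv).2
  obtain ⟨h7, h8, h9⟩ := relIndex_iInf_mul_le hp2 hζ hb (hS.mono Finset.subset_union_left)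
    (sUnits_mono (Finset.subset_union_left (s₂ := T)) hSb) hNQ
  rw [hE'] at h9
  have h10 : (Q ⊔ V).index ≤ p := by
    have h11 : (⨅ v ∈ S, locPow (F := F) p v) ⊔ V ≤ Q ⊔ V := by
      refine sup_le_sup_right (le_iInf₂ fun v hv => ?_) V
      exact (iInf₂_le v (hmem v hv).1).trans (hRP v (hmem v hv).1 (hmem v hv).2)
    refine (Nat.le_of_dvd (Nat.pos_of_ne_zero h1) (Subgroup.index_dvd_of_le h11)).trans ?_
    refine Nat.le_of_mul_le_mul_right (h2.trans_eq ?_) (pow_pos hp.out.pos T.card)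
    rw [← pow_succ', hTc]
    congr 1
    omega
  have h12 := relIndex_mul_index_sup Q V
  have h13 : Q.relIndex V ≠ 0 := fun h => h6 (by rw [← h12, h, zero_mul])
  have h14 : Q.index ≤ Q.relIndex V * p := by
    rw [← h12]
    exact Nat.mul_le_mul_left _ h10
  have h15 : (nmGroup p ζ (b : F)).relIndex V = Q.relIndex V := by
    refine le_antisymm ?_ h8
    exact Nat.le_of_mul_le_mul_right (h9.trans (h5.trans h14)) hp.out.pos
  have h16 : Q.index = p ^ E.card :=
    le_antisymm (h14.trans (by rw [← h15]; exact h9)) h5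
  refine ⟨fun v hv hbv => ?_, fun y hy hyR => ?_⟩
  · by_contra hne
    have hvE : v ∈ E := Finset.mem_filter.mpr ⟨hv, hbv⟩
    have h17 : ∏ _v ∈ E, p < ∏ v ∈ E, (R v).index :=
      Finset.prod_lt_prod (fun _ _ => hp.out.pos) h4 ⟨v, hvE, lt_of_le_of_ne (h4 v hvE) (Ne.symm hne)⟩
    rw [← h3, h16, Finset.prod_const] at h17
    exact lt_irrefl _ h17
  · have h17 : (nmGroup p ζ (b : F) ⊓ V).relIndex (Q ⊓ V) = 1 := by
      have h18 := Subgroup.relIndex_mul_relIndex (nmGroup p ζ (b : F) ⊓ V) (Q ⊓ V) V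
        (inf_le_inf_right V hNQ) inf_le_right
      rw [Subgroup.inf_relIndex_right, Subgroup.inf_relIndex_right, h15] at h18
      exact Nat.eq_of_mul_eq_mul_right (Nat.pos_of_ne_zero h13) (h18.trans (one_mul _).symm)
    refine (Subgroup.relIndex_eq_one.mp h17 ⟨?_, ?_⟩).1
    · have : y ∈ ⨅ v ∈ E, R v := by
        simp only [Subgroup.mem_iInf]
        exact fun v hv => hyR v (hmem v hv).1 (hmem v hv).2
      exact this
    · exact sUnits_mono Finset.subset_union_left hy

theorem locNm_index_and_eq (hp2 : p ≠ 2) (hζ : IsPrimitiveRoot ζ p) {b : Fˣ}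
    {v : HeightOneSpectrum (𝓞 F)} (hbv : b ∉ locPow p v) :
    (locNm p ζ v (b : F)).index = p ∧
    locNm p ζ v (b : F) = nmGroup p ζ (b : F) ⊔ locPow p v := by
  classical
  have hb : b ∉ (powMonoidHom p : Fˣ →* Fˣ).range := fun h => hbv (powRange_le_locPow v h)
  obtain ⟨S₁, hS₁⟩ := exists_isLarge hζ
  obtain ⟨S₂, hS₂⟩ := exists_mem_sUnits b
  have hle : ∀ v, nmGroup p ζ (b : F) ⊔ locPow p v ≤ locNm p ζ v (b : F) := fun v =>
    sup_le (nmGroup_le_locNm _) (locPow_le_locNm _)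
  have hS : IsLarge ζ (insert v (S₁ ∪ S₂)) := hS₁.mono fun w hw => by simp [hw]
  have hSb : b ∈ sUnits (insert v (S₁ ∪ S₂)) := sUnits_mono (fun w hw => by simp [hw]) hS₂
  have h1 := (mem_nmGroup_of_forall hp2 hζ hb hS hSb
    (R := fun v => locNm p ζ v (b : F)) (fun v _ _ => locPow_le_locNm _)
    (fun v _ _ => nmGroup_le_locNm _) (fun v _ hv => locNm_ne_top hp2 hζ hv)).1 v
    (Finset.mem_insert_self _ _) hbv
  have h2 := (mem_nmGroup_of_forall hp2 hζ hb hS hSb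
    (R := fun v => nmGroup p ζ (b : F) ⊔ locPow p v) (fun v _ _ => le_sup_right)
    (fun v _ _ => le_sup_left) (fun v _ hv h => locNm_ne_top hp2 hζ hv
      (top_le_iff.mp (h ▸ hle v)))).1 v
    (Finset.mem_insert_self _ _) hbv
  refine ⟨h1, le_antisymm (Subgroup.relIndex_eq_one.mp ?_) (hle v)⟩
  have h3 := Subgroup.relIndex_mul_index (hle v)
  rw [h1, h2] at h3
  exact Nat.eq_of_mul_eq_mul_right hp.out.pos (h3.trans (one_mul _).symm)
end hasse

section norms
variable {F K : Type*} [Field F] [Field K] [Algebra F K] {n : ℕ} {ζ a : F} {σ : K ≃ₐ[F] K} {α : K}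

theorem IsKumExt.apply_prod (h : IsKumExt n ζ a σ α) (y : K) :
    σ (∏ i ∈ Finset.range n, (σ ^ i) y) = ∏ i ∈ Finset.range n, (σ ^ i) y := by
  rw [_root_.map_prod]
  have h1 := prod_range_shift_of_periodic (n := n) (fun i => (σ ^ i) y)
    (fun m => by rw [pow_add, h.pow_eq_one, mul_one]) 1
  rw [← h1]
  exact Finset.prod_congr rfl fun i _ => by rw [pow_succ', AlgEquiv.mul_apply]

theorem IsKumExt.prod_root (h : IsKumExt n ζ a σ α) (hn : Odd n) :
    ∏ i ∈ Finset.range n, (σ ^ i) α = algebraMap F K a := by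
  simp only [h.pow_apply]
  rw [Finset.prod_mul_distrib, Finset.prod_const, Finset.card_range, h.pow_eq,
    Finset.prod_pow_eq_pow_sum, Finset.sum_range_id]
  obtain ⟨m, hm⟩ := hn
  have h1 : n * (n - 1) / 2 = n * m := by
    rw [show n - 1 = 2 * m by omega, ← mul_assoc, mul_right_comm, Nat.mul_div_cancel _ two_pos]
  rw [h1, pow_mul, ← map_pow, h.root.pow_eq_one, _root_.map_one, one_pow, one_mul]

/-- The norm of a norm from `K[X]/(X^m - b)` is a norm from `F[X]/(X^m - b)`. -/
theorem IsKumExt.isKNorm_prod (h : IsKumExt n ζ a σ α) {m : ℕ} (hm : m ≠ 0) {η b c : F} {y : K}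
    (hy : IsKNorm m (algebraMap F K η) (algebraMap F K b) y)
    (hc : algebraMap F K c = ∏ i ∈ Finset.range n, (σ ^ i) y) : IsKNorm m η b c := by
  obtain ⟨f, hf⟩ := hy
  set g : K[X] := ∏ j ∈ Finset.range n, f.map ((σ ^ j : K ≃ₐ[F] K) : K →+* K) with hg
  have hfix : g.map (σ : K →+* K) = g := by
    have h1 := prod_range_shift_of_periodic (n := n)
      (fun j => f.map ((σ ^ j : K ≃ₐ[F] K) : K →+* K))
      (fun m => by rw [pow_add, h.pow_eq_one, mul_one]) 1
    rw [hg, Polynomial.map_prod, ← h1]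
    refine Finset.prod_congr rfl fun j _ => ?_
    rw [Polynomial.map_map]
    congr 1
    rw [pow_succ']
    rfl
  have hlift : ∃ G : F[X], G.map (algebraMap F K) = g := by
    rw [← Polynomial.mem_lifts, Polynomial.lifts_iff_coeff_lifts]
    intro i
    obtain ⟨c, hc⟩ := h.mem_base_of_fixed (y := g.coeff i) (by
      conv_rhs => rw [← hfix]
      rw [coeff_map]
      rfl)
    exact ⟨c, hc⟩
  obtain ⟨G, hG⟩ := hlift
  refine ⟨G, ?_⟩
  rw [← Polynomial.map_dvd_map (algebraMap F K) (algebraMap F K).injective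
    (monic_X_pow_sub_C b hm)]
  simp only [Polynomial.map_sub, Polynomial.map_pow, map_X, map_C, Polynomial.map_prod,
    Polynomial.map_comp, Polynomial.map_mul, hG]
  rw [hc]
  have h2 : ∀ j, (X ^ m - C (algebraMap F K b)) ∣
      (∏ i ∈ Finset.range m, (f.map ((σ ^ j : K ≃ₐ[F] K) : K →+* K)).comp
        (C (algebraMap F K η ^ i) * X)) - C ((σ ^ j) y) := by
    intro j
    have h3 := Polynomial.map_dvd ((σ ^ j : K ≃ₐ[F] K) : K →+* K) hf
    simpa [Polynomial.map_prod, Polynomial.map_comp] using h3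
  have h3 : ∀ s : Finset ℕ, (X ^ m - C (algebraMap F K b)) ∣
      (∏ j ∈ s, ∏ i ∈ Finset.range m, (f.map ((σ ^ j : K ≃ₐ[F] K) : K →+* K)).comp
        (C (algebraMap F K η ^ i) * X)) - ∏ j ∈ s, C ((σ ^ j) y) := by
    intro s
    classical
    induction s using Finset.induction_on with
    | empty => simp
    | insert j s hj ih =>
      rw [Finset.prod_insert hj, Finset.prod_insert hj]
      exact dvd_mul_sub_mul (h2 j) ih
  have h4 := h3 (Finset.range n)
  rw [Finset.prod_comm] at h4
  rw [_root_.map_prod]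
  convert h4 using 3 with i hi
  rw [hg, Polynomial.prod_comp]
  simp

/-- The norm map of a cyclic extension with generator `σ` of order `n`, on units. -/
def conjNorm (n : ℕ) (σ : K ≃ₐ[F] K) : Kˣ →* Kˣ :=
  ∏ i ∈ Finset.range n, Units.map ((σ ^ i : K ≃ₐ[F] K) : K →* K)

theorem coe_conjNorm (n : ℕ) (σ : K ≃ₐ[F] K) (y : Kˣ) :
    (conjNorm n σ y : K) = ∏ i ∈ Finset.range n, (σ ^ i) (y : K) := by
  rw [conjNorm, MonoidHom.finsetProd_apply, Units.coe_prod]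
  rfl

theorem IsKumExt.exists_eq_conjNorm (h : IsKumExt n ζ a σ α) (y : Kˣ) :
    ∃ c : Fˣ, Units.map (algebraMap F K : F →* K) c = conjNorm n σ y := by
  obtain ⟨c, hc⟩ := h.mem_base_of_fixed (h.apply_prod (y : K))
  rw [← coe_conjNorm] at hc
  have hc0 : c ≠ 0 := by
    rintro rfl
    rw [map_zero] at hc
    exact (conjNorm n σ y).ne_zero hc.symm
  exact ⟨Units.mk0 c hc0, Units.ext hc⟩

end norms

section local_conditions

theorem valuation_root_sub_one_le_one {F : Type*} [Field F] [NumberField F]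
    (w : HeightOneSpectrum (𝓞 F)) {z : F} {n : ℕ} (hn : n ≠ 0) (hz : z ^ n = 1) :
    w.valuation F (z - 1) ≤ 1 := by
  refine (Valuation.map_sub _ _ _).trans ?_
  rw [valuation_root_eq_one w hn hz, _root_.map_one, max_self]

variable {F K : Type*} [Field F] [NumberField F] [Field K] [NumberField K] [Algebra F K]
  {p : ℕ} [hp : Fact p.Prime] {ζ : F} {a b : Fˣ} {σ : K ≃ₐ[F] K} {α : Kˣ}

/-- At the places where `a` is a local power, `α = a^{1/p}` is a local power times an element
of the base field. -/
theorem IsKumExt.exists_mul_mem_locPow (h : IsKumExt p ζ (a : F) σ (α : K)) {η : F}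
    (hη : η ^ p = ζ) {v : HeightOneSpectrum (𝓞 F)} (hv : a ∈ locPow p v) :
    ∃ y : Fˣ, ∀ w : HeightOneSpectrum (𝓞 K), primeBelow F w = v →
      α * Units.map (algebraMap F K : F →* K) y ∈ locPow p w := by
  have hζ' := h.root.map_of_injective (algebraMap F K).injective
  have hl0 : ζ - 1 ≠ 0 := sub_ne_zero.mpr (h.root.ne_one hp.out.one_lt)
  have hζ0 : algebraMap F K ζ ≠ 0 := hζ'.ne_zero hp.out.ne_zero
  obtain ⟨m, hm⟩ := exists_exp_neg_le (pow_ne_zero (p * p)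
    ((Valuation.ne_zero_iff (v.valuation F)).mpr hl0))
  obtain ⟨y, hy⟩ := exists_approx_of_mem_locPow hv (m + 1)
  refine ⟨y⁻¹, ?_⟩
  rintro w rfl
  have h1 : (primeBelow F w).valuation F (a / y ^ p - 1) <
      (primeBelow F w).valuation F ((ζ - 1) ^ (p * p)) := by
    rw [_root_.map_pow]
    refine lt_of_le_of_lt hy (lt_of_lt_of_le ?_ hm)
    rw [exp_lt_exp]
    push_cast
    omega
  rw [← valuation_algebraMap_lt_iff] at h1
  set t : K := α / algebraMap F K y with ht
  have hy0 : algebraMap F K y ≠ 0 := (_root_.map_ne_zero _).mpr y.ne_zero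
  have h2 : algebraMap F K (a / y ^ p - 1) =
      ∏ i ∈ Finset.range p, (t - algebraMap F K ζ ^ i) := by
    have h3 := congrArg (eval t)
      (X_pow_sub_C_eq_prod hζ' hp.out.pos (a := (1 : K)) (α := 1) (one_pow p))
    simp only [eval_sub, eval_pow, eval_X, eval_C, eval_prod, mul_one] at h3
    rw [_root_.map_sub, map_div₀, ← h.pow_eq, _root_.map_pow, ← div_pow, _root_.map_one, h3]
  rw [h2, _root_.map_prod, _root_.map_pow, _root_.map_pow, pow_mul] at h1
  obtain ⟨i, hi⟩ : ∃ i, w.valuation K (t - algebraMap F K ζ ^ i) <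
      w.valuation K (algebraMap F K (ζ - 1)) ^ p := by
    by_contra! hcon
    refine h1.not_ge ?_
    rw [← Finset.card_range p, ← Finset.prod_const, Finset.card_range]
    exact Finset.prod_le_prod' fun i _ => hcon i
  have hw1 : w.valuation K (algebraMap F K ζ) = 1 :=
    valuation_root_eq_one w hp.out.ne_zero (h.root.map_of_injective
      (algebraMap F K).injective).pow_eq_one
  have h3 : Units.map (algebraMap F K : F →* K) y⁻¹ * α ∈ locPow p w := by
    have hη0 : algebraMap F K η ≠ 0 := by
      rintro h0
      rw [← hη, _root_.map_pow, h0, zero_pow hp.out.ne_zero] at hζ0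
      exact hζ0 rfl
    refine mem_locPow_of_lt hζ' (y := Units.mk0 _ hη0 ^ i) ?_
    have h4 : ((Units.map (algebraMap F K : F →* K) y⁻¹ * α : Kˣ) : K) /
        ((Units.mk0 _ hη0 ^ i : Kˣ) : K) ^ p - 1 =
        (t - algebraMap F K ζ ^ i) / algebraMap F K ζ ^ i := by
      rw [sub_div, div_self (pow_ne_zero i hζ0), ht]
      congr 1
      rw [Units.val_pow_eq_pow_val, Units.val_mk0, ← pow_mul, mul_comm i p, pow_mul,
        ← _root_.map_pow, hη]
      simp [div_eq_mul_inv, mul_comm]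
    rw [h4, map_div₀, _root_.map_pow, hw1, one_pow, div_one]
    simpa using hi
  rwa [mul_comm] at h3

theorem conjPrime_pow_valuation {w : HeightOneSpectrum (𝓞 K)} (hw : conjPrime σ w = w) (i : ℕ)
    (x : K) : w.valuation K ((σ ^ i) x) = w.valuation K x := by
  induction i with
  | zero => rfl
  | succ i ih => rw [pow_succ', AlgEquiv.mul_apply, ← conjPrime_valuation, hw, ih]

theorem heightOneSpectrum_eq_of_valuation {v w : HeightOneSpectrum (𝓞 F)}
    (h : ∀ x, v.valuation F x = w.valuation F x) : v = w := by
  ext x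
  rw [← HeightOneSpectrum.valuation_lt_one_iff_mem (K := F), h,
    HeightOneSpectrum.valuation_lt_one_iff_mem]

theorem IsKumExt.conjPrime_pow_ne (h : IsKumExt p ζ (a : F) σ (α : K))
    {w : HeightOneSpectrum (𝓞 K)} (hw : conjPrime σ w ≠ w) {i : ℕ} (hi : ¬ p ∣ i) :
    conjPrime (σ ^ i) w ≠ w := by
  intro hc
  refine hw ?_
  obtain ⟨j, -, hj⟩ := Nat.exists_mul_mod_eq_one_of_coprime
    ((Nat.Prime.coprime_iff_not_dvd hp.out).mpr hi).symm hp.out.one_lt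
  have h1 : σ = (σ ^ i) ^ j := by
    rw [← pow_mul, ← Nat.div_add_mod (i * j) p, hj, pow_add, pow_mul, h.pow_eq_one, one_pow,
      one_mul, pow_one]
  refine heightOneSpectrum_eq_of_valuation fun x => ?_
  rw [conjPrime_valuation]
  conv_lhs => rw [h1]
  exact conjPrime_pow_valuation hc j x

/-- If `a` is not a local power at `v` then `v` is not split in `F(a^{1/p})`. -/
theorem IsKumExt.conjPrime_eq (h : IsKumExt p ζ (a : F) σ (α : K))
    {w : HeightOneSpectrum (𝓞 K)} (hw : a ∉ locPow p (primeBelow F w)) : conjPrime σ w = w := by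
  classical
  by_contra hne
  refine hw ?_
  have hl0 : ζ - 1 ≠ 0 := sub_ne_zero.mpr (h.root.ne_one hp.out.one_lt)
  have hl0' : algebraMap F K (ζ - 1) ≠ 0 := (_root_.map_ne_zero _).mpr hl0
  set θ := w.valuation K (algebraMap F K (ζ - 1)) ^ p with hθ
  have hθ0 : θ ≠ 0 := pow_ne_zero p ((Valuation.ne_zero_iff _).mpr hl0')
  have hθ1 : θ ≤ 1 := pow_le_one₀ zero_le (by
    rw [_root_.map_sub, _root_.map_one]
    exact valuation_root_sub_one_le_one w hp.out.ne_zero (h.root.map_of_injective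
      (algebraMap F K).injective).pow_eq_one)
  obtain ⟨m, hm⟩ := exists_exp_neg_le hθ0
  obtain ⟨e, he⟩ := exists_approx_add
    ((Finset.range p).image fun i => conjPrime (σ ^ i) w)
    (fun u => if u = w then 1 else 0) (m + 1)
  have hlt : exp (-((m + 1 : ℕ) : ℤ)) < θ := by
    refine lt_of_lt_of_le ?_ hm
    rw [exp_lt_exp]
    push_cast
    omega
  have he0 : w.valuation K (e - 1) < θ := by
    have h1 := he w (Finset.mem_image.mpr ⟨0, Finset.mem_range.mpr hp.out.pos,
      heightOneSpectrum_eq_of_valuation fun x => by rw [conjPrime_valuation]; rfl⟩)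
    rw [if_pos rfl] at h1
    exact h1.trans_lt hlt
  have hei : ∀ i ∈ Finset.range p, i ≠ 0 → w.valuation K ((σ ^ i) e) < θ := by
    intro i hi hi0
    have hd : ¬ p ∣ i := fun hd => hi0 (Nat.eq_zero_of_dvd_of_lt hd (Finset.mem_range.mp hi))
    have h1 := he (conjPrime (σ ^ i) w) (Finset.mem_image_of_mem _ hi)
    rw [if_neg (h.conjPrime_pow_ne hne hd), sub_zero, conjPrime_valuation] at h1
    exact h1.trans_lt hlt
  have hfix : σ (∑ i ∈ Finset.range p, (σ ^ i) (α * e)) = ∑ i ∈ Finset.range p, (σ ^ i) (α * e) := by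
    have h1 := Finset.sum_range_succ' (fun i => (σ ^ i) ((α : K) * e)) p
    rw [Finset.sum_range_succ, h.pow_eq_one, pow_zero] at h1
    rw [_root_.map_sum, add_right_cancel h1]
    exact Finset.sum_congr rfl fun i _ => by rw [pow_succ', AlgEquiv.mul_apply]
  obtain ⟨c, hc⟩ := h.mem_base_of_fixed hfix
  have hw1 : w.valuation K (algebraMap F K ζ) = 1 :=
    valuation_root_eq_one w hp.out.ne_zero (h.root.map_of_injective
      (algebraMap F K).injective).pow_eq_one
  have hsum : algebraMap F K c / α - 1 =
      (e - 1) + ∑ i ∈ (Finset.range p).erase 0, algebraMap F K ζ ^ i * (σ ^ i) e := by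
    rw [hc, ← Finset.add_sum_erase _ _ (Finset.mem_range.mpr hp.out.pos), pow_zero,
      AlgEquiv.one_apply, add_div, mul_div_cancel_left₀ _ α.ne_zero, Finset.sum_div]
    rw [add_sub_right_comm]
    congr 1
    refine Finset.sum_congr rfl fun i _ => ?_
    rw [_root_.map_mul, h.pow_apply]
    field_simp
  have hsmall : w.valuation K (algebraMap F K c / α - 1) < θ := by
    rw [hsum]
    refine Valuation.map_add_lt _ he0 (Valuation.map_sum_lt _ hθ0 fun i hi => ?_)
    rw [_root_.map_mul, _root_.map_pow, hw1, one_pow, one_mul]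
    exact hei i (Finset.mem_of_mem_erase hi) (Finset.ne_of_mem_erase hi)
  have hc1 : w.valuation K (algebraMap F K c / α) = 1 := by
    have h1 := Valuation.map_eq_of_sub_lt (w.valuation K) (x := 1) (y := algebraMap F K c / α)
      (by rw [_root_.map_one]; exact hsmall.trans_le hθ1)
    rw [h1, _root_.map_one]
  have hpow : w.valuation K ((algebraMap F K c / α) ^ p - 1) < θ := by
    rw [← geom_sum_mul, _root_.map_mul]
    refine (mul_le_of_le_one_left' (Valuation.map_sum_le _ fun i _ => ?_)).trans_lt hsmall
    rw [_root_.map_pow, hc1, one_pow]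
  have hc0 : c ≠ 0 := by
    rintro rfl
    rw [map_zero, zero_div, map_zero] at hc1
    exact zero_ne_one hc1
  have hmem : a⁻¹ ∈ locPow p (primeBelow F w) := by
    refine mem_locPow_of_lt h.root (y := (Units.mk0 c hc0)⁻¹) ?_
    rw [← _root_.map_pow, ← valuation_algebraMap_lt_iff, _root_.map_pow, _root_.map_pow, ← hθ]
    convert hpow using 2
    rw [div_pow, h.pow_eq]
    simp [div_eq_mul_inv, mul_comm]
  exact (inv_mem_iff).mp hmem

/-- Norms of local powers are local powers. -/
theorem IsKumExt.mem_locPow_of_conjNorm (h : IsKumExt p ζ (a : F) σ (α : K))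
    {w : HeightOneSpectrum (𝓞 K)} (hw : conjPrime σ w = w) {y : Kˣ} (hy : y ∈ locPow p w) {c : Fˣ}
    (hc : Units.map (algebraMap F K : F →* K) c = conjNorm p σ y) :
    c ∈ locPow p (primeBelow F w) := by
  have hl0 : ζ - 1 ≠ 0 := sub_ne_zero.mpr (h.root.ne_one hp.out.one_lt)
  have hl0' : algebraMap F K (ζ - 1) ≠ 0 := (_root_.map_ne_zero _).mpr hl0
  set θ := w.valuation K (algebraMap F K (ζ - 1)) ^ p with hθ
  have hθ0 : θ ≠ 0 := pow_ne_zero p ((Valuation.ne_zero_iff _).mpr hl0')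
  have hθ1 : θ ≤ 1 := pow_le_one₀ zero_le (by
    rw [_root_.map_sub, _root_.map_one]
    exact valuation_root_sub_one_le_one w hp.out.ne_zero (h.root.map_of_injective
      (algebraMap F K).injective).pow_eq_one)
  obtain ⟨m, hm⟩ := exists_exp_neg_le hθ0
  obtain ⟨z, hz⟩ := exists_approx_of_mem_locPow hy (m + 1)
  obtain ⟨d, hd⟩ := h.exists_eq_conjNorm z
  have hlt : w.valuation K (y / z ^ p - 1) < θ := by
    refine lt_of_le_of_lt hz (lt_of_lt_of_le ?_ hm)
    rw [exp_lt_exp]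
    push_cast
    omega
  refine mem_locPow_of_lt h.root (y := d) ?_
  rw [← _root_.map_pow, ← valuation_algebraMap_lt_iff, _root_.map_pow, _root_.map_pow, ← hθ]
  have h1 : algebraMap F K (c / d ^ p - 1) =
      ∏ i ∈ Finset.range p, (σ ^ i) ((y : K) / z ^ p) - 1 := by
    have h2 := congrArg Units.val hc
    have h3 := congrArg Units.val hd
    rw [coe_conjNorm] at h2 h3
    simp only [Units.coe_map, MonoidHom.coe_coe] at h2 h3
    rw [_root_.map_sub, map_div₀, _root_.map_pow, _root_.map_one, h2, h3, ← Finset.prod_pow,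
      ← Finset.prod_div_distrib]
    simp only [map_div₀, _root_.map_pow]
  rw [h1]
  have h2 : ∀ n : ℕ, w.valuation K (∏ i ∈ Finset.range n, (σ ^ i) ((y : K) / z ^ p) - 1) < θ := by
    intro n
    induction n with
    | zero => simpa using zero_lt_iff.mpr hθ0
    | succ n ih =>
      rw [Finset.prod_range_succ]
      set u := (σ ^ n) ((y : K) / z ^ p) with hu
      have h4 : w.valuation K (u - 1) < θ := by
        rw [hu, ← _root_.map_one (σ ^ n), ← _root_.map_sub, conjPrime_pow_valuation hw]
        exact hlt
      have h5 : w.valuation K u = 1 := by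
        have h1 := Valuation.map_eq_of_sub_lt (w.valuation K) (x := 1) (y := u)
          (by rw [_root_.map_one]; exact h4.trans_le hθ1)
        rw [h1, _root_.map_one]
      set P := ∏ i ∈ Finset.range n, (σ ^ i) ((y : K) / z ^ p)
      rw [show P * u - 1 = (P - 1) * u + (u - 1) by ring]
      refine Valuation.map_add_lt _ ?_ h4
      rw [_root_.map_mul, h5, mul_one]
      exact ih
  exact h2 p

end local_conditions

section kummer_norms
variable {F K : Type*} [Field F] [NumberField F] [Field K] [NumberField K] [Algebra F K]
  {p : ℕ} [hp : Fact p.Prime] {ζ : F} {a b : Fˣ} {σ : K ≃ₐ[F] K} {α : Kˣ}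

theorem mem_zpowers_mul_of_index_le {A : Type*} [CommGroup A] {P : Subgroup A}
    (hP : ∀ x, x ^ p ∈ P) (h0 : P.index ≠ 0) (hle : P.index ≤ p) {x : A} (hx : x ∉ P) :
    Subgroup.zpowers x ⊔ P = ⊤ :=
  eq_top_of_lt_of_index_le hP h0 hle (lt_of_le_of_ne le_sup_right fun h =>
    hx (h ▸ (le_sup_left : Subgroup.zpowers x ≤ _) (Subgroup.mem_zpowers x)))

/-- At the places where `a` is not a local power, `α = a^{1/p}` is a local norm as soon as `a` is
a global norm. -/
theorem IsKumExt.mem_locNm (hp2 : p ≠ 2) (h : IsKumExt p ζ (a : F) σ (α : K))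
    (hab : a ∈ nmGroup p ζ (b : F))
    {w : HeightOneSpectrum (𝓞 K)} (hw : a ∉ locPow p (primeBelow F w))
    (hbw : Units.map (algebraMap F K : F →* K) b ∉ locPow p w) :
    α ∈ locNm p (algebraMap F K ζ) w (algebraMap F K b) := by
  by_contra hα
  have hζ' := h.root.map_of_injective (algebraMap F K).injective
  set ι := Units.map (algebraMap F K : F →* K) with hι
  have hιinj : Function.Injective ι := Units.map_injective (algebraMap F K).injective
  set v := primeBelow F w with hv
  have hbv : b ∉ locPow p v := fun hb => hbw (map_mem_locPow h.root w hb)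
  have hw' := h.conjPrime_eq hw
  obtain ⟨h1, h2⟩ := locNm_index_and_eq hp2 hζ' hbw
  set R := locNm p (algebraMap F K ζ) w (ι b : K) with hR
  have hpp := hp.out.ne_zero
  have h3 := mem_zpowers_mul_of_index_le (p := p) (P := R)
    (fun x => locPow_le_locNm _ (pow_mem_locPow w x)) (by rw [h1]; exact hpp) h1.le hα
  set H := locNm p ζ v (b : F) with hH
  have h4 : Subgroup.zpowers α ⊔ R ≤ (H.map ι).comap (conjNorm p σ) := by
    have key : ∀ {y : Kˣ} {c : Fˣ}, ι c = conjNorm p σ y → c ∈ H →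
        y ∈ (H.map ι).comap (conjNorm p σ) := fun h hc => ⟨_, hc, h⟩
    refine sup_le ?_ ?_
    · rw [Subgroup.zpowers_le]
      refine key (c := a) (Units.ext ?_) (nmGroup_le_locNm _ hab)
      rw [coe_conjNorm, h.prod_root (hp.out.odd_of_ne_two hp2)]
      rfl
    · rw [h2]
      refine sup_le (fun y hy => ?_) (fun y hy => ?_) <;>
        obtain ⟨c, hc⟩ := h.exists_eq_conjNorm y
      · refine key hc (nmGroup_le_locNm _ ?_)
        refine h.isKNorm_prod hpp hy ?_
        rw [← coe_conjNorm, ← hc]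
        rfl
      · exact key hc (locPow_le_locNm _ (h.mem_locPow_of_conjNorm hw' hy hc))
  have h5 : locNm p ζ v (a : F) ≤ H := by
    rw [(locNm_index_and_eq hp2 h.root hw).2]
    refine sup_le (fun u hu => ?_) (locPow_le_locNm _)
    obtain ⟨y, hy⟩ := h.exists_prod_of_isKNorm hu
    have hy0 : y ≠ 0 := by
      rintro rfl
      rw [Finset.prod_eq_zero (Finset.mem_range.mpr hp.out.pos) (map_zero (σ ^ 0))] at hy
      exact u.ne_zero ((map_eq_zero_iff _ (algebraMap F K).injective).mp hy.symm)
    have h6 : Units.mk0 y hy0 ∈ Subgroup.zpowers α ⊔ R := h3 ▸ Subgroup.mem_top _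
    obtain ⟨c, hc, hcy⟩ := h4 h6
    rwa [← hιinj (hcy.trans (Units.ext ((coe_conjNorm _ _ _).trans hy)))]
  have h6 : locNm p ζ v (a : F) = H := by
    have h7 := (locNm_index_and_eq hp2 h.root hw).1
    have h8 := (locNm_index_and_eq hp2 h.root hbv).1
    have h9 := Subgroup.relIndex_mul_index h5
    rw [h7, h8] at h9
    refine le_antisymm h5 (Subgroup.relIndex_eq_one.mp ?_)
    exact Nat.eq_of_mul_eq_mul_right hp.out.pos (h9.trans (one_mul p).symm)
  obtain ⟨x, -, hx⟩ := SetLike.exists_of_lt (lt_top_iff_ne_top.mpr (locNm_ne_top hp2 h.root hbv))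
  have hxv : x ∉ locPow p v := fun hc => hx (locPow_le_locNm _ hc)
  have hax : a ∉ locNm p ζ v (x : F) := fun hc => hx (by
    rw [← hH, ← h6]; exact mem_locNm_symm hp2 h.root hc)
  obtain ⟨h7, -⟩ := locNm_index_and_eq hp2 h.root hxv
  have h8 := mem_zpowers_mul_of_index_le (p := p) (P := locNm p ζ v (x : F))
    (fun x => locPow_le_locNm _ (pow_mem_locPow v x)) (by rw [h7]; exact hpp) h7.le hax
  obtain ⟨_, ⟨k, rfl⟩, m, hm, hkm⟩ := Subgroup.mem_sup.mp (h8 ▸ Subgroup.mem_top b)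
  simp only at hkm
  have hxm : x ∈ locNm p ζ v (m : F) := mem_locNm_symm hp2 h.root hm
  have hHm : H ≤ locNm p ζ v (m : F) := by
    intro u hu
    refine mem_locNm_symm hp2 h.root ?_
    have hb : b ∈ locNm p ζ v (u : F) := mem_locNm_symm hp2 h.root hu
    have ha : a ∈ locNm p ζ v (u : F) := mem_locNm_symm hp2 h.root (h6 ▸ hu)
    rw [← hkm] at hb
    exact (Subgroup.mul_mem_cancel_left _ (zpow_mem ha k)).mp hb
  have hmv : m ∈ locPow p v := by
    by_contra hc
    refine locNm_ne_top hp2 h.root hc ?_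
    obtain ⟨h9, -⟩ := locNm_index_and_eq hp2 h.root hbv
    refine eq_top_of_lt_of_index_le (p := p) (P := H)
      (fun x => locPow_le_locNm _ (pow_mem_locPow v x)) (by rw [h9]; exact hpp) h9.le
      (lt_of_le_of_ne hHm fun heq => hx ?_)
    rw [← hH, heq]
    exact hxm
  refine hbw ?_
  rw [← hkm, _root_.map_mul, map_zpow]
  refine mul_mem (zpow_mem ?_ k) (map_mem_locPow h.root w hmv)
  exact powRange_le_locPow w ⟨α, Units.ext h.pow_eq⟩

end kummer_norms

section kummer_norms
variable {F K : Type*} [Field F] [NumberField F] [Field K] [NumberField K] [Algebra F K]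
  {p : ℕ} [hp : Fact p.Prime] {ζ : F} {a b : Fˣ} {σ : K ≃ₐ[F] K} {α : Kˣ}

theorem not_mem_zpowers_mul_sup {A : Type*} [CommGroup A] {P : Subgroup A} (hP : ∀ x, x ^ p ∈ P)
    {a b : A} (ha : a ∉ P) (hb : b ∉ Subgroup.zpowers a ⊔ P) :
    a ∉ Subgroup.zpowers (a * b) ⊔ P := by
  intro h
  obtain ⟨_, ⟨i, rfl⟩, z, hz, hzi⟩ := Subgroup.mem_sup.mp h
  simp only at hzi
  by_cases hi : (p : ℤ) ∣ i
  · obtain ⟨j, rfl⟩ := hi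
    refine ha ?_
    rw [← hzi, zpow_mul, zpow_natCast]
    exact mul_mem (zpow_mem (hP _) j) hz
  · refine hb ?_
    have hco : IsCoprime (p : ℤ) i :=
      (Int.isCoprime_iff_gcd_eq_one.mpr (by
        rw [Int.gcd_comm, ← Int.isCoprime_iff_gcd_eq_one]
        exact ((Nat.prime_iff_prime_int.mp hp.out).coprime_iff_not_dvd.mpr hi).symm))
    obtain ⟨r, s, hrs⟩ := hco
    have ha' : a ∈ Subgroup.zpowers a ⊔ P := Subgroup.mem_sup_left (Subgroup.mem_zpowers a)
    have h1 : b ^ i ∈ Subgroup.zpowers a ⊔ P := by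
      have h2 : b ^ i = a * (a ^ i)⁻¹ * z⁻¹ := by
        rw [eq_mul_inv_iff_mul_eq, eq_mul_inv_iff_mul_eq]
        refine Eq.trans ?_ hzi
        rw [mul_zpow]
        ac_rfl
      rw [h2]
      exact mul_mem (mul_mem ha' (inv_mem (zpow_mem ha' i))) (inv_mem (Subgroup.mem_sup_right hz))
    have h3 : b = (b ^ p) ^ r * (b ^ i) ^ s := by
      rw [← zpow_natCast, ← zpow_mul, ← zpow_mul, ← zpow_add, mul_comm (p : ℤ), mul_comm i, hrs,
        zpow_one]
    rw [h3]
    exact mul_mem (zpow_mem (Subgroup.mem_sup_right (hP b)) r) (zpow_mem h1 s)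

theorem IsKumExt.exists_mul_mem_nmGroup (hp2 : p ≠ 2) (h : IsKumExt p ζ (a : F) σ (α : K))
    {η : F} (hη : η ^ p = ζ) (hab : a ∈ nmGroup p ζ (b : F))
    (hb : b ∉ Subgroup.zpowers a ⊔ (powMonoidHom p : Fˣ →* Fˣ).range) :
    ∃ x : Fˣ, α * Units.map (algebraMap F K : F →* K) x ∈
      nmGroup p (algebraMap F K ζ) (algebraMap F K b) := by
  classical
  have hζ' := h.root.map_of_injective (algebraMap F K).injective
  have ha : a ∉ (powMonoidHom p : Fˣ →* Fˣ).range := by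
    rintro ⟨y, rfl⟩
    refine pow_ne_of_irreducible_X_pow_sub_C h.irr dvd_rfl hp.out.ne_one (b := (y : F)) ?_
    simp
  set ι := Units.map (algebraMap F K : F →* K) with hι
  have hιb : ι b ∉ (powMonoidHom p : Kˣ →* Kˣ).range := fun hc => hb (h.mem_zpowers_sup hc)
  obtain ⟨S₁, hS₁⟩ := exists_isLarge h.root
  obtain ⟨S₂, hS₂⟩ := exists_mem_sUnits a
  obtain ⟨S₃, hS₃⟩ := exists_mem_sUnits b
  obtain ⟨S₄, hS₄⟩ := exists_isLarge hζ'
  obtain ⟨S₅, hS₅⟩ := exists_mem_sUnits α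
  set S := S₁ ∪ S₂ ∪ S₃ ∪ S₄.image (primeBelow F) ∪ S₅.image (primeBelow F) with hS
  have hSl : IsLarge ζ S := hS₁.mono fun v hv => by simp only [hS, Finset.mem_union, hv, true_or]
  have haS : a ∈ sUnits S := sUnits_mono
    (fun v hv => by simp only [hS, Finset.mem_union, hv, true_or, or_true]) hS₂
  have hbS : b ∈ sUnits S := sUnits_mono
    (fun v hv => by simp only [hS, Finset.mem_union, hv, true_or, or_true]) hS₃
  have hr : 0 < Fintype.card (InfinitePlace F) := Fintype.card_pos
  obtain ⟨T, hTc, hTS, hTb, hT⟩ := exists_finset_relIndex hp2 h.root hSl b ∅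
    (pow_le_relIndex_zpowers_sup h.root S b)
  rw [Finset.union_empty] at hTS
  obtain ⟨v₀, hv₀, habv, hav⟩ := exists_mem_locPow_not_mem hp2 h.root
    (not_mem_zpowers_mul_sup (fun x => pow_mem_powRange x) ha hb) (S ∪ T)
  rw [Finset.mem_union, not_or] at hv₀
  have hbv₀ : b ∉ locPow p v₀ := fun hc => hav ((Subgroup.mul_mem_cancel_right _ hc).mp habv)
  set T' := insert v₀ T with hT'
  have hTc' : T'.card = S.card + Fintype.card (InfinitePlace F) := by
    rw [hT', Finset.card_insert_of_notMem hv₀.2, hTc]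
    omega
  have hrel : (⨅ v ∈ T', locPow p v).relIndex (sUnits S) = p ^ T'.card := by
    rw [hT', Finset.iInf_insert, ← Subgroup.relIndex_inf_mul_relIndex, hT,
      Finset.card_insert_of_notMem hv₀.2, hTc, pow_succ']
    congr 1
    have h2 := relIndex_locPow_unitsAt h.root (hSl.sub_one v₀ hv₀.1)
    have h3 : (⨅ v ∈ T, locPow p v) ⊓ sUnits S ≤ unitsAt v₀ :=
      fun x hx => mem_unitsAt.mpr (hx.2 v₀ hv₀.1)
    exact relIndex_eq_prime (fun x => pow_mem_locPow v₀ x)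
      (fun h => h2.1 (Subgroup.relIndex_eq_zero_of_le_right h3 h))
      ((Subgroup.relIndex_le_of_le_right h3 h2.1).trans h2.2)
      (Subgroup.mem_inf.mpr ⟨by simpa only [Subgroup.mem_iInf] using hTb, hbS⟩) hbv₀
  have htop := iInf_locPow_sup_sUnits_eq_top hp2 h.root hSl
    (Finset.disjoint_insert_right.mpr ⟨hv₀.1, hTS.symm⟩) hTc' hrel
  have htarget : ∀ v : HeightOneSpectrum (𝓞 F), ∃ y : Fˣ, a ∈ locPow p v →
      ∀ w : HeightOneSpectrum (𝓞 K), primeBelow F w = v → α * ι y ∈ locPow p w := by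
    intro v
    by_cases hv : a ∈ locPow p v
    · obtain ⟨y, hy⟩ := h.exists_mul_mem_locPow hη hv
      exact ⟨y, fun _ => hy⟩
    · exact ⟨1, fun hc => absurd hc hv⟩
  choose t ht using htarget
  obtain ⟨y, hy⟩ := exists_div_mem_locPow h.root S
    (fun v => if a ∈ locPow p v then t v else 1)
  obtain ⟨z, hz, x, hx, hzx⟩ := Subgroup.mem_sup.mp (htop ▸ Subgroup.mem_top y)
  refine ⟨x, ?_⟩
  have hxv : ∀ v ∈ S, x / (if a ∈ locPow p v then t v else 1) ∈ locPow p v := by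
    intro v hv
    have h1 : z ∈ locPow p v := by
      exact Subgroup.mem_iInf.mp (Subgroup.mem_iInf.mp hz v) hv
    have h2 : x / (if a ∈ locPow p v then t v else 1) =
        z⁻¹ * (y / (if a ∈ locPow p v then t v else 1)) := by
      rw [← hzx, mul_div_assoc, inv_mul_cancel_left]
    rw [h2]
    exact mul_mem (inv_mem h1) (hy v hv)
  have hSK : IsLarge (algebraMap F K ζ) (primesAbove K (S ∪ T')) := hS₄.mono fun w hw =>
    mem_primesAbove.mpr (Finset.mem_union_left _ (Finset.mem_union_left _
      (Finset.mem_union_right _ (Finset.mem_image_of_mem _ hw))))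
  have hαS : α ∈ sUnits (primesAbove K (S ∪ T')) := sUnits_mono (fun w hw =>
    mem_primesAbove.mpr (Finset.mem_union_left _
      (Finset.mem_union_right _ (Finset.mem_image_of_mem _ hw)))) hS₅
  have hbSK : ι b ∈ sUnits (primesAbove K (S ∪ T')) :=
    (algebraMap_mem_sUnits _).mpr (sUnits_mono Finset.subset_union_left hbS)
  have hxSK : ι x ∈ sUnits (primesAbove K (S ∪ T')) := (algebraMap_mem_sUnits _).mpr hx
  obtain ⟨-, hW⟩ := mem_nmGroup_of_forall hp2 hζ' hιb hSK hbSK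
    (R := fun w => locNm p (algebraMap F K ζ) w (ι b : K))
    (fun w _ _ => locPow_le_locNm _) (fun w _ _ => nmGroup_le_locNm _)
    (fun w _ hw => locNm_ne_top hp2 hζ' hw)
  refine hW _ (mul_mem hαS hxSK) ?_
  intro w hw hbw
  have hbw' : b ∉ locPow p (primeBelow F w) := fun hc => hbw (map_mem_locPow h.root w hc)
  have hwS : primeBelow F w ∈ S := by
    rcases Finset.mem_union.mp (mem_primesAbove.mp hw) with hw | hw
    · exact hw
    rcases Finset.mem_insert.mp hw with hw | hw
    · refine absurd ?_ hbw
      have h1 : ι a ∈ locPow p w := powRange_le_locPow w ⟨α, Units.ext h.pow_eq⟩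
      have h2 : ι (a * b) ∈ locPow p w := map_mem_locPow h.root w (hw ▸ habv)
      rw [_root_.map_mul] at h2
      exact (Subgroup.mul_mem_cancel_left _ h1).mp h2
    · exact absurd (hTb _ hw) hbw'
  have h1 := hxv _ hwS
  by_cases hav : a ∈ locPow p (primeBelow F w)
  · rw [if_pos hav] at h1
    have h2 := mul_mem (ht _ hav w rfl) (map_mem_locPow h.root w h1)
    refine locPow_le_locNm _ ?_
    convert h2 using 1
    change _ = _ * ι _ * ι _
    rw [mul_assoc, ← _root_.map_mul, mul_div_cancel]
  · rw [if_neg hav, div_one] at h1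
    exact mul_mem (h.mem_locNm hp2 hab hav hbw) (locPow_le_locNm _ (map_mem_locPow h.root w h1))

end kummer_norms

theorem prod_range_prod_range_mul_add {M : Type*} [CommMonoid M] (g : ℕ → M) (m n : ℕ) :
    ∏ i ∈ Finset.range n, ∏ j ∈ Finset.range m, g (m * i + j) = ∏ k ∈ Finset.range (m * n), g k := by
  induction n with
  | zero => simp
  | succ n ih => rw [Finset.prod_range_succ, ih, Nat.mul_succ, Finset.prod_range_add]

section tower
variable {p : ℕ} [hp : Fact p.Prime] {F K : Type*} [Field F] [Field K] [Algebra F K]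
  {η A : F} {σ : K ≃ₐ[F] K} {β : K}

/-- The generator of a Kummer extension of odd prime degree is not a `p`-th power in it. -/
theorem IsKumExt.irreducible_X_pow_sub_C_root {ζ : F} (hp2 : p ≠ 2) (h : IsKumExt p ζ A σ β) :
    Irreducible (X ^ p - C β) := by
  refine X_pow_sub_C_irreducible_of_prime hp.out fun γ hγ => ?_
  obtain ⟨c, hc⟩ := h.mem_base_of_fixed (h.apply_prod γ)
  refine pow_ne_of_irreducible_X_pow_sub_C h.irr dvd_rfl hp.out.ne_one c
    ((algebraMap F K).injective ?_)
  rw [map_pow, hc, ← Finset.prod_pow, ← h.prod_root (hp.out.odd_of_ne_two hp2)]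
  simp only [← map_pow, hγ]

/-- A Kummer extension of degree `p ^ 2` is a Kummer extension of its subextension of
degree `p`. -/
theorem IsKumExt.tower {L : Type*} [Field L] [Algebra F L] [Algebra K L] [IsScalarTower F K L]
    {τ : L ≃ₐ[F] L} {θ : L} (h : IsKumExt p (η ^ p) A σ β) (h' : IsKumExt (p ^ 2) η A τ θ)
    (hθ : θ ^ p = algebraMap K L β) (hirr : Irreducible (X ^ p - C β)) :
    ∃ τ' : L ≃ₐ[K] L, (∀ y, τ' y = (τ ^ p) y) ∧
      IsKumExt p (algebraMap F K (η ^ p)) β τ' θ := by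
  have hc : ∀ y : K, (τ ^ p) (algebraMap K L y) = algebraMap K L y := by
    intro y
    obtain ⟨f, rfl⟩ := h.surj y
    rw [← aeval_algebraMap_apply, ← aeval_algHom_apply, ← hθ, map_pow, h'.pow_apply, mul_pow,
      ← pow_mul, ← pow_two, ← map_pow, h'.root.pow_eq_one, map_one, one_mul]
  refine ⟨AlgEquiv.ofRingEquiv (f := (τ ^ p : L ≃ₐ[F] L).toRingEquiv) hc, fun y => rfl, ?_⟩
  exact {
    root := h.root.map_of_injective (algebraMap F K).injective
    ne_zero := h.cast_ne_zero
    b_ne_zero := h.beta_ne_zero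
    irr := hirr
    pow_eq := hθ
    apply_eq := by
      change (τ ^ p) θ = _
      rw [h'.pow_apply, ← IsScalarTower.algebraMap_apply, map_pow]
    surj := fun y => by
      obtain ⟨f, rfl⟩ := h'.surj y
      exact ⟨f.map (algebraMap F K), aeval_map_algebraMap _ _ _⟩ }

theorem IsKumExt.exists_isKNorm_sq_of_tower {L : Type*} [Field L] [Algebra F L] [Algebra K L]
    [IsScalarTower F K L] {τ : L ≃ₐ[F] L} {θ : L} {τ' : L ≃ₐ[K] L} {ζ b : F}
    (h : IsKumExt (p ^ 2) η A τ θ) (h' : IsKumExt p (algebraMap F K ζ) β τ' θ)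
    (hτ : ∀ y, τ' y = (τ ^ p) y) (hb : b ≠ 0)
    (hN : IsKNorm p (algebraMap F K ζ) β (algebraMap F K b)) :
    ∃ f : F, f ≠ 0 ∧ IsKNorm (p ^ 2) η A (b * f ^ p) := by
  have hτi : ∀ i y, (τ' ^ i) y = (τ ^ (p * i)) y := by
    intro i
    induction i with
    | zero => simp
    | succ i ih =>
      intro y
      rw [pow_succ', AlgEquiv.mul_apply, hτ, ih, ← AlgEquiv.mul_apply, ← pow_add]
      congr 2
      ring
  obtain ⟨z, hz⟩ := h'.exists_prod_of_isKNorm hN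
  rw [← IsScalarTower.algebraMap_apply] at hz
  have hb' : algebraMap F L b ≠ 0 := (_root_.map_ne_zero _).mpr hb
  have hz0 : z ≠ 0 := by
    rintro rfl
    exact hb' (hz.symm.trans (Finset.prod_eq_zero (Finset.mem_range.mpr hp.out.pos)
      (_root_.map_zero (τ' ^ 0))))
  have hcomm : ∀ i y, (τ' ^ i) (τ y) = τ ((τ' ^ i) y) := by
    intro i y
    rw [hτi, hτi, ← AlgEquiv.mul_apply, ← AlgEquiv.mul_apply, ← pow_succ, ← pow_succ']
  have hu : ∏ i ∈ Finset.range p, (τ' ^ i) (τ z / z) = 1 := by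
    simp only [_root_.map_div₀, hcomm]
    rw [Finset.prod_div_distrib, ← _root_.map_prod, hz, AlgEquiv.commutes, div_self hb']
  obtain ⟨m, hm0, hm⟩ := h'.exists_eq_div hu
  rw [hτ] at hm
  set M := ∏ i ∈ Finset.range p, (τ ^ i) m with hM
  have hτm : ∀ i, (τ ^ i) m ≠ 0 := fun i => (_root_.map_ne_zero _).mpr hm0
  have hM0 : M ≠ 0 := Finset.prod_ne_zero_iff.mpr fun i _ => hτm i
  have hτM : τ M * z = τ z * M := by
    have h1 : τ M * m = (τ ^ p) m * M := by
      rw [hM, _root_.map_prod, mul_comm ((τ ^ p) m), ← Finset.prod_range_succ,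
        Finset.prod_range_succ', pow_zero, AlgEquiv.one_apply]
      congr 1
      exact Finset.prod_congr rfl fun i _ => by rw [pow_succ', AlgEquiv.mul_apply]
    rw [hm] at h1
    field_simp at h1
    linear_combination h1
  obtain ⟨f, hf⟩ := h.mem_base_of_fixed (y := M / z) (by
    rw [_root_.map_div₀, div_eq_div_iff ((_root_.map_ne_zero _).mpr hz0) hz0, hτM, mul_comm])
  have hf0 : f ≠ 0 := by
    rintro rfl
    rw [_root_.map_zero] at hf
    exact div_ne_zero hM0 hz0 hf.symm
  refine ⟨f, hf0, h.isKNorm_of_prod (y := m) ?_⟩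
  have h2 : ∏ i ∈ Finset.range p, (τ' ^ i) M = ∏ i ∈ Finset.range (p ^ 2), (τ ^ i) m := by
    rw [pow_two, ← prod_range_prod_range_mul_add]
    refine Finset.prod_congr rfl fun i _ => ?_
    rw [hτi, _root_.map_prod]
    exact Finset.prod_congr rfl fun j _ => by rw [pow_add, AlgEquiv.mul_apply]
  rw [← h2, show M = algebraMap F L f * z by rw [hf, div_mul_cancel₀ _ hz0]]
  simp only [_root_.map_mul, hτi, AlgEquiv.commutes]
  simp only [← hτi]
  rw [Finset.prod_mul_distrib, hz, Finset.prod_const, Finset.card_range, map_pow, mul_comm]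

theorem IsKumExt.exists_algHom {ζ : F} {n : ℕ} (h : IsKumExt n ζ A σ β) {L : Type*} [Field L]
    [Algebra F L] {γ : L} (hγ : γ ^ n = algebraMap F L A) : ∃ j : K →ₐ[F] L, j β = γ := by
  have := Fact.mk h.irr
  have h1 : aeval β (X ^ n - C A) = 0 := by simp [h.pow_eq]
  have h2 : aeval γ (X ^ n - C A) = 0 := by simp [hγ]
  let e : AdjoinRoot (X ^ n - C A) ≃ₐ[F] K :=
    AlgEquiv.ofBijective (AdjoinRoot.liftAlgHom _ (Algebra.ofId F K) β h1)
      ⟨RingHom.injective _, fun y => by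
        obtain ⟨f, rfl⟩ := h.surj y
        exact ⟨AdjoinRoot.mk _ f, AdjoinRoot.liftAlgHom_mk _ _ _ _ _⟩⟩
  refine ⟨(AdjoinRoot.liftAlgHom _ (Algebra.ofId F L) γ h2).comp e.symm, ?_⟩
  have h3 : e.symm β = AdjoinRoot.root _ := by
    rw [AlgEquiv.symm_apply_eq]
    exact (AdjoinRoot.liftAlgHom_root (X ^ n - C A) (Algebra.ofId F K) β h1).symm
  change AdjoinRoot.liftAlgHom _ (Algebra.ofId F L) γ h2 (e.symm β) = γ
  rw [h3]
  exact AdjoinRoot.liftAlgHom_root _ _ _ _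

/-- If `b` is a norm from `K(β ^ (1 / p))`, then up to `p`-th powers it is a norm from
`F(A ^ (1 / p ^ 2))`. -/
theorem IsKumExt.exists_isKNorm_sq {b : F} (hp2 : p ≠ 2) (hη : IsPrimitiveRoot η (p ^ 2))
    (h : IsKumExt p (η ^ p) A σ β) (hb : b ≠ 0)
    (hN : IsKNorm p (algebraMap F K (η ^ p)) β (algebraMap F K b)) :
    ∃ f : F, f ≠ 0 ∧ IsKNorm (p ^ 2) η A (b * f ^ p) := by
  have hirr : Irreducible (X ^ p ^ 2 - C A) :=
    X_pow_sub_C_irreducible_of_prime_pow hp.out hp2 _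
      (pow_ne_of_irreducible_X_pow_sub_C h.irr dvd_rfl hp.out.ne_one)
  have := Fact.mk hirr
  obtain ⟨τ, h'⟩ := exists_isKumExt hη (by simpa using h.ne_zero) h.b_ne_zero hirr
  obtain ⟨j, hj⟩ := h.exists_algHom (γ := AdjoinRoot.root (X ^ p ^ 2 - C A) ^ p)
    (by rw [← pow_mul, ← pow_two]; exact h'.pow_eq)
  let := j.toAlgebra
  have : IsScalarTower F K (AdjoinRoot (X ^ p ^ 2 - C A)) :=
    IsScalarTower.of_algebraMap_eq fun x => (j.commutes x).symm
  obtain ⟨τ', hτ, h''⟩ := h.tower h' hj.symm (h.irreducible_X_pow_sub_C_root hp2)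
  exact h'.exists_isKNorm_sq_of_tower h'' hτ hb hN

end tower

section
variable {p : ℕ} [hp : Fact p.Prime] {F K : Type*} [Field F] [Field K] [Algebra F K]

theorem IsKumExt.mul_algebraMap {ζ a : F} {σ : K ≃ₐ[F] K} {α : K} (h : IsKumExt p ζ a σ α)
    {x : F} (hx : x ≠ 0) : IsKumExt p ζ (a * x ^ p) σ (α * algebraMap F K x) where
  root := h.root
  ne_zero := h.ne_zero
  b_ne_zero := mul_ne_zero h.b_ne_zero (pow_ne_zero _ hx)
  irr := X_pow_sub_C_irreducible_of_prime hp.out fun c hc =>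
    pow_ne_of_irreducible_X_pow_sub_C h.irr dvd_rfl hp.out.ne_one (c / x) (by
      rw [div_pow, hc, mul_div_cancel_right₀ _ (pow_ne_zero _ hx)])
  pow_eq := by rw [mul_pow, h.pow_eq, map_mul, map_pow]
  apply_eq := by rw [map_mul, h.apply_eq, AlgEquiv.commutes, mul_assoc]
  surj y := by
    obtain ⟨f, rfl⟩ := h.surj y
    refine ⟨f.comp (X * C x⁻¹), ?_⟩
    rw [aeval_comp]
    have hx' : algebraMap F K x ≠ 0 := (_root_.map_ne_zero _).mpr hx
    have h1 : aeval (α * algebraMap F K x) (X * C x⁻¹) = α := by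
      rw [map_mul, aeval_X, aeval_C, map_inv₀, mul_assoc, mul_inv_cancel₀ hx', mul_one]
    rw [h1]

theorem exists_isKNorm_sq [NumberField F] (hp2 : p ≠ 2) {η : F} (hη : IsPrimitiveRoot η (p ^ 2))
    {a b : Fˣ} (hab : a ∈ nmGroup p (η ^ p) (b : F))
    (ha : a ∉ (powMonoidHom p : Fˣ →* Fˣ).range)
    (hb : b ∉ Subgroup.zpowers a ⊔ (powMonoidHom p : Fˣ →* Fˣ).range) :
    ∃ x f : F, x ≠ 0 ∧ f ≠ 0 ∧ IsKNorm (p ^ 2) η (a * x ^ p) (b * f ^ p) := by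
  have hζ : IsPrimitiveRoot (η ^ p) p :=
    hη.pow (pow_pos hp.out.pos 2) (pow_two p)
  have hirr := irreducible_X_pow_sub_C ha
  have := Fact.mk hirr
  obtain ⟨σ, h⟩ := exists_isKumExt hζ (Nat.cast_ne_zero.mpr hp.out.ne_zero) a.ne_zero hirr
  have : Module.Finite F (AdjoinRoot (X ^ p - C (a : F))) :=
    (monic_X_pow_sub_C _ hp.out.ne_zero).finite_adjoinRoot
  have : NumberField (AdjoinRoot (X ^ p - C (a : F))) := NumberField.of_module_finite F _
  set α := AdjoinRoot.root (X ^ p - C (a : F))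
  have hα : IsKumExt p (η ^ p) (a : F) σ ((Units.mk0 α h.beta_ne_zero : _ˣ) : AdjoinRoot _) := h
  obtain ⟨x, hx⟩ := hα.exists_mul_mem_nmGroup hp2 rfl hab hb
  have h' := h.mul_algebraMap x.ne_zero
  have hN : IsKNorm p (algebraMap F (AdjoinRoot (X ^ p - C (a : F))) (η ^ p))
      (algebraMap F (AdjoinRoot (X ^ p - C (a : F))) b)
      (α * algebraMap F (AdjoinRoot (X ^ p - C (a : F))) x) := hx
  have hN' := IsKNorm.symm hp2 (hζ.map_of_injective (algebraMap F _).injective)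
    ((_root_.map_ne_zero _).mpr b.ne_zero) h'.beta_ne_zero hN
  obtain ⟨f, hf0, hf⟩ := h'.exists_isKNorm_sq hp2 hη b.ne_zero hN'
  exact ⟨x, f, x.ne_zero, hf0, hf⟩

end

section lift
variable {k Ω : Type*} [Field k] [Field Ω] [Algebra k Ω] {p : ℕ} [hp : Fact p.Prime] {η : k}

theorem neZero_natCast_of_isPrimitiveRoot_sq (hη : IsPrimitiveRoot η (p ^ 2)) :
    NeZero (p : Ω) := by
  have hζ : IsPrimitiveRoot (η ^ p) p := hη.pow (pow_pos hp.out.pos 2) (pow_two p)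
  have : NeZero (p : k) := hζ.neZero'
  exact ⟨by
    rw [← map_natCast (algebraMap k Ω)]
    exact (_root_.map_ne_zero _).mpr (NeZero.ne _)⟩

/-- The reduction map from `ZMod (p ^ 2)` to `ZMod p`. -/
abbrev sqReduction (p : ℕ) : ZMod (p ^ 2) →+* ZMod p :=
  ZMod.castHom (dvd_pow_self p two_ne_zero) (ZMod p)

/-- The Kummer character of a `p`-th root of a radical lifts the character of the radical. -/
theorem IsKum.sqReduction_eq (hη : IsPrimitiveRoot η (p ^ 2)) {α α' : Ω} (hα : α ≠ 0)
    (hα' : α' ^ p = α) {x : (Ω ≃ₐ[k] Ω) → ZMod p} (hx : IsKum (η ^ p) α x)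
    {X : (Ω ≃ₐ[k] Ω) → ZMod (p ^ 2)} (hX : IsKum η α' X) (g : Ω ≃ₐ[k] Ω) :
    sqReduction p (X g) = x g := by
  have hζ : IsPrimitiveRoot (η ^ p) p := hη.pow (pow_pos hp.out.pos 2) (pow_two p)
  apply zpw_injective hζ
  apply (algebraMap k Ω).injective
  apply mul_right_cancel₀ hα
  rw [← hx g, ← hα', map_pow, hX g, mul_pow]
  congr 1
  rw [← map_pow]
  congr 1
  conv_lhs => rw [← ZMod.natCast_zmod_val (X g)]
  rw [map_natCast, zpw_natCast hζ.pow_eq_one, zpw, ← pow_mul, ← pow_mul, mul_comm]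

theorem IsKum.exists_lift (hη : IsPrimitiveRoot η (p ^ 2)) {α α' : Ω} (hα : α ≠ 0)
    (hα' : α' ^ p = α) {a : k} (ha : α ^ p = algebraMap k Ω a)
    {x : (Ω ≃ₐ[k] Ω) → ZMod p} (hx : IsKum (η ^ p) α x) :
    ∃ X : (Ω ≃ₐ[k] Ω) → ZMod (p ^ 2), IsKum η α' X ∧ FinDet X ∧
      (∀ g h, X (g * h) = X g + X h) ∧ ∀ g, sqReduction p (X g) = x g := by
  have ha' : α' ^ p ^ 2 = algebraMap k Ω a := by rw [pow_two, pow_mul, hα', ha]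
  have ha0 : a ≠ 0 := by
    rintro rfl
    rw [_root_.map_zero] at ha
    exact hα (eq_zero_of_pow_eq_zero ha)
  have hα0 : α' ≠ 0 := by
    rintro rfl
    rw [zero_pow hp.out.ne_zero] at hα'
    exact hα hα'.symm
  obtain ⟨X, hX⟩ := exists_isKum hη ha' ha0
  exact ⟨X, hX, hX.finDet hη hα0, hX.map_mul hη hα0, hx.sqReduction_eq hη hα hα' hX⟩

theorem exists_isKum_of_finDet [IsGalois k Ω] {n : ℕ} [NeZero n] {ζ : k}
    (hζ : IsPrimitiveRoot ζ n) {x : (Ω ≃ₐ[k] Ω) → ZMod n} (hx : FinDet x)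
    (hadd : ∀ g h, x (g * h) = x g + x h) :
    ∃ (a : kˣ) (α : Ω), α ≠ 0 ∧ α ^ n = algebraMap k Ω a ∧ IsKum ζ α x := by
  obtain ⟨α, hα0, hα⟩ := exists_kummer_generator hζ.pow_eq_one ⊤ hx (fun g _ h _ => hadd g h)
  have hk : IsKum ζ α x := fun g => hα g trivial
  obtain ⟨a, ha⟩ := (InfiniteGalois.mem_range_algebraMap_iff_fixed (α ^ n)).mpr fun g => by
    rw [map_pow, hk g, mul_pow, ← map_pow, zpw_pow hζ.pow_eq_one, map_one, one_mul]
  have ha0 : a ≠ 0 := by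
    rintro rfl
    rw [_root_.map_zero] at ha
    exact pow_ne_zero n hα0 ha.symm
  exact ⟨Units.mk0 a ha0, α, hα0, ha.symm, hk⟩

theorem exists_character_lift [IsGalois k Ω] [IsSepClosed Ω] (hη : IsPrimitiveRoot η (p ^ 2))
    {x : (Ω ≃ₐ[k] Ω) → ZMod p} (hx : FinDet x) (hadd : ∀ g h, x (g * h) = x g + x h) :
    ∃ X : (Ω ≃ₐ[k] Ω) → ZMod (p ^ 2), FinDet X ∧
      (∀ g h, X (g * h) = X g + X h) ∧ ∀ g, sqReduction p (X g) = x g := by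
  have := neZero_natCast_of_isPrimitiveRoot_sq (Ω := Ω) hη
  have hζ : IsPrimitiveRoot (η ^ p) p := hη.pow (pow_pos hp.out.pos 2) (pow_two p)
  obtain ⟨a, α, hα0, hα, hk⟩ := exists_isKum_of_finDet hζ hx hadd
  obtain ⟨α', hα'⟩ := IsSepClosed.exists_pow_nat_eq α p
  obtain ⟨X, -, hX⟩ := hk.exists_lift hη hα0 hα' hα
  exact ⟨X, hX⟩

/-- If the cup product of lifts of two characters vanishes, then any cochain trivializing
the cup product of the two characters lifts as well. -/
theorem exists_cochain_lift [IsGalois k Ω] [IsSepClosed Ω] (hη : IsPrimitiveRoot η (p ^ 2))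
    {x y z : (Ω ≃ₐ[k] Ω) → ZMod p} (hz : FinDet z)
    (hxyz : ∀ g h, z (g * h) = z g + z h + x g * y h)
    {X Y Z : (Ω ≃ₐ[k] Ω) → ZMod (p ^ 2)} (hZ : FinDet Z)
    (hX : ∀ g, sqReduction p (X g) = x g) (hY : ∀ g, sqReduction p (Y g) = y g)
    (hXYZ : ∀ g h, Z (g * h) = Z g + Z h + X g * Y h) :
    ∃ Z' : (Ω ≃ₐ[k] Ω) → ZMod (p ^ 2), FinDet Z' ∧
      (∀ g h, Z' (g * h) = Z' g + Z' h + X g * Y h) ∧ ∀ g, sqReduction p (Z' g) = z g := by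
  obtain ⟨W, hW, hWadd, hWz⟩ := exists_character_lift hη
    (x := fun g => z g - sqReduction p (Z g)) (hz.comp₂ hZ fun s t => s - sqReduction p t)
    (fun g h => by
      simp only [hxyz, hXYZ, map_add, map_mul, hX, hY]
      ring)
  refine ⟨fun g => Z g + W g, hZ.comp₂ hW (· + ·), fun g h => ?_, fun g => ?_⟩
  · simp only [hXYZ, hWadd]
    ring
  · rw [map_add, hWz]
    ring

/-- Lifting when both characters are multiples of a single one. -/
theorem exists_cochain_of_proportional (hp2 : p ≠ 2) {X : (Ω ≃ₐ[k] Ω) → ZMod (p ^ 2)}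
    (hX : FinDet X) (hadd : ∀ g h, X (g * h) = X g + X h) (c : ZMod (p ^ 2)) :
    ∃ Z : (Ω ≃ₐ[k] Ω) → ZMod (p ^ 2), FinDet Z ∧
      ∀ g h, Z (g * h) = Z g + Z h + X g * (c * X h) := by
  have h2 : IsUnit (2 : ZMod (p ^ 2)) := by
    have h3 : (p ^ 2).Coprime 2 :=
      Nat.Coprime.pow_left 2 ((Nat.coprime_primes hp.out Nat.prime_two).mpr hp2)
    have := (ZMod.isUnit_iff_coprime 2 (p ^ 2)).mpr h3.symm
    exact_mod_cast this
  obtain ⟨d, hd⟩ := h2.exists_right_inv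
  refine ⟨fun g => d * c * X g ^ 2, hX.comp fun t => d * c * t ^ 2, fun g h => ?_⟩
  simp only [hadd]
  linear_combination c * X g * X h * hd

theorem zpw_zpow {n : ℕ} [NeZero n] {ζ : k} (hζ : ζ ^ n = 1) (c : ZMod n) (m : ℤ) :
    zpw ζ c ^ m = zpw ζ ((m : ZMod n) * c) := by
  obtain ⟨m, rfl | rfl⟩ := m.eq_nat_or_neg
  · rw [zpow_natCast, zpw_pow' hζ, Int.cast_natCast]
  · rw [zpow_neg, zpow_natCast, zpw_pow' hζ, Int.cast_neg, Int.cast_natCast, neg_mul, zpw_neg hζ]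

theorem IsKum.zpow {n : ℕ} [NeZero n] {ζ : k} (hζ : ζ ^ n = 1) {α : Ω}
    {x : (Ω ≃ₐ[k] Ω) → ZMod n} (hx : IsKum ζ α x) (m : ℤ) :
    IsKum ζ (α ^ m) fun g => (m : ZMod n) * x g := fun g => by
  rw [map_zpow₀, hx g, mul_zpow, ← zpw_zpow hζ, map_zpow₀]

/-- Radicals whose powers agree up to powers from the base have the same character. -/
theorem IsKum.eq_of_pow_eq {n : ℕ} [NeZero n] {ζ : k} (hζ : IsPrimitiveRoot ζ n) {α β : Ω}
    {x y : (Ω ≃ₐ[k] Ω) → ZMod n} (hx : IsKum ζ α x) (hy : IsKum ζ β y) (hα : α ≠ 0)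
    {c : k} (hc : c ≠ 0) (h : β ^ n = algebraMap k Ω c ^ n * α ^ n) (g : Ω ≃ₐ[k] Ω) :
    y g = x g := by
  have hc' : algebraMap k Ω c ≠ 0 := (_root_.map_ne_zero _).mpr hc
  obtain ⟨i, hi⟩ := exists_zpw_eq hζ (x := β / (algebraMap k Ω c * α)) (by
    rw [div_pow, h, ← mul_pow, div_self (pow_ne_zero _ (mul_ne_zero hc' hα))])
  rw [div_eq_iff (mul_ne_zero hc' hα)] at hi
  have hi0 : algebraMap k Ω (zpw ζ i) ≠ 0 :=
    (_root_.map_ne_zero _).mpr (zpw_ne_zero hζ.pow_eq_one i)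
  have h1 := hy g
  rw [hi, _root_.map_mul, _root_.map_mul, AlgEquiv.commutes, AlgEquiv.commutes, hx g] at h1
  apply zpw_injective hζ
  apply (algebraMap k Ω).injective
  apply mul_right_cancel₀ (mul_ne_zero hi0 (mul_ne_zero hc' hα))
  rw [← h1]
  ring

theorem isKum_one {n : ℕ} [NeZero n] {ζ : k} :
    IsKum (Ω := Ω) ζ 1 fun _ => (0 : ZMod n) := fun g => by
  rw [map_one, zpw_zero, map_one, one_mul]

theorem finDet_const {X : Type*} (t : X) : FinDet fun _ : Ω ≃ₐ[k] Ω => t :=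
  ⟨∅, fun _ _ _ => rfl⟩

/-- Over a number field containing a primitive `p ^ 2`-th root of unity, unitriangular
`3 × 3` representations mod `p` lift to representations mod `p ^ 2`, in terms of entries. -/
theorem exists_heisenberg_lift [NumberField k] [IsGalois k Ω] [IsSepClosed Ω] (hp2 : p ≠ 2)
    (hη : IsPrimitiveRoot η (p ^ 2)) {x y z : (Ω ≃ₐ[k] Ω) → ZMod p} (hx : FinDet x)
    (hy : FinDet y) (hz : FinDet z) (hxadd : ∀ g h, x (g * h) = x g + x h)
    (hyadd : ∀ g h, y (g * h) = y g + y h) (hxyz : ∀ g h, z (g * h) = z g + z h + x g * y h) :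
    ∃ X Y Z : (Ω ≃ₐ[k] Ω) → ZMod (p ^ 2), FinDet X ∧ FinDet Y ∧ FinDet Z ∧
      (∀ g h, X (g * h) = X g + X h) ∧ (∀ g h, Y (g * h) = Y g + Y h) ∧
      (∀ g h, Z (g * h) = Z g + Z h + X g * Y h) ∧
      (∀ g, sqReduction p (X g) = x g) ∧ (∀ g, sqReduction p (Y g) = y g) ∧
      ∀ g, sqReduction p (Z g) = z g := by
  suffices h : ∃ X Y Z : (Ω ≃ₐ[k] Ω) → ZMod (p ^ 2), FinDet X ∧ FinDet Y ∧ FinDet Z ∧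
      (∀ g h, X (g * h) = X g + X h) ∧ (∀ g h, Y (g * h) = Y g + Y h) ∧
      (∀ g h, Z (g * h) = Z g + Z h + X g * Y h) ∧
      (∀ g, sqReduction p (X g) = x g) ∧ ∀ g, sqReduction p (Y g) = y g by
    obtain ⟨X, Y, Z, hX, hY, hZ, hXadd, hYadd, hXYZ, hXx, hYy⟩ := h
    obtain ⟨Z', hZ', hXYZ', hZz⟩ := exists_cochain_lift hη hz hxyz hZ hXx hYy hXYZ
    exact ⟨X, Y, Z', hX, hY, hZ', hXadd, hYadd, hXYZ', hXx, hYy, hZz⟩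
  have hζ : IsPrimitiveRoot (η ^ p) p := hη.pow (pow_pos hp.out.pos 2) (pow_two p)
  have := neZero_natCast_of_isPrimitiveRoot_sq (Ω := Ω) hη
  obtain ⟨a, α, hα0, hα, hkα⟩ := exists_isKum_of_finDet hζ hx hxadd
  obtain ⟨b, β, hβ0, hβ, hkβ⟩ := exists_isKum_of_finDet hζ hy hyadd
  have hN : IsKNorm p (η ^ p) (b : k) (a : k) :=
    isKNorm_of_cochain hp2 hζ b.ne_zero a.ne_zero hβ hα hkβ hkα hz hxyz
  by_cases ha : a ∈ (powMonoidHom p : kˣ →* kˣ).range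
  · obtain ⟨c, rfl⟩ := ha
    have hx0 : ∀ g, x g = 0 := isKum_one.eq_of_pow_eq hζ hkα one_ne_zero c.ne_zero (by
      rw [hα, one_pow, mul_one, ← map_pow]
      rfl)
    obtain ⟨Y, hY, hYadd, hYy⟩ := exists_character_lift hη hy hyadd
    exact ⟨fun _ => 0, Y, fun _ => 0, finDet_const 0, hY, finDet_const 0, by simp, hYadd,
      by simp, by simp [hx0], hYy⟩
  by_cases hb : b ∈ Subgroup.zpowers a ⊔ (powMonoidHom p : kˣ →* kˣ).range
  · obtain ⟨_, ⟨m, rfl⟩, _, ⟨c, rfl⟩, hm⟩ := Subgroup.mem_sup.mp hb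
    have hyx : ∀ g, y g = (m : ZMod p) * x g :=
      (hkα.zpow hζ.pow_eq_one m).eq_of_pow_eq hζ hkβ (zpow_ne_zero _ hα0) c.ne_zero (by
        rw [hβ, ← hm, ← zpow_natCast (α ^ m), zpow_comm, zpow_natCast, hα, ← map_pow,
          ← map_zpow₀, ← map_mul]
        congr 1
        simp [mul_comm])
    obtain ⟨X, hX, hXadd, hXx⟩ := exists_character_lift hη hx hxadd
    obtain ⟨Z, hZ, hXZ⟩ := exists_cochain_of_proportional hp2 hX hXadd m
    exact ⟨X, fun g => m * X g, Z, hX, hX.comp (m * ·), hZ, hXadd,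
      fun g h => by simp only [hXadd, mul_add], hXZ, hXx,
      fun g => by rw [map_mul, hXx, hyx, map_intCast]⟩
  obtain ⟨c, f, hc, hf, hN'⟩ := exists_isKNorm_sq hp2 hη hN ha hb
  have key : ∀ {γ : Ω} {w : (Ω ≃ₐ[k] Ω) → ZMod p} {u c : k}, γ ≠ 0 → c ≠ 0 →
      γ ^ p = algebraMap k Ω u → IsKum (η ^ p) γ w → ∃ (γ' : Ω) (W : (Ω ≃ₐ[k] Ω) → ZMod (p ^ 2)),
        γ' ^ p ^ 2 = algebraMap k Ω (u * c ^ p) ∧ IsKum η γ' W ∧ FinDet W ∧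
        (∀ g h, W (g * h) = W g + W h) ∧ ∀ g, sqReduction p (W g) = w g := by
    intro γ w u c hγ hc hu hw
    have hc' : algebraMap k Ω c ≠ 0 := (_root_.map_ne_zero _).mpr hc
    obtain ⟨γ', hγ'⟩ := IsSepClosed.exists_pow_nat_eq (γ * algebraMap k Ω c) p
    have h1 : (γ * algebraMap k Ω c) ^ p = algebraMap k Ω (u * c ^ p) := by
      rw [mul_pow, hu, map_mul, map_pow]
    have hw' : IsKum (η ^ p) (γ * algebraMap k Ω c) w := fun g => by
      rw [map_mul, AlgEquiv.commutes, hw g, mul_assoc]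
    obtain ⟨W, hW⟩ := hw'.exists_lift hη (mul_ne_zero hγ hc') hγ' h1
    exact ⟨γ', W, by rw [pow_two, pow_mul, hγ', h1], hW⟩
  obtain ⟨α', X, hα', hkX, hX, hXadd, hXx⟩ := key hα0 hc hα hkα
  obtain ⟨β', Y, hβ', hkY, hY, hYadd, hYy⟩ := key hβ0 hf hβ hkβ
  have : NeZero ((p ^ 2 : ℕ) : Ω) := ⟨by
    rw [Nat.cast_pow]
    exact pow_ne_zero _ (NeZero.ne _)⟩
  obtain ⟨φ, hφ, hcup⟩ := exists_cochain_of_isKNorm hη (mul_ne_zero a.ne_zero (pow_ne_zero p hc))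
    (mul_ne_zero b.ne_zero (pow_ne_zero p hf)) hα' hβ' hkX hkY hN'
  refine ⟨X, Y, fun g => φ g + X g * Y g, hX, hY, hφ.comp₂ (hX.comp₂ hY (· * ·)) (· + ·), hXadd,
    hYadd, fun g h => ?_, hXx, hYy⟩
  simp only [hcup, hXadd, hYadd]
  ring

end lift

section continuity
variable {k Ω : Type*} [Field k] [Field Ω] [Algebra k Ω]

theorem finDet_of_isOpen_ker {M : Type*} [Group M] (ρ : (Ω ≃ₐ[k] Ω) →* M)
    (hρ : IsOpen (ρ.ker : Set (Ω ≃ₐ[k] Ω))) : FinDet ρ := by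
  classical
  obtain ⟨E, hE, hEρ⟩ := (krullTopology_mem_nhds_one_iff k Ω _).mp
    (hρ.mem_nhds (one_mem ρ.ker))
  obtain ⟨s, hs⟩ := E.fg_of_fg_toSubalgebra
    (Subalgebra.fg_of_fg_toSubmodule (Module.Finite.iff_fg.mp hE))
  refine ⟨s, fun g h hgh => ?_⟩
  have h1 : g⁻¹ * h ∈ E.fixingSubgroup := by
    rw [← hs, IntermediateField.mem_fixingSubgroup_iff]
    intro x hx
    have h2 : IntermediateField.adjoin k (s : Set Ω) ≤
        IntermediateField.fixedField (Subgroup.zpowers (g⁻¹ * h)) := by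
      rw [IntermediateField.adjoin_le_iff]
      intro y hy
      rw [SetLike.mem_coe, IntermediateField.mem_fixedField_iff]
      have h3 : (g⁻¹ * h) y = y := by
        rw [AlgEquiv.mul_apply, ← hgh y hy, ← AlgEquiv.mul_apply, inv_mul_cancel,
          AlgEquiv.one_apply]
      have h4 : Subgroup.zpowers (g⁻¹ * h) ≤ MulAction.stabilizer (Ω ≃ₐ[k] Ω) y := by
        rw [Subgroup.zpowers_le]
        exact h3
      exact fun f hf => h4 hf
    exact IntermediateField.mem_fixedField_iff _ _ |>.mp (h2 hx) _ (Subgroup.mem_zpowers _)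
  have h2 : ρ (g⁻¹ * h) = 1 := hEρ h1
  rwa [map_mul, map_inv, inv_mul_eq_one] at h2

theorem FinDet.isOpen_ker [Algebra.IsAlgebraic k Ω] {M : Type*} [Group M]
    {ρ : (Ω ≃ₐ[k] Ω) →* M} (hρ : FinDet ρ) : IsOpen (ρ.ker : Set (Ω ≃ₐ[k] Ω)) := by
  obtain ⟨s, hs⟩ := hρ
  have : FiniteDimensional k (IntermediateField.adjoin k (s : Set Ω)) :=
    IntermediateField.finiteDimensional_adjoin fun x _ => Algebra.IsIntegral.isIntegral x
  refine Subgroup.isOpen_of_mem_nhds _ (g := 1)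
    ((krullTopology_mem_nhds_one_iff k Ω _).mpr ⟨_, this, fun g hg => ?_⟩)
  rw [SetLike.mem_coe, MonoidHom.mem_ker, hs g 1, map_one]
  intro x hx
  rw [AlgEquiv.one_apply]
  exact (IntermediateField.mem_fixingSubgroup_iff _ _).mp hg x
    (IntermediateField.subset_adjoin k _ hx)

end continuity

section heisenberg
variable {G R : Type*} [Group G] [CommRing R]

/-- The representation by unitriangular `3 × 3` matrices with given entries. -/
def heisenbergRep (X Y Z : G → R) (hX : ∀ g h, X (g * h) = X g + X h)
    (hY : ∀ g h, Y (g * h) = Y g + Y h) (hZ : ∀ g h, Z (g * h) = Z g + Z h + X g * Y h) :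
    G →* (Matrix (Fin 3) (Fin 3) R)ˣ :=
  MonoidHom.toHomUnits
    { toFun := fun g => !![1, X g, Z g; 0, 1, Y g; 0, 0, 1]
      map_one' := by
        have h1 : X 1 = 0 := by simpa using hX 1 1
        have h2 : Y 1 = 0 := by simpa using hY 1 1
        have h3 : Z 1 = 0 := by simpa [h1] using hZ 1 1
        rw [h1, h2, h3, Matrix.one_fin_three]
      map_mul' := fun g h => by
        rw [hX, hY, hZ]
        ext i j
        fin_cases i <;> fin_cases j <;> simp [Matrix.mul_apply, Fin.sum_univ_three] <;> ring }

theorem coe_heisenbergRep (X Y Z : G → R) (hX hY hZ) (g : G) :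
    (heisenbergRep X Y Z hX hY hZ g : Matrix (Fin 3) (Fin 3) R) =
      !![1, X g, Z g; 0, 1, Y g; 0, 0, 1] := rfl

end heisenberg

end

theorem IsUniTri.coe_eq {R : Type} [CommRing R] {g : GL (Fin 3) R} (hg : IsUniTri g) :
    (g : Matrix (Fin 3) (Fin 3) R) = !![1, g 0 1, g 0 2; 0, 1, g 1 2; 0, 0, 1] := by
  ext i j
  fin_cases i <;> fin_cases j
  · exact hg.2 0
  · rfl
  · rfl
  · exact hg.1 1 0 (by decide)
  · exact hg.2 1
  · rfl
  · exact hg.1 2 0 (by decide)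
  · exact hg.1 2 1 (by decide)
  · exact hg.2 2

theorem isUniTri_of_coe_eq {R : Type} [CommRing R] {g : GL (Fin 3) R} {x y z : R}
    (hg : (g : Matrix (Fin 3) (Fin 3) R) = !![1, x, z; 0, 1, y; 0, 0, 1]) : IsUniTri g := by
  refine ⟨fun i j hij => ?_, fun i => ?_⟩
  · rw [hg]
    fin_cases i <;> fin_cases j <;> first | rfl | exact absurd hij (by decide)
  · rw [hg]
    fin_cases i <;> rfl

theorem stmt_10 (p : ℕ) [Fact p.Prime] (hodd : p ≠ 2)
    (F : Type) [Field F] [NumberField F]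
    (ζ : F) (hζ : IsPrimitiveRoot ζ (p ^ 2))
    (ρ : AbsGal F →* GL (Fin 3) (ZMod p))
    (hcont : IsOpen (ρ.ker : Set (AbsGal F)))
    (htri : ∀ g, IsUniTri (ρ g)) :
    ∃ ρ₂ : AbsGal F →* GL (Fin 3) (ZMod (p ^ 2)),
      IsOpen (ρ₂.ker : Set (AbsGal F)) ∧ (∀ g, IsUniTri (ρ₂ g)) ∧
      (Matrix.GeneralLinearGroup.map
        (ZMod.castHom (dvd_pow_self p two_ne_zero) (ZMod p))).comp ρ₂ = ρ := by
  have hρ := finDet_of_isOpen_ker ρ hcont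
  have hmul : ∀ g h i j, ρ (g * h) i j = ∑ l, ρ g i l * ρ h l j := fun g h i j => by
    rw [map_mul, Matrix.GeneralLinearGroup.coe_mul, Matrix.mul_apply]
  obtain ⟨X, Y, Z, hX, hY, hZ, hXadd, hYadd, hZadd, hXx, hYy, hZz⟩ :=
    exists_heisenberg_lift (x := fun g => ρ g 0 1) (y := fun g => ρ g 1 2)
      (z := fun g => ρ g 0 2) hodd hζ (hρ.comp fun m => m 0 1) (hρ.comp fun m => m 1 2)
      (hρ.comp fun m => m 0 2)
      (fun g h => by
        rw [hmul, (htri g).coe_eq, (htri h).coe_eq]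
        simp [Fin.sum_univ_three, add_comm])
      (fun g h => by
        rw [hmul, (htri g).coe_eq, (htri h).coe_eq]
        simp [Fin.sum_univ_three, add_comm])
      (fun g h => by
        rw [hmul, (htri g).coe_eq, (htri h).coe_eq]
        simp [Fin.sum_univ_three]
        ring)
  refine ⟨heisenbergRep X Y Z hXadd hYadd hZadd, FinDet.isOpen_ker ?_, fun g =>
    isUniTri_of_coe_eq (coe_heisenbergRep X Y Z hXadd hYadd hZadd g), ?_⟩
  · obtain ⟨s, hs⟩ := (hX.comp₂ hY Prod.mk).comp₂ hZ Prod.mk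
    refine ⟨s, fun g h hgh => ?_⟩
    have h1 := hs g h hgh
    simp only [Prod.mk.injEq] at h1
    refine Units.ext ?_
    rw [coe_heisenbergRep, coe_heisenbergRep, h1.1.1, h1.1.2, h1.2]
  · refine MonoidHom.ext fun g => Units.ext ?_
    rw [(htri g).coe_eq, ← hXx g, ← hYy g, ← hZz g]
    ext i j
    fin_cases i <;> fin_cases j <;>
      first | rfl | exact map_one (sqReduction p) | exact map_zero (sqReduction p)
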